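/- Let B be a block of k⟦G⟧ with non-trivial cyclic defect group D and let P be an indecomposable projective B-module. Then Rad(P)/Rad²(P) ≅ T ⊕ T′, where each of T and T′ is either a simple B-module or zero, and if both are non-zero they are non-isomorphic. -/

import Mathlib

open scoped Classical
set_option maxHeartbeats 1000000
set_option synthInstance.maxHeartbeats 400000

noncomputable section

namespace ProfiniteBlocks

variable (k : Type) [Field k] (G : Type) [Group G] [TopologicalSpace G]

/-- Discrete topology on each finite level group algebra. -/
instance (X : Type) : TopologicalSpace (MonoidAlgebra k X) := ⊥

/-- The canonical quotient homomorphism `G/N → G/M` for `N ≤ M`. -/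
def qHom (N M : OpenNormalSubgroup G) (h : N ≤ M) :
    G ⧸ N.toSubgroup →* G ⧸ M.toSubgroup :=
  QuotientGroup.map _ _ (MonoidHom.id G) (fun x hx => h hx)

/-- The induced algebra homomorphism `k[G/N] → k[G/M]` for `N ≤ M`. -/
def tHom (N M : OpenNormalSubgroup G) (h : N ≤ M) :
    MonoidAlgebra k (G ⧸ N.toSubgroup) →ₐ[k] MonoidAlgebra k (G ⧸ M.toSubgroup) :=
  MonoidAlgebra.mapDomainAlgHom k k (qHom G N M h)

/-- The completed group algebra `k⟦G⟧`, realized as the inverse limit of the finite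
level group algebras `k[G/N]` over all open normal subgroups `N` of `G`, sitting inside
their product. -/
def CGA : Subalgebra k (∀ N : OpenNormalSubgroup G, MonoidAlgebra k (G ⧸ N.toSubgroup)) where
  carrier := {x | ∀ (N M : OpenNormalSubgroup G) (h : N ≤ M), tHom k G N M h (x N) = x M}
  add_mem' hx hy N M h := by simp [map_add, hx N M h, hy N M h]
  mul_mem' hx hy N M h := by simp [map_mul, hx N M h, hy N M h]
  algebraMap_mem' r N M h := by
    simp [tHom, MonoidAlgebra.mapDomainAlgHom, MonoidAlgebra.mapDomainRingHom,
      Finsupp.mapDomain_single]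

instance : Ring (CGA k G) := inferInstance
instance : Algebra k (CGA k G) := inferInstance

/-- `k⟦G⟧` carries the inverse limit topology (each `k[G/N]` being discrete). -/
instance : TopologicalSpace (CGA k G) := inferInstanceAs (TopologicalSpace (Subtype _))

/-- The canonical (continuous) inclusion of `G` into `k⟦G⟧`. -/
def ofG : G →* CGA k G where
  toFun g := ⟨fun N => MonoidAlgebra.single ((g : G) : G ⧸ N.toSubgroup) 1, by
    intro N M h
    simp [tHom, MonoidAlgebra.mapDomainAlgHom, MonoidAlgebra.mapDomainRingHom,
      Finsupp.mapDomain_single, qHom, QuotientGroup.map_mk]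
    rfl⟩
  map_one' := by
    ext N
    simp [MonoidAlgebra.one_def]
  map_mul' g g' := by
    ext N
    simp [MonoidAlgebra.single_mul_single]


/-- The map between quotient modules induced by `f` (the canonical map whenever
`f` carries `P` into `Q`). -/
def mapQ' {R X Y : Type} [Ring R] [AddCommGroup X] [AddCommGroup Y] [Module R X]
    [Module R Y] (P : Submodule R X) (Q : Submodule R Y) (f : X →ₗ[R] Y) :
    (X ⧸ P) →ₗ[R] (Y ⧸ Q) :=
  if h : P ≤ Q.comap f then Submodule.mapQ P Q f h else 0

/-- The map between submodules induced by `f` (the canonical restriction whenever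
`f` carries `P` into `Q`). -/
def restrict' {R X Y : Type} [Ring R] [AddCommGroup X] [AddCommGroup Y] [Module R X]
    [Module R Y] (P : Submodule R X) (Q : Submodule R Y) (f : X →ₗ[R] Y) :
    P →ₗ[R] Q :=
  if h : ∀ x ∈ P, f x ∈ Q then f.restrict h else 0

/-- The subquotient `W / W'` of a module. -/
abbrev subQuot {R X : Type} [Ring R] [AddCommGroup X] [Module R X]
    (W W' : Submodule R X) : Type :=
  W ⧸ (W'.comap W.subtype)

/-- The radical of a topological module: the intersection of its maximal open
submodules. -/
def radical (R : Type) [Ring R] (X : Type) [AddCommGroup X] [Module R X]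
    [TopologicalSpace X] : Submodule R X :=
  sInf {W : Submodule R X | IsCoatom W ∧ IsOpen (W : Set X)}

/-- Iterated radicals `Rad^i(X)`, with `Rad^0(X) = X`. -/
def radPow (R : Type) [Ring R] (X : Type) [AddCommGroup X] [Module R X]
    [TopologicalSpace X] : ℕ → Submodule R X
  | 0 => ⊤
  | (n + 1) => (radical R (radPow R X n)).map (radPow R X n).subtype

/-- A topological module is semisimple if every closed submodule has a closed
complement. -/
def IsSemisimpleTop (R : Type) [Ring R] (X : Type) [AddCommGroup X] [Module R X]
    [TopologicalSpace X] : Prop :=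
  ∀ W : Submodule R X, IsClosed (W : Set X) →
    ∃ W' : Submodule R X, IsClosed (W' : Set X) ∧ IsCompl W W'

/-- The socle of a topological module: the largest closed semisimple submodule
(defined as the join of all closed semisimple submodules). -/
def socle (R : Type) [Ring R] (X : Type) [AddCommGroup X] [Module R X]
    [TopologicalSpace X] : Submodule R X :=
  sSup {W : Submodule R X | IsClosed (W : Set X) ∧ IsSemisimpleTop R W}

/-- A module is uniserial if its submodules form a chain. -/
def Uniserial (R : Type) [Ring R] (X : Type) [AddCommGroup X] [Module R X] : Prop :=
  ∀ W W' : Submodule R X, W ≤ W' ∨ W' ≤ W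

/-- A topological module is (topologically) indecomposable if it is non-zero and
admits no non-trivial decomposition into closed direct summands. -/
def IsIndecTop (R : Type) [Ring R] (X : Type) [AddCommGroup X] [Module R X]
    [TopologicalSpace X] : Prop :=
  Nontrivial X ∧ ∀ W W' : Submodule R X, IsClosed (W : Set X) → IsClosed (W' : Set X) →
    IsCompl W W' → W = ⊥ ∨ W' = ⊥

/-- The inverse limit of a compatible system of modules indexed by a preorder,
realized as the submodule of compatible families in the product. -/
def compatLim {ι : Type} [Preorder ι] {R : Type} [Ring R] (T : ι → Type)
    [∀ i, AddCommGroup (T i)] [∀ i, Module R (T i)]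
    (t : ∀ i j, i ≤ j → (T i →ₗ[R] T j)) : Submodule R (∀ i, T i) where
  carrier := {f | ∀ (i j : ι) (h : i ≤ j), t i j h (f i) = f j}
  add_mem' ha hb i j h := by simp only [Pi.add_apply, map_add]; rw [ha i j h, hb i j h]
  zero_mem' i j h := by simp
  smul_mem' c a ha i j h := by simp only [Pi.smul_apply, map_smul]; rw [ha i j h]

/-- `X` has exactly `n` composition factors (measured along the radical series). -/
def HasNFactors (R : Type) [Ring R] (X : Type) [AddCommGroup X] [Module R X]
    [TopologicalSpace X] (n : ℕ) : Prop :=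
  radPow R X n = ⊥ ∧ ∀ m < n, radPow R X m ≠ ⊥

/-- `X` has infinitely many composition factors. -/
def HasInfFactors (R : Type) [Ring R] (X : Type) [AddCommGroup X] [Module R X]
    [TopologicalSpace X] : Prop :=
  ∀ n : ℕ, radPow R X n ≠ ⊥



section Coinvariants

variable {k : Type} [Field k] {G : Type} [Group G] [TopologicalSpace G]

variable (k G) in
/-- The (closed) submodule `I_N U` of a topological `k⟦G⟧`-module `U`: the smallest
closed submodule containing all elements `n • u - u` for `n ∈ N`.  Its quotient is the
module of `N`-coinvariants. -/
def coinvKer (N : OpenNormalSubgroup G) (U : Type) [AddCommGroup U]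
    [Module (CGA k G) U] [TopologicalSpace U] : Submodule (CGA k G) U :=
  sInf {W : Submodule (CGA k G) U | IsClosed (W : Set U) ∧
    ∀ n ∈ N.toSubgroup, ∀ u : U, ofG k G n • u - u ∈ W}

variable (k G) in
/-- The module of `N`-coinvariants `U_N` of a topological `k⟦G⟧`-module `U`. -/
abbrev coinv (N : OpenNormalSubgroup G) (U : Type) [AddCommGroup U]
    [Module (CGA k G) U] [TopologicalSpace U] : Type :=
  U ⧸ coinvKer k G N U

variable (k G) in
/-- The canonical projection `φ_N : U → U_N`. -/
def phi (N : OpenNormalSubgroup G) (U : Type) [AddCommGroup U]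
    [Module (CGA k G) U] [TopologicalSpace U] : U →ₗ[CGA k G] coinv k G N U :=
  (coinvKer k G N U).mkQ

lemma coinvKer_mono {N M : OpenNormalSubgroup G} (h : N ≤ M) (U : Type) [AddCommGroup U]
    [Module (CGA k G) U] [TopologicalSpace U] : coinvKer k G N U ≤ coinvKer k G M U :=
  sInf_le_sInf (fun W hW => ⟨hW.1, fun n hn u => hW.2 n (h hn) u⟩)

variable (k G) in
/-- The canonical projection `φ_{MN} : U_N → U_M` for `N ≤ M`. -/
def phiT (N M : OpenNormalSubgroup G) (h : N ≤ M) (U : Type) [AddCommGroup U]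
    [Module (CGA k G) U] [TopologicalSpace U] :
    coinv k G N U →ₗ[CGA k G] coinv k G M U :=
  Submodule.mapQ _ _ LinearMap.id (fun _ hx => coinvKer_mono h U hx)

variable (k G) in
/-- `N` acts trivially on the `k⟦G⟧`-module `W`. -/
def NTrivial (N : OpenNormalSubgroup G) (W : Type) [AddCommGroup W]
    [Module (CGA k G) W] : Prop :=
  ∀ n ∈ N.toSubgroup, ∀ w : W, ofG k G n • w = w

end Coinvariants

section Pseudocompact

variable (k : Type) [Field k]

/-- A pseudocompact module over a topological `k`-algebra `A`: a Hausdorff topological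
module possessing a basis of neighbourhoods of `0` consisting of open submodules of
finite codimension which intersect in `0`, and which is the inverse limit of the
corresponding discrete quotients. -/
structure IsPseudocompactMod (A : Type) [Ring A] [Algebra k A] [TopologicalSpace A]
    (X : Type) [AddCommGroup X] [Module k X] [Module A X] [IsScalarTower k A X]
    [TopologicalSpace X] : Prop where
  t2 : T2Space X
  addGroup : IsTopologicalAddGroup X
  contSMul : ContinuousSMul A X
  basis : (nhds (0 : X)).HasBasis
    (fun V : Submodule A X => IsOpen (V : Set X) ∧
      FiniteDimensional k (X ⧸ V.restrictScalars k))
    (fun V => (V : Set X))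
  inf_bot : (⨅ (V : Submodule A X) (_ : IsOpen (V : Set X) ∧
      FiniteDimensional k (X ⧸ V.restrictScalars k)), V) = ⊥
  complete : ∀ c : ∀ V : {V : Submodule A X // IsOpen (V : Set X) ∧
      FiniteDimensional k (X ⧸ V.restrictScalars k)}, X ⧸ V.1,
    (∀ (V W : {V : Submodule A X // IsOpen (V : Set X) ∧
        FiniteDimensional k (X ⧸ V.restrictScalars k)}), V.1 ≤ W.1 →
      mapQ' V.1 W.1 LinearMap.id (c V) = c W) →
    ∃ x : X, ∀ V, c V = Submodule.Quotient.mk x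

end Pseudocompact

section Blocks

variable (R : Type) [Ring R]

/-- A block idempotent: a centrally primitive idempotent of `R`. -/
structure IsBlockIdem (e : R) : Prop where
  idem : IsIdempotentElem e
  ne_zero : e ≠ 0
  central : e ∈ Set.center R
  primitive : ∀ f g : R, f ∈ Set.center R → g ∈ Set.center R → IsIdempotentElem f →
    IsIdempotentElem g → f * g = 0 → g * f = 0 → e = f + g → f = 0 ∨ g = 0

/-- The block `B = Re` determined by a central idempotent `e`, as a left `R`-module. -/
def blockMod (e : R) (he : e ∈ Set.center R) : Submodule R R where
  carrier := {a : R | a * e = a}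
  add_mem' := by intro a b ha hb; simp only [Set.mem_setOf_eq, add_mul] at *; rw [ha, hb]
  zero_mem' := by simp
  smul_mem' := by
    intro c a ha
    simp only [Set.mem_setOf_eq, smul_eq_mul, mul_assoc] at *
    rw [ha]

/-- A module belongs to the block of the central idempotent `e` if `e` acts as the
identity on it. -/
def InBlock {X : Type} [AddCommGroup X] [Module R X] (e : R) : Prop :=
  ∀ x : X, e • x = x

end Blocks

section Defect

variable {k : Type} [Field k] {G : Type} [Group G] [TopologicalSpace G]

variable (k G) in
/-- The conjugation action of `G` on `k⟦G⟧`. -/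
def conjAct (g : G) (x : CGA k G) : CGA k G :=
  ofG k G g * x * ofG k G g⁻¹

variable (k G) in
/-- The `H`-fixed points of `k⟦G⟧` under conjugation. -/
def fixedBy (H : Subgroup G) : Set (CGA k G) :=
  {x : CGA k G | ∀ h ∈ H, conjAct k G h x = x}

variable (k G) in
/-- The relative trace map `Tr_H^G` on `k⟦G⟧` (a finite sum over coset
representatives when `H` is open). -/
def trMap (H : Subgroup G) (x : CGA k G) : CGA k G :=
  ∑ᶠ c : G ⧸ H, conjAct k G (Quotient.out c) x

variable (k G) in
/-- The image `Tr_H^G(k⟦G⟧^H)`. -/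
def trImage (H : Subgroup G) : Set (CGA k G) :=
  trMap k G H '' fixedBy k G H

variable (k G) in
/-- `D` satisfies the defect property for `e`:
`e ∈ ⋂_N Tr_{DN}^G (k⟦G⟧^{DN})`. -/
def DefectProp (e : CGA k G) (D : Subgroup G) : Prop :=
  ∀ N : OpenNormalSubgroup G, e ∈ trImage k G (D ⊔ N.toSubgroup)

variable (k G) in
/-- `D` is a defect group of the block of `e`: a closed subgroup, minimal subject to
the defect property. -/
structure IsDefectGroup (e : CGA k G) (D : Subgroup G) : Prop where
  closed : IsClosed (D : Set G)
  defect : DefectProp k G e D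
  minimal : ∀ D' : Subgroup G, IsClosed ((D' : Set G)) → D' ≤ D →
    DefectProp k G e D' → D' = D

end Defect

section FiniteDefect

variable (k : Type) [Field k] (Q : Type) [Group Q]

/-- Conjugation on a finite level group algebra `k[Q]`. -/
def conjActF (q : Q) (x : MonoidAlgebra k Q) : MonoidAlgebra k Q :=
  MonoidAlgebra.single q 1 * x * MonoidAlgebra.single q⁻¹ 1

/-- `H`-fixed points of `k[Q]` under conjugation. -/
def fixedByF (H : Subgroup Q) : Set (MonoidAlgebra k Q) :=
  {x | ∀ h ∈ H, conjActF k Q h x = x}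

/-- The relative trace map `Tr_H^Q` on `k[Q]`. -/
def trMapF (H : Subgroup Q) (x : MonoidAlgebra k Q) : MonoidAlgebra k Q :=
  ∑ᶠ c : Q ⧸ H, conjActF k Q (Quotient.out c) x

/-- The image `Tr_H^Q(k[Q]^H)`. -/
def trImageF (H : Subgroup Q) : Set (MonoidAlgebra k Q) :=
  trMapF k Q H '' fixedByF k Q H

/-- `Dq` is a defect group of the block of `e` in the group algebra `k[Q]`. -/
structure IsDefectGroupF (e : MonoidAlgebra k Q) (Dq : Subgroup Q) : Prop where
  defect : e ∈ trImageF k Q Dq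
  minimal : ∀ D' : Subgroup Q, D' ≤ Dq → e ∈ trImageF k Q D' → D' = Dq

end FiniteDefect

section CyclicDefect

variable {k : Type} [Field k] {G : Type} [Group G] [TopologicalSpace G]

variable (G) in
/-- A subgroup is procyclic if it possesses a dense cyclic (abstract) subgroup. -/
def IsProcyclic (D : Subgroup G) : Prop :=
  ∃ g : G, closure ((Subgroup.zpowers g : Subgroup G) : Set G) = (D : Set G)

variable (G) in
/-- `D` is isomorphic, as a topological group, to the `p`-adic integers `ℤ_p`. -/
def IsZpGroup (p : ℕ) [Fact p.Prime] (D : Subgroup G) : Prop :=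
  ∃ φ : D ≃ₜ Multiplicative ℤ_[p], ∀ x y : D, φ (x * y) = φ x * φ y

variable (G) in
/-- `D` is a cyclic pro-`p` group: either a finite cyclic `p`-group or `ℤ_p`. -/
def IsCyclicProP (p : ℕ) [Fact p.Prime] (D : Subgroup G) : Prop :=
  (Finite D ∧ IsPGroup p D ∧ IsCyclic D) ∨ IsZpGroup G p D

end CyclicDefect

section Simples

variable {k : Type} [Field k] {G : Type} [Group G] [TopologicalSpace G]

variable (k G) in
/-- The projection `k⟦G⟧ → k[G/N]`. -/
def projN (N : OpenNormalSubgroup G) (x : CGA k G) :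
    MonoidAlgebra k (G ⧸ N.toSubgroup) :=
  (x : ∀ N : OpenNormalSubgroup G, MonoidAlgebra k (G ⧸ N.toSubgroup)) N

variable (k G) in
/-- `N` acts trivially on every simple module of the block of `e`. -/
def TrivOnSimples (e : CGA k G) (N : OpenNormalSubgroup G) : Prop :=
  ∀ (S : Type) [AddCommGroup S] [Module (CGA k G) S],
    IsSimpleModule (CGA k G) S → InBlock (CGA k G) (X := S) e → NTrivial k G N S

variable (k G) in
/-- Membership of `N` in the standard cofinal system `𝒩` for the block `B` of `e`
with defect group `D`: the coinvariant algebra `B_N` is a block of `k[G/N]` with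
defect group `DN/N`, and `N` acts trivially on every simple `B`-module. -/
structure GoodN (e : CGA k G) (D : Subgroup G) (N : OpenNormalSubgroup G) : Prop where
  blockN : IsBlockIdem (MonoidAlgebra k (G ⧸ N.toSubgroup)) (projN k G N e)
  defectN : IsDefectGroupF k (G ⧸ N.toSubgroup) (projN k G N e)
    (D.map (QuotientGroup.mk' N.toSubgroup))
  triv : TrivOnSimples k G e N

/-- A cofinal set of open normal subgroups. -/
def IsCofinal {G : Type} [Group G] [TopologicalSpace G]
    (𝒩 : Set (OpenNormalSubgroup G)) : Prop :=
  ∀ M : OpenNormalSubgroup G, ∃ N ∈ 𝒩, N ≤ M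

variable (k G) in
/-- A pseudocompact module is pro-uniserial (w.r.t. the cofinal system `𝒩`) if all
its coinvariant quotients at members of `𝒩` are uniserial. -/
def ProUniserial (𝒩 : Set (OpenNormalSubgroup G)) (U : Type) [AddCommGroup U]
    [Module (CGA k G) U] [TopologicalSpace U] : Prop :=
  ∀ N ∈ 𝒩, Uniserial (CGA k G) (coinv k G N U)

variable (k G) in
/-- `S` is a composition factor of the pseudocompact module `U`: it is a composition
factor of some finite coinvariant quotient `U_N`. -/
def IsCompFactorOf (U : Type) [AddCommGroup U] [Module (CGA k G) U]
    [TopologicalSpace U] (S : Type) [AddCommGroup S] [Module (CGA k G) S] : Prop :=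
  ∃ (N : OpenNormalSubgroup G) (W W' : Submodule (CGA k G) (coinv k G N U)),
    W' ≤ W ∧ Nonempty (subQuot W W' ≃ₗ[CGA k G] S)

variable (k G) in
/-- `S` is a composition factor of the finite-dimensional module `X`. -/
def IsCompFactorFin (X : Type) [AddCommGroup X] [Module (CGA k G) X]
    (S : Type) [AddCommGroup S] [Module (CGA k G) S] : Prop :=
  ∃ W W' : Submodule (CGA k G) X, W' ≤ W ∧ Nonempty (subQuot W W' ≃ₗ[CGA k G] S)

end Simples

section Projective

variable {k : Type} [Field k] {G : Type} [Group G] [TopologicalSpace G]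

variable (k G) in
/-- A pseudocompact `k⟦G⟧`-module is (categorically) projective if every continuous
surjection onto it from a pseudocompact module splits. -/
def IsPCProjective (P : Type) [AddCommGroup P] [Module (CGA k G) P]
    [TopologicalSpace P] : Prop :=
  ∀ (W : Type) [AddCommGroup W] [Module k W] [Module (CGA k G) W]
    [IsScalarTower k (CGA k G) W] [TopologicalSpace W],
    IsPseudocompactMod k (CGA k G) W →
    ∀ f : W →ₗ[CGA k G] P, Continuous f → Function.Surjective f →
      ∃ s : P →ₗ[CGA k G] W, Continuous s ∧ f.comp s = LinearMap.id

variable (k G) in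
/-- `P` is a projective cover of the simple module `S` in the block of `e`:
a pseudocompact projective module of the block together with a surjection onto `S`
whose kernel is superfluous (contained in the radical). -/
structure IsProjCover (e : CGA k G) (P : Type) [AddCommGroup P] [Module k P]
    [Module (CGA k G) P] [IsScalarTower k (CGA k G) P] [TopologicalSpace P]
    (S : Type) [AddCommGroup S] [Module (CGA k G) S] : Prop where
  pseudocompact : IsPseudocompactMod k (CGA k G) P
  inBlock : InBlock (CGA k G) (X := P) e
  projective : IsPCProjective k G P
  cover : ∃ π : P →ₗ[CGA k G] S, Function.Surjective π ∧
    LinearMap.ker π ≤ radical (CGA k G) P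

end Projective




/-- The map between subquotients induced by `f`. -/
def subQuotMap {R X Y : Type} [Ring R] [AddCommGroup X] [AddCommGroup Y] [Module R X]
    [Module R Y] (W W' : Submodule R X) (V V' : Submodule R Y) (f : X →ₗ[R] Y) :
    subQuot W W' →ₗ[R] subQuot V V' :=
  mapQ' (W'.comap W.subtype) (V'.comap V.subtype) (restrict' W V f)

/-- The conditions of Proposition 3.8 on a pair of pro-uniserial submodules `X`, `Y`
of an indecomposable projective `P`: `X ∩ Y = Soc(P)`, `X + Y = Rad(P)`, and
`Rad(P)/Soc(P) ≅ X/Soc(P) ⊕ Y/Soc(P)` with no common composition factors. -/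
def ProUniserialPair (k : Type) [Field k] (G : Type) [Group G] [TopologicalSpace G]
    (𝒩 : Set (OpenNormalSubgroup G)) (P : Type) [AddCommGroup P]
    [Module (CGA k G) P] [TopologicalSpace P]
    (X Y : Submodule (CGA k G) P) : Prop :=
  ProUniserial k G 𝒩 X ∧ ProUniserial k G 𝒩 Y ∧
  X ⊓ Y = socle (CGA k G) P ∧
  X ⊔ Y = radical (CGA k G) P ∧
  Nonempty ((subQuot (radical (CGA k G) P) (socle (CGA k G) P)) ≃ₗ[CGA k G]
    (subQuot X (socle (CGA k G) P) × subQuot Y (socle (CGA k G) P))) ∧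
  ∀ (T : Type) [AddCommGroup T] [Module (CGA k G) T], IsSimpleModule (CGA k G) T →
    ¬ (IsCompFactorOf k G (subQuot X (socle (CGA k G) P)) T ∧
       IsCompFactorOf k G (subQuot Y (socle (CGA k G) P)) T)

/-- `S : ι → Type` is a complete set of pairwise non-isomorphic representatives of
the simple modules of the block of `e`. -/
def IsSimpleReps (k : Type) [Field k] (G : Type) [Group G] [TopologicalSpace G]
    (e : CGA k G) {ι : Type} (S : ι → Type) [∀ i, AddCommGroup (S i)]
    [∀ i, Module (CGA k G) (S i)] : Prop :=
  (∀ i, IsSimpleModule (CGA k G) (S i) ∧ InBlock (CGA k G) (X := S i) e) ∧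
  (∀ i j, i ≠ j → IsEmpty (S i ≃ₗ[CGA k G] S j)) ∧
  (∀ (T : Type) [AddCommGroup T] [Module (CGA k G) T],
    IsSimpleModule (CGA k G) T → InBlock (CGA k G) (X := T) e →
      ∃ i, Nonempty (T ≃ₗ[CGA k G] S i))

section Brauer

/-- The size of the `ρ`-orbit of `i` (the number of edges at the corresponding vertex
of the Brauer tree). -/
def orbSize {ι : Type} (ρ : Equiv.Perm ι) (i : ι) : ℕ :=
  Function.minimalPeriod ρ i

/-- Data describing the exceptional vertex of a Brauer tree: `none` if there is no
exceptional vertex, and otherwise a flag recording whether it is a `ρ`-vertex or a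
`σ`-vertex together with an edge adjacent to it. -/
abbrev ExcVertex (ι : Type) : Type := Option (Bool × ι)

/-- The edge `i` is adjacent to the exceptional vertex, its `ρ`-endpoint being
exceptional. -/
def AdjExcRho {ι : Type} (ρ : Equiv.Perm ι) (exc : ExcVertex ι) (i : ι) : Prop :=
  ∃ j : ι, exc = some (true, j) ∧ ρ.SameCycle j i

/-- The edge `i` is adjacent to the exceptional vertex, its `σ`-endpoint being
exceptional. -/
def AdjExcSigma {ι : Type} (σ : Equiv.Perm ι) (exc : ExcVertex ι) (i : ι) : Prop :=
  ∃ j : ι, exc = some (false, j) ∧ σ.SameCycle j i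

/-- The edge `i` is adjacent to the exceptional vertex. -/
def AdjExc {ι : Type} (ρ σ : Equiv.Perm ι) (exc : ExcVertex ι) (i : ι) : Prop :=
  AdjExcRho ρ exc i ∨ AdjExcSigma σ exc i

end Brauer

end ProfiniteBlocks

namespace CyclicBlock

section Basic

variable {k : Type} [Field k] {Γ : Type} [Group Γ]
variable {U V W X : Type} [AddCommGroup U] [Module k U] [AddCommGroup V] [Module k V]
  [AddCommGroup W] [Module k W] [AddCommGroup X] [Module k X]

/-- `f` intertwines two representations. -/
def Eqv (ρ : Representation k Γ V) (σ : Representation k Γ W) (f : V →ₗ[k] W) : Prop :=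
  ∀ g v, f (ρ g v) = σ g (f v)

/-- `Z` is an invariant subspace. -/
def Inv (ρ : Representation k Γ V) (Z : Submodule k V) : Prop :=
  ∀ g, ∀ v ∈ Z, ρ g v ∈ Z

/-- Irreducibility of a representation. -/
def Irr (ρ : Representation k Γ V) : Prop :=
  Nontrivial V ∧ ∀ Z, Inv ρ Z → Z = ⊥ ∨ Z = ⊤

/-- The map `v ↦ ∑ g, σ g (θ (ρ g⁻¹ v))`. -/
def avg [Fintype Γ] (ρ : Representation k Γ V) (σ : Representation k Γ W) (θ : V →ₗ[k] W) :
    V →ₗ[k] W :=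
  ∑ g, (σ g) ∘ₗ θ ∘ₗ (ρ g⁻¹)

/-- Maps that factor through a projective representation, described as averages. -/
def PZ [Fintype Γ] (ρ : Representation k Γ V) (σ : Representation k Γ W) (f : V →ₗ[k] W) : Prop :=
  ∃ θ, f = avg ρ σ θ

lemma rep_inv_apply (ρ : Representation k Γ V) (g : Γ) (v : V) : ρ g⁻¹ (ρ g v) = v := by
  rw [← Module.End.mul_apply, ← map_mul]; simp

lemma rep_apply_inv (ρ : Representation k Γ V) (g : Γ) (v : V) : ρ g (ρ g⁻¹ v) = v := by
  rw [← Module.End.mul_apply, ← map_mul]; simp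

lemma rep_mul_apply (ρ : Representation k Γ V) (g h : Γ) (v : V) : ρ (g * h) v = ρ g (ρ h v) := by
  rw [← Module.End.mul_apply, ← map_mul]

lemma rep_one_apply (ρ : Representation k Γ V) (v : V) : ρ 1 v = v := by
  simp

lemma avg_apply [Fintype Γ] (ρ : Representation k Γ V) (σ : Representation k Γ W) (θ : V →ₗ[k] W)
    (v : V) : avg ρ σ θ v = ∑ g, σ g (θ (ρ g⁻¹ v)) := by
  simp [avg]

namespace Eqv

variable {ρ : Representation k Γ V} {σ : Representation k Γ W} {τ : Representation k Γ X}

lemma id (ρ : Representation k Γ V) : Eqv ρ ρ LinearMap.id := fun _ _ => rfl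

lemma comp {f : V →ₗ[k] W} {h : W →ₗ[k] X} (hh : Eqv σ τ h) (hf : Eqv ρ σ f) :
    Eqv ρ τ (h ∘ₗ f) := fun g v => by simp [hf g v, hh g]

lemma zero : Eqv ρ σ 0 := fun g v => by simp

lemma add {f h : V →ₗ[k] W} (hf : Eqv ρ σ f) (hh : Eqv ρ σ h) : Eqv ρ σ (f + h) :=
  fun g v => by simp [hf g v, hh g v]

lemma sub {f h : V →ₗ[k] W} (hf : Eqv ρ σ f) (hh : Eqv ρ σ h) : Eqv ρ σ (f - h) :=
  fun g v => by simp [hf g v, hh g v]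

lemma smul {f : V →ₗ[k] W} (c : k) (hf : Eqv ρ σ f) : Eqv ρ σ (c • f) :=
  fun g v => by simp [hf g v]

lemma ker {f : V →ₗ[k] W} (hf : Eqv ρ σ f) : Inv ρ (LinearMap.ker f) := fun g v hv => by
  rw [LinearMap.mem_ker] at *; rw [hf, hv, map_zero]

lemma comap {f : V →ₗ[k] W} (hf : Eqv ρ σ f) {Z : Submodule k W} (hZ : Inv σ Z) :
    Inv ρ (Z.comap f) := fun g v hv => by
  rw [Submodule.mem_comap] at *; rw [hf]; exact hZ g _ hv

lemma map {f : V →ₗ[k] W} (hf : Eqv ρ σ f) {Z : Submodule k V} (hZ : Inv ρ Z) :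
    Inv σ (Z.map f) := by
  rintro g _ ⟨v, hv, rfl⟩
  exact ⟨ρ g v, hZ g v hv, hf g v⟩

lemma range {f : V →ₗ[k] W} (hf : Eqv ρ σ f) : Inv σ (LinearMap.range f) := by
  rintro g _ ⟨v, rfl⟩
  exact ⟨ρ g v, hf g v⟩

lemma symm {f : V ≃ₗ[k] W} (hf : Eqv ρ σ f.toLinearMap) : Eqv σ ρ f.symm.toLinearMap :=
  fun g w => by
    apply f.injective
    have := hf g (f.symm w)
    simp only [LinearEquiv.coe_coe, LinearEquiv.apply_symm_apply] at this ⊢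
    exact this.symm

end Eqv

lemma Inv.bot (ρ : Representation k Γ V) : Inv ρ ⊥ := fun g v hv => by
  rw [Submodule.mem_bot] at *; simp [hv]

lemma Inv.top (ρ : Representation k Γ V) : Inv ρ ⊤ := fun _ _ _ => trivial

lemma Inv.inf {ρ : Representation k Γ V} {Z Y : Submodule k V} (hZ : Inv ρ Z) (hY : Inv ρ Y) :
    Inv ρ (Z ⊓ Y) := fun g v hv => ⟨hZ g v hv.1, hY g v hv.2⟩

/-- The subrepresentation on an invariant subspace. -/
def subR (ρ : Representation k Γ V) {Z : Submodule k V} (hZ : Inv ρ Z) : Representation k Γ Z where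
  toFun g := (ρ g).restrict (hZ g)
  map_one' := by ext v; simp [LinearMap.restrict_apply]
  map_mul' g h := by ext v; simp [LinearMap.restrict_apply]

/-- The quotient representation by an invariant subspace. -/
def quoR (ρ : Representation k Γ V) {Z : Submodule k V} (hZ : Inv ρ Z) :
    Representation k Γ (V ⧸ Z) where
  toFun g := Z.mapQ Z (ρ g) (fun v hv => hZ g v hv)
  map_one' := by ext v; simp
  map_mul' g h := by ext v; simp

lemma subR_coe {ρ : Representation k Γ V} {Z : Submodule k V} (hZ : Inv ρ Z) (g : Γ) (v : Z) :
    ((subR ρ hZ g v : Z) : V) = ρ g v := rfl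

lemma eqv_subtype {ρ : Representation k Γ V} {Z : Submodule k V} (hZ : Inv ρ Z) :
    Eqv (subR ρ hZ) ρ Z.subtype := fun _ _ => rfl

lemma eqv_mkQ {ρ : Representation k Γ V} {Z : Submodule k V} (hZ : Inv ρ Z) :
    Eqv ρ (quoR ρ hZ) Z.mkQ := fun _ _ => rfl

lemma Eqv.codRestrict {ρ : Representation k Γ V} {σ : Representation k Γ W} {f : V →ₗ[k] W}
    (hf : Eqv ρ σ f) {Z : Submodule k W} (hZ : Inv σ Z) (h : ∀ v, f v ∈ Z) :
    Eqv ρ (subR σ hZ) (f.codRestrict Z h) := fun g v => Subtype.ext (hf g v)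

/-- A map vanishing on the kernel of a surjection factors through it. -/
lemma exists_factor {q : V →ₗ[k] W} (hq : Function.Surjective q) {f : V →ₗ[k] X}
    (h : LinearMap.ker q ≤ LinearMap.ker f) : ∃ f' : W →ₗ[k] X, f' ∘ₗ q = f := by
  obtain ⟨s, hs⟩ := q.exists_rightInverse_of_surjective (LinearMap.range_eq_top.2 hq)
  refine ⟨f ∘ₗ s, ?_⟩
  ext v
  have : v - s (q v) ∈ LinearMap.ker q := by
    have := LinearMap.congr_fun hs (q v)
    simp only [LinearMap.comp_apply, LinearMap.id_apply] at this
    rw [LinearMap.mem_ker, map_sub, this, sub_self]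
  have := h this
  rw [LinearMap.mem_ker, map_sub, sub_eq_zero] at this
  simp [this]

lemma Eqv.of_comp_surj {ρ : Representation k Γ V} {σ : Representation k Γ W}
    {τ : Representation k Γ X} {q : V →ₗ[k] W} (hq : Function.Surjective q) (hqe : Eqv ρ σ q)
    {f : W →ₗ[k] X} (h : Eqv ρ τ (f ∘ₗ q)) : Eqv σ τ f := fun g w => by
  obtain ⟨v, rfl⟩ := hq w
  rw [← hqe]
  exact h g v

section Schur

variable {ρ : Representation k Γ V} {σ : Representation k Γ W}

lemma Irr.injective (hρ : Irr ρ) {f : V →ₗ[k] W} (hf : Eqv ρ σ f) (h0 : f ≠ 0) :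
    Function.Injective f := by
  rcases hρ.2 _ hf.ker with h | h
  · exact LinearMap.ker_eq_bot.1 h
  · exact absurd (LinearMap.ker_eq_top.1 h) h0

lemma Irr.surjective (hσ : Irr σ) {f : V →ₗ[k] W} (hf : Eqv ρ σ f) (h0 : f ≠ 0) :
    Function.Surjective f := by
  rcases hσ.2 _ hf.range with h | h
  · exact absurd (LinearMap.range_eq_bot.1 h) h0
  · exact LinearMap.range_eq_top.1 h

lemma Irr.equiv (hρ : Irr ρ) (hσ : Irr σ) {f : V →ₗ[k] W} (hf : Eqv ρ σ f) (h0 : f ≠ 0) :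
    ∃ φ : V ≃ₗ[k] W, φ.toLinearMap = f :=
  ⟨LinearEquiv.ofBijective f ⟨hρ.injective hf h0, hσ.surjective hf h0⟩, by ext; rfl⟩

lemma Irr.schur [IsAlgClosed k] [FiniteDimensional k V] (hρ : Irr ρ) {f : V →ₗ[k] V}
    (hf : Eqv ρ ρ f) : ∃ c : k, f = c • LinearMap.id := by
  have := hρ.1
  obtain ⟨c, hc⟩ := Module.End.exists_eigenvalue (K := k) f
  refine ⟨c, ?_⟩
  by_contra h
  have h1 : f - c • LinearMap.id ≠ 0 := fun h' => h (sub_eq_zero.1 h')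
  have h2 := hρ.injective (hf.sub ((Eqv.id ρ).smul c)) h1
  obtain ⟨v, hv⟩ := hc.exists_hasEigenvector
  have h3 := hv.apply_eq_smul
  exact hv.2 (h2 (by simp [h3]))

lemma Irr.congr (hρ : Irr ρ) (φ : V ≃ₗ[k] W) (hφ : Eqv ρ σ φ.toLinearMap) : Irr σ := by
  have := hρ.1
  refine ⟨φ.toEquiv.symm.nontrivial, fun Z hZ => ?_⟩
  rcases hρ.2 _ (hφ.comap hZ) with h | h
  · left
    rw [Submodule.eq_bot_iff] at h ⊢
    intro w hw
    have := h (φ.symm w) (by simpa using hw)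
    simpa using this
  · right
    rw [Submodule.eq_top_iff'] at h ⊢
    intro w
    simpa using h (φ.symm w)

end Schur

section PZ

variable [Fintype Γ] {ρ : Representation k Γ V} {σ : Representation k Γ W}
  {τ : Representation k Γ X} {υ : Representation k Γ U}

lemma avg_eqv (θ : V →ₗ[k] W) : Eqv ρ σ (avg ρ σ θ) := fun g v => by
  rw [avg_apply, avg_apply, map_sum]
  refine Fintype.sum_bijective (fun x => g⁻¹ * x) (Group.mulLeft_bijective _) _ _ fun x => ?_
  rw [← rep_mul_apply, ← rep_mul_apply]
  congr 1
  · simp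
  · simp

lemma PZ.eqv {f : V →ₗ[k] W} (hf : PZ ρ σ f) : Eqv ρ σ f := by
  obtain ⟨θ, rfl⟩ := hf
  exact avg_eqv θ

lemma comp_avg {h : W →ₗ[k] X} (hh : Eqv σ τ h) (θ : V →ₗ[k] W) :
    h ∘ₗ avg ρ σ θ = avg ρ τ (h ∘ₗ θ) := by
  ext v
  simp [avg_apply, hh _ _]

lemma avg_comp {h : U →ₗ[k] V} (hh : Eqv υ ρ h) (θ : V →ₗ[k] W) :
    avg ρ σ θ ∘ₗ h = avg υ σ (θ ∘ₗ h) := by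
  ext v
  simp [avg_apply, hh _ _]

lemma PZ.comp_left {f : V →ₗ[k] W} (hf : PZ ρ σ f) {h : W →ₗ[k] X} (hh : Eqv σ τ h) :
    PZ ρ τ (h ∘ₗ f) := by
  obtain ⟨θ, rfl⟩ := hf
  exact ⟨_, comp_avg hh θ⟩

lemma PZ.comp_right {f : V →ₗ[k] W} (hf : PZ ρ σ f) {h : U →ₗ[k] V} (hh : Eqv υ ρ h) :
    PZ υ σ (f ∘ₗ h) := by
  obtain ⟨θ, rfl⟩ := hf
  exact ⟨_, avg_comp hh θ⟩

lemma PZ.zero : PZ ρ σ 0 := ⟨0, by ext v; simp [avg_apply]⟩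

lemma PZ.add {f h : V →ₗ[k] W} (hf : PZ ρ σ f) (hh : PZ ρ σ h) : PZ ρ σ (f + h) := by
  obtain ⟨θ, rfl⟩ := hf
  obtain ⟨θ', rfl⟩ := hh
  exact ⟨θ + θ', by ext v; simp [avg_apply, Finset.sum_add_distrib]⟩

lemma PZ.smul {f : V →ₗ[k] W} (c : k) (hf : PZ ρ σ f) : PZ ρ σ (c • f) := by
  obtain ⟨θ, rfl⟩ := hf
  exact ⟨c • θ, by ext v; simp [avg_apply, Finset.smul_sum]⟩

lemma PZ.sub {f h : V →ₗ[k] W} (hf : PZ ρ σ f) (hh : PZ ρ σ h) : PZ ρ σ (f - h) := by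
  have := hf.add (hh.smul (-1))
  rwa [neg_one_smul, ← sub_eq_add_neg] at this

lemma PZ.of_id_left (h : PZ ρ ρ LinearMap.id) {f : V →ₗ[k] W} (hf : Eqv ρ σ f) : PZ ρ σ f := by
  simpa using h.comp_left hf

lemma PZ.of_id_right (h : PZ σ σ LinearMap.id) {f : V →ₗ[k] W} (hf : Eqv ρ σ f) : PZ ρ σ f := by
  simpa using h.comp_right hf

/-- Stably zero maps lift along surjections. -/
lemma PZ.lift_surj {f : V →ₗ[k] W} (hf : PZ ρ σ f) {q : X →ₗ[k] W} (hq : Eqv τ σ q)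
    (h : Function.Surjective q) :
    ∃ f', PZ ρ τ f' ∧ q ∘ₗ f' = f := by
  obtain ⟨θ, rfl⟩ := hf
  obtain ⟨s, hs⟩ := q.exists_rightInverse_of_surjective (LinearMap.range_eq_top.2 h)
  refine ⟨avg ρ τ (s ∘ₗ θ), ⟨_, rfl⟩, ?_⟩
  rw [comp_avg hq, ← LinearMap.comp_assoc, hs, LinearMap.id_comp]

/-- Stably zero maps extend along injections. -/
lemma PZ.extend {f : V →ₗ[k] W} (hf : PZ ρ σ f) {i : V →ₗ[k] X} (hi : Eqv ρ τ i)
    (h : Function.Injective i) :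
    ∃ f', PZ τ σ f' ∧ f' ∘ₗ i = f := by
  obtain ⟨θ, rfl⟩ := hf
  obtain ⟨s, hs⟩ := i.exists_leftInverse_of_injective (LinearMap.ker_eq_bot.2 h)
  refine ⟨avg τ σ (θ ∘ₗ s), ⟨_, rfl⟩, ?_⟩
  rw [avg_comp hi, LinearMap.comp_assoc, hs, LinearMap.comp_id]

/-- Lifting for projective representations. -/
lemma PZ.proj_lift (hV : PZ ρ ρ LinearMap.id) {f : V →ₗ[k] W} (hf : Eqv ρ σ f) {q : X →ₗ[k] W}
    (hq : Eqv τ σ q) (h : LinearMap.range f ≤ LinearMap.range q) :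
    ∃ f', Eqv ρ τ f' ∧ q ∘ₗ f' = f := by
  have hf' := hf.codRestrict hq.range (fun v => h ⟨v, rfl⟩)
  have hq' := hq.codRestrict hq.range (fun v => ⟨v, rfl⟩)
  obtain ⟨f', h1, h2⟩ := (hV.of_id_left hf').lift_surj hq' (by
    rintro ⟨_, v, rfl⟩; exact ⟨v, rfl⟩)
  refine ⟨f', h1.eqv, ?_⟩
  ext v
  have := LinearMap.congr_fun h2 v
  exact congrArg Subtype.val this

end PZ

end Basic

section Twist

variable {k : Type} [Field k] {Γ : Type} [Group Γ]
variable {V W : Type} [AddCommGroup V] [Module k V] [AddCommGroup W] [Module k W]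

/-- The twist of a representation by a linear character. -/
def tw (χ : Γ →* kˣ) (ρ : Representation k Γ V) : Representation k Γ V where
  toFun g := (χ g : k) • ρ g
  map_one' := by simp
  map_mul' g h := by
    ext v
    simp only [map_mul, Units.val_mul, LinearMap.smul_apply, Module.End.mul_apply, map_smul,
      mul_smul]
    rw [smul_comm]

variable {ρ : Representation k Γ V} {σ : Representation k Γ W} {χ ψ : Γ →* kˣ}

lemma tw_apply (χ : Γ →* kˣ) (ρ : Representation k Γ V) (g : Γ) (v : V) :
    tw χ ρ g v = (χ g : k) • ρ g v := rfl

lemma tw_one : tw 1 ρ = ρ := by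
  ext g v; simp [tw_apply]

lemma tw_tw : tw χ (tw ψ ρ) = tw (χ * ψ) ρ := by
  ext g v; simp [tw_apply, mul_smul]

lemma char_zpow_zero (χ : Γ →* kˣ) : χ ^ (0 : ℤ) = 1 := by
  ext g; exact congrArg Units.val (zpow_zero (χ g))

lemma char_zpow_one (χ : Γ →* kˣ) : χ ^ (1 : ℤ) = χ := by
  ext g; exact congrArg Units.val (zpow_one (χ g))

lemma char_zpow_add (χ : Γ →* kˣ) (a b : ℤ) : χ ^ (a + b) = χ ^ a * χ ^ b := by
  ext g; exact congrArg Units.val (zpow_add (χ g) a b)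

lemma char_inv_mul (χ : Γ →* kˣ) : χ⁻¹ * χ = 1 := by
  ext g; exact congrArg Units.val (inv_mul_cancel (χ g))

lemma tw_zpow_zero : tw (χ ^ (0 : ℤ)) ρ = ρ := by
  rw [char_zpow_zero, tw_one]

lemma tw_zpow_add (a b : ℤ) : tw (χ ^ a) (tw (χ ^ b) ρ) = tw (χ ^ (a + b)) ρ := by
  rw [tw_tw, char_zpow_add]

lemma Eqv.tw {f : V →ₗ[k] W} (hf : Eqv ρ σ f) (χ : Γ →* kˣ) : Eqv (tw χ ρ) (tw χ σ) f :=
  fun g v => by simp [tw_apply, hf g v]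

lemma Eqv.of_tw {f : V →ₗ[k] W} (hf : Eqv (CyclicBlock.tw χ ρ) (CyclicBlock.tw χ σ) f) :
    Eqv ρ σ f := by
  have := hf.tw χ⁻¹
  rwa [tw_tw, tw_tw, char_inv_mul, tw_one, tw_one] at this

lemma Eqv.shift {f : V →ₗ[k] W} {a b : ℤ} (hf : Eqv (CyclicBlock.tw (χ ^ a) ρ) (CyclicBlock.tw (χ ^ b) σ) f)
    (c : ℤ) : Eqv (CyclicBlock.tw (χ ^ (c + a)) ρ) (CyclicBlock.tw (χ ^ (c + b)) σ) f := by
  rw [← tw_zpow_add, ← tw_zpow_add]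
  exact hf.tw _

lemma Inv.tw {Z : Submodule k V} (h : Inv ρ Z) (χ : Γ →* kˣ) : Inv (tw χ ρ) Z :=
  fun g v hv => Z.smul_mem _ (h g v hv)

lemma Inv.of_tw {Z : Submodule k V} (h : Inv (CyclicBlock.tw χ ρ) Z) : Inv ρ Z := by
  have := h.tw χ⁻¹
  rwa [tw_tw, char_inv_mul, tw_one] at this

lemma Irr.tw (h : Irr ρ) (χ : Γ →* kˣ) : Irr (tw χ ρ) :=
  ⟨h.1, fun Z hZ => h.2 Z hZ.of_tw⟩

lemma avg_tw [Fintype Γ] (χ : Γ →* kˣ) (θ : V →ₗ[k] W) : avg (tw χ ρ) (tw χ σ) θ = avg ρ σ θ := by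
  ext v
  simp [avg_apply, tw_apply, smul_smul]

lemma PZ.tw [Fintype Γ] {f : V →ₗ[k] W} (hf : PZ ρ σ f) (χ : Γ →* kˣ) :
    PZ (tw χ ρ) (tw χ σ) f := by
  obtain ⟨θ, rfl⟩ := hf
  exact ⟨θ, (avg_tw χ θ).symm⟩

end Twist

section Chain

variable {k : Type} [Field k] {Γ : Type} [Group Γ] [Fintype Γ]
variable {V V₂ Z U Y : Type} [AddCommGroup V] [Module k V] [AddCommGroup V₂] [Module k V₂]
  [AddCommGroup Z] [Module k Z] [AddCommGroup U] [Module k U] [AddCommGroup Y] [Module k Y]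

/-- A projective uniserial representation `V` with a twisted endomorphism `t` such that the
invariant subspaces are exactly the ranges of the powers of `t`. -/
structure Chain (χ : Γ →* kˣ) (ρ : Representation k Γ V) (t : Module.End k V) (l : ℕ) : Prop where
  eqv : Eqv (tw χ ρ) ρ t
  pow_eq : t ^ l = 0
  pow_ne : ∀ j < l, t ^ j ≠ 0
  pos : 0 < l
  exists_range : ∀ Z, Inv ρ Z → ∃ j, Z = LinearMap.range (t ^ j)
  proj : PZ ρ ρ LinearMap.id

/-- `q` exhibits `Z` as the quotient of the twist `V ⊗ χ ^ a` of length `m`. -/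
structure LabMap (χ : Γ →* kˣ) (ρ : Representation k Γ V) (t : Module.End k V) (l : ℕ)
    (ζ : Representation k Γ Z) (a : ℤ) (m : ℕ) (q : V →ₗ[k] Z) : Prop where
  surj : Function.Surjective q
  eqv : Eqv (tw (χ ^ a) ρ) ζ q
  ker_eq : LinearMap.ker q = LinearMap.range (t ^ m)
  one_le : 1 ≤ m
  le : m ≤ l

/-- `Z` is the quotient of the twist `V ⊗ χ ^ a` of length `m`. -/
def Lab (χ : Γ →* kˣ) (ρ : Representation k Γ V) (t : Module.End k V) (l : ℕ)
    (ζ : Representation k Γ Z) (a : ℤ) (m : ℕ) : Prop :=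
  ∃ q : V →ₗ[k] Z, LabMap χ ρ t l ζ a m q

variable {χ : Γ →* kˣ} {ρ : Representation k Γ V} {t : Module.End k V} {l : ℕ}
  {ρ₂ : Representation k Γ V₂} {t₂ : Module.End k V₂} {l₂ : ℕ}
  {ζ : Representation k Γ Z} {υ : Representation k Γ U}

lemma range_pow_anti (t : Module.End k V) {i j : ℕ} (h : i ≤ j) :
    LinearMap.range (t ^ j) ≤ LinearMap.range (t ^ i) := by
  obtain ⟨m, rfl⟩ := Nat.exists_eq_add_of_le h
  rw [pow_add]
  exact LinearMap.range_comp_le_range _ _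

lemma map_range_pow (t : Module.End k V) (i j : ℕ) :
    (LinearMap.range (t ^ i)).map (t ^ j) = LinearMap.range (t ^ (j + i)) := by
  rw [pow_add, Module.End.mul_eq_comp, LinearMap.range_comp]

namespace Chain

lemma pow_eqv' (C : Chain χ ρ t l) (j : ℕ) : Eqv (tw (χ ^ (j : ℤ)) ρ) ρ (t ^ j) := by
  induction j with
  | zero => intro g v; simp [tw_apply]
  | succ j ih =>
    have h1 : Eqv (tw (χ ^ ((j : ℤ) + 1)) ρ) (tw (χ ^ (j : ℤ)) ρ) t := by
      rw [← tw_zpow_add, char_zpow_one]; exact C.eqv.tw _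
    have := ih.comp h1
    rw [pow_succ]
    push_cast
    exact this

lemma pow_eqv (C : Chain χ ρ t l) (a : ℤ) (j : ℕ) :
    Eqv (tw (χ ^ (a + j)) ρ) (tw (χ ^ a) ρ) (t ^ j) := by
  rw [← tw_zpow_add]
  exact (C.pow_eqv' j).tw _

lemma inv_range (C : Chain χ ρ t l) (j : ℕ) : Inv ρ (LinearMap.range (t ^ j)) :=
  (C.pow_eqv' j).range

lemma range_eq_bot (C : Chain χ ρ t l) {j : ℕ} (h : l ≤ j) : LinearMap.range (t ^ j) = ⊥ := by
  rw [eq_bot_iff]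
  refine (range_pow_anti t h).trans ?_
  rw [C.pow_eq, LinearMap.range_zero]

lemma le_of_range_le (C : Chain χ ρ t l) {i j : ℕ} (hj : j ≤ l)
    (h : LinearMap.range (t ^ i) ≤ LinearMap.range (t ^ j)) : j ≤ i := by
  by_contra! hij
  have h1 : LinearMap.range (t ^ i) ≤ LinearMap.range (t ^ (i + 1)) :=
    h.trans (range_pow_anti t hij)
  have h2 : ∀ m, LinearMap.range (t ^ i) ≤ LinearMap.range (t ^ (i + m)) := by
    intro m
    induction m with
    | zero => exact le_rfl
    | succ m ih =>
      refine ih.trans ?_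
      have := Submodule.map_mono (f := t ^ m) h1
      rw [map_range_pow, map_range_pow] at this
      rwa [add_comm m i, show m + (i + 1) = i + (m + 1) by ring] at this
  have h3 := h2 l
  rw [C.range_eq_bot (by omega : l ≤ i + l), le_bot_iff, LinearMap.range_eq_bot] at h3
  exact C.pow_ne i (by omega) h3

lemma exists_range_le (C : Chain χ ρ t l) {Y : Submodule k V} (hY : Inv ρ Y) :
    ∃ j ≤ l, Y = LinearMap.range (t ^ j) := by
  obtain ⟨j, hj⟩ := C.exists_range Y hY
  rcases le_total j l with h | h
  · exact ⟨j, h, hj⟩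
  · exact ⟨l, le_rfl, by rw [hj, C.range_eq_bot h, C.range_eq_bot le_rfl]⟩

lemma total (C : Chain χ ρ t l) {X Y : Submodule k V} (hX : Inv ρ X) (hY : Inv ρ Y) :
    X ≤ Y ∨ Y ≤ X := by
  obtain ⟨i, rfl⟩ := C.exists_range X hX
  obtain ⟨j, rfl⟩ := C.exists_range Y hY
  rcases le_total i j with h | h
  · exact Or.inr (range_pow_anti t h)
  · exact Or.inl (range_pow_anti t h)

lemma le_range_one (C : Chain χ ρ t l) {Y : Submodule k V} (hY : Inv ρ Y) (h : Y ≠ ⊤) :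
    Y ≤ LinearMap.range t := by
  obtain ⟨j, rfl⟩ := C.exists_range Y hY
  have : 1 ≤ j := by
    by_contra! h'
    interval_cases j
    exact h (by rw [pow_zero]; exact LinearMap.range_id)
  simpa using range_pow_anti t this

lemma range_ne_top (C : Chain χ ρ t l) : LinearMap.range t ≠ ⊤ := fun h => by
  have h1 : LinearMap.range (t ^ 0) ≤ LinearMap.range (t ^ 1) := by rw [pow_one, h]; exact le_top
  have := C.le_of_range_le C.pos h1
  omega

lemma sup_eq_top (C : Chain χ ρ t l) {X Y : Submodule k V} (hX : Inv ρ X) (hY : Inv ρ Y)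
    (h : X ⊔ Y = ⊤) : X = ⊤ ∨ Y = ⊤ := by
  rcases C.total hX hY with h' | h'
  · right; rwa [sup_eq_right.2 h'] at h
  · left; rwa [sup_eq_left.2 h'] at h

lemma ker_pow (C : Chain χ ρ t l) {j : ℕ} (hj : j ≤ l) :
    LinearMap.ker (t ^ j) = LinearMap.range (t ^ (l - j)) := by
  obtain ⟨i, hi, h⟩ := C.exists_range_le ((C.pow_eqv' j).ker.of_tw)
  rw [h]
  apply le_antisymm
  · apply range_pow_anti
    have h1 : LinearMap.range (t ^ (j + i)) ≤ LinearMap.range (t ^ l) := by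
      rw [C.pow_eq, LinearMap.range_zero, ← map_range_pow, ← h]
      rintro _ ⟨v, hv, rfl⟩
      simpa using hv
    have := C.le_of_range_le le_rfl h1
    omega
  · rw [← h]
    rintro _ ⟨v, rfl⟩
    rw [LinearMap.mem_ker, ← Module.End.mul_apply, ← pow_add,
      show j + (l - j) = l by omega, C.pow_eq, LinearMap.zero_apply]

lemma le_range_succ (C : Chain χ ρ t l) {m : ℕ} {Y : Submodule k V} (hY : Inv ρ Y)
    (h : Y < LinearMap.range (t ^ m)) : Y ≤ LinearMap.range (t ^ (m + 1)) := by
  obtain ⟨j, rfl⟩ := C.exists_range Y hY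
  apply range_pow_anti
  by_contra! hj
  exact absurd (range_pow_anti t (by omega : j ≤ m)) (not_le_of_gt h)

/-- A twisted isomorphism of chains carries powers of one endomorphism to those of the other. -/
lemma map_range_le (C : Chain χ ρ t l) (C₂ : Chain χ ρ₂ t₂ l₂) {a b : ℤ} (y : V ≃ₗ[k] V₂)
    (hy : Eqv (tw (χ ^ a) ρ) (tw (χ ^ b) ρ₂) y.toLinearMap) (m : ℕ)
    (ih : (LinearMap.range (t ^ m)).map y.toLinearMap = LinearMap.range (t₂ ^ m)) :
    (LinearMap.range (t ^ (m + 1))).map y.toLinearMap ≤ LinearMap.range (t₂ ^ (m + 1)) := by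
  have hle : (LinearMap.range (t ^ (m + 1))).map y.toLinearMap ≤ LinearMap.range (t₂ ^ m) := by
    rw [← ih]; exact Submodule.map_mono (range_pow_anti t (by omega))
  rcases hle.lt_or_eq with h | h
  · exact C₂.le_range_succ (hy.map ((C.inv_range (m + 1)).tw _)).of_tw h
  · rw [← ih] at h
    have h2 := Submodule.map_injective_of_injective y.injective h
    by_cases hl : l ≤ m
    · rw [C.range_eq_bot (by omega : l ≤ m + 1), Submodule.map_bot]; exact bot_le
    · have := C.le_of_range_le (by omega : m + 1 ≤ l) h2.ge
      omega

lemma map_range_eq (C : Chain χ ρ t l) (C₂ : Chain χ ρ₂ t₂ l₂) {a b : ℤ} (y : V ≃ₗ[k] V₂)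
    (hy : Eqv (tw (χ ^ a) ρ) (tw (χ ^ b) ρ₂) y.toLinearMap) (m : ℕ) :
    (LinearMap.range (t ^ m)).map y.toLinearMap = LinearMap.range (t₂ ^ m) := by
  induction m with
  | zero =>
    rw [pow_zero, pow_zero]
    change (LinearMap.range LinearMap.id).map _ = LinearMap.range LinearMap.id
    rw [LinearMap.range_id, LinearMap.range_id, Submodule.map_top]
    exact LinearEquiv.range y
  | succ m ih =>
    apply le_antisymm (C.map_range_le C₂ y hy m ih)
    have ih' : (LinearMap.range (t₂ ^ m)).map y.symm.toLinearMap = LinearMap.range (t ^ m) := by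
      rw [← ih, ← Submodule.map_comp]
      simp
    have := Submodule.map_mono (f := y.toLinearMap) (C₂.map_range_le C y.symm hy.symm m ih')
    rw [← Submodule.map_comp] at this
    simpa using this

/-- Two maps from twisted chains with the same nonzero range differ by an isomorphism. -/
lemma exists_equiv [FiniteDimensional k V] [FiniteDimensional k V₂]
    (C : Chain χ ρ t l) (C₂ : Chain χ ρ₂ t₂ l₂) {a b : ℤ} {f : V →ₗ[k] Z}
    (hf : Eqv (tw (χ ^ a) ρ) ζ f) {f₂ : V₂ →ₗ[k] Z} (hf₂ : Eqv (tw (χ ^ b) ρ₂) ζ f₂)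
    (h : LinearMap.range f = LinearMap.range f₂) (h0 : f ≠ 0) :
    ∃ y : V ≃ₗ[k] V₂, Eqv (tw (χ ^ a) ρ) (tw (χ ^ b) ρ₂) y.toLinearMap ∧
      f = f₂ ∘ₗ y.toLinearMap := by
  have key : ∀ {V V₂ : Type} [AddCommGroup V] [Module k V] [AddCommGroup V₂] [Module k V₂]
      {t : Module.End k V} {l : ℕ} {t₂ : Module.End k V₂} {l₂ : ℕ}
      {ρ : Representation k Γ V} {ρ₂ : Representation k Γ V₂} (_ : Chain χ ρ t l)
      (_ : Chain χ ρ₂ t₂ l₂) {a b : ℤ} {f : V →ₗ[k] Z}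
      (_ : Eqv (tw (χ ^ a) ρ) ζ f) {f₂ : V₂ →ₗ[k] Z} (_ : Eqv (tw (χ ^ b) ρ₂) ζ f₂)
      (_ : LinearMap.range f = LinearMap.range f₂) (_ : f ≠ 0),
      ∃ y : V →ₗ[k] V₂, Eqv (tw (χ ^ a) ρ) (tw (χ ^ b) ρ₂) y ∧ f₂ ∘ₗ y = f ∧
        Function.Surjective y := by
    intro V V₂ _ _ _ _ t l t₂ l₂ ρ ρ₂ C C₂ a b f hf f₂ hf₂ h h0
    obtain ⟨y, hy, hy2⟩ := (C.proj.tw (χ ^ a)).proj_lift hf hf₂ h.le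
    refine ⟨y, hy, hy2, ?_⟩
    rw [← LinearMap.range_eq_top]
    have h1 : LinearMap.range y ⊔ LinearMap.ker f₂ = ⊤ := by
      rw [eq_top_iff]
      rintro v -
      have : f₂ v ∈ LinearMap.range f := h ▸ ⟨v, rfl⟩
      obtain ⟨u, hu⟩ := this
      have : v = y u + (v - y u) := by abel
      rw [this]
      refine Submodule.add_mem_sup ⟨u, rfl⟩ ?_
      rw [LinearMap.mem_ker, map_sub, ← hu, ← hy2]
      simp
    rcases C₂.sup_eq_top hy.range.of_tw hf₂.ker.of_tw h1 with h2 | h2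
    · exact h2
    · exfalso
      rw [LinearMap.ker_eq_top] at h2
      rw [h2, LinearMap.range_zero, LinearMap.range_eq_bot] at h
      exact h0 h
  obtain ⟨y, hy, hy2, hys⟩ := key C C₂ hf hf₂ h h0
  have h0' : f₂ ≠ 0 := by
    rintro rfl
    rw [LinearMap.range_zero, LinearMap.range_eq_bot] at h
    exact h0 h
  obtain ⟨y', -, -, hys'⟩ := key C₂ C hf₂ hf h.symm h0'
  have hd : Module.finrank k V = Module.finrank k V₂ :=
    le_antisymm (LinearMap.finrank_le_finrank_of_injective (f := (y'.exists_rightInverse_of_surjective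
      (LinearMap.range_eq_top.2 hys')).choose) (fun a b hab => by
        have := (y'.exists_rightInverse_of_surjective (LinearMap.range_eq_top.2 hys')).choose_spec
        have h1 := LinearMap.congr_fun this a
        have h2 := LinearMap.congr_fun this b
        simp only [LinearMap.comp_apply, LinearMap.id_apply] at h1 h2
        rw [← h1, ← h2, hab]))
      (LinearMap.finrank_le_finrank_of_injective (f := (y.exists_rightInverse_of_surjective
      (LinearMap.range_eq_top.2 hys)).choose) (fun a b hab => by
        have := (y.exists_rightInverse_of_surjective (LinearMap.range_eq_top.2 hys)).choose_spec
        have h1 := LinearMap.congr_fun this a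
        have h2 := LinearMap.congr_fun this b
        simp only [LinearMap.comp_apply, LinearMap.id_apply] at h1 h2
        rw [← h1, ← h2, hab]))
  have hyi := (LinearMap.injective_iff_surjective_of_finrank_eq_finrank hd).2 hys
  exact ⟨LinearEquiv.ofBijective y ⟨hyi, hys⟩, hy, hy2.symm⟩

/-- Two maps with the same nonzero range from a chain agree up to a scalar on the top. -/
lemma exists_smul_lt [IsAlgClosed k] [FiniteDimensional k V] (C : Chain χ ρ t l) {a : ℤ}
    {f x : V →ₗ[k] Z} (hf : Eqv (tw (χ ^ a) ρ) ζ f) (hx : Eqv (tw (χ ^ a) ρ) ζ x)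
    (h : LinearMap.range f = LinearMap.range x) (h0 : f ≠ 0) :
    ∃ β : k, LinearMap.range (f - β • x) < LinearMap.range f := by
  obtain ⟨y, hy, rfl⟩ := C.exists_equiv C hf hx h h0
  have : Nontrivial V := by
    by_contra hn
    rw [not_nontrivial_iff_subsingleton] at hn
    exact h0 (Subsingleton.elim _ _)
  obtain ⟨β, hβ⟩ := Module.End.exists_eigenvalue (K := k) y.toLinearMap
  refine ⟨β, ?_⟩
  have hye : Eqv (tw (χ ^ a) ρ) (tw (χ ^ a) ρ) (y.toLinearMap - β • LinearMap.id) :=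
    hy.sub ((Eqv.id _).smul β)
  have h1 : LinearMap.range (y.toLinearMap - β • LinearMap.id) ≤ LinearMap.range t := by
    refine C.le_range_one hye.range.of_tw fun htop => ?_
    have := LinearMap.injective_iff_surjective.2 (LinearMap.range_eq_top.1 htop)
    obtain ⟨v, hv⟩ := hβ.exists_hasEigenvector
    have h3 := hv.apply_eq_smul
    refine hv.2 (this ?_)
    simpa [sub_eq_zero] using h3
  have h2 : x ∘ₗ y.toLinearMap - β • x = x ∘ₗ (y.toLinearMap - β • LinearMap.id) := by
    ext v; simp
  rw [h2, LinearMap.range_comp, h, LinearMap.range_eq_map x]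
  refine lt_of_le_of_ne (Submodule.map_mono le_top) fun heq => ?_
  have h3 : LinearMap.range t ⊔ LinearMap.ker x = ⊤ := by
    rw [eq_top_iff]
    rintro v -
    have : x v ∈ Submodule.map x (LinearMap.range (y.toLinearMap - β • LinearMap.id)) := by
      rw [heq]; exact ⟨v, trivial, rfl⟩
    obtain ⟨u, hu, huv⟩ := this
    rw [show v = u + (v - u) by abel]
    exact Submodule.add_mem_sup (h1 hu) (by rw [LinearMap.mem_ker, map_sub, huv, sub_self])
  rcases C.sup_eq_top (by simpa using C.inv_range 1) hx.ker.of_tw h3 with h4 | h4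
  · exact C.range_ne_top h4
  · rw [LinearMap.ker_eq_top] at h4
    exact h0 (by rw [h4, LinearMap.zero_comp])

end Chain

end Chain

section Core

variable {k : Type} [Field k] {Γ : Type} [Group Γ] [Fintype Γ]
variable {V V₂ Z U Y : Type} [AddCommGroup V] [Module k V] [AddCommGroup V₂] [Module k V₂]
  [AddCommGroup Z] [Module k Z] [AddCommGroup U] [Module k U] [AddCommGroup Y] [Module k Y]
variable {χ : Γ →* kˣ} {ρ : Representation k Γ V} {t : Module.End k V} {l : ℕ}
  {ρ₂ : Representation k Γ V₂} {t₂ : Module.End k V₂} {l₂ : ℕ}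
  {ζ : Representation k Γ Z} {υ : Representation k Γ U}

lemma comp_pow_eq_zero_iff {f : V →ₗ[k] Z} {n : ℕ} :
    f ∘ₗ (t ^ n) = 0 ↔ LinearMap.range (t ^ n) ≤ LinearMap.ker f := by
  rw [LinearMap.range_le_ker_iff]

lemma LabMap.comp_pow_eq_zero {a : ℤ} {m n : ℕ} {q : V →ₗ[k] Z} (L : LabMap χ ρ t l ζ a m q)
    (h : m ≤ n) : q ∘ₗ (t ^ n) = 0 := by
  rw [comp_pow_eq_zero_iff, L.ker_eq]
  exact range_pow_anti t h

lemma LabMap.le_of_comp_pow (C : Chain χ ρ t l) {a : ℤ} {m n : ℕ} {q : V →ₗ[k] Z}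
    (L : LabMap χ ρ t l ζ a m q) (h : q ∘ₗ (t ^ n) = 0) : m ≤ n := by
  rw [comp_pow_eq_zero_iff, L.ker_eq] at h
  exact C.le_of_range_le L.le h

lemma LabMap.exists_range (C : Chain χ ρ t l) {a : ℤ} {m : ℕ} {q : V →ₗ[k] Z}
    (L : LabMap χ ρ t l ζ a m q) {Y : Submodule k Z} (hY : Inv ζ Y) (h0 : Y ≠ ⊥) :
    ∃ i < m, Y = (LinearMap.range (t ^ i)).map q := by
  obtain ⟨i, hi⟩ := C.exists_range _ (L.eqv.comap hY).of_tw
  have h1 : Y = (LinearMap.range (t ^ i)).map q := by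
    rw [← hi, Submodule.map_comap_eq_of_surjective L.surj]
  refine ⟨i, ?_, h1⟩
  by_contra! h
  apply h0
  rw [h1, ← LinearMap.range_comp, L.comp_pow_eq_zero h, LinearMap.range_zero]

/-- Minimising the range of a map modulo a space of maps produces a label. -/
theorem Chain.core [IsAlgClosed k] [FiniteDimensional k V] [FiniteDimensional k V₂]
    [FiniteDimensional k Z]
    (C : Chain χ ρ t l) (C₂ : Chain χ ρ₂ t₂ l₂) {b : ℤ} {m : ℕ} {q : V₂ →ₗ[k] Z}
    (L : LabMap χ ρ₂ t₂ l₂ ζ b m q) {a : ℤ} {n : ℕ} (𝒮 : Submodule k (V →ₗ[k] Z))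
    (h𝒮 : ∀ s ∈ 𝒮, Eqv (tw (χ ^ a) ρ) ζ s) (hn : ∀ s ∈ 𝒮, s ∘ₗ (t ^ n) = 0)
    {f : V →ₗ[k] Z} (hf : Eqv (tw (χ ^ a) ρ) ζ f) (hfn : f ∘ₗ (t ^ n) = 0) (hf𝒮 : f ∉ 𝒮) :
    ∃ f', f' - f ∈ 𝒮 ∧ (∀ s ∈ 𝒮, LinearMap.range s ≠ LinearMap.range f') ∧
      ∃ i < m, LinearMap.range f' = (LinearMap.range (t₂ ^ i)).map q ∧ m ≤ i + n ∧
      ∃ q' : V →ₗ[k] Z, LabMap χ ρ t l ζ (a - i) m q' ∧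
        LinearMap.range f' = LinearMap.range (q' ∘ₗ (t ^ i)) := by
  have hne : ∃ d, ∃ f', f' - f ∈ 𝒮 ∧ Module.finrank k (LinearMap.range f') = d :=
    ⟨_, f, by simp, rfl⟩
  obtain ⟨f', hf', hd⟩ := Nat.find_spec hne
  have hmin : ∀ f'', f'' - f ∈ 𝒮 → ¬ LinearMap.range f'' < LinearMap.range f' := by
    intro f'' h h2
    have h3 := Submodule.finrank_lt_finrank_of_lt h2
    rw [hd] at h3
    exact Nat.find_min hne h3 ⟨f'', h, rfl⟩
  have hf'e : Eqv (tw (χ ^ a) ρ) ζ f' := by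
    have := hf.add (h𝒮 _ hf')
    rwa [add_sub_cancel] at this
  have hf'n : f' ∘ₗ (t ^ n) = 0 := by
    have := hn _ hf'
    rwa [LinearMap.sub_comp, hfn, sub_zero] at this
  have hf'S : f' ∉ 𝒮 := fun h => hf𝒮 (by simpa using 𝒮.sub_mem h hf')
  have h0 : f' ≠ 0 := by rintro rfl; exact hf'S 𝒮.zero_mem
  have hsep : ∀ s ∈ 𝒮, LinearMap.range s ≠ LinearMap.range f' := by
    intro s hs h
    obtain ⟨β, hβ⟩ := C.exists_smul_lt hf'e (h𝒮 s hs) h.symm h0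
    refine hmin _ ?_ hβ
    rw [sub_right_comm]
    exact 𝒮.sub_mem hf' (𝒮.smul_mem _ hs)
  refine ⟨f', hf', hsep, ?_⟩
  obtain ⟨i, hi, hri⟩ := L.exists_range C₂ hf'e.range
    (by rwa [Ne, LinearMap.range_eq_bot])
  refine ⟨i, hi, hri, ?_⟩
  have hqi : Eqv (tw (χ ^ (b + i)) ρ₂) ζ (q ∘ₗ (t₂ ^ i)) := L.eqv.comp (C₂.pow_eqv b i)
  obtain ⟨y, hy, hfy⟩ := C.exists_equiv C₂ hf'e hqi (by rw [hri, LinearMap.range_comp]) h0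
  have hyr := C.map_range_eq C₂ y hy
  have hkey : ∀ j, (q ∘ₗ y.toLinearMap) ∘ₗ (t ^ j) = 0 ↔ q ∘ₗ (t₂ ^ j) = 0 := by
    intro j
    rw [← LinearMap.range_eq_bot, ← LinearMap.range_eq_bot (f := q ∘ₗ (t₂ ^ j)),
      LinearMap.range_comp, LinearMap.range_comp, ← hyr j, Submodule.map_comp]
  have hyi : y.toLinearMap ∘ₗ (t ^ n) = y.toLinearMap ∘ₗ (t ^ n) := rfl
  have hmn : m ≤ i + n := by
    refine L.le_of_comp_pow C₂ ?_
    rw [← LinearMap.range_eq_bot, pow_add, Module.End.mul_eq_comp, ← LinearMap.comp_assoc,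
      LinearMap.range_comp, ← hyr n, ← Submodule.map_comp, ← hfy, ← LinearMap.range_comp, hf'n,
      LinearMap.range_zero]
  have hl : l₂ ≤ l := by
    refine C₂.le_of_range_le le_rfl ?_
    rw [← hyr l, C.pow_eq]
    simp
  refine ⟨hmn, q ∘ₗ y.toLinearMap, ⟨?_, ?_, ?_, L.one_le, L.le.trans hl⟩, ?_⟩
  · exact L.surj.comp y.surjective
  · have := hy.shift (-(i : ℤ))
    rw [show -(i : ℤ) + a = a - i by ring, show -(i : ℤ) + (b + i) = b by ring] at this
    exact L.eqv.comp this
  · rw [LinearMap.ker_comp, L.ker_eq, ← hyr m, Submodule.comap_map_eq_of_injective y.injective]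
  · rw [hri, LinearMap.comp_assoc, LinearMap.range_comp, LinearMap.range_comp, hyr i]

/-- A map from a submodule of a chain that does not extend produces a label. -/
theorem Chain.lab_of_not_extend [IsAlgClosed k] [FiniteDimensional k V] [FiniteDimensional k V₂]
    [FiniteDimensional k Z]
    (C : Chain χ ρ t l) (C₂ : Chain χ ρ₂ t₂ l₂) {b : ℤ} {m : ℕ} {q : V₂ →ₗ[k] Z}
    (L : LabMap χ ρ₂ t₂ l₂ ζ b m q) {j n : ℕ} {f : V →ₗ[k] Z}
    (hf : Eqv (tw (χ ^ (j : ℤ)) ρ) ζ f) (hfn : f ∘ₗ (t ^ n) = 0)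
    (hne : ∀ x : V →ₗ[k] Z, Eqv ρ ζ x → x ∘ₗ (t ^ (j + n)) = 0 → x ∘ₗ (t ^ j) ≠ f) :
    ∃ c : ℤ, Lab χ ρ t l ζ c m ∧ 0 < c ∧ c ≤ j ∧ j < c + m ∧ c + m ≤ j + n := by
  let 𝒮 : Submodule k (V →ₗ[k] Z) :=
    { carrier := {s | ∃ x, Eqv ρ ζ x ∧ x ∘ₗ (t ^ (j + n)) = 0 ∧ x ∘ₗ (t ^ j) = s}
      add_mem' := by
        rintro _ _ ⟨x, h1, h2, rfl⟩ ⟨x', h1', h2', rfl⟩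
        exact ⟨x + x', h1.add h1', by rw [LinearMap.add_comp, h2, h2', add_zero],
          LinearMap.add_comp _ _ _⟩
      zero_mem' := ⟨0, Eqv.zero, LinearMap.zero_comp _, LinearMap.zero_comp _⟩
      smul_mem' := by
        rintro c _ ⟨x, h1, h2, rfl⟩
        exact ⟨c • x, h1.smul c, by rw [LinearMap.smul_comp, h2, smul_zero],
          LinearMap.smul_comp _ _ _⟩ }
  obtain ⟨f', -, hsep, i, hi, -, hmn, q', L', hr⟩ := C.core C₂ L (a := j) (n := n) 𝒮
    (by
      rintro _ ⟨x, h1, -, rfl⟩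
      exact h1.comp (C.pow_eqv' j))
    (by
      rintro _ ⟨x, -, h2, rfl⟩
      rw [LinearMap.comp_assoc, ← Module.End.mul_eq_comp, ← pow_add, h2])
    hf hfn (by rintro ⟨x, h1, h2, h3⟩; exact hne x h1 h2 h3)
  refine ⟨(j : ℤ) - i, ⟨q', L'⟩, ?_, by omega, by omega, by omega⟩
  by_contra! hc
  have hij : j ≤ i := by omega
  refine hsep (q' ∘ₗ (t ^ i)) ⟨q' ∘ₗ (t ^ (i - j)), ?_, ?_, ?_⟩ hr.symm
  · have := L'.eqv.comp (C.pow_eqv ((j : ℤ) - i) (i - j))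
    rw [show (j : ℤ) - i + ((i - j : ℕ) : ℤ) = 0 by omega, tw_zpow_zero] at this
    exact this
  · rw [LinearMap.comp_assoc, ← Module.End.mul_eq_comp, ← pow_add]
    exact L'.comp_pow_eq_zero (by omega)
  · rw [LinearMap.comp_assoc, ← Module.End.mul_eq_comp, ← pow_add, show i - j + j = i by omega]

/-- A map between uniserial representations that is not stably zero relates their labels. -/
theorem Chain.lab_of_not_pz [IsAlgClosed k] [FiniteDimensional k V] [FiniteDimensional k V₂]
    [FiniteDimensional k Z]
    (C : Chain χ ρ t l) (C₂ : Chain χ ρ₂ t₂ l₂) {b : ℤ} {m : ℕ} {q : V₂ →ₗ[k] Z}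
    (L : LabMap χ ρ₂ t₂ l₂ ζ b m q) {a : ℤ} {n : ℕ} {qU : V →ₗ[k] U}
    (LU : LabMap χ ρ t l υ a n qU) {f : U →ₗ[k] Z} (hf : Eqv υ ζ f) (hne : ¬ PZ υ ζ f) :
    ∃ c : ℤ, Lab χ ρ t l ζ c m ∧ c ≤ a ∧ a < c + m ∧ c + m ≤ a + n ∧ a + n < c + l := by
  let 𝒮 : Submodule k (V →ₗ[k] Z) :=
    { carrier := {s | ∃ x, PZ υ ζ x ∧ x ∘ₗ qU = s}
      add_mem' := by
        rintro _ _ ⟨x, h1, rfl⟩ ⟨x', h1', rfl⟩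
        exact ⟨x + x', h1.add h1', LinearMap.add_comp _ _ _⟩
      zero_mem' := ⟨0, PZ.zero, LinearMap.zero_comp _⟩
      smul_mem' := by
        rintro c _ ⟨x, h1, rfl⟩
        exact ⟨c • x, h1.smul c, LinearMap.smul_comp _ _ _⟩ }
  obtain ⟨f', -, hsep, i, hi, -, hmn, q', L', hr⟩ := C.core C₂ L (a := a) (n := n) 𝒮
    (by
      rintro _ ⟨x, h1, rfl⟩
      exact h1.eqv.comp LU.eqv)
    (by
      rintro _ ⟨x, -, rfl⟩
      rw [LinearMap.comp_assoc, LU.comp_pow_eq_zero le_rfl, LinearMap.comp_zero])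
    (f := f ∘ₗ qU) (hf.comp LU.eqv)
    (by rw [LinearMap.comp_assoc, LU.comp_pow_eq_zero le_rfl, LinearMap.comp_zero])
    (by
      rintro ⟨x, h1, h2⟩
      rw [LinearMap.cancel_right LU.surj] at h2
      exact hne (h2 ▸ h1))
  refine ⟨a - i, ⟨q', L'⟩, by omega, by omega, by omega, ?_⟩
  by_contra! hc
  have hln : l - n ≤ i := by omega
  have hnl := LU.le
  obtain ⟨e, he⟩ := exists_factor LU.surj (f := (t ^ (l - n) : V →ₗ[k] V))
    (by rw [LU.ker_eq, C.ker_pow (by omega), show l - (l - n) = n by omega])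
  have hee : Eqv υ (tw (χ ^ (a - ((l - n : ℕ) : ℤ))) ρ) e := by
    refine Eqv.of_comp_surj LU.surj LU.eqv ?_
    rw [he]
    have := C.pow_eqv (a - ((l - n : ℕ) : ℤ)) (l - n)
    rwa [sub_add_cancel] at this
  have hx : Eqv (tw (χ ^ (a - ((l - n : ℕ) : ℤ))) ρ) ζ (q' ∘ₗ (t ^ (i - (l - n)))) := by
    have := L'.eqv.comp (C.pow_eqv (a - i) (i - (l - n)))
    rwa [show a - (i : ℤ) + ((i - (l - n) : ℕ) : ℤ) = a - ((l - n : ℕ) : ℤ) by omega] at this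
  refine hsep _ ⟨_, ((C.proj.tw _).of_id_right hee).comp_left hx, rfl⟩ ?_
  rw [hr, LinearMap.comp_assoc, he, LinearMap.comp_assoc, ← Module.End.mul_eq_comp, ← pow_add,
    show i - (l - n) + (l - n) = i by omega]

/-- Overlapping labels give a map that is not stably zero. -/
theorem Chain.exists_not_pz [FiniteDimensional k V]
    (C : Chain χ ρ t l) {a c : ℤ} {n m : ℕ} {qU : V →ₗ[k] U} {q : V →ₗ[k] Z}
    (LU : LabMap χ ρ t l υ a n qU) (L : LabMap χ ρ t l ζ c m q)
    (h1 : c ≤ a) (h2 : a < c + m) (h3 : c + m ≤ a + n) (h4 : a + n < c + l) :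
    ∃ f : U →ₗ[k] Z, Eqv υ ζ f ∧ ¬ PZ υ ζ f ∧ (Function.Surjective f → a = c) ∧
      (Function.Injective f → a = c → n = m) := by
  obtain ⟨i, rfl⟩ : ∃ i : ℕ, a = c + i := ⟨(a - c).toNat, by omega⟩
  obtain ⟨f, hf⟩ := exists_factor LU.surj (f := q ∘ₗ (t ^ i)) (by
    rw [LU.ker_eq, ← comp_pow_eq_zero_iff, LinearMap.comp_assoc, ← Module.End.mul_eq_comp,
      ← pow_add]
    exact L.comp_pow_eq_zero (by omega))
  have hqi : Eqv (tw (χ ^ (c + i)) ρ) ζ (q ∘ₗ (t ^ i)) := L.eqv.comp (C.pow_eqv c i)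
  refine ⟨f, Eqv.of_comp_surj LU.surj LU.eqv (by rwa [hf]), fun hpz => ?_, fun hs => ?_,
    fun hi hac => ?_⟩
  · obtain ⟨F, hF, hFf⟩ := hpz.lift_surj L.eqv L.surj
    have hFq := hF.eqv.comp LU.eqv
    obtain ⟨j, hj⟩ := C.exists_range _ hFq.range.of_tw
    have hsum : LinearMap.range (q ∘ₗ (t ^ j)) = LinearMap.range (q ∘ₗ (t ^ i)) := by
      rw [LinearMap.range_comp, ← hj, ← LinearMap.range_comp, ← LinearMap.comp_assoc, hFf, hf]
    have hji : j ≤ i := by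
      by_contra! hij
      have : LinearMap.range (t ^ i) ≤ LinearMap.range (t ^ (i + 1)) := by
        rintro v hv
        have : q v ∈ LinearMap.range (q ∘ₗ (t ^ j)) := by
          rw [hsum, LinearMap.range_comp]; exact ⟨v, hv, rfl⟩
        obtain ⟨w, hw⟩ := this
        rw [show v = (t ^ j) w + (v - (t ^ j) w) by abel]
        refine Submodule.add_mem _ (range_pow_anti t hij ⟨w, rfl⟩) ?_
        have : v - (t ^ j) w ∈ LinearMap.ker q := by
          rw [LinearMap.mem_ker, map_sub, ← hw]; simp
        rw [L.ker_eq] at this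
        exact range_pow_anti t (by omega) this
      have hml := L.le
      have := C.le_of_range_le (by omega) this
      omega
    have hd1 := LinearMap.finrank_range_add_finrank_ker (F ∘ₗ qU)
    have hd2 := LinearMap.finrank_range_add_finrank_ker (t ^ (l - n))
    have hnl := LU.le
    rw [C.ker_pow (by omega), show l - (l - n) = n by omega] at hd2
    have hd3 : Module.finrank k (LinearMap.range (t ^ n)) ≤
        Module.finrank k (LinearMap.ker (F ∘ₗ qU)) := by
      apply Submodule.finrank_mono
      rw [← LU.ker_eq]
      exact LinearMap.ker_le_ker_comp _ _
    rw [hj] at hd1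
    have hd4 : Module.finrank k (LinearMap.range (t ^ j)) ≤
      Module.finrank k (LinearMap.range (t ^ (l - n))) := by omega
    have hle : LinearMap.range (t ^ (l - n)) ≤ LinearMap.range (t ^ j) :=
      range_pow_anti t (by omega)
    have heq := Submodule.eq_of_le_of_finrank_le hle hd4
    have := C.le_of_range_le (by omega : l - n ≤ l) heq.ge
    omega
  · have h5 : LinearMap.range (t ^ i) ⊔ LinearMap.range (t ^ m) = ⊤ := by
      rw [eq_top_iff]
      rintro v -
      obtain ⟨u, hu⟩ := hs (q v)
      obtain ⟨w, rfl⟩ := LU.surj u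
      have h6 : q ((t ^ i) w) = q v := by
        rw [← hu]; exact (LinearMap.congr_fun hf w).symm
      rw [show v = (t ^ i) w + (v - (t ^ i) w) by abel]
      refine Submodule.add_mem_sup ⟨w, rfl⟩ ?_
      rw [← L.ker_eq, LinearMap.mem_ker, map_sub, h6, sub_self]
    have key : ∀ r, LinearMap.range (t ^ r) = ⊤ → r = 0 := fun r hr => by
      have : LinearMap.range (t ^ 0) ≤ LinearMap.range (t ^ r) := by rw [hr]; exact le_top
      by_contra h
      exact C.range_ne_top (top_le_iff.1 (hr ▸ by
        simpa using range_pow_anti t (show 1 ≤ r by omega)))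
    have hm1 := L.one_le
    rcases C.sup_eq_top (C.inv_range i) (C.inv_range m) h5 with h | h
    · simp [key _ h]
    · have := key _ h; omega
  · have hi0 : i = 0 := by omega
    subst hi0
    have : LinearMap.ker qU = LinearMap.ker q := by
      have h6 : f ∘ₗ qU = q := by rw [hf]; ext; simp
      rw [← h6, LinearMap.ker_comp, LinearMap.ker_eq_bot.2 hi, Submodule.comap_bot]
    rw [LU.ker_eq, L.ker_eq] at this
    exact le_antisymm (C.le_of_range_le LU.le this.ge) (C.le_of_range_le L.le this.le)

end Core

section Op

variable {k : Type} [Field k] {Γ : Type} [Group Γ] [Fintype Γ]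
variable {V W : Type} [AddCommGroup V] [Module k V] [AddCommGroup W] [Module k W]

/-- The action of the element `∑ w, x w • w` of the group algebra. -/
def op (ρ : Representation k Γ V) (x : Γ → k) : Module.End k V := ∑ w, x w • ρ w

lemma op_apply (ρ : Representation k Γ V) (x : Γ → k) (v : V) :
    op ρ x v = ∑ w, x w • ρ w v := by simp [op]

/-- The central idempotents of the group algebra, as functions. -/
structure CentralIdem (e : Γ → k) : Prop where
  conj : ∀ g w, e (g * w * g⁻¹) = e w
  idem : ∀ F : Γ → k, ∑ u, ∑ v, e u * e v * F (u * v) = ∑ w, e w * F w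

variable {ρ : Representation k Γ V} {σ : Representation k Γ W} {e : Γ → k}

lemma Eqv.op {f : V →ₗ[k] W} (hf : Eqv ρ σ f) (x : Γ → k) (v : V) :
    f (op ρ x v) = CyclicBlock.op σ x (f v) := by
  simp [op_apply, hf _ _]

lemma CentralIdem.eqv (he : CentralIdem e) (ρ : Representation k Γ V) :
    Eqv ρ ρ (CyclicBlock.op ρ e) := fun g v => by
  rw [op_apply, op_apply, map_sum]
  refine Fintype.sum_bijective (fun x => g⁻¹ * x * g) ?_ _ _ fun x => ?_
  · exact (MulAut.conj g⁻¹).bijective.comp Function.bijective_id |> fun h => by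
      convert h using 1
      ext x; simp
  · have h1 := he.conj g⁻¹ x
    rw [inv_inv] at h1
    rw [map_smul, ← rep_mul_apply, ← rep_mul_apply, h1]
    congr 3
    group

lemma sum_sum_linear {X : Type} [AddCommGroup X] [Module k X]
    (he : CentralIdem e) (F : Γ → X) :
    ∑ u, ∑ v, (e u * e v) • F (u * v) = ∑ w, e w • F w := by
  have key : ∀ w, ∑ u, ∑ v, e u * e v * (if u * v = w then 1 else 0) = e w := fun w => by
    rw [he.idem (fun x => if x = w then 1 else 0)]
    simp
  have h1 : ∀ u v, (e u * e v) • F (u * v) =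
      ∑ w, (e u * e v * (if u * v = w then 1 else 0)) • F w := fun u v => by
    simp
  calc ∑ u, ∑ v, (e u * e v) • F (u * v)
      = ∑ u, ∑ v, ∑ w, (e u * e v * (if u * v = w then 1 else 0)) • F w := by
        refine Finset.sum_congr rfl fun u _ => Finset.sum_congr rfl fun v _ => h1 u v
    _ = ∑ w, ∑ u, ∑ v, (e u * e v * (if u * v = w then 1 else 0)) • F w := by
        rw [Finset.sum_comm]
        rw [Finset.sum_congr rfl fun v _ => Finset.sum_comm]
        rw [Finset.sum_comm]
        refine Finset.sum_congr rfl fun w _ => ?_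
        rw [Finset.sum_comm]
    _ = ∑ w, e w • F w := by
        refine Finset.sum_congr rfl fun w _ => ?_
        rw [← key w, Finset.sum_smul]
        refine Finset.sum_congr rfl fun u _ => ?_
        rw [Finset.sum_smul]

lemma CentralIdem.op_op (he : CentralIdem e) (ρ : Representation k Γ V) (v : V) :
    CyclicBlock.op ρ e (CyclicBlock.op ρ e v) = CyclicBlock.op ρ e v := by
  have := sum_sum_linear he (fun w => ρ w v)
  conv_rhs => rw [op_apply, ← this]
  rw [op_apply, op_apply]
  refine Finset.sum_congr rfl fun u _ => ?_
  rw [map_sum, Finset.smul_sum]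
  refine Finset.sum_congr rfl fun w _ => ?_
  rw [map_smul, smul_smul, rep_mul_apply]

/-- The representation lies in the part of the group algebra cut out by `e`. -/
def InMod (e : Γ → k) (ρ : Representation k Γ V) : Prop := ∀ v, op ρ e v = v

lemma InMod.of_inj (h : InMod e σ) {f : V →ₗ[k] W} (hf : Eqv ρ σ f)
    (hi : Function.Injective f) : InMod e ρ := fun v => hi (by rw [hf.op, h])

lemma InMod.of_surj (h : InMod e ρ) {f : V →ₗ[k] W} (hf : Eqv ρ σ f)
    (hs : Function.Surjective f) : InMod e σ := fun w => by
  obtain ⟨v, rfl⟩ := hs w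
  rw [← hf.op, h]

lemma InMod.sub (h : InMod e ρ) {Z : Submodule k V} (hZ : Inv ρ Z) : InMod e (subR ρ hZ) :=
  h.of_inj (eqv_subtype hZ) Subtype.val_injective

lemma InMod.quo (h : InMod e ρ) {Z : Submodule k V} (hZ : Inv ρ Z) : InMod e (quoR ρ hZ) :=
  h.of_surj (eqv_mkQ hZ) (Submodule.mkQ_surjective Z)

end Op

section Loc

variable {k : Type} [Field k] {Γ : Type} [Group Γ]
variable {M S T : Type} [AddCommGroup M] [Module k M] [AddCommGroup S] [Module k S]
  [AddCommGroup T] [Module k T]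

/-- `q` is the quotient by a unique maximal invariant subspace. -/
structure Loc (ρ : Representation k Γ M) (σ : Representation k Γ S) (q : M →ₗ[k] S) : Prop where
  surj : Function.Surjective q
  eqv : Eqv ρ σ q
  irr : Irr σ
  le_ker : ∀ Z, Inv ρ Z → Z ≠ ⊤ → Z ≤ LinearMap.ker q

/-- `r` restricts to a nonzero intertwiner from the kernel of `q` to an irreducible. -/
structure Ext (ρ : Representation k Γ M) (τ : Representation k Γ T) (q : M →ₗ[k] S)
    (r : M →ₗ[k] T) : Prop where
  irr : Irr τ
  eqv : ∀ g, ∀ v ∈ LinearMap.ker q, r (ρ g v) = τ g (r v)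
  ne : ∃ v ∈ LinearMap.ker q, r v ≠ 0

/-- All irreducible constituents of the second layer are twists of the head. -/
def Nak₁ [Fintype Γ] (e : Γ → k) (χ : Γ →* kˣ) : Prop :=
  ∀ (M S T : Type) [AddCommGroup M] [Module k M] [AddCommGroup S] [Module k S]
    [AddCommGroup T] [Module k T] [FiniteDimensional k M] [FiniteDimensional k S]
    [FiniteDimensional k T] (ρ : Representation k Γ M)
    (σ : Representation k Γ S) (τ : Representation k Γ T) (q : M →ₗ[k] S) (r : M →ₗ[k] T),
    InMod e ρ → Loc ρ σ q → Ext ρ τ q r → ∃ φ : S ≃ₗ[k] T, Eqv (tw χ σ) τ φ.toLinearMap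

/-- Irreducible constituents of the second layer occur with multiplicity one. -/
def Nak₂ [Fintype Γ] (e : Γ → k) : Prop :=
  ∀ (M S T : Type) [AddCommGroup M] [Module k M] [AddCommGroup S] [Module k S]
    [AddCommGroup T] [Module k T] [FiniteDimensional k M] [FiniteDimensional k S]
    [FiniteDimensional k T] (ρ : Representation k Γ M)
    (σ : Representation k Γ S) (τ : Representation k Γ T) (q : M →ₗ[k] S) (r₁ r₂ : M →ₗ[k] T),
    InMod e ρ → Loc ρ σ q → Ext ρ τ q r₁ → Ext ρ τ q r₂ →
    ∃ c : k, ∀ v ∈ LinearMap.ker q, r₂ v = c • r₁ v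

end Loc

section Cover

variable {k : Type} [Field k] {Γ : Type} [Group Γ] [Fintype Γ]
variable {E : Type} [AddCommGroup E] [Module k E] {ε : Representation k Γ E} {e : Γ → k}

/-- The representation induced from the underlying space of `E`. -/
def indR (k E Γ : Type) [Field k] [AddCommGroup E] [Module k E] [Group Γ] :
    Representation k Γ (Γ → E) where
  toFun g := LinearMap.funLeft k E (fun x => g⁻¹ * x)
  map_one' := by ext; simp [LinearMap.funLeft]
  map_mul' g h := by
    refine LinearMap.ext fun f => funext fun x => ?_
    simp [LinearMap.funLeft, mul_assoc]

omit [Fintype Γ] in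
lemma indR_apply (g : Γ) (f : Γ → E) (x : Γ) : indR k E Γ g f x = f (g⁻¹ * x) := rfl

lemma indR_proj : PZ (indR k E Γ) (indR k E Γ) LinearMap.id := by
  refine ⟨LinearMap.single k (fun _ => E) 1 ∘ₗ LinearMap.proj 1, ?_⟩
  refine LinearMap.ext fun f => funext fun x => ?_
  simp only [avg_apply, LinearMap.id_apply, Finset.sum_apply, indR_apply, LinearMap.comp_apply,
    LinearMap.proj_apply, LinearMap.single_apply, inv_inv, mul_one]
  rw [Finset.sum_eq_single x]
  · simp
  · intro g _ hg
    rw [Pi.single_eq_of_ne]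
    intro h
    exact hg (inv_mul_eq_one.1 h)
  · simp

/-- The evaluation map from the induced representation. -/
def indEv (ε : Representation k Γ E) : (Γ → E) →ₗ[k] E :=
  ∑ g, ε g ∘ₗ LinearMap.proj g

lemma indEv_apply (f : Γ → E) : indEv ε f = ∑ g, ε g (f g) := by simp [indEv]

lemma indEv_eqv : Eqv (indR k E Γ) ε (indEv ε) := fun g f => by
  rw [indEv_apply, indEv_apply, map_sum]
  refine Fintype.sum_bijective (fun x => g⁻¹ * x) (Group.mulLeft_bijective _) _ _ fun x => ?_
  rw [indR_apply, ← rep_mul_apply]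
  simp

lemma indEv_surj : Function.Surjective (indEv ε) := fun v => ⟨Pi.single 1 v, by
  rw [indEv_apply, Finset.sum_eq_single 1]
  · simp
  · intro b _ hb; simp [Pi.single_eq_of_ne hb]
  · simp⟩

/-- There is a projective representation of dimension `n` mapping onto `E`. -/
def HasProj (ε : Representation k Γ E) (n : ℕ) : Prop :=
  ∃ (V : Type) (_ : AddCommGroup V) (_ : Module k V) (_ : FiniteDimensional k V)
    (ρ : Representation k Γ V) (q : V →ₗ[k] E), PZ ρ ρ LinearMap.id ∧ Function.Surjective q ∧
    Eqv ρ ε q ∧ Module.finrank k V = n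

lemma hasProj_exists [FiniteDimensional k E] (ε : Representation k Γ E) : ∃ n, HasProj ε n :=
  ⟨_, Γ → E, inferInstance, inferInstance, inferInstance, indR k E Γ, indEv ε, indR_proj,
    indEv_surj, indEv_eqv, rfl⟩

variable {V : Type} [AddCommGroup V] [Module k V] {ρ : Representation k Γ V}
  {Z : Type} [AddCommGroup Z] [Module k Z] {ζ : Representation k Γ Z}

lemma PZ.retract (hV : PZ ρ ρ LinearMap.id) {i : Z →ₗ[k] V} {π : V →ₗ[k] Z} (hi : Eqv ζ ρ i)
    (hπ : Eqv ρ ζ π) (h : π ∘ₗ i = LinearMap.id) : PZ ζ ζ LinearMap.id := by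
  have := (hV.comp_left hπ).comp_right hi
  rwa [LinearMap.comp_id, h] at this

/-- Minimal projective representations over an irreducible one are local. -/
lemma exists_local_proj [FiniteDimensional k E] (he : CentralIdem e) (hε : Irr ε)
    (hE : InMod e ε) :
    ∃ (V : Type) (_ : AddCommGroup V) (_ : Module k V) (_ : FiniteDimensional k V)
      (ρ : Representation k Γ V) (q : V →ₗ[k] E), PZ ρ ρ LinearMap.id ∧ InMod e ρ ∧
        Loc ρ ε q := by
  obtain ⟨V, _, _, _, ρ, q, hP, hq, hqe, hn⟩ := Nat.find_spec (hasProj_exists ε)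
  have hmin : ∀ n, HasProj ε n → Module.finrank k V ≤ n := fun n h => by
    rw [hn]; exact Nat.find_min' _ h
  have hret : ∀ (Z : Submodule k V) (hZ : Inv ρ Z) (π : V →ₗ[k] Z), Eqv ρ (subR ρ hZ) π →
      π ∘ₗ Z.subtype = LinearMap.id → Z.map q = ⊤ → Z = ⊤ := fun Z hZ π hπ h hs => by
    apply Submodule.eq_top_of_finrank_eq
    apply le_antisymm (Submodule.finrank_le Z)
    refine hmin _ ⟨Z, _, _, inferInstance, subR ρ hZ, q ∘ₗ Z.subtype,
      hP.retract (eqv_subtype hZ) hπ h, ?_, hqe.comp (eqv_subtype hZ), rfl⟩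
    rw [← LinearMap.range_eq_top, LinearMap.range_comp, Submodule.range_subtype, hs]
  have hsur : ∀ Z, Inv ρ Z → ¬ Z ≤ LinearMap.ker q → Z.map q = ⊤ := fun Z hZ h => by
    rcases hε.2 _ (hqe.map hZ) with h' | h'
    · refine absurd (fun v hv => ?_) h
      have : q v ∈ Z.map q := ⟨v, hv, rfl⟩
      rw [h'] at this
      exact this
    · exact h'
  refine ⟨V, _, _, inferInstance, ρ, q, hP, ?_, hq, hqe, hε, ?_⟩
  · have hZ := (he.eqv ρ).range
    have h1 : LinearMap.range (op ρ e) = ⊤ := by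
      refine hret _ hZ ((op ρ e).rangeRestrict)
        ((he.eqv ρ).codRestrict hZ fun v => ⟨v, rfl⟩) ?_ ?_
      · ext ⟨_, v, rfl⟩
        simp [he.op_op]
      · rw [eq_top_iff]
        rintro v -
        obtain ⟨w, rfl⟩ := hq v
        exact ⟨op ρ e w, ⟨w, rfl⟩, by rw [hqe.op, hE]⟩
    intro v
    obtain ⟨w, rfl⟩ := LinearMap.range_eq_top.1 h1 v
    rw [he.op_op]
  · intro W hW hWt
    by_contra hWq
    apply hWt
    have hd : ∃ d, ∃ Z, Z ≤ W ∧ Inv ρ Z ∧ ¬ Z ≤ LinearMap.ker q ∧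
      Module.finrank k Z = d := ⟨_, W, le_rfl, hW, hWq, rfl⟩
    obtain ⟨Z, hZW, hZ, hZq, hZd⟩ := Nat.find_spec hd
    have hZmin : ∀ Y ≤ Z, Inv ρ Y → ¬ Y ≤ LinearMap.ker q → Y = Z := fun Y hY hYi hYq => by
      apply Submodule.eq_of_le_of_finrank_le hY
      rw [hZd]
      exact Nat.find_min' _ ⟨Y, hY.trans hZW, hYi, hYq, rfl⟩
    obtain ⟨f, hf, hqf⟩ := hP.proj_lift hqe (hqe.comp (eqv_subtype hZ)) (by
      rw [LinearMap.range_comp, Submodule.range_subtype, hsur Z hZ hZq]; exact le_top)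
    have hq' : ∀ v, q (f v) = q v := fun v => LinearMap.congr_fun hqf v
    have hfs : Function.Surjective (f ∘ₗ Z.subtype) := by
      have h1 : Inv ρ (Z.map (Z.subtype ∘ₗ f)) := ((eqv_subtype hZ).comp hf).map hZ
      have h2 := hZmin _ (by rintro _ ⟨v, -, rfl⟩; exact (f v).2) h1 (fun h => hZq fun v hv => by
        have := h ⟨v, hv, rfl⟩
        simpa [hq'] using this)
      intro z
      have hz : (z : V) ∈ Z.map (Z.subtype ∘ₗ f) := by rw [h2]; exact z.2
      obtain ⟨v, hv, h3⟩ := hz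
      exact ⟨⟨v, hv⟩, Subtype.ext h3⟩
    have hfi : Function.Injective (f ∘ₗ Z.subtype) := LinearMap.injective_iff_surjective.2 hfs
    let F : Z ≃ₗ[k] Z := LinearEquiv.ofBijective (f ∘ₗ Z.subtype) ⟨hfi, hfs⟩
    have hF : Eqv (subR ρ hZ) (subR ρ hZ) F.toLinearMap := hf.comp (eqv_subtype hZ)
    have hZt : Z = ⊤ := by
      refine hret Z hZ (F.symm.toLinearMap ∘ₗ f) (hF.symm.comp hf) ?_ (hsur Z hZ hZq)
      ext z
      have : F z = f z := rfl
      simp [← this]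
    rw [hZt] at hZW
    exact top_le_iff.1 hZW

omit [Fintype Γ] in
/-- A proper invariant subspace is contained in a maximal one. -/
lemma exists_maximal_inv [FiniteDimensional k V] (ρ : Representation k Γ V) {W : Submodule k V}
    (hW : Inv ρ W) {R : Submodule k V} (hWR : W < R) :
    ∃ Z, Inv ρ Z ∧ W ≤ Z ∧ Z < R ∧ ∀ Y, Inv ρ Y → Z ≤ Y → Y ≤ R → Y = Z ∨ Y = R := by
  have hd : ∃ d, ∃ Z, Inv ρ Z ∧ W ≤ Z ∧ Z < R ∧
    Module.finrank k V - Module.finrank k Z = d := ⟨_, W, hW, le_rfl, hWR, rfl⟩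
  obtain ⟨Z, hZ, hWZ, hZR, hZd⟩ := Nat.find_spec hd
  refine ⟨Z, hZ, hWZ, hZR, fun Y hY hZY hYR => ?_⟩
  by_contra! h
  have h1 := Nat.find_min' hd ⟨Y, hY, hWZ.trans hZY, lt_of_le_of_ne hYR h.2, rfl⟩
  have h2 := Submodule.finrank_lt_finrank_of_lt (lt_of_le_of_ne hZY (Ne.symm h.1))
  have h3 := Submodule.finrank_le Y
  omega

omit [Fintype Γ] in
/-- The quotient by a maximal invariant subspace of `R` is irreducible. -/
lemma irr_quo {R Z : Submodule k V} (hR : Inv ρ R) (hZ : Inv ρ Z) (hZR : Z < R)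
    (h : ∀ Y, Inv ρ Y → Z ≤ Y → Y ≤ R → Y = Z ∨ Y = R) :
    Irr (subR (quoR ρ hZ) ((eqv_mkQ hZ).map hR)) := by
  have h0 := eqv_subtype ((eqv_mkQ hZ).map hR)
  constructor
  · obtain ⟨v, hv, hv'⟩ := SetLike.exists_of_lt hZR
    refine ⟨⟨0, ⟨Z.mkQ v, v, hv, rfl⟩, fun h => hv' ?_⟩⟩
    have := congrArg Subtype.val h
    simpa using this.symm
  · intro Y hY
    have h1 := (eqv_mkQ hZ).comap (h0.map hY)
    have h2 : Z ≤ (Y.map (R.map Z.mkQ).subtype).comap Z.mkQ := fun v hv => by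
      have : Z.mkQ v = 0 := (Submodule.Quotient.mk_eq_zero Z).2 hv
      rw [Submodule.mem_comap, this]
      exact Submodule.zero_mem _
    have h3 : (Y.map (R.map Z.mkQ).subtype).comap Z.mkQ ≤ R := by
      rintro v ⟨y, -, hy⟩
      obtain ⟨w, hw, hw'⟩ := y.2
      have : v - w ∈ Z := by
        rw [← Submodule.Quotient.mk_eq_zero, Submodule.Quotient.mk_sub, sub_eq_zero]
        exact (hw'.trans hy).symm
      have := R.add_mem (hZR.le this) hw
      simpa using this
    rcases h _ h1 h2 h3 with h4 | h4
    · left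
      rw [Submodule.eq_bot_iff]
      rintro ⟨_, v, hv, rfl⟩ hy
      have : v ∈ (Y.map (R.map Z.mkQ).subtype).comap Z.mkQ := ⟨_, hy, rfl⟩
      rw [h4] at this
      apply Subtype.ext
      simpa using this
    · right
      rw [Submodule.eq_top_iff']
      rintro ⟨_, v, hv, rfl⟩
      have hv' := hv
      rw [← h4] at hv
      obtain ⟨y, hy, hy'⟩ := hv
      have : y = ⟨Z.mkQ v, v, hv', rfl⟩ := Subtype.ext hy'
      rwa [← this]

end Cover

section HasChains

variable {k : Type} [Field k] {Γ : Type} [Group Γ] [Fintype Γ]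
variable {V : Type} [AddCommGroup V] [Module k V] [FiniteDimensional k V]
  {E : Type} [AddCommGroup E] [Module k E]
  {ρ : Representation k Γ V} {ε : Representation k Γ E} {e : Γ → k} {χ : Γ →* kˣ}

/-- Every irreducible representation is the head of a uniserial projective one. -/
def HasChains (e : Γ → k) (χ : Γ →* kˣ) : Prop :=
  ∀ (E : Type) [AddCommGroup E] [Module k E] [FiniteDimensional k E] (ε : Representation k Γ E),
    Irr ε → InMod e ε → ∃ (V : Type) (_ : AddCommGroup V) (_ : Module k V)
      (_ : FiniteDimensional k V) (ρ : Representation k Γ V) (t : Module.End k V) (l : ℕ)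
      (q : V →ₗ[k] E), Chain χ ρ t l ∧ LabMap χ ρ t l ε 0 1 q

omit [Fintype Γ] [FiniteDimensional k V] in
/-- The top of a maximal invariant subspace of the kernel of `q`. -/
lemma exists_ext {q : V →ₗ[k] E} {R : Submodule k V} (hR : Inv ρ (LinearMap.ker q))
    (hRi : Inv ρ R) (hlt : R < LinearMap.ker q)
    (h : ∀ Y, Inv ρ Y → R ≤ Y → Y ≤ LinearMap.ker q → Y = R ∨ Y = LinearMap.ker q) :
    ∃ r : V →ₗ[k] ((LinearMap.ker q).map R.mkQ),
      Ext ρ (subR (quoR ρ hRi) ((eqv_mkQ hRi).map hR)) q r ∧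
      ∀ v ∈ LinearMap.ker q, r v = 0 ↔ v ∈ R := by
  obtain ⟨r, hr⟩ := LinearMap.exists_extend
    ((R.mkQ ∘ₗ (LinearMap.ker q).subtype).codRestrict ((LinearMap.ker q).map R.mkQ)
      fun v => ⟨v, v.2, rfl⟩)
  have hr' : ∀ v ∈ LinearMap.ker q, (r v : V ⧸ R) = R.mkQ v := fun v hv =>
    congrArg Subtype.val (LinearMap.congr_fun hr ⟨v, hv⟩)
  have h0 : ∀ v ∈ LinearMap.ker q, r v = 0 ↔ v ∈ R := fun v hv => by
    rw [← Submodule.coe_eq_zero, hr' v hv, Submodule.mkQ_apply, Submodule.Quotient.mk_eq_zero]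
  refine ⟨r, ⟨irr_quo hR hRi hlt h, fun g v hv => Subtype.ext ?_, ?_⟩, h0⟩
  · rw [hr' _ (hR g v hv), subR_coe, hr' v hv]
    rfl
  · obtain ⟨v, hv, hv'⟩ := SetLike.exists_of_lt hlt
    exact ⟨v, hv, fun h => hv' ((h0 v hv).1 h)⟩

lemma exists_chain_map [FiniteDimensional k E] (h₁ : Nak₁ e χ) (h₂ : Nak₂ e)
    {q : V →ₗ[k] E} (hP : PZ ρ ρ LinearMap.id) (hM : InMod e ρ) (hL : Loc ρ ε q) :
    ∃ t : Module.End k V, Eqv (tw χ ρ) ρ t ∧ LinearMap.range t = LinearMap.ker q := by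
  have hR := hL.eqv.ker
  by_cases hbot : LinearMap.ker q = ⊥
  · exact ⟨0, Eqv.zero, by rw [hbot, LinearMap.range_zero]⟩
  obtain ⟨R, hRi, -, hlt, hmax⟩ :=
    exists_maximal_inv ρ (Inv.bot ρ) (bot_lt_iff_ne_bot.2 hbot)
  obtain ⟨r, hr, hr0⟩ := exists_ext hR hRi hlt hmax
  obtain ⟨φ, hφ⟩ := h₁ _ _ _ ρ ε _ q r hM hL hr
  have huniq : ∀ W, Inv ρ W → W < LinearMap.ker q → W ≤ R := fun W hW hWlt => by
    obtain ⟨R', hRi', hWR', hlt', hmax'⟩ := exists_maximal_inv ρ hW hWlt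
    obtain ⟨r', hr', hr0'⟩ := exists_ext hR hRi' hlt' hmax'
    obtain ⟨φ', hφ'⟩ := h₁ _ _ _ ρ ε _ q r' hM hL hr'
    obtain ⟨c, hc⟩ := h₂ _ _ _ ρ ε _ q r (φ.toLinearMap ∘ₗ φ'.symm.toLinearMap ∘ₗ r') hM hL hr
      ⟨hr.irr, fun g v hv => by
        have h1 := hφ.comp hφ'.symm g (r' v)
        rw [LinearMap.comp_apply, LinearMap.comp_apply, hr'.eqv g v hv]
        exact h1, by
        obtain ⟨v, hv, hv'⟩ := hr'.ne
        exact ⟨v, hv, by simpa using hv'⟩⟩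
    have hle : R ≤ R' := fun v hv => by
      have hvq := hlt.le hv
      have h1 := hc v hvq
      rw [(hr0 v hvq).2 hv, smul_zero] at h1
      exact (hr0' v hvq).1 (by simpa using h1)
    rcases hmax R' hRi' hle hlt'.le with h | h
    · rwa [← h]
    · exact absurd h hlt'.ne
  obtain ⟨t₀, ht₀, ht₀'⟩ := (hP.tw χ).proj_lift (σ := subR (quoR ρ hRi) ((eqv_mkQ hRi).map hR))
    (τ := subR ρ hR) (hφ.comp (hL.eqv.tw χ)) (q := r ∘ₗ (LinearMap.ker q).subtype)
    (fun g v => hr.eqv g v v.2) (by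
      have h1 : r ∘ₗ (LinearMap.ker q).subtype ≠ 0 := fun h => by
        obtain ⟨v, hv, hv'⟩ := hr.ne
        exact hv' (LinearMap.congr_fun h ⟨v, hv⟩)
      have h2 := hr.irr.surjective (ρ := subR ρ hR) (fun g v => hr.eqv g v v.2) h1
      rw [LinearMap.range_eq_top.2 h2]
      exact le_top)
  refine ⟨(LinearMap.ker q).subtype ∘ₗ t₀, (eqv_subtype hR).comp ht₀, ?_⟩
  have hle : LinearMap.range ((LinearMap.ker q).subtype ∘ₗ t₀) ≤ LinearMap.ker q := by
    rintro _ ⟨v, rfl⟩; exact (t₀ v).2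
  by_contra hne
  have h1 := huniq _ ((eqv_subtype hR).comp ht₀).range (lt_of_le_of_ne hle hne)
  have := hL.irr.1
  obtain ⟨x, hx⟩ := exists_ne (0 : E)
  obtain ⟨v, rfl⟩ := hL.surj x
  have h2 := LinearMap.congr_fun ht₀' v
  have h3 := (hr0 _ (t₀ v).2).2 (h1 ⟨v, rfl⟩)
  simp only [LinearMap.comp_apply, Submodule.subtype_apply, h3] at h2
  exact hx (by simpa using h2.symm)

lemma chain_of_map {q : V →ₗ[k] E} (hP : PZ ρ ρ LinearMap.id)
    (hL : Loc ρ ε q) {t : Module.End k V} (ht : Eqv (tw χ ρ) ρ t)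
    (hr : LinearMap.range t = LinearMap.ker q) :
    ∃ l, Chain χ ρ t l ∧ LabMap χ ρ t l ε 0 1 q := by
  have hE := hL.irr.1
  have hV : Nontrivial V := hL.surj.nontrivial
  have hker : LinearMap.ker t ≠ ⊥ := fun h => by
    have h1 := LinearMap.range_eq_top.2 (LinearMap.injective_iff_surjective.1
      (LinearMap.ker_eq_bot.1 h))
    rw [hr, LinearMap.ker_eq_top] at h1
    obtain ⟨x, hx⟩ := exists_ne (0 : E)
    obtain ⟨v, rfl⟩ := hL.surj x
    exact hx (by rw [h1]; rfl)
  have hsub : ∀ d, ∀ Z, Inv ρ Z → Module.finrank k V ≤ Module.finrank k Z + d →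
      ∃ j, Z = LinearMap.range (t ^ j) := fun d => by
    induction d with
    | zero =>
      intro Z hZ h
      refine ⟨0, ?_⟩
      rw [pow_zero, Module.End.one_eq_id, LinearMap.range_id]
      exact Submodule.eq_top_of_finrank_eq (le_antisymm (Submodule.finrank_le Z) h)
    | succ d ih =>
      intro Z hZ h
      by_cases hZt : Z = ⊤
      · exact ⟨0, by rw [pow_zero, Module.End.one_eq_id, LinearMap.range_id, hZt]⟩
      have hZr : Z ≤ LinearMap.range t := by rw [hr]; exact hL.le_ker Z hZ hZt
      have hmap : (Z.comap t).map t = Z := by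
        rw [Submodule.map_comap_eq, inf_eq_right.2 hZr]
      have hlt : Module.finrank k Z < Module.finrank k (Z.comap t) := by
        have h1 := LinearMap.finrank_range_add_finrank_ker (t.domRestrict (Z.comap t))
        have h2 : LinearMap.range (t.domRestrict (Z.comap t)) = Z := by
          rw [LinearMap.range_domRestrict, hmap]
        rw [h2] at h1
        have h3 : 0 < Module.finrank k (LinearMap.ker (t.domRestrict (Z.comap t))) := by
          rw [Module.finrank_pos_iff]
          obtain ⟨v, hv, hv0⟩ := (Submodule.ne_bot_iff _).1 hker
          rw [LinearMap.mem_ker] at hv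
          refine ⟨⟨0, ⟨⟨v, by rw [Submodule.mem_comap, hv]; exact Z.zero_mem⟩, hv⟩, fun h => ?_⟩⟩
          exact hv0 (congrArg (fun x => ((x : Z.comap t) : V)) (congrArg Subtype.val h)).symm
        omega
      obtain ⟨j, hj⟩ := ih _ (ht.comap hZ).of_tw (by omega)
      refine ⟨j + 1, ?_⟩
      rw [← hmap, hj, add_comm, ← map_range_pow, pow_one]
  have hall : ∀ Z, Inv ρ Z → ∃ j, Z = LinearMap.range (t ^ j) := fun Z hZ =>
    hsub _ Z hZ (Nat.le_add_left _ _)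
  have hnil : ∃ l, t ^ l = 0 := by
    obtain ⟨l, hl⟩ := hall ⊥ (Inv.bot ρ)
    exact ⟨l, LinearMap.range_eq_bot.1 hl.symm⟩
  have hpos : 0 < Nat.find hnil := by
    rw [Nat.pos_iff_ne_zero]
    intro h
    have := Nat.find_spec hnil
    rw [h, pow_zero] at this
    exact one_ne_zero this
  exact ⟨Nat.find hnil, ⟨ht, Nat.find_spec hnil, fun j hj => Nat.find_min hnil hj, hpos, hall, hP⟩,
    ⟨hL.surj, by rw [tw_zpow_zero]; exact hL.eqv, by rw [pow_one, hr], le_rfl, hpos⟩⟩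

/-- Uniserial projective covers exist as soon as second layers are controlled. -/
theorem hasChains_of_nak (he : CentralIdem e) (h₁ : Nak₁ e χ) (h₂ : Nak₂ e) : HasChains e χ := by
  intro E _ _ _ ε hε hE
  obtain ⟨V, _, _, _, ρ, q, hP, hM, hL⟩ := exists_local_proj he hε hE
  obtain ⟨t, ht, hr⟩ := exists_chain_map h₁ h₂ hP hM hL
  obtain ⟨l, h1, h2⟩ := chain_of_map hP hL ht hr
  exact ⟨V, _, _, inferInstance, ρ, t, l, q, h1, h2⟩

end HasChains

section Dec

variable {k : Type} [Field k] {Γ : Type} [Group Γ] [Fintype Γ]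
variable {V : Type} [AddCommGroup V] [Module k V]
  {Y : Type} [AddCommGroup Y] [Module k Y] [FiniteDimensional k Y]
  {ρ : Representation k Γ V} {υ : Representation k Γ Y} {e : Γ → k} {χ : Γ →* kˣ}

omit [Fintype Γ] in
/-- A minimal invariant subspace outside `B`. -/
lemma exists_minimal_inv (υ : Representation k Γ Y) {B : Submodule k Y} {W : Submodule k Y}
    (hW : Inv υ W) (hWB : ¬ W ≤ B) :
    ∃ Q ≤ W, Inv υ Q ∧ ¬ Q ≤ B ∧ ∀ X, Inv υ X → X < Q → X ≤ B := by
  have hd : ∃ d, ∃ Q ≤ W, Inv υ Q ∧ ¬ Q ≤ B ∧ Module.finrank k Q = d :=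
    ⟨_, W, le_rfl, hW, hWB, rfl⟩
  obtain ⟨Q, hQW, hQ, hQB, hQd⟩ := Nat.find_spec hd
  refine ⟨Q, hQW, hQ, hQB, fun X hX hXQ => ?_⟩
  by_contra h
  have h1 := Nat.find_min' hd ⟨X, hXQ.le.trans hQW, hX, h, rfl⟩
  have h2 := Submodule.finrank_lt_finrank_of_lt hXQ
  omega

omit [Fintype Γ] [FiniteDimensional k Y] in
lemma irr_sub {Q : Submodule k Y} (hQ : Inv υ Q) (h0 : ¬ Q ≤ ⊥)
    (h : ∀ X, Inv υ X → X < Q → X ≤ ⊥) : Irr (subR υ hQ) := by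
  constructor
  · obtain ⟨v, hv, hv'⟩ := SetLike.not_le_iff_exists.1 h0
    exact ⟨⟨⟨v, hv⟩, 0, fun h => hv' (congrArg Subtype.val h)⟩⟩
  · intro Z hZ
    have h1 := (eqv_subtype hQ).map hZ
    have h2 : Z.map Q.subtype ≤ Q := Submodule.map_subtype_le Q Z
    rcases h2.lt_or_eq with h3 | h3
    · left
      rw [Submodule.eq_bot_iff]
      intro z hz
      exact Subtype.ext (h _ h1 h3 ⟨z, hz, rfl⟩)
    · right
      rw [Submodule.eq_top_iff']
      intro z
      have : (z : Y) ∈ Z.map Q.subtype := by rw [h3]; exact z.2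
      obtain ⟨z', hz', h4⟩ := this
      rwa [← Subtype.ext h4]

lemma Chain.le_finrank {t : Module.End k V} {l : ℕ} (C : Chain χ ρ t l) {f : V →ₗ[k] Y} {m : ℕ}
    (hf : LinearMap.ker f = LinearMap.range (t ^ m)) (hm : m ≤ l) :
    m ≤ Module.finrank k Y := by
  have key : ∀ j ≤ m, j ≤ Module.finrank k ((LinearMap.range (t ^ (m - j))).map f) := by
    intro j
    induction j with
    | zero => intro _; exact Nat.zero_le _
    | succ j ih =>
      intro hj
      refine (Nat.succ_le_succ (ih (by omega))).trans ?_
      apply Nat.succ_le_of_lt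
      apply Submodule.finrank_lt_finrank_of_lt
      apply lt_of_le_of_ne (Submodule.map_mono (range_pow_anti t (by omega)))
      intro h
      have h1 : LinearMap.range (t ^ (m - (j + 1))) ≤ LinearMap.range (t ^ (m - j)) := by
        intro v hv
        have : f v ∈ (LinearMap.range (t ^ (m - j))).map f := by rw [h]; exact ⟨v, hv, rfl⟩
        obtain ⟨w, hw, hw'⟩ := this
        have h2 : v - w ∈ LinearMap.ker f := by rw [LinearMap.mem_ker, map_sub, hw', sub_self]
        rw [hf] at h2
        have := Submodule.add_mem _ (range_pow_anti t (by omega : m - j ≤ m) h2) hw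
        simpa using this
      have := C.le_of_range_le (by omega) h1
      omega
  exact (key m le_rfl).trans (Submodule.finrank_le _)

/-- The data of a map from a chain whose kernel is the `m`-th term. -/
def Img (χ : Γ →* kˣ) (υ : Representation k Γ Y) (m : ℕ) : Prop :=
  ∃ (V : Type) (_ : AddCommGroup V) (_ : Module k V) (_ : FiniteDimensional k V)
    (ρ : Representation k Γ V) (t : Module.End k V) (l : ℕ) (f : V →ₗ[k] Y),
    Chain χ ρ t l ∧ Eqv ρ υ f ∧ LinearMap.ker f = LinearMap.range (t ^ m) ∧ 1 ≤ m ∧ m ≤ l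

omit [FiniteDimensional k Y] in
lemma Chain.img {t : Module.End k V} {l : ℕ} [FiniteDimensional k V] (C : Chain χ ρ t l)
    {f : V →ₗ[k] Y} (hf : Eqv ρ υ f) (h0 : f ≠ 0) :
    ∃ m, LinearMap.ker f = LinearMap.range (t ^ m) ∧ 1 ≤ m ∧ m ≤ l := by
  obtain ⟨m, hm, hk⟩ := C.exists_range_le hf.ker
  refine ⟨m, hk, ?_, hm⟩
  by_contra! h
  have : m = 0 := by omega
  rw [this, pow_zero, Module.End.one_eq_id, LinearMap.range_id, LinearMap.ker_eq_top] at hk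
  exact h0 hk

lemma img_exists (hC : HasChains e χ) (hY : InMod e υ) [Nontrivial Y] : ∃ m, Img χ υ m := by
  obtain ⟨Q, -, hQ, hQB, hmin⟩ := exists_minimal_inv υ (B := ⊥) (Inv.top υ) (by
    rw [top_le_iff]; exact bot_ne_top)
  have hirr := irr_sub hQ hQB hmin
  obtain ⟨V, _, _, _, ρ, t, l, q, C, L⟩ := hC Q (subR υ hQ) hirr (hY.sub hQ)
  refine ⟨1, V, _, _, inferInstance, ρ, t, l, Q.subtype ∘ₗ q, C, ?_, ?_, le_rfl, C.pos⟩
  · have := L.eqv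
    rw [tw_zpow_zero] at this
    exact (eqv_subtype hQ).comp this
  · rw [LinearMap.ker_comp, Submodule.ker_subtype, Submodule.comap_bot, L.ker_eq]

/-- The image of a map from a chain with `m` maximal is a direct summand. -/
lemma exists_compl [IsAlgClosed k] [FiniteDimensional k V] (hC : HasChains e χ) (hY : InMod e υ)
    {t : Module.End k V} {l : ℕ} (C : Chain χ ρ t l) {f : V →ₗ[k] Y} (hf : Eqv ρ υ f) {m : ℕ}
    (hk : LinearMap.ker f = LinearMap.range (t ^ m)) (h1 : 1 ≤ m) (hl : m ≤ l)
    (hmax : ∀ m', Img χ υ m' → m' ≤ m) : ∃ N, Inv υ N ∧ IsCompl (LinearMap.range f) N := by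
  have hd : ∃ d, ∃ N, Inv υ N ∧ LinearMap.range f ⊓ N = ⊥ ∧
    Module.finrank k Y - Module.finrank k N = d := ⟨_, ⊥, Inv.bot υ, inf_bot_eq _, rfl⟩
  obtain ⟨N, hN, hN0, hNd⟩ := Nat.find_spec hd
  have hNmax : ∀ X, Inv υ X → N ≤ X → LinearMap.range f ⊓ X = ⊥ → X ≤ N := by
    intro X hX hNX hX0
    by_contra h
    have h1 := Nat.find_min' hd ⟨X, hX, hX0, rfl⟩
    have h2 := Submodule.finrank_lt_finrank_of_lt (lt_of_le_not_ge hNX h)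
    have h3 := Submodule.finrank_le X
    omega
  refine ⟨N, hN, disjoint_iff.2 hN0, ?_⟩
  set fb : V →ₗ[k] (Y ⧸ N) := N.mkQ ∘ₗ f with hfb
  have hfbe : Eqv ρ (quoR υ hN) fb := (eqv_mkQ hN).comp hf
  set B := LinearMap.range fb with hB
  have hBi : Inv (quoR υ hN) B := hfbe.range
  have hess : ∀ X, Inv (quoR υ hN) X → B ⊓ X = ⊥ → X = ⊥ := by
    intro X hX hX0
    have h2 := hNmax _ ((eqv_mkQ hN).comap hX) (fun v hv => by
      rw [Submodule.mem_comap, Submodule.mkQ_apply, (Submodule.Quotient.mk_eq_zero N).2 hv]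
      exact X.zero_mem) (by
      rw [Submodule.eq_bot_iff]
      rintro _ ⟨⟨v, rfl⟩, hv⟩
      have h3 : fb v ∈ B ⊓ X := ⟨⟨v, rfl⟩, hv⟩
      rw [hX0, Submodule.mem_bot] at h3
      have h4 : f v ∈ LinearMap.range f ⊓ N := ⟨⟨v, rfl⟩, (Submodule.Quotient.mk_eq_zero N).1 h3⟩
      rwa [hN0, Submodule.mem_bot] at h4)
    rw [Submodule.eq_bot_iff]
    intro x hx
    obtain ⟨y, rfl⟩ := N.mkQ_surjective x
    exact (Submodule.Quotient.mk_eq_zero N).2 (h2 hx)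
  have hkb : LinearMap.ker fb = LinearMap.range (t ^ m) := by
    rw [← hk]
    apply le_antisymm
    · intro v hv
      have h4 : f v ∈ LinearMap.range f ⊓ N := ⟨⟨v, rfl⟩, (Submodule.Quotient.mk_eq_zero N).1 hv⟩
      rwa [hN0, Submodule.mem_bot] at h4
    · exact LinearMap.ker_le_ker_comp _ _
  have hYb := hY.quo hN
  have hBtop : B = ⊤ := by
    by_contra hne
    obtain ⟨Q, -, hQ, hQB, hmin⟩ := exists_minimal_inv (quoR υ hN) (B := B)
      (Inv.top (quoR υ hN)) (by rwa [top_le_iff])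
    have hQ' : Inv (quoR υ hN) (Q ⊓ B) := hQ.inf hBi
    have hlt : Q ⊓ B < Q := lt_of_le_of_ne inf_le_left (fun h => hQB (by rw [← h]; exact inf_le_right))
    have hirr := irr_quo hQ hQ' hlt (fun X hX h2 h3 => by
      rcases h3.lt_or_eq with h4 | h4
      · left; exact le_antisymm (le_inf h3 (hmin X hX h4)) h2
      · right; exact h4)
    obtain ⟨V', _, _, _, ρ', t', l', q', C', L'⟩ := hC _ _ hirr ((hYb.quo hQ').sub _)
    have hq'e := L'.eqv
    rw [tw_zpow_zero] at hq'e
    have hred : Eqv (subR (quoR υ hN) hQ) (subR (quoR (quoR υ hN) hQ') ((eqv_mkQ hQ').map hQ))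
        (((Q ⊓ B).mkQ ∘ₗ Q.subtype).codRestrict (Q.map (Q ⊓ B).mkQ) fun v => ⟨v, v.2, rfl⟩) :=
      ((eqv_mkQ hQ').comp (eqv_subtype hQ)).codRestrict _ _
    obtain ⟨w₀, hw₀, hw₀q⟩ := C'.proj.proj_lift hq'e hred (by
      rintro ⟨_, v, hv, rfl⟩ _
      exact ⟨⟨v, hv⟩, rfl⟩)
    set w : V' →ₗ[k] (Y ⧸ N) := Q.subtype ∘ₗ w₀ with hw
    have hwe : Eqv ρ' (quoR υ hN) w := (eqv_subtype hQ).comp hw₀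
    have hwQ : ∀ v, w v ∈ Q := fun v => (w₀ v).2
    have hwB : ∀ v, w v ∈ B ↔ v ∈ LinearMap.range t' := fun v => by
      rw [← pow_one t', ← L'.ker_eq, LinearMap.mem_ker, ← hw₀q, ← Submodule.coe_eq_zero]
      change _ ↔ (Q ⊓ B).mkQ (w v) = 0
      rw [Submodule.mkQ_apply, Submodule.Quotient.mk_eq_zero]
      exact ⟨fun h => ⟨hwQ v, h⟩, fun h => h.2⟩
    obtain ⟨v₀, hv₀⟩ : ∃ v, v ∉ LinearMap.range t' := by
      by_contra! h
      exact C'.range_ne_top (Submodule.eq_top_iff'.2 h)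
    have hw0 : w ≠ 0 := fun h => hv₀ ((hwB v₀).1 (by rw [h]; exact B.zero_mem))
    obtain ⟨mw, hmk, hm1, hml⟩ := C'.img hwe hw0
    have hmw : mw ≤ m := by
      obtain ⟨w', hw'e, hw'⟩ := C'.proj.proj_lift hwe (eqv_mkQ hN) (by
        rw [Submodule.range_mkQ]; exact le_top)
      have hw'0 : w' ≠ 0 := fun h => hw0 (by rw [← hw', h, LinearMap.comp_zero])
      obtain ⟨m', hm'k, hm'1, hm'l⟩ := C'.img hw'e hw'0
      refine le_trans ?_ (hmax m' ⟨V', _, _, inferInstance, ρ', t', l', w', C', hw'e, hm'k, hm'1,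
        hm'l⟩)
      apply C'.le_of_range_le hml
      rw [← hmk, ← hm'k, ← hw']
      exact LinearMap.ker_le_ker_comp _ _
    have hmem : ∀ v, fb v ∈ B := fun v => ⟨v, rfl⟩
    have LB : LabMap χ ρ t l (subR (quoR υ hN) hBi) 0 m (fb.codRestrict B hmem) := by
      refine ⟨?_, ?_, ?_, h1, hl⟩
      · rintro ⟨_, v, rfl⟩; exact ⟨v, rfl⟩
      · rw [tw_zpow_zero]; exact hfbe.codRestrict hBi _
      · rw [LinearMap.ker_codRestrict, hkb]
    set g : V' →ₗ[k] B := (w ∘ₗ t').codRestrict B (fun v => (hwB _).2 ⟨v, rfl⟩) with hg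
    have hge : Eqv (tw (χ ^ ((1 : ℕ) : ℤ)) ρ') (subR (quoR υ hN) hBi) g := by
      refine (hwe.comp ?_).codRestrict hBi _
      rw [Nat.cast_one, char_zpow_one]
      exact C'.eqv
    have hext : ∃ x : V' →ₗ[k] B, Eqv ρ' (subR (quoR υ hN) hBi) x ∧ x ∘ₗ t' = g := by
      by_contra! hno
      obtain ⟨c, -, hc0, hc1, -, hc3⟩ := C'.lab_of_not_extend C LB (j := 1) (n := mw - 1) hge (by
        apply LinearMap.ext
        intro v
        apply Subtype.ext
        have h2 : (t' ^ mw) v ∈ LinearMap.ker w := by rw [hmk]; exact ⟨v, rfl⟩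
        change w (t' ((t' ^ (mw - 1)) v)) = 0
        rw [← Module.End.mul_apply, ← pow_succ', Nat.sub_add_cancel hm1]
        exact h2) (fun x hx _ h => hno x hx (by rwa [pow_one] at h))
      omega
    obtain ⟨x, hx, hxg⟩ := hext
    set y : V' →ₗ[k] (Y ⧸ N) := w - B.subtype ∘ₗ x with hy
    have hye : Eqv ρ' (quoR υ hN) y := hwe.sub ((eqv_subtype hBi).comp hx)
    have hy0 : LinearMap.range t' ≤ LinearMap.ker y := by
      rintro _ ⟨v, rfl⟩
      have h2 := congrArg Subtype.val (LinearMap.congr_fun hxg v)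
      change (x (t' v) : Y ⧸ N) = w (t' v) at h2
      rw [LinearMap.mem_ker]
      change w (t' v) - (x (t' v) : Y ⧸ N) = 0
      rw [h2, sub_self]
    have hyB : B.comap y = ⊤ := by
      by_contra hnt
      have h2 := (C'.le_range_one (hye.comap hBi) hnt).trans hy0
      have h3 := hess _ hye.range (by
        rw [Submodule.eq_bot_iff]
        rintro _ ⟨hb, v, rfl⟩
        exact h2 hb)
      exact hnt (by
        rw [LinearMap.range_eq_bot] at h3
        rw [h3, Submodule.comap_zero])
    apply hv₀
    rw [← hwB]
    have h2 : y v₀ ∈ B := by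
      have : v₀ ∈ B.comap y := by rw [hyB]; trivial
      exact this
    have h3 : w v₀ = y v₀ + x v₀ := by simp [hy]
    rw [h3]
    exact B.add_mem h2 (x v₀).2
  rw [codisjoint_iff, eq_top_iff]
  intro y _
  have hy : N.mkQ y ∈ B := by rw [hBtop]; trivial
  obtain ⟨v, hv⟩ := hy
  have : y - f v ∈ N := by
    rw [← Submodule.Quotient.mk_eq_zero, Submodule.Quotient.mk_sub, sub_eq_zero]
    exact hv.symm
  have := Submodule.add_mem_sup (show f v ∈ LinearMap.range f from ⟨v, rfl⟩) this
  simpa using this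

omit [Fintype Γ] [FiniteDimensional k Y] in
lemma projectionOnto_eqv {A B : Submodule k Y} (hA : Inv υ A) (hB : Inv υ B) (h : IsCompl A B) :
    Eqv υ (subR υ hA) (A.projectionOnto B h) := fun g v => by
  have hv : v ∈ A ⊔ B := by rw [h.sup_eq_top]; trivial
  obtain ⟨a, ha, b, hb, rfl⟩ := Submodule.mem_sup.1 hv
  rw [map_add, map_add, map_add, map_add, (Submodule.projectionOnto_apply_eq_zero_iff h).2 hb,
    (Submodule.projectionOnto_apply_eq_zero_iff h).2 (hB g b hb), map_zero, add_zero, add_zero]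
  exact (Submodule.projectionOnto_apply_left h ⟨_, hA g a ha⟩).trans
    (congrArg (subR υ hA g) (Submodule.projectionOnto_apply_left h ⟨a, ha⟩).symm)

/-- The representation is a quotient of a member of a chain. -/
def Labelled (χ : Γ →* kˣ) (υ : Representation k Γ Y) : Prop :=
  ∃ (V : Type) (_ : AddCommGroup V) (_ : Module k V) (_ : FiniteDimensional k V)
    (ρ : Representation k Γ V) (t : Module.End k V) (l m : ℕ), Chain χ ρ t l ∧ Lab χ ρ t l υ 0 m

/-- A representation that is not projective has a labelled summand that is not projective. -/
theorem exists_labelled_summand [IsAlgClosed k] (hC : HasChains e χ) (d : ℕ) :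
    ∀ (Y : Type) [AddCommGroup Y] [Module k Y] [FiniteDimensional k Y]
      (υ : Representation k Γ Y), Module.finrank k Y ≤ d → InMod e υ → ¬ PZ υ υ LinearMap.id →
      ∃ (Z : Type) (_ : AddCommGroup Z) (_ : Module k Z) (_ : FiniteDimensional k Z)
        (ζ : Representation k Γ Z) (ι : Z →ₗ[k] Y) (π : Y →ₗ[k] Z),
        Eqv ζ υ ι ∧ Eqv υ ζ π ∧ π ∘ₗ ι = LinearMap.id ∧ ¬ PZ ζ ζ LinearMap.id ∧
        Labelled χ ζ := by
  induction d with
  | zero =>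
    intro Y _ _ _ υ hd _ hn
    have : Subsingleton Y := (Module.finrank_zero_iff (R := k)).1 (Nat.le_zero.1 hd)
    exact absurd ⟨0, Subsingleton.elim _ _⟩ hn
  | succ d ih =>
    intro Y _ _ _ υ hd hY hn
    have hnt : Nontrivial Y := by
      by_contra h
      rw [not_nontrivial_iff_subsingleton] at h
      exact hn ⟨0, Subsingleton.elim _ _⟩
    have hmx : ∃ m, Img χ υ m ∧ ∀ m', Img χ υ m' → m' ≤ m := by
      have hb : ∀ m', Img χ υ m' → m' ≤ Module.finrank k Y := by
        rintro m' ⟨V, _, _, _, ρ, t, l, f, C, hf, hk, h1, hl⟩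
        exact C.le_finrank hk hl
      exact ⟨_, Nat.findGreatest_spec (P := Img χ υ) (hb _ (img_exists hC hY).choose_spec)
        (img_exists hC hY).choose_spec, fun m' h => Nat.le_findGreatest (hb m' h) h⟩
    obtain ⟨m, ⟨V, _, _, _, ρ, t, l, f, C, hf, hk, h1, hl⟩, hmax⟩ := hmx
    obtain ⟨N, hN, hcompl⟩ := exists_compl hC hY C hf hk h1 hl hmax
    have hZ := hf.range
    have hpZ := projectionOnto_eqv hZ hN hcompl
    have hpN := projectionOnto_eqv hN hZ hcompl.symm
    by_cases hz : PZ (subR υ hZ) (subR υ hZ) LinearMap.id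
    · have hn' : ¬ PZ (subR υ hN) (subR υ hN) LinearMap.id := by
        intro hz'
        apply hn
        have h2 := ((hz.of_id_left (eqv_subtype hZ)).comp_right hpZ).add
          ((hz'.of_id_left (eqv_subtype hN)).comp_right hpN)
        convert h2 using 1
        ext v
        exact (Submodule.projection_add_projection_eq_self hcompl v).symm
      have hfN : Module.finrank k N < Module.finrank k Y := by
        apply Submodule.finrank_lt
        rintro rfl
        have := hcompl.inf_eq_bot
        rw [inf_top_eq, LinearMap.range_eq_bot] at this
        rw [this, LinearMap.ker_zero] at hk
        apply C.range_ne_top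
        rw [eq_top_iff, hk]
        simpa using range_pow_anti t h1
      obtain ⟨Z, _, _, _, ζ, ι, π, hι, hπ, hid, hzn, hlab⟩ := ih N (subR υ hN) (by omega)
        (hY.sub hN) hn'
      refine ⟨Z, _, _, inferInstance, ζ, N.subtype ∘ₗ ι, π ∘ₗ N.projectionOnto _ hcompl.symm,
        (eqv_subtype hN).comp hι, hπ.comp hpN, ?_, hzn, hlab⟩
      rw [← hid]
      ext v
      simp only [LinearMap.comp_apply, Submodule.subtype_apply]
      rw [Submodule.projectionOnto_apply_left]
    · refine ⟨LinearMap.range f, _, _, inferInstance, subR υ hZ, Submodule.subtype _,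
        (LinearMap.range f).projectionOnto N hcompl, eqv_subtype hZ, hpZ, ?_, hz,
        V, _, _, inferInstance, ρ, t, l, m, C, f.codRestrict _ fun v => LinearMap.mem_range_self f v, ?_, ?_, ?_, h1, hl⟩
      · ext v
        simp only [LinearMap.comp_apply, Submodule.subtype_apply]
        rw [Submodule.projectionOnto_apply_left]
        rfl
      · rintro ⟨_, v, rfl⟩; exact ⟨v, rfl⟩
      · rw [tw_zpow_zero]; exact hf.codRestrict hZ _
      · rw [LinearMap.ker_codRestrict, hk]

end Dec

section FreeSum

/-- A sum over a finite set with a free group action is a trace. -/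
lemma free_sum {K Ω X : Type} [Group K] [Fintype K] [AddCommGroup X] (act : K → Ω → Ω)
    (h1 : ∀ ω, act 1 ω = ω) (hm : ∀ g h ω, act (g * h) ω = act g (act h ω)) (Φ : K → X →+ X)
    (F : Ω → X) (hF : ∀ h ω, F (act h ω) = Φ h (F ω)) (n : ℕ) :
    ∀ s : Finset Ω, s.card ≤ n → (∀ h, ∀ ω ∈ s, act h ω ∈ s) →
      (∀ ω ∈ s, ∀ h, act h ω = ω → h = 1) → ∃ x, ∑ ω ∈ s, F ω = ∑ h, Φ h x := by
  induction n with
  | zero =>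
    intro s hs _ _
    rw [Finset.card_eq_zero.1 (Nat.le_zero.1 hs)]
    exact ⟨0, by simp⟩
  | succ n ih =>
    intro s hs hst hfr
    rcases s.eq_empty_or_nonempty with rfl | ⟨ω, hω⟩
    · exact ⟨0, by simp⟩
    set O : Finset Ω := Finset.univ.image (fun h => act h ω) with hO
    have hOs : O ⊆ s := by
      intro x hx
      obtain ⟨h, -, rfl⟩ := Finset.mem_image.1 hx
      exact hst h ω hω
    have hωO : ω ∈ O := Finset.mem_image.2 ⟨1, Finset.mem_univ _, h1 ω⟩
    have hinv : ∀ h ω', act h⁻¹ (act h ω') = ω' := fun h ω' => by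
      rw [← hm, inv_mul_cancel, h1]
    obtain ⟨x, hx⟩ := ih (s \ O) (by
        rw [Finset.card_sdiff_of_subset hOs]
        have : 0 < O.card := Finset.card_pos.2 ⟨ω, hωO⟩
        omega) (by
        intro h ω' hω'
        rw [Finset.mem_sdiff] at hω' ⊢
        refine ⟨hst h _ hω'.1, fun hc => hω'.2 ?_⟩
        obtain ⟨h', -, h3⟩ := Finset.mem_image.1 hc
        refine Finset.mem_image.2 ⟨h⁻¹ * h', Finset.mem_univ _, ?_⟩
        rw [hm]
        exact (congrArg _ h3).trans (hinv h ω'))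
      (fun ω' hω' => hfr ω' (Finset.mem_sdiff.1 hω').1)
    refine ⟨x + F ω, ?_⟩
    rw [← Finset.sum_sdiff hOs, hx, hO, Finset.sum_image]
    · simp only [map_add, hF]
      rw [Finset.sum_add_distrib]
    · intro h _ h' _ hh
      have : act (h'⁻¹ * h) ω = ω := by
        rw [hm]
        exact (congrArg _ hh).trans (hinv h' ω)
      exact (inv_mul_eq_one.1 (hfr ω hω _ this)).symm

/-- In characteristic `p`, only fixed points contribute to the sum of an invariant function. -/
lemma sum_fixed {k Ω : Type} [Field k] [Fintype Ω] (p : ℕ) (hp : p.Prime) [CharP k p]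
    (π : Equiv.Perm Ω) (hπ : π ^ p = 1) (f : Ω → k) (hf : ∀ ω, f (π ω) = f ω) :
    ∑ ω, f ω = ∑ ω ∈ Finset.univ.filter (fun ω => π ω = ω), f ω := by
  rw [← Finset.sum_filter_add_sum_filter_not Finset.univ (fun ω => π ω = ω) f, add_eq_left]
  by_cases h1 : π = 1
  · rw [Finset.sum_eq_zero]
    intro ω hω
    exact absurd (by rw [h1]; rfl) (Finset.mem_filter.1 hω).2
  have hord : orderOf π = p := by
    have := Fact.mk hp
    exact orderOf_eq_prime hπ h1
  have hcard : Nat.card (Subgroup.zpowers π) = p := by rw [Nat.card_zpowers, hord]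
  have key : ∀ g ∈ Subgroup.zpowers π, ∀ ω, f (g ω) = f ω := by
    intro g hg ω
    have hle : Subgroup.zpowers π ≤
        { carrier := {g : Equiv.Perm Ω | ∀ ω, f (g ω) = f ω}
          mul_mem' := fun {a b} ha hb ω => (ha (b ω)).trans (hb ω)
          one_mem' := fun ω => rfl
          inv_mem' := fun {a} ha ω => by
            have := ha (a⁻¹ ω)
            exact this.symm.trans (congrArg f (Equiv.apply_symm_apply a ω)) } := by
      rw [Subgroup.zpowers_le]
      exact hf
    exact hle hg ω
  obtain ⟨x, hx⟩ := free_sum (K := Subgroup.zpowers π) (fun g ω => (g : Equiv.Perm Ω) ω)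
    (fun _ => rfl) (fun _ _ _ => rfl) (fun _ => AddMonoidHom.id k) f
    (fun h ω => key h h.2 ω) _ (Finset.univ.filter (fun ω => ¬ π ω = ω)) le_rfl (by
      intro h ω hω
      rw [Finset.mem_filter] at hω ⊢
      refine ⟨Finset.mem_univ _, fun hc => hω.2 ?_⟩
      have hcomm : π * (h : Equiv.Perm Ω) = h * π := by
        obtain ⟨i, hi⟩ := h.2
        rw [← hi]
        exact (Commute.refl π).zpow_right i
      apply (h : Equiv.Perm Ω).injective
      rw [← Equiv.Perm.mul_apply, ← hcomm]
      exact hc) (by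
      intro ω hω h hh
      have := Fact.mk hp
      have h3 : Fact (Nat.card (Subgroup.zpowers π)).Prime := by rw [hcard]; exact this
      rcases Subgroup.eq_bot_or_eq_top_of_prime_card
        ((MulAction.stabilizer (Equiv.Perm Ω) ω).subgroupOf (Subgroup.zpowers π)) with h4 | h4
      · have : h ∈ (MulAction.stabilizer (Equiv.Perm Ω) ω).subgroupOf (Subgroup.zpowers π) := hh
        rwa [h4, Subgroup.mem_bot] at this
      · exfalso
        have : (⟨π, Subgroup.mem_zpowers π⟩ : Subgroup.zpowers π) ∈
          (MulAction.stabilizer (Equiv.Perm Ω) ω).subgroupOf (Subgroup.zpowers π) := by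
          rw [h4]; trivial
        exact (Finset.mem_filter.1 hω).2 this)
  rw [hx]
  simp only [AddMonoidHom.id_apply, Finset.sum_const, Finset.card_univ]
  rw [Fintype.card_eq_nat_card, hcard, nsmul_eq_mul, CharP.cast_eq_zero, zero_mul]

variable {k : Type} [Field k] {K Ω V W : Type} [Group K] [Fintype K] [AddCommGroup V] [Module k V]
  [AddCommGroup W] [Module k W]

/-- Conjugation of a linear map by a group element. -/
def cj (ρ : Representation k K V) (σ : Representation k K W) (g : K) (f : V →ₗ[k] W) :
    V →ₗ[k] W := σ g ∘ₗ f ∘ₗ ρ g⁻¹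

omit [Fintype K] in
lemma cj_apply (ρ : Representation k K V) (σ : Representation k K W) (g : K) (f : V →ₗ[k] W)
    (v : V) : cj ρ σ g f v = σ g (f (ρ g⁻¹ v)) := rfl

/-- A sum of linear maps over a free orbit space is stably zero. -/
lemma pz_free_sum {ρ : Representation k K V} {σ : Representation k K W} (act : K → Ω → Ω)
    (h1 : ∀ ω, act 1 ω = ω) (hm : ∀ g h ω, act (g * h) ω = act g (act h ω))
    (F : Ω → V →ₗ[k] W) (hF : ∀ h ω, F (act h ω) = cj ρ σ h (F ω)) (s : Finset Ω)
    (hs : ∀ h, ∀ ω ∈ s, act h ω ∈ s) (hfr : ∀ ω ∈ s, ∀ h, act h ω = ω → h = 1) :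
    PZ ρ σ (∑ ω ∈ s, F ω) := by
  obtain ⟨x, hx⟩ := free_sum act h1 hm (fun h =>
    { toFun := cj ρ σ h
      map_zero' := by ext v; simp [cj_apply]
      map_add' := fun a b => by ext v; simp [cj_apply] }) F hF _ s le_rfl hs hfr
  exact ⟨x, hx⟩

end FreeSum

section Geo

variable {Γ A : Type} [Group Γ] [MulAction Γ A]

/-- A transitive action whose point stabilisers all contain a unique minimal subgroup, generated
by `z` at the base point; `H` is the stabiliser of the fixed point set of `z`. -/
structure Geo (p : ℕ) (a0 : A) (z : Γ) (H : Subgroup Γ) : Prop where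
  prime : p.Prime
  trans : ∀ a : A, ∃ g : Γ, g • a0 = a
  zne : z ≠ 1
  zpow : z ^ p = 1
  zfix : z • a0 = a0
  memH : ∀ g, g ∈ H ↔ z • g • a0 = g • a0
  stab : ∀ g : Γ, g • a0 = a0 → Commute g z
  free : ∀ g : Γ, g • a0 = a0 → g ≠ 1 → z ∈ Subgroup.zpowers g

/-- An element carrying the base point to `a`. -/
def gA (Γ : Type) [Group Γ] [MulAction Γ A] (a0 a : A) : Γ :=
  if h : ∃ g : Γ, g • a0 = a then h.choose else 1

/-- The conjugate of `z` attached to the point `a`. -/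
def zA (a0 : A) (z : Γ) (a : A) : Γ := gA Γ a0 a * z * (gA Γ a0 a)⁻¹

variable {p : ℕ} {a0 : A} {z : Γ} {H : Subgroup Γ}

namespace Geo

lemma gA_smul (hG : Geo p a0 z H) (a : A) : gA Γ a0 a • a0 = a := by
  have h := hG.trans a
  rw [gA, dif_pos h]
  exact h.choose_spec

lemma zA_eq (hG : Geo p a0 z H) {g : Γ} {a : A} (h : g • a0 = a) : zA a0 z a = g * z * g⁻¹ := by
  have h1 : (g⁻¹ * gA Γ a0 a) • a0 = a0 := by
    rw [mul_smul, hG.gA_smul, inv_smul_eq_iff, h]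
  have h2 := hG.stab _ h1
  have h3 : gA Γ a0 a = g * (g⁻¹ * gA Γ a0 a) := by group
  rw [zA, h3]
  generalize g⁻¹ * gA Γ a0 a = s at h2
  rw [mul_inv_rev, mul_assoc g s z, h2.eq]
  group

lemma zA_smul (hG : Geo p a0 z H) (g : Γ) (a : A) :
    zA a0 z (g • a) = g * zA a0 z a * g⁻¹ := by
  rw [hG.zA_eq (g := g * gA Γ a0 a) (by rw [mul_smul, hG.gA_smul]), zA]
  group

lemma zA_base (hG : Geo p a0 z H) : zA a0 z a0 = z := by
  rw [hG.zA_eq (g := 1) (one_smul _ _)]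
  group

lemma zA_mem (hG : Geo p a0 z H) {g : Γ} {a : A} (h : g • a = a) (h1 : g ≠ 1) :
    zA a0 z a ∈ Subgroup.zpowers g := by
  set y := gA Γ a0 a with hy
  have h2 : (y⁻¹ * g * y) • a0 = a0 := by
    rw [mul_smul, mul_smul, hy, hG.gA_smul, h, inv_smul_eq_iff, hG.gA_smul]
  have h3 : y⁻¹ * g * y ≠ 1 := by
    intro hc
    apply h1
    have : g = y * (y⁻¹ * g * y) * y⁻¹ := by group
    rw [this, hc]
    group
  obtain ⟨i, hi⟩ := hG.free _ h2 h3
  refine ⟨i, ?_⟩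
  have h4 : (y⁻¹ * g * y) ^ i = y⁻¹ * g ^ i * y := by
    have := conj_zpow (a := y⁻¹) (b := g) (i := i)
    rwa [inv_inv] at this
  have hi' : y⁻¹ * g ^ i * y = z := h4.symm.trans hi
  change g ^ i = y * z * y⁻¹
  rw [← hi']
  group

lemma zA_zpowers (hG : Geo p a0 z H) {a : A} (h : z • a = a) :
    Subgroup.zpowers (zA a0 z a) = Subgroup.zpowers z := by
  have hle : Subgroup.zpowers (zA a0 z a) ≤ Subgroup.zpowers z := by
    rw [Subgroup.zpowers_le]
    exact hG.zA_mem h hG.zne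
  have hf := Fact.mk hG.prime
  have ho : orderOf z = p := orderOf_eq_prime hG.zpow hG.zne
  have ho' : orderOf (zA a0 z a) = p := by
    rw [zA, orderOf_eq_prime_iff]
    constructor
    · rw [conj_pow, hG.zpow]; group
    · intro hc
      exact hG.zne (conj_eq_one_iff.1 hc)
  have hfin : Finite (Subgroup.zpowers z) := by
    refine Nat.finite_of_card_ne_zero ?_
    rw [Nat.card_zpowers, ho]
    exact hG.prime.ne_zero
  refine Subgroup.eq_of_le_of_card_ge hle ?_
  rw [Nat.card_zpowers, Nat.card_zpowers, ho, ho']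

lemma zA_comm (hG : Geo p a0 z H) {a : A} (h : z • a = a) (w : Γ) :
    Commute w (zA a0 z a) ↔ Commute w z := by
  have h1 := hG.zA_zpowers h
  constructor
  · intro hc
    have : z ∈ Subgroup.zpowers (zA a0 z a) := by rw [h1]; exact Subgroup.mem_zpowers z
    obtain ⟨i, hi⟩ := this
    rw [← hi]
    exact hc.zpow_right i
  · intro hc
    have : zA a0 z a ∈ Subgroup.zpowers z := by rw [← h1]; exact Subgroup.mem_zpowers _
    obtain ⟨i, hi⟩ := this
    rw [← hi]
    exact hc.zpow_right i

lemma z_mem (hG : Geo p a0 z H) {a : A} (h : z • a = a) {g : Γ} (hg : g • a = a) (h1 : g ≠ 1) :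
    z ∈ Subgroup.zpowers g := by
  have h2 : z ∈ Subgroup.zpowers (zA a0 z a) := by
    rw [hG.zA_zpowers h]; exact Subgroup.mem_zpowers z
  exact (Subgroup.zpowers_le.2 (hG.zA_mem hg h1)) h2

lemma gA_mem (hG : Geo p a0 z H) (a : A) : gA Γ a0 a ∈ H ↔ z • a = a := by
  rw [hG.memH, hG.gA_smul]

lemma fix_smul (hG : Geo p a0 z H) {h : Γ} (hh : h ∈ H) (a : A) :
    z • h • a = h • a ↔ z • a = a := by
  have h1 := hG.memH (h * gA Γ a0 a)
  rw [mul_smul, hG.gA_smul] at h1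
  rw [← h1, ← hG.gA_mem a]
  exact H.mul_mem_cancel_left hh

lemma fix_base (hG : Geo p a0 z H) {h : Γ} (hh : h ∈ H) : z • h • a0 = h • a0 :=
  (hG.memH h).1 hh

lemma stab_mem (hG : Geo p a0 z H) {g : Γ} (h : g • a0 = a0) : g ∈ H := by
  rw [hG.memH, h, hG.zfix]

lemma comm_mem (hG : Geo p a0 z H) {w : Γ} (h : Commute w z) : w ∈ H := by
  rw [hG.memH, ← mul_smul, ← h.eq, mul_smul, hG.zfix]

lemma z_memH (hG : Geo p a0 z H) : z ∈ H := hG.comm_mem (Commute.refl z)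

lemma comm_conj (hG : Geo p a0 z H) {h : Γ} (hh : h ∈ H) (w : Γ) :
    Commute (h * w * h⁻¹) z ↔ Commute w z := by
  have h1 := hG.zA_comm (hG.fix_base hh) (h * w * h⁻¹)
  rw [hG.zA_smul, hG.zA_base] at h1
  rw [← h1]
  exact Commute.conj_iff h

/-- Elements carrying the base point to the same point lie in the same coset of `H`. -/
lemma coset_mem (hG : Geo p a0 z H) {g g' : Γ} (h : g • a0 = g' • a0) : g⁻¹ * g' ∈ H := by
  apply hG.stab_mem
  rw [mul_smul, ← h, inv_smul_smul]

end Geo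

end Geo

section Trunc

variable {k : Type} [Field k] {Γ A : Type} [Group Γ] [MulAction Γ A]

/-- The sum of a family of group algebra elements. -/
def tot [Fintype A] (E : A → Γ → k) (w : Γ) : k := ∑ a, E a w

/-- An equivariant family of group algebra elements whose sum is a central idempotent. -/
structure Dat [Fintype Γ] [Fintype A] (E : A → Γ → k) : Prop where
  eqv : ∀ g a w, E (g • a) (g * w * g⁻¹) = E a w
  idem : CentralIdem (tot E)

/-- Truncation of each `E a` to the centraliser of `zA a`. -/
def EC (a0 : A) (z : Γ) (E : A → Γ → k) (a : A) (w : Γ) : k :=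
  if Commute w (zA a0 z a) then E a w else 0

/-- Truncation of the total sum to the centraliser of `z`. -/
def eC [Fintype A] (z : Γ) (E : A → Γ → k) (w : Γ) : k := if Commute w z then tot E w else 0

/-- Restriction of the truncated idempotent to a subgroup. -/
def eH [Fintype A] (z : Γ) (H : Subgroup Γ) (E : A → Γ → k) (h : H) : k := eC z E h

/-- Restriction of a representation. -/
def res {V : Type} [AddCommGroup V] [Module k V] (H : Subgroup Γ) (ρ : Representation k Γ V) :
    Representation k H V := MonoidHom.comp ρ H.subtype

omit [MulAction Γ A] in
lemma res_apply {V : Type} [AddCommGroup V] [Module k V] (H : Subgroup Γ)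
    (ρ : Representation k Γ V) (h : H) (v : V) : res H ρ h v = ρ (h : Γ) v := rfl

variable {p : ℕ} {a0 : A} {z : Γ} {H : Subgroup Γ} {E : A → Γ → k}

lemma EC_conj (hG : Geo p a0 z H) (hE : ∀ g a w, E (g • a) (g * w * g⁻¹) = E a w) (g : Γ) (a : A)
    (w : Γ) : EC a0 z E (g • a) (g * w * g⁻¹) = EC a0 z E a w := by
  rw [EC, EC, hG.zA_smul, hE]
  simp only [Commute.conj_iff]

variable [Fintype A]

lemma tot_conj (hE : ∀ g a w, E (g • a) (g * w * g⁻¹) = E a w) (g w : Γ) :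
    tot E (g * w * g⁻¹) = tot E w := by
  rw [tot, tot, ← Equiv.sum_comp (MulAction.toPerm g)]
  exact Finset.sum_congr rfl fun a _ => hE g a w

lemma eC_conj (hG : Geo p a0 z H) (hE : ∀ g a w, E (g • a) (g * w * g⁻¹) = E a w) {h : Γ}
    (hh : h ∈ H) (w : Γ) : eC z E (h * w * h⁻¹) = eC z E w := by
  rw [eC, eC, tot_conj hE]
  simp only [hG.comm_conj hh]

lemma eC_eq [CharP k p] (hG : Geo p a0 z H) (hE : ∀ g a w, E (g • a) (g * w * g⁻¹) = E a w)
    (w : Γ) : eC z E w = ∑ a ∈ Finset.univ.filter (fun a : A => z • a = a), EC a0 z E a w := by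
  have key : ∀ a ∈ Finset.univ.filter (fun a : A => z • a = a),
      EC a0 z E a w = if Commute w z then E a w else 0 := by
    intro a ha
    rw [EC]
    simp only [hG.zA_comm (Finset.mem_filter.1 ha).2]
  rw [Finset.sum_congr rfl key, eC]
  by_cases hw : Commute w z
  · simp only [hw, if_true]
    rw [tot, sum_fixed p hG.prime (MulAction.toPermHom Γ A z) (by rw [← map_pow, hG.zpow, map_one])]
    · rfl
    · intro a
      have := hE z a w
      rwa [show z * w * z⁻¹ = w by rw [← hw.eq, mul_inv_cancel_right]] at this
  · simp [hw]

variable [Fintype Γ]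

omit [MulAction Γ A] [Fintype A] in
lemma sum_subgroup {X : Type} [AddCommMonoid X] {f : Γ → X} (hf : ∀ g, g ∉ H → f g = 0) :
    ∑ h : H, f h = ∑ g, f g := by
  rw [← Finset.sum_subtype (Finset.univ.filter (fun g => g ∈ H)) (by simp) f]
  apply Finset.sum_filter_of_ne
  intro g _ hg
  by_contra hc
  exact hg (hf g hc)

lemma Dat.eH_idem [CharP k p] (hE : Dat E) (hG : Geo p a0 z H) : CentralIdem (eH z H E) where
  conj g w := by
    simp only [eH]
    exact eC_conj hG hE.eqv g.2 w
  idem F := by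
    have hsub : ∀ (f : Γ → k), (∀ g, ¬ Commute g z → f g = 0) → ∑ h : H, f h = ∑ g, f g :=
      fun f hf => sum_subgroup fun g hg => hf g fun h => hg (hG.comm_mem h)
    set F' : Γ → k := fun g => if h : Commute g z then F ⟨g, hG.comm_mem h⟩ else 0 with hF'
    have hFF : ∀ h : H, Commute (h : Γ) z → F' h = F h := fun h hh => by
      rw [hF']; simp only [hh, dif_pos]
    have h1 := hE.idem.idem F'
    have h2 : ∑ w : H, eH z H E w * F w = ∑ w, tot E w * F' w := by
      have := hsub (fun g => tot E g * F' g) (fun g hg => by simp [hF', hg])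
      rw [← this]
      refine Finset.sum_congr rfl fun w _ => ?_
      rw [eH, eC]
      by_cases hw : Commute (w : Γ) z
      · rw [if_pos hw, hFF w hw]
      · simp [hF', hw]
    have h3 : ∑ u, ∑ v, tot E u * tot E v * F' (u * v) =
        ∑ u, ∑ v, eC z E u * eC z E v * F' (u * v) := by
      rw [← Fintype.sum_prod_type', ← Fintype.sum_prod_type']
      have hconj : ∀ w, F' (z * w * z⁻¹) = F' w := by
        intro w
        by_cases hw : Commute w z
        · rw [← hw.eq, mul_inv_cancel_right]
        · have hw' : ¬ Commute (z * w * z⁻¹) z := fun hc => hw ((hG.comm_conj hG.z_memH w).1 hc)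
          simp [hF', hw, hw']
      set π : Equiv.Perm (Γ × Γ) := (MulAut.conj z).toEquiv.prodCongr (MulAut.conj z).toEquiv
        with hπ
      have hπa : ∀ x : Γ × Γ, π x = (z * x.1 * z⁻¹, z * x.2 * z⁻¹) := fun _ => rfl
      have hππ : ∀ n (x : Γ × Γ), (π ^ n) x = (z ^ n * x.1 * (z ^ n)⁻¹, z ^ n * x.2 * (z ^ n)⁻¹) := by
        intro n
        induction n with
        | zero => intro x; simp
        | succ n ih =>
          intro x
          rw [pow_succ', Equiv.Perm.mul_apply, ih, hπa, pow_succ']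
          ext <;> simp [mul_assoc]
      rw [sum_fixed p hG.prime π (by
          ext x <;> rw [hππ, hG.zpow] <;> simp)
        (fun x : Γ × Γ => tot E x.1 * tot E x.2 * F' (x.1 * x.2)) (by
          intro x
          rw [hπa]
          simp only [tot_conj hE.eqv]
          rw [show z * x.1 * z⁻¹ * (z * x.2 * z⁻¹) = z * (x.1 * x.2) * z⁻¹ by group, hconj])]
      have h5 : ∑ x ∈ Finset.univ.filter (fun x : Γ × Γ => π x = x),
          eC z E x.1 * eC z E x.2 * F' (x.1 * x.2) =
          ∑ x : Γ × Γ, eC z E x.1 * eC z E x.2 * F' (x.1 * x.2) := by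
        apply Finset.sum_filter_of_ne
        intro x _ hx
        have c1 : Commute x.1 z := by
          by_contra hc; exact hx (by simp [eC, hc])
        have c2 : Commute x.2 z := by
          by_contra hc; exact hx (by simp [eC, hc])
        rw [hπa, ← c1.eq, ← c2.eq, mul_inv_cancel_right, mul_inv_cancel_right]
      rw [← h5]
      refine Finset.sum_congr (by ext; simp) fun x hx => ?_
      have hx' := (Finset.mem_filter.1 hx).2
      rw [hπa] at hx'
      have e1 := congrArg Prod.fst hx'
      have e2 := congrArg Prod.snd hx'
      simp only at e1 e2
      have c1 : Commute x.1 z := by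
        rw [mul_inv_eq_iff_eq_mul] at e1; exact e1.symm
      have c2 : Commute x.2 z := by
        rw [mul_inv_eq_iff_eq_mul] at e2; exact e2.symm
      rw [eC, eC, if_pos c1, if_pos c2]
    rw [h2, ← h1, h3]
    have h4 : ∀ u : Γ, ∑ v : H, eC z E u * eC z E (v : Γ) * F' (u * v) =
        ∑ v, eC z E u * eC z E v * F' (u * v) := fun u =>
      hsub (fun v => eC z E u * eC z E v * F' (u * v)) (fun g hg => by simp [eC, hg])
    rw [← hsub (fun u => ∑ v, eC z E u * eC z E v * F' (u * v)) (fun g hg => by simp [eC, hg])]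
    refine Finset.sum_congr rfl fun u _ => ?_
    rw [← h4]
    refine Finset.sum_congr rfl fun v _ => ?_
    by_cases hu : Commute (u : Γ) z
    · by_cases hv : Commute (v : Γ) z
      · have := hFF (u * v) (hu.mul_left hv)
        rw [Subgroup.coe_mul] at this
        rw [this]; rfl
      · simp [eH, eC, hv]
    · simp [eH, eC, hu]

section Maps

variable {V W : Type} [AddCommGroup V] [Module k V] [AddCommGroup W] [Module k W]

omit [Fintype A] [Fintype Γ] [MulAction Γ A] in
lemma Eqv.res {ρ : Representation k Γ V} {σ : Representation k Γ W} {f : V →ₗ[k] W}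
    (hf : Eqv ρ σ f) (H : Subgroup Γ) : Eqv (res H ρ) (CyclicBlock.res H σ) f :=
  fun h v => hf h v

omit [MulAction Γ A] in
lemma op_res (hG : ∀ w, Commute w z → w ∈ H) (ρ : Representation k Γ V) (v : V) :
    op (res H ρ) (eH z H E) v = op ρ (eC z E) v := by
  rw [op_apply, op_apply]
  have h1 : ∀ h : H, eH z H E h • res H ρ h v = (fun g => eC z E g • ρ g v) (h : Γ) :=
    fun h => rfl
  rw [Finset.sum_congr rfl fun h _ => h1 h]
  exact sum_subgroup (H := H) (f := fun g => eC z E g • ρ g v)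
    fun g hg => by simp [eC, show ¬ Commute g z from fun h => hg (hG g h)]

/-- The action of the truncated idempotent on a representation. -/
def eta (z : Γ) (E : A → Γ → k) (ρ : Representation k Γ V) : V →ₗ[k] V := op ρ (eC z E)

lemma Dat.eta_eqv [CharP k p] (hE : Dat E) (hG : Geo p a0 z H) (ρ : Representation k Γ V) :
    Eqv (res H ρ) (res H ρ) (eta z E ρ) := by
  have h1 := (hE.eH_idem hG).eqv (res H ρ)
  have h2 : op (res H ρ) (eH z H E) = eta z E ρ := by
    ext v
    exact op_res (fun w => hG.comm_mem) ρ v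
  rwa [h2] at h1

lemma Dat.eta_eta [CharP k p] (hE : Dat E) (hG : Geo p a0 z H) (ρ : Representation k Γ V) (v : V) :
    eta z E ρ (eta z E ρ v) = eta z E ρ v := by
  have h1 := (hE.eH_idem hG).op_op (res H ρ) v
  simp only [op_res (fun w => hG.comm_mem)] at h1
  exact h1

omit [MulAction Γ A] in
lemma eta_natural {ρ : Representation k Γ V} {σ : Representation k Γ W} {f : V →ₗ[k] W}
    (hf : Eqv ρ σ f) (v : V) : f (eta z E ρ v) = eta z E σ (f v) := hf.op _ v

/-- Stably zero maps restrict to stably zero maps. -/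
lemma PZ.res {ρ : Representation k Γ V} {σ : Representation k Γ W} {f : V →ₗ[k] W}
    (hf : PZ ρ σ f) (H : Subgroup Γ) : PZ (res H ρ) (CyclicBlock.res H σ) f := by
  obtain ⟨θ, rfl⟩ := hf
  have := pz_free_sum (ρ := CyclicBlock.res H ρ) (σ := CyclicBlock.res H σ)
    (fun (h : H) (g : Γ) => (h : Γ) * g) (by simp) (by simp [mul_assoc])
    (fun g => cj ρ σ g θ) (by
      intro h g
      ext v
      simp only [cj_apply, res_apply, mul_inv_rev, rep_mul_apply]
      rfl) Finset.univ (by simp) (by simp)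
  exact this

end Maps

end Trunc

section Trace

variable {k : Type} [Field k] {Γ A : Type} [Group Γ] [MulAction Γ A]
variable {U V W X : Type} [AddCommGroup U] [Module k U] [AddCommGroup V] [Module k V]
  [AddCommGroup W] [Module k W] [AddCommGroup X] [Module k X]
variable {ρ : Representation k Γ V} {σ : Representation k Γ W} {τ : Representation k Γ X}
  {υ : Representation k Γ U}
variable {p : ℕ} {a0 : A} {z : Γ} {H : Subgroup Γ} {E : A → Γ → k}

omit [MulAction Γ A] in
lemma cj_mul (g h : Γ) (f : V →ₗ[k] W) : cj ρ σ (g * h) f = cj ρ σ g (cj ρ σ h f) := by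
  ext v
  simp only [cj_apply, mul_inv_rev, rep_mul_apply]

lemma cj_of_eqv {f : V →ₗ[k] W} (hf : Eqv ρ σ f) (g : Γ) : cj ρ σ g f = f := by
  ext v
  rw [cj_apply, hf, rep_apply_inv]

lemma eqv_of_cj {f : V →ₗ[k] W} (hf : ∀ g, cj ρ σ g f = f) : Eqv ρ σ f := fun g v => by
  conv_lhs => rw [← hf g]
  rw [cj_apply, rep_inv_apply]

lemma cj_coset {f : V →ₗ[k] W} (hf : Eqv (res H ρ) (res H σ) f) {g g' : Γ} (h : g⁻¹ * g' ∈ H) :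
    cj ρ σ g f = cj ρ σ g' f := by
  have h1 : g' = g * (g⁻¹ * g') := by group
  rw [h1, cj_mul]
  congr 1
  ext v
  rw [cj_apply, ← res_apply H σ ⟨_, h⟩, ← hf, res_apply, rep_apply_inv]

lemma cj_sum {ι : Type} (s : Finset ι) (f : ι → V →ₗ[k] W) (g : Γ) :
    cj ρ σ g (∑ i ∈ s, f i) = ∑ i ∈ s, cj ρ σ g (f i) := by
  ext v
  simp [cj_apply]

lemma cj_comp {f : W →ₗ[k] X} {h : V →ₗ[k] W} (g : Γ) :
    cj ρ τ g (f ∘ₗ h) = cj σ τ g f ∘ₗ cj ρ σ g h := by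
  ext v
  simp [cj_apply]

lemma sum_comp' {ι : Type} (s : Finset ι) (f : ι → W →ₗ[k] X) (h : V →ₗ[k] W) :
    (∑ i ∈ s, f i) ∘ₗ h = ∑ i ∈ s, f i ∘ₗ h := by
  ext v
  simp

lemma comp_sum' {ι : Type} (s : Finset ι) (f : W →ₗ[k] X) (h : ι → V →ₗ[k] W) :
    f ∘ₗ (∑ i ∈ s, h i) = ∑ i ∈ s, f ∘ₗ h i := by
  ext v
  simp

variable [Fintype Γ]

lemma cj_op (g : Γ) {x x' : Γ → k} (hx : ∀ w, x' (g * w * g⁻¹) = x w) :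
    cj ρ ρ g (op ρ x) = op ρ x' := by
  ext v
  rw [cj_apply, op_apply, op_apply, map_sum]
  refine Fintype.sum_equiv (MulAut.conj g).toEquiv _ _ fun w => ?_
  have : (MulAut.conj g).toEquiv w = g * w * g⁻¹ := rfl
  rw [this, hx, map_smul, ← rep_mul_apply, ← rep_mul_apply, mul_assoc]

lemma op_sum {ι : Type} (s : Finset ι) (x : ι → Γ → k) :
    op ρ (fun w => ∑ i ∈ s, x i w) = ∑ i ∈ s, op ρ (x i) := by
  simp only [op, Finset.sum_smul]
  exact Finset.sum_comm

variable [Fintype A]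

/-- The relative trace of the truncation of a map. -/
def tr (z : Γ) (H : Subgroup Γ) (E : A → Γ → k) (ρ : Representation k Γ V)
    (σ : Representation k Γ W) (h : V →ₗ[k] W) : V →ₗ[k] W :=
  ∑ x : Γ ⧸ H, cj ρ σ x.out (eta z E σ ∘ₗ h)

omit [MulAction Γ A] in
lemma tr_comp {h : V →ₗ[k] W} {i : U →ₗ[k] V} (hi : Eqv υ ρ i) :
    tr z H E ρ σ h ∘ₗ i = tr z H E υ σ (h ∘ₗ i) := by
  rw [tr, tr, sum_comp']
  refine Finset.sum_congr rfl fun x _ => ?_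
  ext v
  simp [cj_apply, hi _ _]

variable [CharP k p] (hG : Geo p a0 z H) (hE : Dat E)

include hG hE

lemma eta_sum : eta z E σ =
    ∑ a ∈ Finset.univ.filter (fun a : A => z • a = a), op σ (EC a0 z E a) := by
  rw [eta, ← op_sum]
  congr 1
  ext w
  exact eC_eq hG hE.eqv w

lemma tr_eta (h : V →ₗ[k] W) : tr z H E ρ σ (eta z E σ ∘ₗ h) = tr z H E ρ σ h := by
  rw [tr, tr]
  refine Finset.sum_congr rfl fun x _ => ?_
  congr 1
  ext v
  exact hE.eta_eta hG σ (h v)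

lemma tr_eqv {h : V →ₗ[k] W} (hh : Eqv (res H ρ) (res H σ) h) : Eqv ρ σ (tr z H E ρ σ h) := by
  have hf := (hE.eta_eqv hG σ).comp hh
  apply eqv_of_cj
  intro g
  rw [tr, cj_sum]
  refine Fintype.sum_equiv (MulAction.toPerm g) _ _ fun x => ?_
  rw [← cj_mul]
  apply cj_coset hf
  rw [← QuotientGroup.eq]
  change _ = ((g • x : Γ ⧸ H).out : Γ ⧸ H)
  rw [QuotientGroup.out_eq', ← smul_eq_mul, MulAction.Quotient.coe_smul_out]

lemma tr_eq {h : V →ₗ[k] W} (hh : Eqv (res H ρ) (res H σ) h) :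
    tr z H E ρ σ h = ∑ a : A, op σ (EC a0 z E a) ∘ₗ cj ρ σ (gA Γ a0 a) h := by
  rw [← Finset.sum_fiberwise Finset.univ (fun a : A => (gA Γ a0 a : Γ ⧸ H)), tr]
  refine Finset.sum_congr rfl fun x _ => ?_
  rw [eta_sum hG hE, sum_comp', cj_sum]
  refine Finset.sum_equiv (MulAction.toPerm x.out) (fun a => ?_) (fun a ha => ?_)
  · simp only [Finset.mem_filter, Finset.mem_univ, true_and, MulAction.toPerm_apply]
    have h1 : x.out⁻¹ * gA Γ a0 (x.out • a) ∈ H ↔ z • a = a := by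
      rw [hG.memH, mul_smul, hG.gA_smul, inv_smul_smul]
    rw [← h1, ← QuotientGroup.eq, QuotientGroup.out_eq', eq_comm]
  · rw [cj_comp (σ := σ), cj_op _ fun w => EC_conj hG hE.eqv x.out a w]
    congr 1
    apply cj_coset hh
    rw [MulAction.toPerm_apply, hG.memH, mul_smul, hG.gA_smul, inv_smul_smul]
    exact (Finset.mem_filter.1 ha).2

omit [CharP k p] in
lemma op_EC_cj (g : Γ) (a : A) : cj σ σ g (op σ (EC a0 z E a)) = op σ (EC a0 z E (g • a)) :=
  cj_op g fun w => EC_conj hG hE.eqv g a w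

/-- The trace of an intertwiner is stably the intertwiner itself. -/
lemma tr_sub_pz {r : V →ₗ[k] W} (hr : Eqv ρ σ r) (hσ : InMod (tot E) σ) :
    PZ ρ σ (tr z H E ρ σ r - r) := by
  have h1 : r = ∑ a : A, op σ (E a) ∘ₗ r := by
    ext v
    conv_lhs => rw [← hσ (r v)]
    have : op σ (tot E) = ∑ a, op σ (E a) := op_sum _ _
    rw [this]
    simp
  have h2 : r - tr z H E ρ σ r = ∑ x ∈ Finset.univ.filter
      (fun x : A × Γ => ¬ Commute x.2 (zA a0 z x.1)), E x.1 x.2 • (σ x.2 ∘ₗ r) := by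
    rw [tr_eq hG hE (hr.res H)]
    conv_lhs => rw [h1]
    rw [Finset.sum_filter, Fintype.sum_prod_type, ← Finset.sum_sub_distrib]
    refine Finset.sum_congr rfl fun a _ => ?_
    have h3 : ∑ b : A, op σ (E b) ∘ₗ r = r := h1.symm
    rw [h3, cj_of_eqv hr]
    ext v
    rw [LinearMap.sub_apply, LinearMap.comp_apply, LinearMap.comp_apply, op_apply, op_apply,
      ← Finset.sum_sub_distrib, LinearMap.sum_apply]
    refine Finset.sum_congr rfl fun w _ => ?_
    by_cases hw : Commute w (zA a0 z a) <;> simp [EC, hw]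
  have h3 : PZ ρ σ (r - tr z H E ρ σ r) := by
    rw [h2]
    refine pz_free_sum (fun g x => (g • x.1, g * x.2 * g⁻¹)) (by simp) (by
      intro g h x
      ext
      · simp [mul_smul]
      · simp [mul_assoc]) _ ?_ _ ?_ ?_
    · intro g x
      ext v
      simp only [LinearMap.smul_apply, LinearMap.comp_apply, cj_apply, hE.eqv, map_smul, hr _ _]
      rw [← rep_mul_apply, ← rep_mul_apply, mul_assoc]
    · intro g x hx
      simpa [hG.zA_smul] using hx
    · intro x hx g hg
      by_contra hc
      have e1 := congrArg Prod.fst hg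
      have e2 := congrArg Prod.snd hg
      simp only at e1 e2
      apply (Finset.mem_filter.1 hx).2
      obtain ⟨i, hi⟩ := hG.zA_mem e1 hc
      simp only at hi
      rw [← hi]
      have : Commute x.2 g := by
        rw [mul_inv_eq_iff_eq_mul] at e2; exact e2.symm
      exact this.zpow_right i
  have := h3.smul (-1)
  rwa [neg_one_smul, neg_sub] at this

/-- The truncated trace of an `H`-map is stably its truncation. -/
lemma eta_tr_pz {h : V →ₗ[k] W} (hh : Eqv (res H ρ) (res H σ) h) :
    PZ (res H ρ) (res H σ) (eta z E σ ∘ₗ tr z H E ρ σ h - eta z E σ ∘ₗ h) := by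
  set s := Finset.univ.filter (fun a : A => z • a = a) with hs
  set s' := Finset.univ.filter (fun a : A => ¬ z • a = a) with hs'
  have h1 : tr z H E ρ σ h = eta z E σ ∘ₗ h +
      ∑ a ∈ s', op σ (EC a0 z E a) ∘ₗ cj ρ σ (gA Γ a0 a) h := by
    rw [tr_eq hG hE hh, ← Finset.sum_filter_add_sum_filter_not Finset.univ
      (fun a : A => z • a = a), eta_sum hG hE, sum_comp']
    congr 1
    refine Finset.sum_congr rfl fun a ha => ?_
    congr 1
    have h2 : cj ρ σ 1 h = h := by
      ext v
      rw [cj_apply, inv_one, rep_one_apply, rep_one_apply]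
    conv_rhs => rw [← h2]
    symm
    apply cj_coset hh
    rw [inv_one, one_mul, hG.gA_mem]
    exact (Finset.mem_filter.1 ha).2
  have h2 : eta z E σ ∘ₗ tr z H E ρ σ h - eta z E σ ∘ₗ h = ∑ x ∈ s ×ˢ s',
      op σ (EC a0 z E x.1) ∘ₗ op σ (EC a0 z E x.2) ∘ₗ cj ρ σ (gA Γ a0 x.2) h := by
    rw [h1, LinearMap.comp_add]
    have h3 : eta z E σ ∘ₗ eta z E σ ∘ₗ h = eta z E σ ∘ₗ h := by
      ext v
      exact hE.eta_eta hG σ (h v)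
    rw [h3, add_sub_cancel_left, Finset.sum_product, eta_sum hG hE, sum_comp']
    refine Finset.sum_congr rfl fun a _ => ?_
    rw [comp_sum']
  rw [h2]
  refine pz_free_sum (fun (g : H) (x : A × A) => ((g : Γ) • x.1, (g : Γ) • x.2)) (by simp) (by
      intro g g' x
      simp [mul_smul]) _ ?_ _ ?_ ?_
  · intro g x
    have e1 : ∀ f : V →ₗ[k] W, cj (res H ρ) (res H σ) g f = cj ρ σ (g : Γ) f := fun f => rfl
    rw [e1, cj_comp (σ := σ), cj_comp (σ := σ), op_EC_cj hG hE, op_EC_cj hG hE, ← cj_mul]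
    congr 2
    apply cj_coset hh
    apply hG.coset_mem
    rw [hG.gA_smul, mul_smul, hG.gA_smul]
  · intro g x hx
    rw [Finset.mem_product, hs, hs', Finset.mem_filter, Finset.mem_filter] at hx ⊢
    simp only [Finset.mem_univ, true_and, hG.fix_smul g.2] at hx ⊢
    exact hx
  · intro x hx g hg
    rw [Finset.mem_product, hs, hs', Finset.mem_filter, Finset.mem_filter] at hx
    by_contra hc
    have e1 := congrArg Prod.fst hg
    have e2 := congrArg Prod.snd hg
    simp only at e1 e2
    apply hx.2.2
    obtain ⟨i, hi⟩ := hG.z_mem hx.1.2 e1 (fun h => hc (Subtype.ext h))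
    simp only at hi
    rw [← hi]
    have : (g : Γ) ∈ MulAction.stabilizer Γ x.2 := e2
    exact (MulAction.stabilizer Γ x.2).zpow_mem this i

/-- Traces of stably zero maps are stably zero. -/
lemma tr_of_pz {h : V →ₗ[k] W} (hh : PZ (res H ρ) (res H σ) h) : PZ ρ σ (tr z H E ρ σ h) := by
  obtain ⟨θ, rfl⟩ := hh
  refine ⟨eta z E σ ∘ₗ θ, ?_⟩
  have h1 : ∀ x : Γ ⧸ H, cj ρ σ x.out (eta z E σ ∘ₗ avg (res H ρ) (res H σ) θ) =
      ∑ h : H, cj ρ σ (x.out * h) (eta z E σ ∘ₗ θ) := by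
    intro x
    rw [comp_avg (hE.eta_eqv hG σ)]
    change cj ρ σ x.out (∑ h : H, cj ρ σ (h : Γ) (eta z E σ ∘ₗ θ)) = _
    rw [cj_sum]
    simp only [cj_mul]
  rw [tr, Finset.sum_congr rfl fun x _ => h1 x, ← Fintype.sum_prod_type']
  have hm : ∀ g : Γ, (g : Γ ⧸ H).out⁻¹ * g ∈ H := fun g => by
    rw [← QuotientGroup.eq, QuotientGroup.out_eq']
  refine Finset.sum_bij' (fun x _ => x.1.out * (x.2 : Γ)) (fun g _ => ((g : Γ ⧸ H), ⟨_, hm g⟩))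
    (fun _ _ => Finset.mem_univ _) (fun _ _ => Finset.mem_univ _) ?_ ?_ (fun _ _ => rfl)
  · intro x _
    have h2 : ((x.1.out * (x.2 : Γ) : Γ) : Γ ⧸ H) = x.1 := by
      rw [QuotientGroup.mk_mul_of_mem _ x.2.2, QuotientGroup.out_eq']
    ext
    · exact h2
    · change ((x.1.out * (x.2 : Γ) : Γ) : Γ ⧸ H).out⁻¹ * (x.1.out * (x.2 : Γ)) = x.2
      rw [h2, inv_mul_cancel_left]
  · intro g _
    exact mul_inv_cancel_left _ _

/-- A truncated intertwiner is stably zero only if the intertwiner is. -/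
lemma pz_of_eta {r : V →ₗ[k] W} (hr : Eqv ρ σ r) (hσ : InMod (tot E) σ)
    (h : PZ (res H ρ) (res H σ) (eta z E σ ∘ₗ r)) : PZ ρ σ r := by
  have h1 := tr_of_pz hG hE h
  rw [tr_eta hG hE] at h1
  have := h1.sub (tr_sub_pz hG hE hr hσ)
  rwa [sub_sub_cancel] at this

/-- Truncation of a class function away from the centraliser of `z` acts stably as zero. -/
lemma eta_op_pz {x : Γ → k} (hx : ∀ g w, x (g * w * g⁻¹) = x w) :
    PZ (res H σ) (res H σ)
      (eta z E σ ∘ₗ op σ (fun w => if Commute w z then 0 else x w)) := by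
  set s := Finset.univ.filter (fun a : A => z • a = a) with hs
  set s' := Finset.univ.filter (fun w : Γ => ¬ Commute w z) with hs'
  have h2 : eta z E σ ∘ₗ op σ (fun w => if Commute w z then 0 else x w) = ∑ y ∈ s ×ˢ s',
      x y.2 • (op σ (EC a0 z E y.1) ∘ₗ σ y.2) := by
    rw [Finset.sum_product, eta_sum hG hE, sum_comp']
    refine Finset.sum_congr rfl fun a _ => ?_
    have h3 : op σ (fun w => if Commute w z then 0 else x w) = ∑ w ∈ s', x w • σ w := by
      rw [hs', Finset.sum_filter, op]
      refine Finset.sum_congr rfl fun w _ => ?_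
      by_cases hw : Commute w z <;> simp [hw]
    rw [h3, comp_sum']
    exact Finset.sum_congr rfl fun w _ => by rw [LinearMap.comp_smul]
  rw [h2]
  refine pz_free_sum (fun (g : H) (y : A × Γ) => ((g : Γ) • y.1, (g : Γ) * y.2 * (g : Γ)⁻¹))
    (by simp) (by
      intro g h y
      ext
      · simp [mul_smul]
      · simp [mul_assoc]) _ ?_ _ ?_ ?_
  · intro g y
    have e1 : ∀ f : W →ₗ[k] W, cj (res H σ) (res H σ) g f = cj σ σ (g : Γ) f := fun f => rfl
    have e2 : cj σ σ (g : Γ) (x y.2 • (op σ (EC a0 z E y.1) ∘ₗ σ y.2)) =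
        x y.2 • cj σ σ (g : Γ) (op σ (EC a0 z E y.1) ∘ₗ σ y.2) := by
      ext v; simp [cj_apply]
    rw [e1, e2, cj_comp (σ := σ), op_EC_cj hG hE, hx]
    congr 2
    ext v
    rw [cj_apply, ← rep_mul_apply, ← rep_mul_apply, mul_assoc]
  · intro g y hy
    rw [Finset.mem_product, hs, hs', Finset.mem_filter, Finset.mem_filter] at hy ⊢
    simp only [Finset.mem_univ, true_and, hG.fix_smul g.2, hG.comm_conj g.2] at hy ⊢
    exact hy
  · intro y hy g hg
    rw [Finset.mem_product, hs, hs', Finset.mem_filter, Finset.mem_filter] at hy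
    by_contra hc
    have e1 := congrArg Prod.fst hg
    have e2 := congrArg Prod.snd hg
    simp only at e1 e2
    apply hy.2.2
    obtain ⟨i, hi⟩ := hG.z_mem hy.1.2 e1 (fun h => hc (Subtype.ext h))
    simp only at hi
    rw [← hi]
    have : Commute y.2 (g : Γ) := by
      rw [mul_inv_eq_iff_eq_mul] at e2; exact e2.symm
    exact this.zpow_right i

/-- Comparison of two truncations on a representation. -/
lemma eta_sub_eta_pz {E' : A → Γ → k} (hE' : Dat E') :
    PZ (res H σ) (res H σ) (eta z E σ ∘ₗ op σ (tot E') - eta z E σ ∘ₗ eta z E' σ) := by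
  have h1 := eta_op_pz (σ := σ) hG hE (x := tot E') hE'.idem.conj
  convert h1 using 1
  rw [← LinearMap.comp_sub]
  congr 1
  ext v
  rw [LinearMap.sub_apply, eta, op_apply, op_apply, op_apply, ← Finset.sum_sub_distrib]
  refine Finset.sum_congr rfl fun w _ => ?_
  by_cases hw : Commute w z <;> simp [eC, hw]

end Trace

section Model

variable {k : Type} [Field k] {Γ A : Type} [Group Γ] [Fintype Γ] [Fintype A]

/-- A representation of `H` that is stably the truncation of the restriction of `σ`. -/
structure Model {T Z : Type} [AddCommGroup T] [Module k T] [AddCommGroup Z] [Module k Z]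
    (z : Γ) (H : Subgroup Γ) (E : A → Γ → k) (σ : Representation k Γ T)
    (ζ : Representation k H Z) (ι : Z →ₗ[k] T) (π : T →ₗ[k] Z) : Prop where
  eqv_i : Eqv ζ (res H σ) ι
  eqv_p : Eqv (res H σ) ζ π
  split : π ∘ₗ ι = LinearMap.id
  eta_i : eta z E σ ∘ₗ ι = ι
  p_eta : π ∘ₗ eta z E σ = π
  pz : PZ (res H σ) (res H σ) (eta z E σ - ι ∘ₗ π)
  ne : ¬ PZ ζ ζ LinearMap.id

variable [MulAction Γ A] {p : ℕ} [CharP k p] {a0 : A} {z : Γ} {H : Subgroup Γ} {E : A → Γ → k}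
variable {χ : H →* kˣ}
variable {T Z : Type} [AddCommGroup T] [Module k T] [FiniteDimensional k T]
  [AddCommGroup Z] [Module k Z] {σ : Representation k Γ T}

/-- Every irreducible representation that is not projective has a model. -/
theorem exists_model [IsAlgClosed k] (hG : Geo p a0 z H) (hE : Dat E)
    (hC : HasChains (eH z H E) χ) (hi : Irr σ) (hM : InMod (tot E) σ)
    (hn : ¬ PZ σ σ LinearMap.id) :
    ∃ (Z : Type) (_ : AddCommGroup Z) (_ : Module k Z) (_ : FiniteDimensional k Z)
      (ζ : Representation k H Z) (ι : Z →ₗ[k] T) (π : T →ₗ[k] Z),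
      Model z H E σ ζ ι π ∧ Labelled χ ζ := by
  have hη := hE.eta_eqv hG σ
  have hηη := hE.eta_eta hG σ
  have hηr := hη.codRestrict hη.range (fun v => LinearMap.mem_range_self _ v)
  set ηr := (eta z E σ).codRestrict (LinearMap.range (eta z E σ))
    (fun v => LinearMap.mem_range_self _ v) with hηr_def
  have hsub : ∀ y : LinearMap.range (eta z E σ), ηr (y : T) = y := by
    rintro ⟨_, v, rfl⟩
    exact Subtype.ext (hηη v)
  have hnY : ¬ PZ (subR (res H σ) hη.range) (subR (res H σ) hη.range) LinearMap.id := by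
    intro h
    apply hn
    refine pz_of_eta hG hE (Eqv.id σ) hM ?_
    have := (h.comp_left (eqv_subtype hη.range)).comp_right hηr
    convert this using 1
    ext v
    rfl
  have hMY : InMod (eH z H E) (subR (res H σ) hη.range) := by
    intro y
    apply Subtype.ext
    have h1 := (eqv_subtype hη.range).op (eH z H E) y
    rw [op_res (fun w => hG.comm_mem)] at h1
    obtain ⟨v, hv⟩ := y.2
    refine h1.trans ?_
    change eta z E σ (y : T) = y
    rw [← hv]
    exact hηη v
  obtain ⟨Z, _, _, _, ζ, ι₀, π₀, hι, hπ, hs, hne, hl⟩ :=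
    exists_labelled_summand hC _ _ _ le_rfl hMY hnY
  refine ⟨Z, _, _, inferInstance, ζ, (LinearMap.range (eta z E σ)).subtype ∘ₗ ι₀, π₀ ∘ₗ ηr, ?_, hl⟩
  have h1 := (eqv_subtype hη.range).comp hι
  have h2 := hπ.comp hηr
  have hsp : (π₀ ∘ₗ ηr) ∘ₗ (LinearMap.range (eta z E σ)).subtype ∘ₗ ι₀ = LinearMap.id := by
    ext v
    have := LinearMap.congr_fun hs v
    simp only [LinearMap.comp_apply, Submodule.subtype_apply, hsub]
    exact this
  have he1 : eta z E σ ∘ₗ (LinearMap.range (eta z E σ)).subtype ∘ₗ ι₀ =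
      (LinearMap.range (eta z E σ)).subtype ∘ₗ ι₀ := by
    ext v
    have := congrArg Subtype.val (hsub (ι₀ v))
    exact this
  have he2 : (π₀ ∘ₗ ηr) ∘ₗ eta z E σ = π₀ ∘ₗ ηr := by
    ext v
    simp only [LinearMap.comp_apply]
    congr 1
    exact Subtype.ext (hηη v)
  set ι := (LinearMap.range (eta z E σ)).subtype ∘ₗ ι₀ with hιdef
  set π := π₀ ∘ₗ ηr with hπdef
  refine ⟨h1, h2, hsp, he1, he2, ?_, hne⟩
  have hα := h1.comp h2
  obtain ⟨c, hc⟩ := hi.schur (tr_eqv hG hE hα)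
  have h3 := eta_tr_pz hG hE hα
  rw [hc, LinearMap.comp_smul, LinearMap.comp_id, ← LinearMap.comp_assoc, he1] at h3
  have hc1 : c = 1 := by
    by_contra hc1
    apply hne
    have h4 := ((h3.comp_left h2).comp_right h1).smul (c - 1)⁻¹
    convert h4 using 1
    have h5 : π ∘ₗ eta z E σ ∘ₗ ι = LinearMap.id := by rw [he1, hsp]
    ext v
    have h6 := LinearMap.congr_fun h5 v
    have h7 : ∀ v, π (ι v) = v := LinearMap.congr_fun hsp
    simp only [LinearMap.comp_apply, LinearMap.id_apply] at h6
    simp only [LinearMap.smul_apply, LinearMap.comp_apply, LinearMap.sub_apply, map_sub, map_smul,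
      h6, h7, LinearMap.id_apply]
    rw [show c • v - v = (c - 1) • v by rw [sub_smul, one_smul], smul_smul, inv_mul_cancel₀ (sub_ne_zero.2 hc1), one_smul]
  rwa [hc1, one_smul] at h3

end Model

section Orth

variable {k : Type} [Field k] {Γ A : Type} [Group Γ]

/-- An automorphism of a uniserial representation modulo stably zero maps is injective. -/
lemma Chain.injective_of_pz [Fintype Γ] {V Z : Type} [AddCommGroup V] [Module k V]
    [AddCommGroup Z] [Module k Z] [FiniteDimensional k Z] {χ : Γ →* kˣ}
    {ρ : Representation k Γ V} {t : Module.End k V} {l : ℕ} (C : Chain χ ρ t l)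
    {ζ : Representation k Γ Z} {a : ℤ} {m : ℕ} {q : V →ₗ[k] Z} (L : LabMap χ ρ t l ζ a m q)
    (hn : ¬ PZ ζ ζ LinearMap.id) {f : Z →ₗ[k] Z} (hf : PZ ζ ζ (f - LinearMap.id)) :
    Function.Injective f := by
  set g := f - LinearMap.id with hg
  have hfg : f = LinearMap.id + g := by rw [hg]; abel
  have hker : LinearMap.ker g ≠ ⊥ := by
    intro h
    apply hn
    have h1 := hf.eqv
    set φ := LinearEquiv.ofInjectiveEndo g (LinearMap.ker_eq_bot.1 h) with hφ
    have h2 : φ.toLinearMap = g := by ext; rfl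
    rw [← h2] at hf h1
    have := hf.comp_right h1.symm
    convert this using 1
    ext v
    simp
  have hfe : Eqv ζ ζ f := by rw [hfg]; exact (Eqv.id ζ).add hf.eqv
  have hdis : ∀ v, f v = 0 → g v = 0 → v = 0 := fun v h1 h2 => by
    have := LinearMap.congr_fun hfg v
    rw [h1, LinearMap.add_apply, h2, add_zero] at this
    exact this.symm
  have key := C.total (L.eqv.comap hfe.ker).of_tw (L.eqv.comap hf.eqv.ker).of_tw
  rw [← LinearMap.ker_eq_bot, Submodule.eq_bot_iff]
  intro v hv
  rcases key with h | h
  · obtain ⟨w, rfl⟩ := L.surj v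
    exact hdis _ hv (h hv)
  · exfalso
    apply hker
    rw [Submodule.eq_bot_iff]
    intro v hv
    obtain ⟨w, rfl⟩ := L.surj v
    exact hdis _ (h hv) hv

variable [MulAction Γ A] [Fintype Γ] [Fintype A]
variable {p : ℕ} [CharP k p] {a0 : A} {z : Γ} {H : Subgroup Γ} {E E' : A → Γ → k}
variable {χ : H →* kˣ}
variable {V T Z T' Z' : Type} [AddCommGroup V] [Module k V] [FiniteDimensional k V]
  [AddCommGroup T] [Module k T]
  [AddCommGroup Z] [Module k Z] {σ : Representation k Γ T} [AddCommGroup T'] [Module k T']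
  [AddCommGroup Z'] [Module k Z'] {σ' : Representation k Γ T'}
  {ζ : Representation k H Z} {ζ' : Representation k H Z'}
  {ι : Z →ₗ[k] T} {π : T →ₗ[k] Z} {ι' : Z' →ₗ[k] T'} {π' : T' →ₗ[k] Z'}

/-- Irreducible representations whose models overlap on a chain are isomorphic. -/
theorem Model.orth (hG : Geo p a0 z H) (hE : Dat E) (hE' : Dat E')
    (hi : Irr σ) (hi' : Irr σ') (hM' : InMod (tot E') σ')
    (D : Model z H E σ ζ ι π) (D' : Model z H E' σ' ζ' ι' π')
    {ρ : Representation k H V} {t : Module.End k V} {l : ℕ} (C : Chain χ ρ t l)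
    {c c' : ℤ} {n n' : ℕ} (L : Lab χ ρ t l ζ c n) (L' : Lab χ ρ t l ζ' c' n')
    (h1 : c' ≤ c) (h2 : c < c' + n') (h3 : c' + n' ≤ c + n) (h4 : c + n < c' + l) :
    (∃ φ : T ≃ₗ[k] T', Eqv σ σ' φ.toLinearMap) ∧ c = c' ∧ n = n' := by
  obtain ⟨q, L⟩ := L
  obtain ⟨q', L'⟩ := L'
  have : FiniteDimensional k Z := Module.Finite.of_surjective q L.surj
  have : FiniteDimensional k Z' := Module.Finite.of_surjective q' L'.surj
  obtain ⟨f, hf, hne, hsur, hinj⟩ := C.exists_not_pz L L' h1 h2 h3 h4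
  have hF₀ := (D'.eqv_i.comp hf).comp D.eqv_p
  have hF := tr_eqv hG hE' hF₀
  have hpz := eta_tr_pz hG hE' hF₀
  rw [show eta z E' σ' ∘ₗ (ι' ∘ₗ f) ∘ₗ π = (ι' ∘ₗ f) ∘ₗ π by
    rw [← LinearMap.comp_assoc, ← LinearMap.comp_assoc, D'.eta_i]] at hpz
  set F := tr z H E' σ σ' ((ι' ∘ₗ f) ∘ₗ π) with hFdef
  have hs := LinearMap.congr_fun D.split
  have hs' := LinearMap.congr_fun D'.split
  simp only [LinearMap.comp_apply, LinearMap.id_apply] at hs hs'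
  have hF0 : F ≠ 0 := by
    intro h
    rw [h, LinearMap.comp_zero, zero_sub] at hpz
    apply hne
    have := ((hpz.comp_left D'.eqv_p).comp_right D.eqv_i).smul (-1)
    convert this using 1
    ext v
    simp [hs, hs']
  obtain ⟨φ, hφ⟩ := hi.equiv hi' hF hF0
  have hφe : Eqv σ σ' φ.toLinearMap := by rw [hφ]; exact hF
  have hφs := hφe.symm
  have hM : InMod (tot E') σ := hM'.of_surj hφs φ.symm.surjective
  have hφF : ∀ v, F v = φ v := fun v => (LinearMap.congr_fun hφ v).symm
  have hsurj : Function.Surjective f := by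
    have k1 : PZ ζ' ζ' (f ∘ₗ π ∘ₗ φ.symm.toLinearMap ∘ₗ ι' - LinearMap.id) := by
      have := ((hpz.comp_left D'.eqv_p).comp_right ((hφs.res H).comp D'.eqv_i)).smul (-1)
      convert this using 1
      ext v
      have h5 := LinearMap.congr_fun D'.p_eta (ι' v)
      simp only [LinearMap.comp_apply] at h5
      simp [hs', hφF, h5]
    have k2 := C.injective_of_pz L' D'.ne k1
    have k3 := LinearMap.injective_iff_surjective.1 k2
    intro v
    obtain ⟨w, hw⟩ := k3 v
    exact ⟨_, hw⟩
  have hinjf : Function.Injective f := by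
    have k1 : PZ ζ ζ ((π ∘ₗ φ.symm.toLinearMap ∘ₗ ι') ∘ₗ f - LinearMap.id) := by
      have e1 := ((hpz.comp_left (D.eqv_p.comp (hφs.res H))).comp_right D.eqv_i).smul (-1)
      have e2 := (((eta_sub_eta_pz (σ := σ) hG hE hE').comp_left D.eqv_p).comp_right D.eqv_i).smul
        (-1)
      have := e1.add e2
      convert this using 1
      ext v
      have h5 := LinearMap.congr_fun D.p_eta
      simp only [LinearMap.comp_apply] at h5
      have h6 : eta z E' σ' (φ (ι v)) = φ (eta z E' σ (ι v)) := (eta_natural hφe _).symm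
      simp [hs, hφF, h5, hM _, h6]
    have k2 := C.injective_of_pz L D.ne k1
    exact Function.Injective.of_comp (f := π ∘ₗ φ.symm.toLinearMap ∘ₗ ι') k2
  exact ⟨⟨φ, hφe⟩, hsur hsurj, hinj hinjf (hsur hsurj)⟩

end Orth

section Coinduced

variable {k : Type} [Field k] {Γ A : Type} [Group Γ]
variable {X : Type} [AddCommGroup X] [Module k X] {H : Subgroup Γ}

/-- The space of the coinduced representation. -/
def coS (ξ : Representation k H X) : Submodule k (Γ → X) where
  carrier := {f | ∀ (h : H) (g : Γ), f (h * g) = ξ h (f g)}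
  add_mem' {f f'} hf hf' h g := by simp [hf h g, hf' h g]
  zero_mem' h g := by simp
  smul_mem' c f hf h g := by simp [hf h g]

/-- The coinduced representation. -/
def coR (ξ : Representation k H X) : Representation k Γ (coS ξ) where
  toFun γ :=
    { toFun := fun f => ⟨fun g => f.1 (g * γ), fun h g => by
        have := f.2 h (g * γ)
        rwa [← mul_assoc] at this⟩
      map_add' := fun _ _ => rfl
      map_smul' := fun _ _ => rfl }
  map_one' := by
    refine LinearMap.ext fun f => Subtype.ext (funext fun g => ?_)
    exact congrArg f.1 (mul_one g)
  map_mul' γ γ' := by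
    refine LinearMap.ext fun f => Subtype.ext (funext fun g => ?_)
    exact congrArg f.1 (mul_assoc g γ γ').symm

/-- The unit of coinduction. -/
def coI (ξ : Representation k H X) : X →ₗ[k] coS ξ where
  toFun x := ⟨fun g => if hg : g ∈ H then ξ ⟨g, hg⟩ x else 0, fun h g => by
    dsimp only
    by_cases hg : g ∈ H
    · have h1 : (h : Γ) * g ∈ H := H.mul_mem h.2 hg
      rw [dif_pos h1, dif_pos hg, ← rep_mul_apply]
      rfl
    · have h1 : ¬ (h : Γ) * g ∈ H := fun h1 => hg ((H.mul_mem_cancel_left h.2).1 h1)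
      rw [dif_neg h1, dif_neg hg, map_zero]⟩
  map_add' x y := by
    refine Subtype.ext (funext fun g => ?_)
    by_cases hg : g ∈ H <;> simp [hg]
  map_smul' c x := by
    refine Subtype.ext (funext fun g => ?_)
    by_cases hg : g ∈ H <;> simp [hg]

/-- Evaluation at the identity. -/
def coE (ξ : Representation k H X) : coS ξ →ₗ[k] X where
  toFun f := f.1 1
  map_add' _ _ := rfl
  map_smul' _ _ := rfl

lemma coE_coI (ξ : Representation k H X) : coE ξ ∘ₗ coI ξ = LinearMap.id := by
  ext x
  change (if hg : (1 : Γ) ∈ H then ξ ⟨1, hg⟩ x else 0) = x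
  rw [dif_pos H.one_mem]
  exact rep_one_apply ξ x

lemma coE_eqv (ξ : Representation k H X) : Eqv (res H (coR ξ)) ξ (coE ξ) := fun h f => by
  change f.1 (1 * h) = ξ h (f.1 1)
  rw [← f.2 h 1, mul_one, one_mul]

lemma coI_eqv (ξ : Representation k H X) : Eqv ξ (res H (coR ξ)) (coI ξ) := fun h x => by
  refine Subtype.ext (funext fun g => ?_)
  change (if hg : g ∈ H then ξ ⟨g, hg⟩ (ξ h x) else 0) =
    if hg : g * h ∈ H then ξ ⟨g * h, hg⟩ x else 0
  by_cases hg : g ∈ H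
  · have h1 : g * (h : Γ) ∈ H := H.mul_mem hg h.2
    rw [dif_pos h1, dif_pos hg, ← rep_mul_apply]
    rfl
  · have h1 : ¬ g * (h : Γ) ∈ H := fun h1 => hg ((H.mul_mem_cancel_right h.2).1 h1)
    rw [dif_neg h1, dif_neg hg]

variable [Fintype Γ] [MulAction Γ A] [Fintype A]
variable {p : ℕ} [CharP k p] {a0 : A} {z : Γ} {E : A → Γ → k}

lemma exists_irr_of_not_pz (hG : Geo p a0 z H) (hE : Dat E) (ξ : Representation k H X) (d : ℕ) :
    ∀ (W : Type) [AddCommGroup W] [Module k W] [FiniteDimensional k W] (ω : Representation k Γ W)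
      (f : X →ₗ[k] W), Module.finrank k W ≤ d → InMod (tot E) ω → Eqv ξ (res H ω) f →
      ¬ PZ ξ (res H ω) (eta z E ω ∘ₗ f) →
      ∃ (T : Type) (_ : AddCommGroup T) (_ : Module k T) (_ : FiniteDimensional k T)
        (τ : Representation k Γ T) (f : X →ₗ[k] T), Irr τ ∧ InMod (tot E) τ ∧
        Eqv ξ (res H τ) f ∧ ¬ PZ ξ (res H τ) (eta z E τ ∘ₗ f) := by
  induction d with
  | zero =>
    intro W _ _ _ ω f hd _ _ hn
    have : Subsingleton W := (Module.finrank_zero_iff (R := k)).1 (Nat.le_zero.1 hd)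
    exact absurd ⟨0, Subsingleton.elim _ _⟩ hn
  | succ d ih =>
    intro W _ _ _ ω f hd hM hf hn
    by_cases hi : Irr ω
    · exact ⟨W, _, _, inferInstance, ω, f, hi, hM, hf, hn⟩
    have hnt : Nontrivial W := by
      by_contra h
      rw [not_nontrivial_iff_subsingleton] at h
      exact hn ⟨0, Subsingleton.elim _ _⟩
    obtain ⟨Y, hY, hY0, hY1⟩ : ∃ Y, Inv ω Y ∧ Y ≠ ⊥ ∧ Y ≠ ⊤ := by
      by_contra! h
      refine hi ⟨hnt, fun Y hY => ?_⟩
      by_cases h0 : Y = ⊥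
      · exact Or.inl h0
      · exact Or.inr (h Y hY h0)
    have hm := eqv_mkQ hY
    by_cases hq : PZ ξ (res H (quoR ω hY)) (eta z E (quoR ω hY) ∘ₗ Y.mkQ ∘ₗ f)
    · have h1 : eta z E (quoR ω hY) ∘ₗ Y.mkQ ∘ₗ f = Y.mkQ ∘ₗ eta z E ω ∘ₗ f := by
        ext v
        exact (eta_natural hm (f v)).symm
      rw [h1] at hq
      obtain ⟨g, hg, hgq⟩ := hq.lift_surj (hm.res H) (Submodule.mkQ_surjective Y)
      have hD := ((hE.eta_eqv hG ω).comp hf).sub hg.eqv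
      have hmem : ∀ v, (eta z E ω ∘ₗ f - g) v ∈ Y := fun v => by
        rw [← Submodule.ker_mkQ Y, LinearMap.mem_ker]
        have := LinearMap.congr_fun hgq v
        simp only [LinearMap.comp_apply] at this
        rw [LinearMap.sub_apply, map_sub, this, LinearMap.comp_apply, sub_self]
      have hYH : Inv (res H ω) Y := fun h v hv => hY h v hv
      have hc : Eqv ξ (res H (subR ω hY)) ((eta z E ω ∘ₗ f - g).codRestrict Y hmem) :=
        hD.codRestrict hYH hmem
      refine ih Y (subR ω hY) _ ?_ (hM.sub hY) hc ?_
      · have := Submodule.finrank_lt hY1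
        omega
      · intro hp
        apply hn
        have e1 := hp.comp_left ((eqv_subtype hY).res H)
        have e2 := e1.add (hg.comp_left (hE.eta_eqv hG ω))
        convert e2 using 1
        ext v
        have e3 := eta_natural (z := z) (E := E) (eqv_subtype hY)
          ((eta z E ω ∘ₗ f - g).codRestrict Y hmem v)
        rw [LinearMap.add_apply, LinearMap.comp_apply, LinearMap.comp_apply, LinearMap.comp_apply,
          LinearMap.comp_apply, e3]
        change _ = eta z E ω ((eta z E ω ∘ₗ f - g) v) + _
        rw [LinearMap.sub_apply, map_sub, LinearMap.comp_apply, hE.eta_eta hG, sub_add_cancel]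
    · refine ih (W ⧸ Y) (quoR ω hY) (Y.mkQ ∘ₗ f) ?_ (hM.quo hY) ((hm.res H).comp hf) hq
      have h1 := Submodule.finrank_quotient_add_finrank Y
      have h2 : 0 < Module.finrank k Y := by
        rw [Module.finrank_pos_iff]
        exact Submodule.nontrivial_iff_ne_bot.2 hY0
      omega

/-- A representation of `H` that is not projective maps nontrivially to an irreducible
representation of the large group. -/
theorem exists_irr_map (hG : Geo p a0 z H) (hE : Dat E) [FiniteDimensional k X]
    {ξ : Representation k H X} (hM : InMod (eH z H E) ξ) (hn : ¬ PZ ξ ξ LinearMap.id) :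
    ∃ (T : Type) (_ : AddCommGroup T) (_ : Module k T) (_ : FiniteDimensional k T)
      (τ : Representation k Γ T) (f : X →ₗ[k] T), Irr τ ∧ InMod (tot E) τ ∧
      Eqv ξ (res H τ) f ∧ ¬ PZ ξ (res H τ) (eta z E τ ∘ₗ f) := by
  have hν := hE.idem.eqv (coR ξ)
  have hνr := hν.codRestrict hν.range (fun v => LinearMap.mem_range_self _ v)
  have hηi : ∀ x, eta z E (coR ξ) (coI ξ x) = coI ξ x := fun x => by
    have := (coI_eqv ξ).op (eH z H E) x
    rw [hM x, op_res (fun w => hG.comm_mem)] at this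
    exact this.symm
  refine exists_irr_of_not_pz hG hE ξ _ (LinearMap.range (op (coR ξ) (tot E)))
    (subR (coR ξ) hν.range)
    ((op (coR ξ) (tot E)).codRestrict _ (fun v => LinearMap.mem_range_self _ v) ∘ₗ coI ξ) le_rfl ?_
    ((hνr.res H).comp (coI_eqv ξ)) ?_
  · intro y
    apply Subtype.ext
    have h1 := (eqv_subtype hν.range).op (tot E) y
    obtain ⟨v, hv⟩ := y.2
    refine h1.trans ?_
    change op (coR ξ) (tot E) (y : coS ξ) = y
    rw [← hv]
    exact hE.idem.op_op _ v
  · intro h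
    apply hn
    have e1 := h.comp_left ((eqv_subtype hν.range).res H)
    have e2 := (eta_sub_eta_pz (σ := coR ξ) hG hE hE).comp_right (coI_eqv ξ)
    have e3 := (e1.sub e2).comp_left (coE_eqv ξ)
    rw [← coE_coI ξ]
    convert e3 using 1
    ext x
    have e4 := eta_natural (z := z) (E := E) (eqv_subtype hν.range)
      ((op (coR ξ) (tot E)).codRestrict _ (fun v => LinearMap.mem_range_self _ v) (coI ξ x))
    simp only [LinearMap.comp_apply, LinearMap.sub_apply]
    rw [e4]
    change _ = coE ξ (eta z E (coR ξ) (op (coR ξ) (tot E) (coI ξ x)) - _)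
    rw [sub_sub_cancel, hηi, hηi]

end Coinduced

section NoExt

variable {k : Type} [Field k] {Γ : Type} [Group Γ]
variable {M S T : Type} [AddCommGroup M] [Module k M] [AddCommGroup S] [Module k S]
  [AddCommGroup T] [Module k T]
variable {ρ : Representation k Γ M} {σ : Representation k Γ S} {τ : Representation k Γ T}
  {q : M →ₗ[k] S} {r : M →ₗ[k] T}

/-- The restriction of `r` to the kernel of `q` is an intertwiner. -/
lemma Ext.eqv_sub (hq : Loc ρ σ q) (hr : Ext ρ τ q r) :
    Eqv (subR ρ hq.eqv.ker) τ (r ∘ₗ (LinearMap.ker q).subtype) := fun g v => hr.eqv g v.1 v.2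

lemma Ext.sub_surj (hq : Loc ρ σ q) (hr : Ext ρ τ q r) :
    Function.Surjective (r ∘ₗ (LinearMap.ker q).subtype) := by
  refine hr.irr.surjective (hr.eqv_sub hq) fun h => ?_
  obtain ⟨v, hv, hne⟩ := hr.ne
  exact hne (LinearMap.congr_fun h ⟨v, hv⟩)

lemma Ext.inMod [Fintype Γ] {e : Γ → k} (hq : Loc ρ σ q) (hr : Ext ρ τ q r) (hM : InMod e ρ) :
    InMod e τ := (hM.sub hq.eqv.ker).of_surj (hr.eqv_sub hq) (hr.sub_surj hq)

lemma Ext.op [Fintype Γ] (hr : Ext ρ τ q r) (x : Γ → k) {v : M} (hq : Loc ρ σ q)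
    (hv : v ∈ LinearMap.ker q) : r (op ρ x v) = CyclicBlock.op τ x (r v) := by
  have h1 := (eqv_subtype hq.eqv.ker).op x ⟨v, hv⟩
  have h2 := (hr.eqv_sub hq).op x ⟨v, hv⟩
  simp only [LinearMap.comp_apply] at h2
  rw [h1] at h2
  exact h2

/-- The restriction of `r` to the kernel of `q` does not extend to an intertwiner. -/
lemma Ext.no_extension (hq : Loc ρ σ q) (hr : Ext ρ τ q r) {y : M →ₗ[k] T} (hy : Eqv ρ τ y)
    (h : ∀ v ∈ LinearMap.ker q, y v = r v) : False := by
  have hS := hq.irr.1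
  have h1 : LinearMap.ker y ≠ ⊤ := fun h1 => by
    obtain ⟨v, hv, hne⟩ := hr.ne
    rw [← h v hv] at hne
    exact hne (LinearMap.mem_ker.1 (h1 ▸ Submodule.mem_top))
  have h2 := hq.le_ker _ hy.ker h1
  obtain ⟨s, hs⟩ := exists_ne (0 : S)
  obtain ⟨m, rfl⟩ := hq.surj s
  obtain ⟨v, hv⟩ := hr.sub_surj hq (y m)
  have h3 : m - v ∈ LinearMap.ker y := by
    rw [LinearMap.mem_ker, map_sub, h v v.2, sub_eq_zero, ← hv]
    rfl
  have h4 := Submodule.add_mem _ (h2 h3) v.2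
  rw [sub_add_cancel] at h4
  exact hs h4

variable [Fintype Γ]

lemma Ext.not_pz_right (hq : Loc ρ σ q) (hr : Ext ρ τ q r) : ¬ PZ τ τ LinearMap.id := fun h => by
  obtain ⟨y, hy, h1⟩ := (h.of_id_right (hr.eqv_sub hq)).extend (eqv_subtype hq.eqv.ker)
    Subtype.val_injective
  exact hr.no_extension hq hy.eqv fun v hv => LinearMap.congr_fun h1 ⟨v, hv⟩

lemma Ext.not_pz_left (hq : Loc ρ σ q) (hr : Ext ρ τ q r) : ¬ PZ σ σ LinearMap.id := fun h => by
  have hS := hq.irr.1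
  obtain ⟨s, hs, hqs⟩ := h.proj_lift (Eqv.id σ) hq.eqv (by rw [LinearMap.range_eq_top.2 hq.surj]; exact le_top)
  have hqs' := LinearMap.congr_fun hqs
  simp only [LinearMap.comp_apply, LinearMap.id_apply] at hqs'
  by_cases ht : LinearMap.range s = ⊤
  · obtain ⟨v, hv, hne⟩ := hr.ne
    obtain ⟨w, rfl⟩ := LinearMap.range_eq_top.1 ht v
    rw [LinearMap.mem_ker, hqs'] at hv
    rw [hv, map_zero, map_zero] at hne
    exact hne rfl
  · obtain ⟨w, hw⟩ := exists_ne (0 : S)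
    have := hq.le_ker _ hs.range ht ⟨w, rfl⟩
    rw [LinearMap.mem_ker, hqs'] at this
    exact hw this

end NoExt

section Cocycle

variable {k : Type} [Field k] {Γ : Type} [Group Γ] [Fintype Γ]
variable {M S T : Type} [AddCommGroup M] [Module k M] [AddCommGroup S] [Module k S]
  [AddCommGroup T] [Module k T]
variable {ρ : Representation k Γ M} {σ : Representation k Γ S} {τ : Representation k Γ T}

/-- A linear map whose defect of equivariance factors through `q` as a coboundary up to an
average can be corrected to an intertwiner. -/
lemma exists_eqv_correction {q : M →ₗ[k] S} (hqs : Function.Surjective q) (hq : Eqv ρ σ q)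
    {r : M →ₗ[k] T} {D : Γ → S →ₗ[k] T} (hD : ∀ h, D h ∘ₗ q = cj ρ τ h r - r)
    {u₀ : S →ₗ[k] T} {θ : S →ₗ[k] S}
    (hθ : ∀ h, D h = cj σ τ h u₀ - u₀ + D h ∘ₗ avg σ σ θ) :
    ∃ U : S →ₗ[k] T, Eqv ρ τ (r - U ∘ₗ q) := by
  have hcq : ∀ h (f : S →ₗ[k] T), cj ρ τ h (f ∘ₗ q) = cj σ τ h f ∘ₗ q := fun h f => by
    rw [cj_comp (σ := σ), cj_of_eqv hq]
  have hsub : ∀ h (f f' : M →ₗ[k] T), cj ρ τ h (f - f') = cj ρ τ h f - cj ρ τ h f' :=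
    fun h f f' => by ext v; simp [cj_apply]
  have hsub' : ∀ h (f f' : S →ₗ[k] T), cj σ τ h (f - f') = cj σ τ h f - cj σ τ h f' :=
    fun h f f' => by ext v; simp [cj_apply]
  have hcoc : ∀ h g, cj σ τ h (D g) = D (h * g) - D h := fun h g => by
    rw [← LinearMap.cancel_right hqs, LinearMap.sub_comp, hD, hD, ← hcq, hD, hsub, cj_mul]
    abel
  have havg : avg σ σ θ = ∑ g, cj σ σ g θ := rfl
  set u : S →ₗ[k] T := ∑ g, D g ∘ₗ cj σ σ g θ with hu
  have hcu : ∀ h, cj σ τ h u = u - D h ∘ₗ avg σ σ θ := fun h => by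
    rw [hu, cj_sum, havg, comp_sum', ← Equiv.sum_comp (Equiv.mulLeft h) (fun g => D g ∘ₗ cj σ σ g θ),
      ← Equiv.sum_comp (Equiv.mulLeft h) (fun g => D h ∘ₗ cj σ σ g θ), ← Finset.sum_sub_distrib]
    refine Finset.sum_congr rfl fun g _ => ?_
    rw [cj_comp (σ := σ), hcoc, ← cj_mul, LinearMap.sub_comp]
    rfl
  refine ⟨u₀ - u, eqv_of_cj fun h => ?_⟩
  rw [hsub, hcq, hsub', hcu]
  have h1 := hD h
  have h2 := hθ h
  rw [show cj σ τ h u₀ - (u - D h ∘ₗ avg σ σ θ) =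
    (u₀ - u) + (cj σ τ h u₀ - u₀ + D h ∘ₗ avg σ σ θ) by abel, ← h2, LinearMap.add_comp, h1]
  abel

end Cocycle

section ExtChain

variable {k : Type} [Field k] {Γ A : Type} [Group Γ] [MulAction Γ A] [Fintype Γ] [Fintype A]
variable {p : ℕ} [CharP k p] {a0 : A} {z : Γ} {H : Subgroup Γ} {E : A → Γ → k}
variable {χ : H →* kˣ}
variable {M S T V Z Z' : Type} [AddCommGroup M] [Module k M] [AddCommGroup S] [Module k S]
  [AddCommGroup T] [Module k T] [AddCommGroup V] [Module k V] [AddCommGroup Z] [Module k Z]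
  [AddCommGroup Z'] [Module k Z']
variable {ρ : Representation k Γ M} {σ : Representation k Γ S} {τ : Representation k Γ T}
  {q : M →ₗ[k] S} {r : M →ₗ[k] T}
  {ζ : Representation k H Z} {ζ' : Representation k H Z'}
  {ι : Z →ₗ[k] S} {π : S →ₗ[k] Z} {ι' : Z' →ₗ[k] T} {π' : T →ₗ[k] Z'}

/-- A nonsplit extension gives a map on the chain that does not extend. -/
lemma Ext.not_extend (hG : Geo p a0 z H) (hE : Dat E) (hM : InMod (tot E) ρ) (hq : Loc ρ σ q)
    (hr : Ext ρ τ q r) (D : Model z H E σ ζ ι π) (D' : Model z H E τ ζ' ι' π')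
    {κ : Representation k H V} {qZ : V →ₗ[k] Z} (hZs : Function.Surjective qZ) (hZ : Eqv κ ζ qZ)
    {w : V →ₗ[k] M} (hw : Eqv κ (res H ρ) w) (hqw : q ∘ₗ w = ι ∘ₗ qZ) {x : V →ₗ[k] Z'}
    (hx : Eqv κ ζ' x) (hxr : ∀ v ∈ LinearMap.ker qZ, x v = π' (r (w v))) : False := by
  have hη := hE.eta_eqv hG ρ
  have hηη := hE.eta_eta hG ρ
  have hqη : ∀ v, q (eta z E ρ v) = eta z E σ (q v) := eta_natural hq.eqv
  set r' := π' ∘ₗ r ∘ₗ eta z E ρ with hr'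
  have hr'K : ∀ v ∈ LinearMap.ker q, r' v = π' (r v) := fun v hv => by
    rw [hr', LinearMap.comp_apply, LinearMap.comp_apply]
    have h1 : r (eta z E ρ v) = eta z E τ (r v) := hr.op _ hq hv
    rw [h1]
    exact LinearMap.congr_fun D'.p_eta (r v)
  have hqw' := LinearMap.congr_fun hqw
  simp only [LinearMap.comp_apply] at hqw'
  have hwK : ∀ v ∈ LinearMap.ker qZ, w v ∈ LinearMap.ker q := fun v hv => by
    rw [LinearMap.mem_ker, hqw', LinearMap.mem_ker.1 hv, map_zero]
  obtain ⟨u₀, hu₀⟩ := exists_factor hZs (f := r' ∘ₗ w - x) (fun v hv => by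
    rw [LinearMap.mem_ker, LinearMap.sub_apply, LinearMap.comp_apply, hr'K _ (hwK v hv),
      hxr v hv, sub_self])
  have hDex : ∀ h : H, ∃ f : S →ₗ[k] Z', f ∘ₗ q = cj (res H ρ) ζ' h r' - r' := fun h => by
    apply exists_factor hq.surj
    intro v hv
    have hv' : res H ρ h⁻¹ v ∈ LinearMap.ker q := hq.eqv.ker _ _ hv
    rw [LinearMap.mem_ker, LinearMap.sub_apply, cj_apply, hr'K _ hv, hr'K _ hv', res_apply,
      hr.eqv _ _ hv, ← res_apply, D'.eqv_p, rep_apply_inv, sub_self]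
  choose Df hDf using hDex
  obtain ⟨θ, hθ⟩ := D.pz
  have hDη : ∀ h, Df h ∘ₗ eta z E σ = Df h := fun h => by
    rw [← LinearMap.cancel_right hq.surj]
    have h1 : (Df h ∘ₗ eta z E σ) ∘ₗ q = (Df h ∘ₗ q) ∘ₗ eta z E ρ := by
      ext v
      simp only [LinearMap.comp_apply, hqη]
    rw [h1, hDf]
    ext v
    simp only [LinearMap.comp_apply, LinearMap.sub_apply, cj_apply]
    rw [← hη]
    simp only [hr', LinearMap.comp_apply, hηη]
  have hDι : ∀ h, Df h ∘ₗ ι = cj ζ ζ' h u₀ - u₀ := fun h => by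
    rw [← LinearMap.cancel_right hZs, LinearMap.comp_assoc, ← hqw, ← LinearMap.comp_assoc, hDf,
      LinearMap.sub_comp, LinearMap.sub_comp]
    have h1 : cj ζ ζ' h u₀ ∘ₗ qZ = cj κ ζ' h (u₀ ∘ₗ qZ) := by
      rw [cj_comp (σ := ζ), cj_of_eqv hZ]
    have h2 : cj (res H ρ) ζ' h r' ∘ₗ w = cj κ ζ' h (r' ∘ₗ w) := by
      rw [cj_comp (σ := res H ρ), cj_of_eqv hw]
    have h3 : cj κ ζ' h (r' ∘ₗ w - x) = cj κ ζ' h (r' ∘ₗ w) - x := by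
      conv_rhs => rw [← cj_of_eqv hx h]
      ext v; simp [cj_apply]
    rw [h1, h2, hu₀, h3]
    abel
  obtain ⟨U, hU⟩ := exists_eqv_correction (ρ := res H ρ) (σ := res H σ) (τ := ζ') hq.surj
    (hq.eqv.res H) hDf (u₀ := u₀ ∘ₗ π) (θ := θ) (fun h => by
      have h1 : cj (res H σ) ζ' h (u₀ ∘ₗ π) = cj ζ ζ' h u₀ ∘ₗ π := by
        rw [cj_comp (σ := ζ), cj_of_eqv D.eqv_p]
      rw [h1, ← LinearMap.sub_comp, ← hDι, ← hθ, LinearMap.comp_sub, hDη, LinearMap.comp_assoc]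
      abel)
  set y₁ := r' - U ∘ₗ q with hy₁
  have hy₁K : ∀ v ∈ LinearMap.ker q, y₁ v = π' (r v) := fun v hv => by
    have h1 : (U ∘ₗ q) v = 0 := by
      rw [LinearMap.comp_apply, LinearMap.mem_ker.1 hv, map_zero]
    rw [hy₁, LinearMap.sub_apply, h1, sub_zero, hr'K v hv]
  have hK := eqv_subtype hq.eqv.ker
  have hrK := hr.eqv_sub hq
  obtain ⟨g₀, hg₀, hg₀K⟩ := (D'.pz.comp_right (hrK.res H)).extend (hK.res H)
    Subtype.val_injective
  have hg : Eqv (res H ρ) (res H τ) (ι' ∘ₗ y₁ + g₀) := (D'.eqv_i.comp hU).add hg₀.eqv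
  have hgK : (ι' ∘ₗ y₁ + g₀) ∘ₗ (LinearMap.ker q).subtype =
      eta z E τ ∘ₗ (r ∘ₗ (LinearMap.ker q).subtype) := by
    rw [LinearMap.add_comp, hg₀K]
    ext v
    simp [hy₁K v v.2]
  obtain ⟨g₁, hg₁, hg₁K⟩ := (tr_sub_pz hG hE hrK (hr.inMod hq hM)).extend hK
    Subtype.val_injective
  refine hr.no_extension hq ((tr_eqv hG hE hg).sub hg₁.eqv) fun v hv => ?_
  have h1 := tr_comp (z := z) (H := H) (E := E) (σ := τ) (h := ι' ∘ₗ y₁ + g₀) hK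
  rw [hgK, tr_eta hG hE] at h1
  have h2 := LinearMap.congr_fun h1 ⟨v, hv⟩
  have h3 := LinearMap.congr_fun hg₁K ⟨v, hv⟩
  rw [LinearMap.sub_apply]
  change tr z H E ρ τ (ι' ∘ₗ y₁ + g₀) v = _ at h2
  change g₁ v = _ at h3
  rw [h2, h3, LinearMap.sub_apply, sub_sub_cancel]
  rfl

end ExtChain

section LabTwo

variable {k : Type} [Field k] {Γ : Type} [Group Γ] [Fintype Γ]
variable {V V₂ Z : Type} [AddCommGroup V] [Module k V] [AddCommGroup V₂] [Module k V₂]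
  [AddCommGroup Z] [Module k Z]
variable {χ : Γ →* kˣ} {ρ : Representation k Γ V} {t : Module.End k V} {l : ℕ}
  {ρ₂ : Representation k Γ V₂} {t₂ : Module.End k V₂} {l₂ : ℕ} {ζ : Representation k Γ Z}

/-- Two maps from a submodule of a chain that are independent modulo extendable maps produce two
labels. -/
theorem Chain.lab_two_of_not_extend [IsAlgClosed k] [FiniteDimensional k V]
    [FiniteDimensional k V₂] [FiniteDimensional k Z]
    (C : Chain χ ρ t l) (C₂ : Chain χ ρ₂ t₂ l₂) {b : ℤ} {m : ℕ} {q : V₂ →ₗ[k] Z}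
    (L : LabMap χ ρ₂ t₂ l₂ ζ b m q) {j n : ℕ} {f₁ f₂ : V →ₗ[k] Z}
    (hf₁ : Eqv (tw (χ ^ (j : ℤ)) ρ) ζ f₁) (hfn₁ : f₁ ∘ₗ (t ^ n) = 0)
    (hf₂ : Eqv (tw (χ ^ (j : ℤ)) ρ) ζ f₂) (hfn₂ : f₂ ∘ₗ (t ^ n) = 0)
    (hne₁ : ∀ x : V →ₗ[k] Z, Eqv ρ ζ x → x ∘ₗ (t ^ j) ≠ f₁)
    (hne₂ : ∀ (c : k) (x : V →ₗ[k] Z), Eqv ρ ζ x → x ∘ₗ (t ^ j) ≠ f₂ - c • f₁) :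
    ∃ c c' : ℤ, c ≠ c' ∧ (Lab χ ρ t l ζ c m ∧ 0 < c ∧ c ≤ j ∧ j < c + m ∧ c + m ≤ j + n) ∧
      (Lab χ ρ t l ζ c' m ∧ 0 < c' ∧ c' ≤ j ∧ j < c' + m ∧ c' + m ≤ j + n) := by
  let 𝒮 : Submodule k (V →ₗ[k] Z) :=
    { carrier := {s | ∃ x, Eqv ρ ζ x ∧ x ∘ₗ (t ^ (j + n)) = 0 ∧ x ∘ₗ (t ^ j) = s}
      add_mem' := by
        rintro _ _ ⟨x, h1, h2, rfl⟩ ⟨x', h1', h2', rfl⟩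
        exact ⟨x + x', h1.add h1', by rw [LinearMap.add_comp, h2, h2', add_zero],
          LinearMap.add_comp _ _ _⟩
      zero_mem' := ⟨0, Eqv.zero, LinearMap.zero_comp _, LinearMap.zero_comp _⟩
      smul_mem' := by
        rintro c _ ⟨x, h1, h2, rfl⟩
        exact ⟨c • x, h1.smul c, by rw [LinearMap.smul_comp, h2, smul_zero],
          LinearMap.smul_comp _ _ _⟩ }
  have hS : ∀ s ∈ 𝒮, Eqv (tw (χ ^ (j : ℤ)) ρ) ζ s := by
    rintro _ ⟨x, h1, -, rfl⟩
    exact h1.comp (C.pow_eqv' j)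
  have hSn : ∀ s ∈ 𝒮, s ∘ₗ (t ^ n) = 0 := by
    rintro _ ⟨x, -, h2, rfl⟩
    rw [LinearMap.comp_assoc, ← Module.End.mul_eq_comp, ← pow_add, h2]
  obtain ⟨f₁', hf₁', hsep, i, hi, hri, hmn, q', L', hr⟩ := C.core C₂ L (a := j) (n := n) 𝒮 hS hSn
    hf₁ hfn₁ (by rintro ⟨x, h1, h2, h3⟩; exact hne₁ x h1 h3)
  obtain ⟨f₂', -, hsep₂, i₂, hi₂, hri₂, hmn₂, q₂', L₂', hr₂⟩ :=
    C.core C₂ L (a := j) (n := n) (𝒮 ⊔ k ∙ f₁) (by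
      intro s hs
      obtain ⟨a, ha, b, hb, rfl⟩ := Submodule.mem_sup.1 hs
      obtain ⟨c, rfl⟩ := Submodule.mem_span_singleton.1 hb
      exact (hS a ha).add (hf₁.smul c)) (by
      intro s hs
      obtain ⟨a, ha, b, hb, rfl⟩ := Submodule.mem_sup.1 hs
      obtain ⟨c, rfl⟩ := Submodule.mem_span_singleton.1 hb
      rw [LinearMap.add_comp, hSn a ha, LinearMap.smul_comp, hfn₁, smul_zero, add_zero])
    hf₂ hfn₂ (by
      intro hs
      obtain ⟨a, ⟨x, h1, h2, h3⟩, b, hb, hab⟩ := Submodule.mem_sup.1 hs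
      obtain ⟨c, rfl⟩ := Submodule.mem_span_singleton.1 hb
      exact hne₂ c x h1 (by rw [h3, ← hab, add_sub_cancel_right]))
  have hpos : ∀ (i : ℕ) (q' : V →ₗ[k] Z), LabMap χ ρ t l ζ ((j : ℤ) - i) m q' → m ≤ i + n →
      j ≤ i → ∃ s ∈ 𝒮, LinearMap.range s = LinearMap.range (q' ∘ₗ (t ^ i)) := by
    intro i q' L' hmn hij
    refine ⟨q' ∘ₗ (t ^ i), ⟨q' ∘ₗ (t ^ (i - j)), ?_, ?_, ?_⟩, rfl⟩
    · have := L'.eqv.comp (C.pow_eqv ((j : ℤ) - i) (i - j))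
      rw [show (j : ℤ) - i + ((i - j : ℕ) : ℤ) = 0 by omega, tw_zpow_zero] at this
      exact this
    · rw [LinearMap.comp_assoc, ← Module.End.mul_eq_comp, ← pow_add]
      exact L'.comp_pow_eq_zero (by omega)
    · rw [LinearMap.comp_assoc, ← Module.End.mul_eq_comp, ← pow_add, show i - j + j = i by omega]
  refine ⟨(j : ℤ) - i, (j : ℤ) - i₂, ?_, ⟨⟨q', L'⟩, ?_, by omega, by omega, by omega⟩,
    ⟨⟨q₂', L₂'⟩, ?_, by omega, by omega, by omega⟩⟩
  · intro h
    obtain rfl : i = i₂ := by omega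
    refine hsep₂ f₁' ?_ (hri.trans hri₂.symm)
    have h2 := Submodule.add_mem _ (Submodule.mem_sup_left (T := k ∙ f₁) hf₁')
      (Submodule.mem_sup_right (S := 𝒮) (Submodule.mem_span_singleton_self f₁))
    rwa [sub_add_cancel] at h2
  · by_contra! hc
    obtain ⟨s, hs, hs'⟩ := hpos i q' L' hmn (by omega)
    exact hsep s hs (hs'.trans hr.symm)
  · by_contra! hc
    obtain ⟨s, hs, hs'⟩ := hpos i₂ q₂' L₂' hmn₂ (by omega)
    exact hsep₂ s (Submodule.mem_sup_left hs) (hs'.trans hr₂.symm)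

end LabTwo

section Good

variable {k : Type} [Field k] {Γ A : Type} [Group Γ] [MulAction Γ A] [Fintype Γ] [Fintype A]
variable {p : ℕ} [CharP k p] {a0 : A} {z : Γ} {H : Subgroup Γ} {E E' : A → Γ → k}
variable {χ : H →* kˣ}
variable {M S T T' V : Type} [AddCommGroup M] [Module k M] [AddCommGroup S] [Module k S]
  [AddCommGroup T] [Module k T] [AddCommGroup T'] [Module k T'] [AddCommGroup V] [Module k V]
variable {ρ : Representation k Γ M} {σ : Representation k Γ S} {τ : Representation k Γ T}
  {τ' : Representation k Γ T'} {q : M →ₗ[k] S} {r r₁ r₂ : M →ₗ[k] T}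
  {κ : Representation k H V} {t : Module.End k V} {l : ℕ}

/-- An irreducible representation whose model has the label `(c, m)` on a chain. -/
def Good (z : Γ) (H : Subgroup Γ) (E : A → Γ → k) (χ : H →* kˣ) (κ : Representation k H V)
    (t : Module.End k V) (l : ℕ) (τ : Representation k Γ T) (c : ℤ) (m : ℕ) : Prop :=
  Irr τ ∧ InMod (tot E) τ ∧ ∃ (Z : Type) (_ : AddCommGroup Z) (_ : Module k Z)
    (_ : FiniteDimensional k Z) (ζ : Representation k H Z) (ι : Z →ₗ[k] T) (π : T →ₗ[k] Z),
    Model z H E τ ζ ι π ∧ Lab χ κ t l ζ c m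

lemma Good.orth [FiniteDimensional k V] (hG : Geo p a0 z H) (hE : Dat E) (hE' : Dat E')
    (C : Chain χ κ t l) {c c' : ℤ} {n n' : ℕ} (L : Good z H E χ κ t l τ c n)
    (L' : Good z H E' χ κ t l τ' c' n')
    (h1 : c' ≤ c) (h2 : c < c' + n') (h3 : c' + n' ≤ c + n) (h4 : c + n < c' + l) :
    (∃ φ : T ≃ₗ[k] T', Eqv τ τ' φ.toLinearMap) ∧ c = c' ∧ n = n' := by
  obtain ⟨hi, hM, Z, _, _, _, ζ, ι, π, D, L⟩ := L
  obtain ⟨hi', hM', Z', _, _, _, ζ', ι', π', D', L'⟩ := L'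
  exact Model.orth hG hE hE' hi hi' hM' D D' C L L' h1 h2 h3 h4

lemma exists_head [IsAlgClosed k] [FiniteDimensional k S] (hG : Geo p a0 z H) (hE : Dat E)
    (hC : HasChains (eH z H E) χ) (hi : Irr σ) (hM : InMod (tot E) σ)
    (hn : ¬ PZ σ σ LinearMap.id) :
    ∃ (V : Type) (_ : AddCommGroup V) (_ : Module k V) (_ : FiniteDimensional k V)
      (κ : Representation k H V) (t : Module.End k V) (l n : ℕ), Chain χ κ t l ∧
      Good z H E χ κ t l σ 0 n := by
  obtain ⟨Z, _, _, _, ζ, ι, π, D, V, _, _, _, κ, t, l, n, C, L⟩ := exists_model hG hE hC hi hM hn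
  exact ⟨V, _, _, inferInstance, κ, t, l, n, C, hi, hM, Z, _, _, inferInstance, ζ, ι, π, D, L⟩

omit [MulAction Γ A] in
lemma Good.bounds {c : ℤ} {n : ℕ} (L : Good z H E χ κ t l τ c n) : 1 ≤ n ∧ n ≤ l := by
  obtain ⟨hi, hM, Z, _, _, _, ζ, ι, π, D, q, L⟩ := L
  exact ⟨L.one_le, L.le⟩

omit [MulAction Γ A] in
lemma InMod.ker_right (hM : InMod (tot E) ρ) (hq : Loc ρ σ q) (hr : Ext ρ τ q r) :
    InMod (tot E) τ :=
  hr.inMod hq hM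

section Lift

variable {Z Z' : Type} [AddCommGroup Z] [Module k Z] [AddCommGroup Z'] [Module k Z']
  {ζ : Representation k H Z} {ζ' : Representation k H Z'}
  {ι : Z →ₗ[k] S} {π : S →ₗ[k] Z} {ι' : Z' →ₗ[k] T} {π' : T →ₗ[k] Z'}

omit [MulAction Γ A] in
lemma exists_chain_lift (hq : Loc ρ σ q) (D : Model z H E σ ζ ι π) (C : Chain χ κ t l) {n : ℕ}
    {qZ : V →ₗ[k] Z} (L : LabMap χ κ t l ζ 0 n qZ) :
    ∃ w : V →ₗ[k] M, Eqv κ (res H ρ) w ∧ q ∘ₗ w = ι ∘ₗ qZ := by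
  have hZ := L.eqv
  rw [tw_zpow_zero] at hZ
  obtain ⟨w, hw, h⟩ := C.proj.proj_lift (D.eqv_i.comp hZ) (hq.eqv.res H)
    (by rw [LinearMap.range_eq_top.2 hq.surj]; exact le_top)
  exact ⟨w, hw, h⟩

lemma Ext.chain_map (hG : Geo p a0 z H) (hE : Dat E) (hM : InMod (tot E) ρ) (hq : Loc ρ σ q)
    (hr : Ext ρ τ q r) (D : Model z H E σ ζ ι π) (D' : Model z H E τ ζ' ι' π')
    (C : Chain χ κ t l) {n : ℕ}
    {qZ : V →ₗ[k] Z} (L : LabMap χ κ t l ζ 0 n qZ) {w : V →ₗ[k] M}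
    (hw : Eqv κ (res H ρ) w) (hqw : q ∘ₗ w = ι ∘ₗ qZ) :
    Eqv (tw (χ ^ (n : ℤ)) κ) ζ' ((π' ∘ₗ r ∘ₗ w) ∘ₗ (t ^ n)) ∧
    ((π' ∘ₗ r ∘ₗ w) ∘ₗ (t ^ n)) ∘ₗ (t ^ (l - n)) = 0 ∧
    ∀ x : V →ₗ[k] Z', Eqv κ ζ' x → x ∘ₗ (t ^ n) ≠ (π' ∘ₗ r ∘ₗ w) ∘ₗ (t ^ n) := by
  have hZ := L.eqv
  rw [tw_zpow_zero] at hZ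
  have hker : ∀ v, w ((t ^ n) v) ∈ LinearMap.ker q := fun v => by
    have h1 := LinearMap.congr_fun hqw ((t ^ n) v)
    have h2 : (t ^ n) v ∈ LinearMap.ker qZ := by rw [L.ker_eq]; exact ⟨v, rfl⟩
    rw [LinearMap.mem_ker]
    refine h1.trans ?_
    rw [LinearMap.comp_apply, LinearMap.mem_ker.1 h2, map_zero]
  refine ⟨fun h v => ?_, ?_, fun x hx hxt => ?_⟩
  · simp only [LinearMap.comp_apply]
    rw [C.pow_eqv' n h v, hw, res_apply, hr.eqv _ _ (hker v), ← res_apply, D'.eqv_p]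
  · rw [LinearMap.comp_assoc, ← Module.End.mul_eq_comp, ← pow_add,
      show n + (l - n) = l by have := L.le; omega, C.pow_eq, LinearMap.comp_zero]
  · refine hr.not_extend hG hE hM hq D D' L.surj hZ hw hqw hx fun v hv => ?_
    rw [L.ker_eq] at hv
    obtain ⟨u, rfl⟩ := hv
    exact LinearMap.congr_fun hxt u

end Lift

lemma Ext.good [IsAlgClosed k] [FiniteDimensional k V] [FiniteDimensional k T]
    (hG : Geo p a0 z H) (hE : Dat E)
    (hC : HasChains (eH z H E) χ) (hM : InMod (tot E) ρ) (hq : Loc ρ σ q) (hr : Ext ρ τ q r)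
    (C : Chain χ κ t l) {n : ℕ} (L : Good z H E χ κ t l σ 0 n) :
    ∃ (c : ℤ) (m : ℕ), Good z H E χ κ t l τ c m ∧ 0 < c ∧ c ≤ n ∧ n < c + m ∧ c + m ≤ l := by
  obtain ⟨-, -, Z, _, _, _, ζ, ι, π, D, qZ, L⟩ := L
  have hMτ := hM.ker_right hq hr
  obtain ⟨Z', _, _, _, ζ', ι', π', D', V₂, _, _, _, κ₂, t₂, l₂, m, C₂, q₂, L₂⟩ :=
    exists_model hG hE hC hr.irr hMτ (hr.not_pz_right hq)
  obtain ⟨w, hw, hqw⟩ := exists_chain_lift hq D C L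
  obtain ⟨h1, h2, h3⟩ := hr.chain_map hG hE hM hq D D' C L hw hqw
  obtain ⟨c, L', h4, h5, h6, h7⟩ := C.lab_of_not_extend C₂ L₂ h1 h2 (fun x hx _ => h3 x hx)
  have := L.le
  exact ⟨c, m, ⟨hr.irr, hMτ, Z', _, _, inferInstance, ζ', ι', π', D', L'⟩, h4, h5, h6, by omega⟩

/-- Irreducible constituents of the second layer have multiplicity one. -/
theorem ext_unique [IsAlgClosed k] [FiniteDimensional k S] [FiniteDimensional k T]
    (hG : Geo p a0 z H) (hE : Dat E)
    (hC : HasChains (eH z H E) χ) (hM : InMod (tot E) ρ) (hq : Loc ρ σ q) (hr₁ : Ext ρ τ q r₁)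
    (hr₂ : Ext ρ τ q r₂) : ∃ c : k, ∀ v ∈ LinearMap.ker q, r₂ v = c • r₁ v := by
  by_contra! hcon
  have hr : ∀ c : k, Ext ρ τ q (r₂ - c • r₁) := fun c => by
    refine ⟨hr₁.irr, fun g v hv => ?_, ?_⟩
    · simp [hr₁.eqv g v hv, hr₂.eqv g v hv]
    · obtain ⟨v, hv, h⟩ := hcon c
      exact ⟨v, hv, by simpa [sub_eq_zero] using h⟩
  obtain ⟨V, _, _, _, κ, t, l, n, C, -, -, Z, _, _, _, ζ, ι, π, D, qZ, L⟩ :=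
    exists_head hG hE hC hq.irr (hM.of_surj hq.eqv hq.surj) (hr₁.not_pz_left hq)
  have hMτ := hM.ker_right hq hr₁
  obtain ⟨Z', _, _, _, ζ', ι', π', D', V₂, _, _, _, κ₂, t₂, l₂, m, C₂, q₂, L₂⟩ :=
    exists_model hG hE hC hr₁.irr hMτ (hr₁.not_pz_right hq)
  obtain ⟨w, hw, hqw⟩ := exists_chain_lift hq D C L
  obtain ⟨h1, h2, h3⟩ := hr₁.chain_map hG hE hM hq D D' C L hw hqw
  obtain ⟨k1, k2, -⟩ := hr₂.chain_map hG hE hM hq D D' C L hw hqw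
  obtain ⟨c, c', hcc, ⟨K, a1, a2, a3, a4⟩, K', b1, b2, b3, b4⟩ :=
    C.lab_two_of_not_extend C₂ L₂ h1 h2 k1 k2 h3 (fun c x hx hxt => by
      obtain ⟨-, -, k3⟩ := (hr c).chain_map hG hE hM hq D D' C L hw hqw
      refine k3 x hx (hxt.trans ?_)
      ext v; simp)
  have hn := L.le
  have G : ∀ {c}, Lab χ κ t l ζ' c m → Good z H E χ κ t l τ c m := fun K =>
    ⟨hr₁.irr, hMτ, Z', _, _, inferInstance, ζ', ι', π', D', K⟩
  rcases lt_or_gt_of_ne hcc with h | h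
  · have := (Good.orth hG hE hE C (G K') (G K) (by omega) (by omega) (by omega) (by omega)).2.1
    omega
  · have := (Good.orth hG hE hE C (G K) (G K') (by omega) (by omega) (by omega) (by omega)).2.1
    omega

omit [CharP k p] in
lemma Model.inMod {Z : Type} [AddCommGroup Z] [Module k Z] {ζ : Representation k H Z}
    {ι : Z →ₗ[k] T} {π : T →ₗ[k] Z} (hG : Geo p a0 z H) (D : Model z H E τ ζ ι π) :
    InMod (eH z H E) ζ := fun v => by
  have hi : Function.Injective ι := fun a b h => by
    have h1 := LinearMap.congr_fun D.split
    rw [← LinearMap.id_apply (R := k) a, ← h1 a, LinearMap.comp_apply, h, ← LinearMap.comp_apply,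
      h1 b, LinearMap.id_apply]
  apply hi
  have h1 := D.eqv_i.op (eH z H E) v
  rw [op_res (fun w => hG.comm_mem)] at h1
  exact h1.trans (LinearMap.congr_fun D.eta_i v)

/-- A proper nonzero quotient of a twist of a chain supports a map to a labelled irreducible. -/
lemma Good.exists_of_quo [IsAlgClosed k] [FiniteDimensional k V] (hG : Geo p a0 z H) (hE : Dat E)
    (hC : HasChains (eH z H E) χ) (C : Chain χ κ t l) {c : ℤ} {m n : ℕ}
    (L : Good z H E χ κ t l τ c m) (h1 : 1 ≤ n) (h2 : n ≤ m) (h3 : n < l) :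
    ∃ (U : Type) (_ : AddCommGroup U) (_ : Module k U) (υ : Representation k Γ U) (s : ℤ) (u : ℕ),
      Good z H E χ κ t l υ s u ∧ s ≤ c ∧ c < s + u ∧ s + u ≤ c + n ∧ c + n < s + l := by
  obtain ⟨hi, hM, Z, _, _, _, ζ, ι, π, D, qZ, L⟩ := L
  have hinv : Inv (tw (χ ^ c) κ) (LinearMap.range (t ^ n)) := (C.inv_range n).tw _
  have LX : LabMap χ κ t l (quoR (tw (χ ^ c) κ) hinv) c n (LinearMap.range (t ^ n)).mkQ :=
    ⟨Submodule.mkQ_surjective _, eqv_mkQ hinv, Submodule.ker_mkQ _, h1, h3.le⟩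
  obtain ⟨f, hf⟩ := exists_factor L.surj (f := (LinearMap.range (t ^ n)).mkQ)
    (by rw [L.ker_eq, Submodule.ker_mkQ]; exact range_pow_anti t h2)
  have hfe : Eqv ζ (quoR (tw (χ ^ c) κ) hinv) f :=
    Eqv.of_comp_surj L.surj L.eqv (by rw [hf]; exact eqv_mkQ hinv)
  have hfs : Function.Surjective f := by
    have := Submodule.mkQ_surjective (LinearMap.range (t ^ n))
    rw [← hf] at this
    exact Function.Surjective.of_comp (g := qZ) this
  have hMX := (D.inMod hG).of_surj hfe hfs
  have hnX : ¬ PZ (quoR (tw (χ ^ c) κ) hinv) (quoR (tw (χ ^ c) κ) hinv) LinearMap.id := by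
    obtain ⟨g, hg, hgn, -⟩ := C.exists_not_pz LX LX le_rfl (by omega) le_rfl (by omega)
    intro h
    exact hgn (h.of_id_left hg)
  obtain ⟨U, _, _, _, υ, g, hiU, hMU, hge, hgn⟩ := exists_irr_map hG hE hMX hnX
  have hnU : ¬ PZ υ υ LinearMap.id := fun h =>
    hgn ((h.res H).of_id_right ((hE.eta_eqv hG υ).comp hge))
  obtain ⟨Z', _, _, _, ζ', ι', π', D', V₂, _, _, _, κ₂, t₂, l₂, u, C₂, q₂, L₂⟩ :=
    exists_model hG hE hC hiU hMU hnU
  have hpn : ¬ PZ _ ζ' (π' ∘ₗ g) := fun h => by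
    apply hgn
    have h5 := (h.comp_left D'.eqv_i).add (D'.pz.comp_right hge)
    convert h5 using 1
    ext v
    simp
  obtain ⟨s, Ls, h5, h6, h7, h8⟩ := C.lab_of_not_pz C₂ L₂ LX (D'.eqv_p.comp hge) hpn
  exact ⟨U, _, _, υ, s, u, ⟨hiU, hMU, Z', _, _, inferInstance, ζ', ι', π', D', Ls⟩, h5, h6, h7, h8⟩

end Good

section Branching

variable {k : Type} [Field k] {Γ A : Type} [Group Γ] [MulAction Γ A] [Fintype Γ] [Fintype A]
variable {p : ℕ} [CharP k p] {a0 : A} {z : Γ} {H : Subgroup Γ} {E : A → Γ → k}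
variable {χ : H →* kˣ}

/-- Two representations admit an equivariant linear equivalence. -/
def Iso {V W : Type} [AddCommGroup V] [Module k V] [AddCommGroup W] [Module k W]
    (ρ : Representation k Γ V) (σ : Representation k Γ W) : Prop :=
  ∃ φ : V ≃ₗ[k] W, Eqv ρ σ φ.toLinearMap

section

variable {V : Type} [AddCommGroup V] [Module k V] [FiniteDimensional k V]
  {κ : Representation k H V} {t : Module.End k V} {l : ℕ}
variable {S T₁ T₂ T₃ : Type} [AddCommGroup S] [Module k S] [AddCommGroup T₁] [Module k T₁]
  [AddCommGroup T₂] [Module k T₂] [AddCommGroup T₃] [Module k T₃]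
  {σ : Representation k Γ S} {τ₁ : Representation k Γ T₁}
  {τ₂ : Representation k Γ T₂} {τ₃ : Representation k Γ T₃}

lemma Good.not_nested [IsAlgClosed k] (hG : Geo p a0 z H) (hE : Dat E)
    (hC : HasChains (eH z H E) χ) (C : Chain χ κ t l) {n n₂ n₃ : ℕ} {c₂ c₃ : ℤ}
    (L : Good z H E χ κ t l σ 0 n) (L₂ : Good z H E χ κ t l τ₂ c₂ n₂)
    (L₃ : Good z H E χ κ t l τ₃ c₃ n₃) (h0 : 0 < c₂) (h1 : c₂ < c₃) (h2 : c₃ ≤ n)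
    (h3 : n < c₃ + n₃) (h4 : c₃ + n₃ < c₂ + n₂) (h5 : c₂ + n₂ < l) : False := by
  obtain ⟨U, _, _, υ, s, u, G, k1, k2, k3, k4⟩ :=
    L₂.exists_of_quo hG hE hC C (n := (c₃ + n₃ - c₂).toNat) (by omega) (by omega) (by omega)
  have e : (((c₃ + n₃ - c₂).toNat : ℕ) : ℤ) = c₃ + n₃ - c₂ := Int.toNat_of_nonneg (by omega)
  rw [e] at k3 k4
  by_cases b1 : c₃ < s + u
  · have := (L₃.orth hG hE hE C G (by omega) (by omega) (by omega) (by omega)).2.1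
    omega
  by_cases b2 : s ≤ 0
  · have := (L.orth hG hE hE C G (by omega) (by omega) (by omega) (by omega)).2
    have := (L₂.orth hG hE hE C L (by omega) (by omega) (by omega) (by omega)).2.1
    omega
  · have := (L₂.orth hG hE hE C G (by omega) (by omega) (by omega) (by omega)).2
    omega

end

variable {M S T₁ T₂ T₃ : Type} [AddCommGroup M] [Module k M] [AddCommGroup S] [Module k S]
  [AddCommGroup T₁] [Module k T₁] [AddCommGroup T₂] [Module k T₂] [AddCommGroup T₃] [Module k T₃]
  [FiniteDimensional k S] [FiniteDimensional k T₁] [FiniteDimensional k T₂]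
  [FiniteDimensional k T₃]
  {ρ : Representation k Γ M} {σ : Representation k Γ S} {τ₁ : Representation k Γ T₁}
  {τ₂ : Representation k Γ T₂} {τ₃ : Representation k Γ T₃} {q : M →ₗ[k] S}
  {r₁ : M →ₗ[k] T₁} {r₂ : M →ₗ[k] T₂} {r₃ : M →ₗ[k] T₃}

/-- The second layer has at most two non-isomorphic irreducible constituents. -/
theorem ext_three [IsAlgClosed k] (hG : Geo p a0 z H) (hE : Dat E)
    (hC : HasChains (eH z H E) χ) (hM : InMod (tot E) ρ) (hq : Loc ρ σ q) (hr₁ : Ext ρ τ₁ q r₁)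
    (hr₂ : Ext ρ τ₂ q r₂) (hr₃ : Ext ρ τ₃ q r₃) (h₁₂ : ¬ Iso τ₁ τ₂) (h₁₃ : ¬ Iso τ₁ τ₃)
    (h₂₃ : ¬ Iso τ₂ τ₃) : False := by
  obtain ⟨V, _, _, _, κ, t, l, n, C, L⟩ :=
    exists_head hG hE hC hq.irr (hM.of_surj hq.eqv hq.surj) (hr₁.not_pz_left hq)
  obtain ⟨c₁, n₁, L₁, a₁, b₁, d₁, e₁⟩ := hr₁.good hG hE hC hM hq C L
  obtain ⟨c₂, n₂, L₂, a₂, b₂, d₂, e₂⟩ := hr₂.good hG hE hC hM hq C L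
  obtain ⟨c₃, n₃, L₃, a₃, b₃, d₃, e₃⟩ := hr₃.good hG hE hC hM hq C L
  have key : ∀ {T T' : Type} [AddCommGroup T] [Module k T] [AddCommGroup T'] [Module k T']
      {τ : Representation k Γ T} {τ' : Representation k Γ T'} {c c' : ℤ} {m m' : ℕ},
      Good z H E χ κ t l τ c m → Good z H E χ κ t l τ' c' m' → ¬ Iso τ τ' → c ≤ n → c + m ≤ l →
      0 < c' → n < c' + m' → c' ≤ c → c + m < c' + m' := by
    intro T T' _ _ _ _ τ τ' c c' m m' K K' hi h1 h2 h3 h4 h5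
    by_contra! h6
    exact hi (K.orth hG hE hE C K' h5 (by omega) h6 (by omega)).1
  have symm : ∀ {T T' : Type} [AddCommGroup T] [Module k T] [AddCommGroup T'] [Module k T']
      {τ : Representation k Γ T} {τ' : Representation k Γ T'}, ¬ Iso τ τ' → ¬ Iso τ' τ := by
    rintro T T' _ _ _ _ τ τ' h ⟨φ, hφ⟩
    exact h ⟨φ.symm, hφ.symm⟩
  have k₁₂ := key L₁ L₂ h₁₂ b₁ e₁ a₂ d₂
  have k₂₁ := key L₂ L₁ (symm h₁₂) b₂ e₂ a₁ d₁
  have k₁₃ := key L₁ L₃ h₁₃ b₁ e₁ a₃ d₃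
  have k₃₁ := key L₃ L₁ (symm h₁₃) b₃ e₃ a₁ d₁
  have k₂₃ := key L₂ L₃ h₂₃ b₂ e₂ a₃ d₃
  have k₃₂ := key L₃ L₂ (symm h₂₃) b₃ e₃ a₂ d₂
  have f₁₂ : ¬ (0 < c₁ ∧ c₁ < c₂ ∧ c₁ + n₁ < l ∧ c₂ + n₂ < c₁ + n₁) := fun h =>
    Good.not_nested hG hE hC C L L₁ L₂ h.1 h.2.1 b₂ d₂ h.2.2.2 h.2.2.1
  have f₂₁ : ¬ (0 < c₂ ∧ c₂ < c₁ ∧ c₂ + n₂ < l ∧ c₁ + n₁ < c₂ + n₂) := fun h =>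
    Good.not_nested hG hE hC C L L₂ L₁ h.1 h.2.1 b₁ d₁ h.2.2.2 h.2.2.1
  have f₁₃ : ¬ (0 < c₁ ∧ c₁ < c₃ ∧ c₁ + n₁ < l ∧ c₃ + n₃ < c₁ + n₁) := fun h =>
    Good.not_nested hG hE hC C L L₁ L₃ h.1 h.2.1 b₃ d₃ h.2.2.2 h.2.2.1
  have f₃₁ : ¬ (0 < c₃ ∧ c₃ < c₁ ∧ c₃ + n₃ < l ∧ c₁ + n₁ < c₃ + n₃) := fun h =>
    Good.not_nested hG hE hC C L L₃ L₁ h.1 h.2.1 b₁ d₁ h.2.2.2 h.2.2.1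
  have f₂₃ : ¬ (0 < c₂ ∧ c₂ < c₃ ∧ c₂ + n₂ < l ∧ c₃ + n₃ < c₂ + n₂) := fun h =>
    Good.not_nested hG hE hC C L L₂ L₃ h.1 h.2.1 b₃ d₃ h.2.2.2 h.2.2.1
  have f₃₂ : ¬ (0 < c₃ ∧ c₃ < c₂ ∧ c₃ + n₃ < l ∧ c₂ + n₂ < c₃ + n₃) := fun h =>
    Good.not_nested hG hE hC C L L₃ L₂ h.1 h.2.1 b₂ d₂ h.2.2.2 h.2.2.1
  omega

end Branching

section Twisting

variable {k : Type} [Field k] {Γ A : Type} [Group Γ] [MulAction Γ A] [Fintype Γ] [Fintype A]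

/-- The twist of a family of group algebra elements by a character. -/
def twE (ψ : Γ →* kˣ) (E : A → Γ → k) (a : A) (w : Γ) : k := ((ψ w)⁻¹ : kˣ) * E a w

omit [MulAction Γ A] [Fintype Γ] in
lemma tot_twE (ψ : Γ →* kˣ) (E : A → Γ → k) (w : Γ) :
    tot (twE ψ E) w = ((ψ w)⁻¹ : kˣ) * tot E w := by
  simp only [tot, twE, Finset.mul_sum]

lemma Dat.twE {E : A → Γ → k} (hE : Dat E) (ψ : Γ →* kˣ) : Dat (twE ψ E) where
  eqv g a w := by
    rw [CyclicBlock.twE, CyclicBlock.twE, hE.eqv, show ψ (g * w * g⁻¹) = ψ w by simp]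
  idem :=
    { conj := fun g w => by
        rw [tot_twE, tot_twE, hE.idem.conj, show ψ (g * w * g⁻¹) = ψ w by simp]
      idem := fun F => by
        have := hE.idem.idem (fun w => ((ψ w)⁻¹ : kˣ) * F w)
        simp only [tot_twE]
        calc _ = _ := ?_
          _ = _ := this
          _ = _ := ?_
        · refine Finset.sum_congr rfl fun u _ => Finset.sum_congr rfl fun v _ => ?_
          simp only [map_mul, mul_inv_rev, Units.val_mul]
          ring
        · refine Finset.sum_congr rfl fun u _ => ?_
          ring }

variable {T Z V : Type} [AddCommGroup T] [Module k T] [AddCommGroup Z] [Module k Z]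
  [AddCommGroup V] [Module k V]

omit [Fintype A] [MulAction Γ A] in
lemma op_tw (ψ : Γ →* kˣ) (x : Γ → k) (σ : Representation k Γ T) :
    op (tw ψ σ) (fun w => ((ψ w)⁻¹ : kˣ) * x w) = op σ x := by
  ext v
  rw [op_apply, op_apply]
  refine Finset.sum_congr rfl fun w _ => ?_
  rw [tw_apply, smul_smul, mul_right_comm, Units.inv_mul, one_mul]

omit [MulAction Γ A] in
lemma eta_tw (ψ : Γ →* kˣ) (z : Γ) (E : A → Γ → k) (σ : Representation k Γ T) :
    eta z (twE ψ E) (tw ψ σ) = eta z E σ := by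
  rw [eta, eta, ← op_tw ψ (eC z E) σ]
  congr 1
  ext w
  change (if Commute w z then tot (twE ψ E) w else 0) =
    ((ψ w)⁻¹ : kˣ) * (if Commute w z then tot E w else 0)
  rw [tot_twE]
  split_ifs <;> simp

variable {p : ℕ} [CharP k p] {a0 : A} {z : Γ} {H : Subgroup Γ} {E : A → Γ → k}
variable {χ : H →* kˣ} {τ : Representation k Γ T} {κ : Representation k H V}
  {t : Module.End k V} {l : ℕ}

omit [MulAction Γ A] in
lemma Good.tw {ψ : Γ →* kˣ} {b : ℤ} (hψ : ψ.comp H.subtype = χ ^ b) {c : ℤ} {m : ℕ}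
    (L : Good z H E χ κ t l τ c m) :
    Good z H (twE ψ E) χ κ t l (CyclicBlock.tw ψ τ) (b + c) m := by
  obtain ⟨hi, hM, Z, _, _, _, ζ, ι, π, D, q, L⟩ := L
  have hres : res H (CyclicBlock.tw ψ τ) = CyclicBlock.tw (χ ^ b) (res H τ) := by
    rw [← hψ]; rfl
  refine ⟨hi.tw ψ, fun v => ?_, Z, _, _, inferInstance, CyclicBlock.tw (χ ^ b) ζ, ι, π,
    ⟨?_, ?_, D.split, ?_, ?_, ?_, ?_⟩, q, L.surj, ?_, L.ker_eq, L.one_le, L.le⟩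
  · have h1 := LinearMap.congr_fun (op_tw ψ (tot E) τ) v
    rw [hM v] at h1
    convert h1 using 3
    ext w
    exact tot_twE ψ E w
  · rw [hres]; exact D.eqv_i.tw _
  · rw [hres]; exact D.eqv_p.tw _
  · rw [eta_tw]; exact D.eta_i
  · rw [eta_tw]; exact D.p_eta
  · rw [eta_tw, hres]; exact D.pz.tw _
  · intro h
    apply D.ne
    have := h.tw (χ ^ (-b))
    rwa [tw_zpow_add, neg_add_cancel, tw_zpow_zero] at this
  · rw [← tw_zpow_add]
    exact L.eqv.tw _

variable {M S : Type} [AddCommGroup M] [Module k M] [AddCommGroup S] [Module k S]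
  [FiniteDimensional k S] [FiniteDimensional k T]
  {ρ : Representation k Γ M} {σ : Representation k Γ S} {q : M →ₗ[k] S} {r : M →ₗ[k] T}

/-- If the character of the chains extends to the whole group, then the second layer is a twist
of the head. -/
theorem ext_twist [IsAlgClosed k] (hG : Geo p a0 z H) (hE : Dat E)
    (hC : HasChains (eH z H E) χ) {ψ : Γ →* kˣ} (hψ : ψ.comp H.subtype = χ)
    (hM : InMod (tot E) ρ) (hq : Loc ρ σ q) (hr : Ext ρ τ q r) : Iso (tw ψ σ) τ := by
  obtain ⟨V, _, _, _, κ, t, l, n, C, L⟩ :=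
    exists_head hG hE hC hq.irr (hM.of_surj hq.eqv hq.surj) (hr.not_pz_left hq)
  obtain ⟨c, m, L', h1, h2, h3, h4⟩ := hr.good hG hE hC hM hq C L
  have hb : ∀ b : ℤ, (ψ ^ b).comp H.subtype = χ ^ b := fun b => by
    subst hψ
    ext g
    rfl
  have hS := fun b => L.tw (hb b)
  have hc := hS c
  have ho := hS 1
  rw [add_zero] at hc ho
  have hnl := L.bounds
  have hmn : n = m := by
    rcases le_total n m with h | h
    · exact (L'.orth hG hE (hE.twE _) C hc (by omega) (by omega) (by omega) (by omega)).2.2.symm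
    · exact (hc.orth hG (hE.twE _) hE C L' (by omega) (by omega) (by omega) (by omega)).2.2
  subst hmn
  obtain ⟨⟨φ, hφ⟩, -, -⟩ :=
    L'.orth hG hE (hE.twE _) C ho (by omega) (by omega) (by omega) (by omega)
  refine ⟨φ.symm, ?_⟩
  have := hφ.symm
  rwa [char_zpow_one] at this

end Twisting

section GData

variable {k : Type} [Field k] {Γ A : Type} [Group Γ] [MulAction Γ A] [Fintype Γ] [Fintype A]

/-- A family of group algebra elements indexed by a transitive set whose base point has the cyclic
stabiliser generated by `d`, of order `p ^ n`. -/
structure GData (p n : ℕ) (E : A → Γ → k) (a0 : A) (d : Γ) : Prop where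
  prime : p.Prime
  trans : ∀ a : A, ∃ g : Γ, g • a0 = a
  stab : ∀ g : Γ, g • a0 = a0 ↔ g ∈ Subgroup.zpowers d
  ord : orderOf d = p ^ n
  dat : Dat E

variable {p n : ℕ} {E : A → Γ → k} {a0 : A} {d : Γ}
variable {M S T : Type} [AddCommGroup M] [Module k M] [AddCommGroup S] [Module k S]
  [AddCommGroup T] [Module k T]
variable {ρ : Representation k Γ M} {σ : Representation k Γ S} {τ : Representation k Γ T}
  {q : M →ₗ[k] S} {r : M →ₗ[k] T}

/-- A nonsplit extension does not split over the point stabiliser. -/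
theorem GData.no_split (hG : GData p n E a0 d) (hM : InMod (tot E) ρ) (hq : Loc ρ σ q)
    (hr : Ext ρ τ q r) {f : M →ₗ[k] T} (hf : ∀ v, f (ρ d v) = τ d (f v))
    (hfr : ∀ v ∈ LinearMap.ker q, f v = r v) : False := by
  have hfH : Eqv (res (Subgroup.zpowers d) ρ) (res (Subgroup.zpowers d) τ) f := by
    have h1 : ∀ (i : ℕ) v, f (ρ (d ^ i) v) = τ (d ^ i) (f v) := by
      intro i
      induction i with
      | zero => intro v; simp
      | succ i ih => intro v; rw [pow_succ, rep_mul_apply, rep_mul_apply, ih, hf]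
    rintro ⟨g, hg⟩ v
    obtain ⟨i, rfl⟩ := mem_powers_iff_mem_zpowers.2 hg
    exact h1 i v
  have hgA : ∀ a : A, gA Γ a0 a • a0 = a := fun a => by
    rw [gA, dif_pos (hG.trans a)]
    exact (hG.trans a).choose_spec
  have hcoset : ∀ {g g' : Γ}, g • a0 = g' • a0 → cj ρ τ g f = cj ρ τ g' f := fun {g g'} h =>
    cj_coset hfH ((hG.stab _).1 (by rw [mul_smul, ← h, inv_smul_smul]))
  refine hr.no_extension hq (y := ∑ a : A, op τ (E a) ∘ₗ cj ρ τ (gA Γ a0 a) f) ?_ ?_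
  · apply eqv_of_cj
    intro g
    rw [cj_sum]
    refine Fintype.sum_equiv (MulAction.toPerm g) _ _ fun a => ?_
    rw [cj_comp (σ := τ), cj_op g (x' := E (g • a)) (fun w => hG.dat.eqv g a w), ← cj_mul,
      MulAction.toPerm_apply]
    congr 1
    exact hcoset (by rw [mul_smul, hgA, hgA])
  · intro v hv
    have h1 : ∀ g, cj ρ τ g f v = r v := fun g => by
      rw [cj_apply, hfr _ (hq.eqv.ker _ _ hv), hr.eqv _ _ hv, rep_apply_inv]
    rw [LinearMap.sum_apply]
    simp only [LinearMap.comp_apply, h1]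
    have h2 : op τ (tot E) = ∑ a, op τ (E a) := op_sum (ρ := τ) Finset.univ E
    rw [← LinearMap.sum_apply, ← h2]
    exact hM.ker_right hq hr _ |>.symm.symm

end GData

section Geometry

variable {k : Type} [Field k] {Γ A : Type} [Group Γ] [MulAction Γ A] [Fintype Γ] [Fintype A]
variable {p n : ℕ} {E : A → Γ → k} {a0 : A} {d : Γ}

/-- The generator of the minimal subgroup of the stabiliser. -/
def zG (p n : ℕ) (d : Γ) : Γ := d ^ (p ^ (n - 1))

namespace GData

lemma z_pow (hG : GData p n E a0 d) : zG p n d ^ p = 1 := by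
  rw [zG, ← pow_mul, ← pow_succ]
  rcases Nat.eq_zero_or_pos n with h | h
  · have := hG.ord
    rw [h, pow_zero, orderOf_eq_one_iff] at this
    rw [this, one_pow]
  · rw [Nat.sub_add_cancel h, ← hG.ord, pow_orderOf_eq_one]

lemma z_ne (hG : GData p n E a0 d) (hn : 0 < n) : zG p n d ≠ 1 := by
  intro h
  have h1 := orderOf_dvd_of_pow_eq_one h
  rw [hG.ord, Nat.pow_dvd_pow_iff_le_right hG.prime.one_lt] at h1
  omega

lemma z_ord (hG : GData p n E a0 d) (hn : 0 < n) : orderOf (zG p n d) = p :=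
  have := Fact.mk hG.prime
  orderOf_eq_prime hG.z_pow (hG.z_ne hn)

lemma mem_z (hG : GData p n E a0 d) (hn : 0 < n) {g : Γ} (hg : g ∈ Subgroup.zpowers d)
    (h : g ^ p = 1) : ∃ i : ℕ, g = zG p n d ^ i := by
  obtain ⟨i, rfl⟩ := mem_powers_iff_mem_zpowers.2 hg
  change (d ^ i) ^ p = 1 at h
  rw [← pow_mul] at h
  have h1 := orderOf_dvd_of_pow_eq_one h
  rw [hG.ord, show n = n - 1 + 1 by omega, pow_succ] at h1
  obtain ⟨j, hj⟩ := Nat.dvd_of_mul_dvd_mul_right hG.prime.pos h1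
  exact ⟨j, by rw [zG, ← pow_mul, ← hj]⟩

lemma z_smul (hG : GData p n E a0 d) (hn : 0 < n) {g : Γ} :
    zG p n d • g • a0 = g • a0 ↔ ∃ i : ℕ, g⁻¹ * zG p n d * g = zG p n d ^ i := by
  have h0 : zG p n d • g • a0 = g • a0 ↔ (g⁻¹ * zG p n d * g) • a0 = a0 := by
    rw [mul_smul, mul_smul, inv_smul_eq_iff]
  rw [h0, hG.stab]
  constructor
  · intro h
    refine hG.mem_z hn h ?_
    have := conj_pow (a := g⁻¹) (b := zG p n d) (i := p)
    rw [inv_inv, hG.z_pow] at this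
    rw [this]
    group
  · rintro ⟨i, hi⟩
    rw [hi]
    exact Subgroup.pow_mem _ (Subgroup.pow_mem _ (Subgroup.mem_zpowers d) _) _

omit [Fintype Γ] in
lemma conj_pow_z {z : Γ} {g : Γ} {i : ℕ} (h : g⁻¹ * z * g = z ^ i) (j : ℕ) :
    g⁻¹ * z ^ j * g = z ^ (i * j) := by
  have := conj_pow (a := g⁻¹) (b := z) (i := j)
  rw [inv_inv, h] at this
  rw [← this, pow_mul]

/-- The stabiliser of the set of fixed points of `zG`. -/
def stabZ (hG : GData p n E a0 d) (hn : 0 < n) : Subgroup Γ :=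
  have hmul : ∀ {g h : Γ}, zG p n d • g • a0 = g • a0 → zG p n d • h • a0 = h • a0 →
      zG p n d • (g * h) • a0 = (g * h) • a0 := by
    intro g h hg hh
    rw [hG.z_smul hn] at hg hh ⊢
    obtain ⟨i, hi⟩ := hg
    obtain ⟨j, hj⟩ := hh
    refine ⟨j * i, ?_⟩
    rw [← conj_pow_z hj, ← hi]
    group
  have hone : zG p n d • (1 : Γ) • a0 = (1 : Γ) • a0 := by
    rw [hG.z_smul hn]
    exact ⟨1, by group⟩
  have hpow : ∀ {g : Γ}, zG p n d • g • a0 = g • a0 → ∀ i : ℕ,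
      zG p n d • (g ^ i) • a0 = (g ^ i) • a0 := by
    intro g hg i
    induction i with
    | zero => rw [pow_zero]; exact hone
    | succ i ih => rw [pow_succ]; exact hmul ih hg
  { carrier := {g | zG p n d • g • a0 = g • a0}
    mul_mem' := hmul
    one_mem' := hone
    inv_mem' := by
      intro g hg
      obtain ⟨i, hi⟩ := mem_powers_iff_mem_zpowers.2
        (Subgroup.inv_mem _ (Subgroup.mem_zpowers g))
      have := hpow hg i
      change g ^ i = g⁻¹ at hi
      rwa [hi] at this }

lemma mem_stabZ (hG : GData p n E a0 d) (hn : 0 < n) {g : Γ} :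
    g ∈ hG.stabZ hn ↔ zG p n d • g • a0 = g • a0 := Iff.rfl

lemma exists_conj (hG : GData p n E a0 d) (hn : 0 < n) {g : Γ} (hg : g ∈ hG.stabZ hn) :
    ∃ i : ℕ, g * zG p n d * g⁻¹ = zG p n d ^ i := by
  obtain ⟨i, hi⟩ := (hG.z_smul hn).1 ((hG.mem_stabZ hn).1 (Subgroup.inv_mem _ hg))
  exact ⟨i, by rwa [inv_inv] at hi⟩

lemma geo (hG : GData p n E a0 d) (hn : 0 < n) : Geo p a0 (zG p n d) (hG.stabZ hn) where
  prime := hG.prime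
  trans := hG.trans
  zne := hG.z_ne hn
  zpow := hG.z_pow
  zfix := (hG.stab _).2 (Subgroup.pow_mem _ (Subgroup.mem_zpowers d) _)
  memH _ := hG.mem_stabZ hn
  stab g hg := by
    obtain ⟨i, rfl⟩ := Subgroup.mem_zpowers_iff.1 ((hG.stab g).1 hg)
    exact ((Commute.refl d).zpow_left i).pow_right _
  free g hg h1 := by
    obtain ⟨i, rfl⟩ := mem_powers_iff_mem_zpowers.2 ((hG.stab g).1 hg)
    change d ^ i ≠ 1 at h1
    change _ ∈ Subgroup.zpowers (d ^ i)
    have h2 : (p ^ n).gcd i ∣ p ^ (n - 1) := by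
      obtain ⟨j, hj, h3⟩ := (Nat.dvd_prime_pow hG.prime).1 (Nat.gcd_dvd_left (p ^ n) i)
      rw [h3]
      refine Nat.pow_dvd_pow _ ?_
      by_contra! h4
      apply h1
      rw [← orderOf_dvd_iff_pow_eq_one, hG.ord, show n = j by omega, ← h3]
      exact Nat.gcd_dvd_right _ _
    obtain ⟨c, hc⟩ := h2
    have h5 := Nat.gcd_eq_gcd_ab (p ^ n) i
    have h6 : d ^ ((p ^ n).gcd i) = (d ^ i) ^ ((p ^ n).gcdB i) := by
      rw [← zpow_natCast, h5, zpow_add, zpow_mul, zpow_natCast, ← hG.ord, pow_orderOf_eq_one,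
        one_zpow, one_mul, zpow_mul, zpow_natCast]
    rw [zG, hc, pow_mul, h6]
    exact Subgroup.pow_mem _ (Subgroup.zpow_mem _ (Subgroup.mem_zpowers _) _) _

/-- The compatibility of a character with the conjugation action on the minimal subgroup. -/
def Compat (p n : ℕ) (d : Γ) (ψ : Γ →* kˣ) : Prop :=
  0 < n → ∀ (g : Γ) (i : ℕ), g * zG p n d * g⁻¹ = zG p n d ^ i → (ψ g : k) = i

omit [Fintype Γ] in
lemma exists_char [CharP k p] {z : Γ} (hz : orderOf z = p)
    (h : ∀ g : Γ, ∃ i : ℕ, g * z * g⁻¹ = z ^ i) :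
    ∃ ψ : Γ →* kˣ, ∀ (g : Γ) (i : ℕ), g * z * g⁻¹ = z ^ i → (ψ g : k) = i := by
  choose f hf using h
  have huniq : ∀ (g : Γ) (i : ℕ), g * z * g⁻¹ = z ^ i → (f g : k) = i := fun g i hi => by
    rw [hf, pow_eq_pow_iff_modEq, hz] at hi
    exact (CharP.natCast_eq_natCast' k p hi)
  let ψ : Γ →* k :=
    { toFun := fun g => f g
      map_one' := by
        rw [huniq 1 1 (by group), Nat.cast_one]
      map_mul' := fun g h => by
        rw [huniq (g * h) (f g * f h), Nat.cast_mul]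
        have := conj_pow_z (z := z) (g := g⁻¹) (i := f g) (by rw [inv_inv, hf]) (f h)
        rw [← this, ← hf h]
        group }
  exact ⟨ψ.toHomUnits, fun g i hi => huniq g i hi⟩

end GData

end Geometry

section Section

variable {k : Type} [Field k] {M S : Type} [AddCommGroup M] [Module k M] [AddCommGroup S]
  [Module k S]

/-- If a nilpotent operator of a quotient is free, the quotient map has a linear section which
commutes with the operators up to the top power. -/
lemma exists_section {q : M →ₗ[k] S} (hq : Function.Surjective q) {x : Module.End k S}
    {y : Module.End k M} (hxy : ∀ v, q (y v) = x (q v)) {m : ℕ} (hx : x ^ (m + 1) = 0)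
    (hfree : ∀ s, (x ^ m) s = 0 → ∃ s', s = x s') :
    ∃ f : S →ₗ[k] M, (∀ s, q (f s) = s) ∧ ∀ s, ∃ v, f (x s) - y (f s) = (y ^ (m + 1)) v := by
  obtain ⟨B, hB⟩ := Submodule.exists_isCompl (LinearMap.range x)
  obtain ⟨σ, hσ⟩ := q.exists_rightInverse_of_surjective (LinearMap.range_eq_top.2 hq)
  have hσ' : ∀ s, q (σ s) = s := fun s => LinearMap.congr_fun hσ s
  let Φ : (Fin (m + 1) → B) →ₗ[k] S :=
    ∑ j : Fin (m + 1), (x ^ (j : ℕ)) ∘ₗ B.subtype ∘ₗ LinearMap.proj j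
  let Ψ : (Fin (m + 1) → B) →ₗ[k] M :=
    ∑ j : Fin (m + 1), (y ^ (j : ℕ)) ∘ₗ σ ∘ₗ B.subtype ∘ₗ LinearMap.proj j
  have hΦ : ∀ b, Φ b = ∑ j : Fin (m + 1), (x ^ (j : ℕ)) (b j : S) := fun b => by simp [Φ]
  have hΨ : ∀ b, Ψ b = ∑ j : Fin (m + 1), (y ^ (j : ℕ)) (σ (b j : S)) := fun b => by simp [Ψ]
  have hpow : ∀ (i : ℕ) v, q ((y ^ i) v) = (x ^ i) (q v) := by
    intro i
    induction i with
    | zero => intro v; simp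
    | succ i ih => intro v; rw [pow_succ', pow_succ', Module.End.mul_apply, Module.End.mul_apply,
        hxy, ih]
  have hqΨ : ∀ b, q (Ψ b) = Φ b := fun b => by
    rw [hΦ, hΨ, map_sum]
    exact Finset.sum_congr rfl fun j _ => by rw [hpow, hσ']
  have hbig : ∀ (i : ℕ) s, m < i → (x ^ i) s = 0 := fun i s hi => by
    rw [show i = (i - (m + 1)) + (m + 1) by omega, pow_add, hx, mul_zero, LinearMap.zero_apply]
  have hinj : Function.Injective Φ := by
    rw [injective_iff_map_eq_zero]
    intro b hb
    rw [hΦ] at hb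
    have key : ∀ i (hi : i < m + 1), b ⟨i, hi⟩ = 0 := by
      intro i
      induction i using Nat.strong_induction_on with
      | _ i ih =>
      intro hi
      have h1 := congrArg (x ^ (m - i)) hb
      rw [map_sum, map_zero, Finset.sum_eq_single ⟨i, hi⟩] at h1
      · rw [← Module.End.mul_apply, ← pow_add] at h1
        change (x ^ (m - i + i)) _ = 0 at h1
        rw [Nat.sub_add_cancel (by omega)] at h1
        obtain ⟨s', hs'⟩ := hfree _ h1
        have h2 : (b ⟨i, hi⟩ : S) ∈ LinearMap.range x ⊓ B := ⟨⟨s', hs'.symm⟩, (b ⟨i, hi⟩).2⟩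
        rw [hB.inf_eq_bot, Submodule.mem_bot] at h2
        exact Subtype.ext h2
      · intro j _ hj
        rw [← Module.End.mul_apply, ← pow_add]
        rcases lt_or_gt_of_ne (fun h => hj (Fin.ext h) : (j : ℕ) ≠ i) with h | h
        · rw [show b j = 0 from ih j h j.2]
          simp
        · exact hbig _ _ (by omega)
      · intro h
        exact absurd (Finset.mem_univ _) h
    funext i
    exact key i i.2
  have hshift : ∀ b : Fin (m + 1) → B, ∃ b' : Fin (m + 1) → B, Φ b' = x (Φ b) ∧
      ∃ v, Ψ b' - y (Ψ b) = (y ^ (m + 1)) v := by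
    intro b
    refine ⟨Fin.cons 0 (Fin.init b), ?_, -σ (b (Fin.last m)), ?_⟩
    · rw [hΦ, hΦ, Fin.sum_univ_succ, map_sum, Fin.sum_univ_castSucc]
      simp only [Fin.cons_zero, Fin.cons_succ, Fin.init, Fin.val_succ, Fin.val_castSucc,
        Fin.val_last, ← Module.End.mul_apply, ← pow_succ', hx]
      simp
    · rw [hΨ, hΨ, Fin.sum_univ_succ, map_sum, Fin.sum_univ_castSucc]
      simp only [Fin.cons_zero, Fin.cons_succ, Fin.init, Fin.val_succ, Fin.val_castSucc,
        Fin.val_last, ← Module.End.mul_apply, ← pow_succ']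
      simp
  have hsurj : Function.Surjective Φ := by
    have hdec : ∀ s : S, ∃ b c, Φ b + x c = s := by
      intro s
      have h1 : s ∈ LinearMap.range x ⊔ B := by rw [hB.sup_eq_top]; trivial
      obtain ⟨_, ⟨c, rfl⟩, b, hb, rfl⟩ := Submodule.mem_sup.1 h1
      refine ⟨Fin.cons ⟨b, hb⟩ 0, c, ?_⟩
      rw [hΦ, Fin.sum_univ_succ]
      simp [add_comm]
    have hdec' : ∀ (i : ℕ) (s : S), ∃ b c, Φ b + (x ^ i) c = s := by
      intro i
      induction i with
      | zero => intro s; exact ⟨0, s, by simp⟩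
      | succ i ih =>
        intro s
        obtain ⟨b, c, rfl⟩ := hdec s
        obtain ⟨b₁, c₁, rfl⟩ := ih c
        obtain ⟨b₂, hb₂, -⟩ := hshift b₁
        refine ⟨b + b₂, c₁, ?_⟩
        rw [map_add, map_add, hb₂, pow_succ', Module.End.mul_apply]
        abel
    intro s
    obtain ⟨b, c, h⟩ := hdec' (m + 1) s
    rw [hx, LinearMap.zero_apply, add_zero] at h
    exact ⟨b, h⟩
  let φ := LinearEquiv.ofBijective Φ ⟨hinj, hsurj⟩
  refine ⟨Ψ ∘ₗ φ.symm.toLinearMap, fun s => ?_, fun s => ?_⟩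
  · obtain ⟨b, rfl⟩ := φ.surjective s
    simp only [LinearMap.comp_apply, LinearEquiv.coe_coe, LinearEquiv.symm_apply_apply]
    exact hqΨ b
  · obtain ⟨b, rfl⟩ := φ.surjective s
    obtain ⟨b', h1, v, hv⟩ := hshift b
    refine ⟨v, ?_⟩
    have h2 : x (φ b) = φ b' := h1.symm
    simp only [LinearMap.comp_apply, LinearEquiv.coe_coe, h2, LinearEquiv.symm_apply_apply]
    exact hv

end Section

section Normal

variable {k : Type} [Field k] {Γ : Type} [Group Γ]
variable {M S T : Type} [AddCommGroup M] [Module k M] [AddCommGroup S] [Module k S]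
  [AddCommGroup T] [Module k T]
variable {ρ : Representation k Γ M} {σ : Representation k Γ S} {τ : Representation k Γ T}
  {q : M →ₗ[k] S} {r : M →ₗ[k] T} {z : Γ} {p : ℕ}

lemma conj_inv_of_conj (hz : ∀ g : Γ, ∃ i : ℕ, g * z * g⁻¹ = z ^ i) (g : Γ) :
    ∃ i : ℕ, g⁻¹ * z * g = z ^ i := by
  simpa using hz g⁻¹

/-- A normal `p`-subgroup acts trivially on irreducible representations. -/
lemma Irr.trivial_of_normal [CharP k p] (hp : p.Prime) (hσ : Irr σ) (hzp : z ^ p = 1)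
    (hz : ∀ g : Γ, ∃ i : ℕ, g * z * g⁻¹ = z ^ i) (s : S) : σ z s = s := by
  have := hσ.1
  have := Fact.mk hp
  have hinv : Inv σ (LinearMap.ker (σ z - 1)) := by
    intro g v hv
    rw [LinearMap.mem_ker, LinearMap.sub_apply, Module.End.one_apply, sub_eq_zero] at hv ⊢
    obtain ⟨i, hi⟩ := conj_inv_of_conj hz g
    have h1 : ∀ j : ℕ, σ (z ^ j) v = v := by
      intro j
      induction j with
      | zero => simp
      | succ j ih => rw [pow_succ, rep_mul_apply, hv, ih]
    rw [← rep_mul_apply, show z * g = g * z ^ i by rw [← hi]; group, rep_mul_apply, h1]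
  rcases hσ.2 _ hinv with h | h
  · exfalso
    have h1 : Function.Injective (σ z - 1 : Module.End k S) := LinearMap.ker_eq_bot.1 h
    have hc : CharP (Module.End k S) p :=
      charP_of_injective_algebraMap (algebraMap k (Module.End k S)).injective p
    have h2 : (σ z - 1 : Module.End k S) ^ p = 0 := by
      rw [sub_pow_char_of_commute p (Commute.one_right _), ← map_pow, hzp, map_one, one_pow,
        sub_self]
    have h3 : Function.Injective ((σ z - 1 : Module.End k S) ^ p) := by
      rw [Module.End.coe_pow]
      exact h1.iterate p
    obtain ⟨v, hv⟩ := exists_ne (0 : S)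
    apply hv
    apply h3
    rw [h2]
    rfl
  · have h1 : s ∈ LinearMap.ker (σ z - 1) := by rw [h]; trivial
    rwa [LinearMap.mem_ker, LinearMap.sub_apply, Module.End.one_apply, sub_eq_zero] at h1

/-- The failure of `z` to act trivially gives an intertwiner from a twist of the head. -/
lemma Ext.exists_twist (hq : Loc ρ σ q) (hr : Ext ρ τ q r)
    (hz : ∀ g : Γ, ∃ i : ℕ, g * z * g⁻¹ = z ^ i) (hσ : ∀ s, σ z s = s) (hτ : ∀ s, τ z s = s)
    {ψ : Γ →* kˣ} (hψ : ∀ (g : Γ) (i : ℕ), g * z * g⁻¹ = z ^ i → (ψ g : k) = i) :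
    ∃ φ : S →ₗ[k] T, Eqv (tw ψ σ) τ φ ∧ ∀ v, φ (q v) = r (ρ z v) - r v := by
  have hmem : ∀ v, ρ z v - v ∈ LinearMap.ker q := fun v => by
    rw [LinearMap.mem_ker, map_sub, hq.eqv, hσ, sub_self]
  set u : M →ₗ[k] T := r ∘ₗ ρ z - r with hu
  have hu' : ∀ v, u v = r (ρ z v) - r v := fun v => by simp [hu]
  have hker : LinearMap.ker q ≤ LinearMap.ker u := fun v hv => by
    rw [LinearMap.mem_ker, hu', hr.eqv _ _ hv, hτ, sub_self]
  have hpow : ∀ (i : ℕ) v, ρ (z ^ i) v - v ∈ LinearMap.ker q ∧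
      r (ρ (z ^ i) v - v) = (i : k) • u v := by
    intro i
    induction i with
    | zero => intro v; simp
    | succ i ih =>
      intro v
      have h1 : ρ (z ^ (i + 1)) v - v = ρ z (ρ (z ^ i) v - v) + (ρ z v - v) := by
        rw [pow_succ', rep_mul_apply, map_sub]; abel
      rw [h1]
      refine ⟨add_mem (hq.eqv.ker _ _ (ih v).1) (hmem v), ?_⟩
      rw [map_add, hr.eqv _ _ (ih v).1, hτ, (ih v).2, map_sub, ← hu', Nat.cast_succ, add_smul,
        one_smul]
  have heq : Eqv (tw ψ ρ) τ u := by
    intro g v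
    obtain ⟨i, hi⟩ := conj_inv_of_conj hz g
    have h1 := hψ g⁻¹ i (by rw [inv_inv, hi])
    have h2 : u (ρ g v) = (i : k) • τ g (u v) := by
      rw [hu', ← map_sub, ← rep_mul_apply, show z * g = g * z ^ i by rw [← hi]; group,
        rep_mul_apply, ← map_sub, hr.eqv _ _ (hpow i v).1, (hpow i v).2, map_smul]
    rw [tw_apply, map_smul, h2, ← h1, smul_smul, ← Units.val_mul, ← map_mul, mul_inv_cancel,
      map_one, Units.val_one, one_smul]
  obtain ⟨φ, hφ⟩ := exists_factor hq.surj hker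
  have hq' : Eqv (tw ψ ρ) (tw ψ σ) q := fun g v => by
    rw [tw_apply, tw_apply, map_smul, hq.eqv]
  refine ⟨φ, Eqv.of_comp_surj hq.surj hq' (hφ ▸ heq), fun v => ?_⟩
  rw [← hu', ← hφ]
  rfl

variable {A : Type} [MulAction Γ A] [Fintype Γ] [Fintype A] {n : ℕ} {E : A → Γ → k} {a0 : A}
  {d : Γ}

/-- If the head is related to `T` by a nontrivial action of `z`, every extension by `T` sees a
nontrivial action of `z`. -/
theorem GData.no_trivial_ext [CharP k p] (hG : GData p n E a0 d) (hM : InMod (tot E) ρ)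
    (hq : Loc ρ σ q) (hr : Ext ρ τ q r) (hσ : ∀ s, σ (zG p n d) s = s)
    (hr0 : ∀ v, r (ρ (zG p n d) v) = r v) {r₁ : M →ₗ[k] T} (hr₁ : Ext ρ τ q r₁)
    {φ : S ≃ₗ[k] T} (hφd : ∀ s, φ (σ d s) = τ d (φ s))
    (hφ : ∀ v, φ (q v) = r₁ (ρ (zG p n d) v) - r₁ v) : False := by
  have := Fact.mk hG.prime
  obtain ⟨m, hm⟩ : ∃ m, p ^ (n - 1) = m + 1 :=
    ⟨p ^ (n - 1) - 1, (Nat.sub_add_cancel (Nat.pos_of_ne_zero (pow_ne_zero _ hG.prime.ne_zero))).symm⟩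
  have hMn : Nontrivial M := by
    have := hq.irr.1
    exact hq.surj.nontrivial
  have := hq.irr.1
  have hpow : ∀ {X : Type} [AddCommGroup X] [Module k X] [Nontrivial X] (κ : Representation k Γ X),
      (κ d - 1) ^ (m + 1) = κ (zG p n d) - 1 := by
    intro X _ _ _ κ
    have hc : CharP (Module.End k X) p :=
      charP_of_injective_algebraMap (algebraMap k (Module.End k X)).injective p
    rw [← hm, sub_pow_char_pow_of_commute _ _ (Commute.one_right _), one_pow, zG, map_pow]
  have hx : (σ d - 1) ^ (m + 1) = 0 := by
    rw [hpow σ]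
    ext s
    simp [hσ]
  have hxy : ∀ v, q ((ρ d - 1) v) = (σ d - 1) (q v) := fun v => by
    simp [hq.eqv d v]
  have hxyp : ∀ (i : ℕ) v, q (((ρ d - 1) ^ i) v) = ((σ d - 1) ^ i) (q v) := by
    intro i
    induction i with
    | zero => intro v; simp
    | succ i ih => intro v; rw [pow_succ', pow_succ', Module.End.mul_apply, Module.End.mul_apply,
        hxy, ih]
  have hfree : ∀ s, ((σ d - 1) ^ m) s = 0 → ∃ s', s = (σ d - 1) s' := by
    intro s hs
    obtain ⟨v, rfl⟩ := hq.surj s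
    have h1 : ((ρ d - 1) ^ m) v ∈ LinearMap.ker q := by rw [LinearMap.mem_ker, hxyp, hs]
    have h2 : φ (q v) = (τ d - 1) (r₁ (((ρ d - 1) ^ m) v)) := by
      have h3 := LinearMap.congr_fun (hpow ρ) v
      rw [pow_succ', Module.End.mul_apply] at h3
      simp only [LinearMap.sub_apply, Module.End.one_apply] at h3 ⊢
      rw [hφ, ← map_sub, ← h3, map_sub, hr₁.eqv _ _ h1]
    refine ⟨φ.symm (r₁ (((ρ d - 1) ^ m) v)), φ.injective ?_⟩
    rw [h2]
    simp only [LinearMap.sub_apply, Module.End.one_apply, map_sub, hφd, LinearEquiv.apply_symm_apply]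
  obtain ⟨f, hf, hf'⟩ := exists_section hq.surj hxy hx hfree
  have hmem : ∀ v, v - f (q v) ∈ LinearMap.ker q := fun v => by
    rw [LinearMap.mem_ker, map_sub, hf, sub_self]
  refine hG.no_split hM hq hr (f := r - r ∘ₗ f ∘ₗ q) (fun v => ?_) (fun v hv => ?_)
  · obtain ⟨w, hw⟩ := hf' (q v)
    have h1 : r ((f ((σ d - 1) (q v))) - (ρ d - 1) (f (q v))) = 0 := by
      rw [hw, hpow ρ, LinearMap.sub_apply, map_sub, hr0]
      simp
    simp only [LinearMap.sub_apply, Module.End.one_apply, map_sub] at h1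
    have h2 := hr.eqv d _ (hmem v)
    simp only [map_sub] at h2
    simp only [LinearMap.sub_apply, LinearMap.comp_apply, hq.eqv d v, map_sub, ← h2]
    rw [← sub_eq_zero]
    rw [← sub_eq_zero] at h1
    rw [← neg_eq_zero, ← h1]
    abel
  · rw [LinearMap.mem_ker] at hv
    simp [hv]

end Normal

section Push

variable {k : Type} [Field k] {Γ Δ A : Type} [Group Γ] [Group Δ] [Fintype Γ] [Fintype Δ]

/-- Push-forward of a group algebra element along a homomorphism. -/
def push (π : Γ →* Δ) (x : Γ → k) (w : Δ) : k := ∑ g, if π g = w then x g else 0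

lemma push_sum (π : Γ →* Δ) (x : Γ → k) {X : Type} [AddCommGroup X] [Module k X] (F : Δ → X) :
    ∑ w, push π x w • F w = ∑ g, x g • F (π g) := by
  simp only [push, Finset.sum_smul]
  rw [Finset.sum_comm]
  refine Finset.sum_congr rfl fun g _ => ?_
  simp [ite_smul]

lemma push_op {V : Type} [AddCommGroup V] [Module k V] (π : Γ →* Δ) (x : Γ → k)
    {ρ : Representation k Γ V} {κ : Representation k Δ V} (h : ∀ g, κ (π g) = ρ g) :
    op κ (push π x) = op ρ x := by
  rw [op, op, push_sum]
  simp only [h]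

omit [Fintype Δ] in
lemma push_conj (π : Γ →* Δ) {x y : Γ → k} {g : Γ} (h : ∀ w, y (g * w * g⁻¹) = x w) (w : Δ) :
    push π y (π g * w * (π g)⁻¹) = push π x w := by
  rw [push, push, ← Equiv.sum_comp (MulAut.conj g).toEquiv]
  refine Finset.sum_congr rfl fun v _ => ?_
  have h1 : π (g * v * g⁻¹) = π g * w * (π g)⁻¹ ↔ π v = w := by
    simp
  simp only [MulEquiv.toEquiv_eq_coe, MulEquiv.coe_toEquiv, MulAut.conj_apply, h, h1]

lemma CentralIdem.push {π : Γ →* Δ} (hπ : Function.Surjective π) {e : Γ → k}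
    (he : CentralIdem e) : CentralIdem (push π e) where
  conj g w := by
    obtain ⟨g, rfl⟩ := hπ g
    exact push_conj π (he.conj g) w
  idem F := by
    have h1 := push_sum π e F
    have h2 : ∀ u, ∑ v, CyclicBlock.push π e v * F (u * v) = ∑ v, e v * F (u * π v) := fun u => by
      simpa using push_sum π e (fun v => F (u * v))
    have h3 := push_sum π e (fun u => ∑ v, e v * F (u * π v))
    simp only [smul_eq_mul] at h1 h3
    rw [h1, ← he.idem (fun w => F (π w))]
    simp only [mul_assoc, ← Finset.mul_sum, h2, h3, map_mul]

omit [Fintype Δ] in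
lemma tot_push [Fintype A] (π : Γ →* Δ) (E : A → Γ → k) :
    tot (fun a => push π (E a)) = push π (tot E) := by
  funext w
  simp only [tot, push]
  rw [Finset.sum_comm]
  refine Finset.sum_congr rfl fun g _ => ?_
  by_cases h : π g = w <;> simp [h]

end Push

section Bar

variable {k : Type} [Field k] {Γ A : Type} [Group Γ] [MulAction Γ A]
variable {M S T : Type} [AddCommGroup M] [Module k M] [AddCommGroup S] [Module k S]
  [AddCommGroup T] [Module k T]
variable {ρ : Representation k Γ M} {σ : Representation k Γ S} {τ : Representation k Γ T}
  {q : M →ₗ[k] S} {r : M →ₗ[k] T}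

/-- The action of a quotient group. -/
@[reducible] def barAction (Z : Subgroup Γ) [Z.Normal] (h : ∀ z ∈ Z, ∀ a : A, z • a = a) :
    MulAction (Γ ⧸ Z) A :=
  MulAction.compHom A (QuotientGroup.lift Z (MulAction.toPermHom Γ A) fun z hz => by
    ext a; exact h z hz a)

/-- The representation of a quotient group. -/
def bar (Z : Subgroup Γ) [Z.Normal] (ρ : Representation k Γ M) (h : ∀ z ∈ Z, ρ z = 1) :
    Representation k (Γ ⧸ Z) M := QuotientGroup.lift Z ρ h

variable {Z : Subgroup Γ} [Z.Normal]

lemma Eqv.bar {f : M →ₗ[k] S} (hf : Eqv ρ σ f) (h : ∀ z ∈ Z, ρ z = 1) (h' : ∀ z ∈ Z, σ z = 1) :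
    Eqv (bar Z ρ h) (bar Z σ h') f := by
  rintro ⟨g⟩ v
  exact hf g v

lemma Inv.of_bar {h : ∀ z ∈ Z, ρ z = 1} {W : Submodule k M} (hW : Inv (bar Z ρ h) W) : Inv ρ W :=
  fun g v hv => hW (QuotientGroup.mk g) v hv

lemma Irr.bar (hσ : Irr σ) (h : ∀ z ∈ Z, σ z = 1) : Irr (bar Z σ h) :=
  ⟨hσ.1, fun _ hW => hσ.2 _ hW.of_bar⟩

lemma Loc.bar (hq : Loc ρ σ q) (h : ∀ z ∈ Z, ρ z = 1) (h' : ∀ z ∈ Z, σ z = 1) :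
    Loc (bar Z ρ h) (bar Z σ h') q where
  surj := hq.surj
  eqv := hq.eqv.bar h h'
  irr := hq.irr.bar h'
  le_ker W hW hne := hq.le_ker W hW.of_bar hne

lemma Ext.bar (hr : Ext ρ τ q r) (h : ∀ z ∈ Z, ρ z = 1) (h' : ∀ z ∈ Z, τ z = 1) :
    Ext (bar Z ρ h) (bar Z τ h') q r where
  irr := hr.irr.bar h'
  eqv := by
    rintro ⟨g⟩ v hv
    exact hr.eqv g v hv
  ne := hr.ne

lemma Loc.quo (hq : Loc ρ σ q) {N : Submodule k M} (hN : Inv ρ N) (hNq : N ≤ LinearMap.ker q) :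
    Loc (quoR ρ hN) σ (N.liftQ q hNq) where
  surj s := by
    obtain ⟨v, rfl⟩ := hq.surj s
    exact ⟨N.mkQ v, by simp⟩
  eqv g v := by
    obtain ⟨v, rfl⟩ := N.mkQ_surjective v
    exact hq.eqv g v
  irr := hq.irr
  le_ker W hW hne := by
    have h1 := hq.le_ker _ ((eqv_mkQ hN).comap hW) (fun h => hne (by
      rw [eq_top_iff]
      intro v _
      obtain ⟨v, rfl⟩ := N.mkQ_surjective v
      have : v ∈ W.comap N.mkQ := by rw [h]; trivial
      exact this))
    intro v hv
    obtain ⟨v, rfl⟩ := N.mkQ_surjective v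
    exact h1 hv

lemma Ext.quo (hr : Ext ρ τ q r) {N : Submodule k M} (hN : Inv ρ N) (hNq : N ≤ LinearMap.ker q)
    (hNr : N ≤ LinearMap.ker r) : Ext (quoR ρ hN) τ (N.liftQ q hNq) (N.liftQ r hNr) where
  irr := hr.irr
  eqv g v hv := by
    obtain ⟨v, rfl⟩ := N.mkQ_surjective v
    exact hr.eqv g v hv
  ne := by
    obtain ⟨v, hv, h⟩ := hr.ne
    exact ⟨N.mkQ v, by simpa using hv, by simpa using h⟩

lemma Ext.inv_inf (hq : Eqv ρ σ q) (hr : Ext ρ τ q r) :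
    Inv ρ (LinearMap.ker q ⊓ LinearMap.ker r) := fun g v hv =>
  ⟨hq.ker g v hv.1, by
    have h1 : r v = 0 := hv.2
    change r (ρ g v) = 0
    rw [hr.eqv g v hv.1, h1, map_zero]⟩

end Bar

section Quotient

variable {k : Type} [Field k] {Γ A : Type} [Group Γ] [MulAction Γ A] [Fintype Γ] [Fintype A]
variable {p n : ℕ} {E : A → Γ → k} {a0 : A} {d : Γ}

lemma zpowers_normal {z : Γ} (hz : ∀ g : Γ, ∃ i : ℕ, g * z * g⁻¹ = z ^ i) :
    (Subgroup.zpowers z).Normal := by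
  refine ⟨fun w hw g => ?_⟩
  obtain ⟨j, rfl⟩ := mem_powers_iff_mem_zpowers.2 hw
  obtain ⟨i, hi⟩ := hz g
  change g * z ^ j * g⁻¹ ∈ _
  rw [← conj_pow, hi]
  exact Subgroup.pow_mem _ (Subgroup.pow_mem _ (Subgroup.mem_zpowers z) _) _

omit [Fintype Γ] in
lemma GData.zG_mem (d : Γ) : zG p n d ∈ Subgroup.zpowers d :=
  Subgroup.pow_mem _ (Subgroup.mem_zpowers d) _

lemma GData.bar (hG : GData p (n + 1) E a0 d) [hN : (Subgroup.zpowers (zG p (n + 1) d)).Normal]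
    (hfix : ∀ z ∈ Subgroup.zpowers (zG p (n + 1) d), ∀ a : A, z • a = a) :
    letI := barAction (Subgroup.zpowers (zG p (n + 1) d)) hfix
    GData p n (fun a => push (QuotientGroup.mk' (Subgroup.zpowers (zG p (n + 1) d))) (E a)) a0
      (QuotientGroup.mk d) := by
  let := barAction (Subgroup.zpowers (zG p (n + 1) d)) hfix
  set Z := Subgroup.zpowers (zG p (n + 1) d) with hZ
  have hact : ∀ (g : Γ) (a : A), (QuotientGroup.mk g : Γ ⧸ Z) • a = g • a := fun _ _ => rfl
  refine ⟨hG.prime, fun a => ?_, ?_, ?_, ?_, ?_⟩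
  · obtain ⟨g, hg⟩ := hG.trans a
    exact ⟨QuotientGroup.mk g, hg⟩
  · rintro ⟨g⟩
    change (QuotientGroup.mk g : Γ ⧸ Z) • a0 = a0 ↔ (QuotientGroup.mk g : Γ ⧸ Z) ∈ _
    rw [hact, hG.stab]
    constructor
    · rintro ⟨i, rfl⟩
      exact ⟨i, rfl⟩
    · rintro ⟨i, hi⟩
      have h1 : (QuotientGroup.mk (d ^ i) : Γ ⧸ Z) = QuotientGroup.mk g := hi
      rw [QuotientGroup.eq] at h1
      have h2 : (d ^ i)⁻¹ * g ∈ Subgroup.zpowers d :=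
        (Subgroup.zpowers_le.2 (GData.zG_mem d)) h1
      have h3 := Subgroup.mul_mem _ (Subgroup.zpow_mem _ (Subgroup.mem_zpowers d) i) h2
      rwa [mul_inv_cancel_left] at h3
  · apply Nat.dvd_antisymm
    · apply orderOf_dvd_of_pow_eq_one
      change (QuotientGroup.mk (d ^ p ^ n) : Γ ⧸ Z) = 1
      rw [QuotientGroup.eq_one_iff]
      exact Subgroup.mem_zpowers (zG p (n + 1) d)
    · have h1 : (QuotientGroup.mk (d ^ orderOf (QuotientGroup.mk d : Γ ⧸ Z)) : Γ ⧸ Z) = 1 :=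
        pow_orderOf_eq_one (QuotientGroup.mk d : Γ ⧸ Z)
      rw [QuotientGroup.eq_one_iff] at h1
      obtain ⟨j, hj⟩ := mem_powers_iff_mem_zpowers.2 h1
      change zG p (n + 1) d ^ j = _ at hj
      have h2 : d ^ (orderOf (QuotientGroup.mk d : Γ ⧸ Z) * p) = 1 := by
        rw [pow_mul, ← hj, ← pow_mul, mul_comm, pow_mul, hG.z_pow, one_pow]
      have h3 := orderOf_dvd_of_pow_eq_one h2
      rw [hG.ord, pow_succ] at h3
      exact Nat.dvd_of_mul_dvd_mul_right hG.prime.pos h3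
  · rintro ⟨g⟩ a w
    exact push_conj (QuotientGroup.mk' Z) (hG.dat.eqv g a) w
  · have h1 := hG.dat.idem.push (QuotientGroup.mk'_surjective Z)
    rw [← tot_push] at h1
    exact h1

lemma GData.compat_bar (hG : GData p (n + 1) E a0 d)
    [hN : (Subgroup.zpowers (zG p (n + 1) d)).Normal]
    {ψ : Γ →* kˣ} (hψ : GData.Compat p (n + 1) d ψ)
    (h1 : ∀ z ∈ Subgroup.zpowers (zG p (n + 1) d), ψ z = 1) :
    GData.Compat p n (QuotientGroup.mk d : Γ ⧸ Subgroup.zpowers (zG p (n + 1) d))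
      (QuotientGroup.lift _ ψ h1) := by
  rintro hn ⟨g⟩ i hi
  change (ψ g : k) = i
  apply hψ n.succ_pos g i
  have h2 : (QuotientGroup.mk (g * d ^ p ^ (n - 1) * g⁻¹) :
      Γ ⧸ Subgroup.zpowers (zG p (n + 1) d)) = QuotientGroup.mk ((d ^ p ^ (n - 1)) ^ i) := hi
  rw [eq_comm, QuotientGroup.eq] at h2
  obtain ⟨j, hj⟩ := mem_powers_iff_mem_zpowers.2 h2
  change zG p (n + 1) d ^ j = _ at hj
  have h3 : zG p (n + 1) d = (d ^ p ^ (n - 1)) ^ p := by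
    rw [zG, ← pow_mul, ← pow_succ]
    congr 2
    omega
  have h4 : g * d ^ p ^ (n - 1) * g⁻¹ = (d ^ p ^ (n - 1)) ^ i * zG p (n + 1) d ^ j := by
    rw [hj]; group
  have h5 : Commute ((d ^ p ^ (n - 1)) ^ i) (zG p (n + 1) d ^ j) :=
    ((((Commute.refl d).pow_left _).pow_left _).pow_right _).pow_right _
  have h6 := congrArg (· ^ p) h4
  simp only [conj_pow, h5.mul_pow] at h6
  rw [← h3, ← pow_mul (zG p (n + 1) d) j p, mul_comm j p, pow_mul _ p j, hG.z_pow, one_pow,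
    mul_one, ← pow_mul, mul_comm i p, pow_mul, ← h3] at h6
  exact h6

end Quotient

/-- The two assertions about the second layer of local modules, for all data with stabiliser of
order `p ^ n`. -/
def LayerThm (k : Type) [Field k] (p n : ℕ) : Prop :=
  ∀ (Γ A : Type) [Group Γ] [MulAction Γ A] [Fintype Γ] [Fintype A] (E : A → Γ → k) (a0 : A) (d : Γ),
    GData p n E a0 d →
      (∀ ψ : Γ →* kˣ, GData.Compat p n d ψ → Nak₁ (tot E) ψ) ∧ Nak₂ (tot E)

variable {k : Type} [Field k] {p n : ℕ}

section Step

variable {Γ A : Type} [Group Γ] [MulAction Γ A] [Fintype Γ] [Fintype A]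
  {E : A → Γ → k} {a0 : A} {d : Γ}

lemma rep_zpowers {M : Type} [AddCommGroup M] [Module k M] {ρ : Representation k Γ M} {z : Γ}
    (h : ∀ v, ρ z v = v) : ∀ g ∈ Subgroup.zpowers z, ρ g = 1 := by
  intro g hg
  obtain ⟨i, rfl⟩ := mem_powers_iff_mem_zpowers.2 hg
  have h1 : ρ z = 1 := by ext v; exact h v
  change ρ (z ^ i) = 1
  rw [map_pow, h1, one_pow]

/-- The assertions for the quotient by the minimal subgroup, if that is normal, imply them for the
group itself. -/
theorem layer_of_normal [IsAlgClosed k] [CharP k p] (ih : LayerThm k p n)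
    (hG : GData p (n + 1) E a0 d) (hfix : ∀ a : A, zG p (n + 1) d • a = a) :
    (∀ ψ : Γ →* kˣ, GData.Compat p (n + 1) d ψ → Nak₁ (tot E) ψ) ∧ Nak₂ (tot E) := by
  have hz : ∀ g : Γ, ∃ i : ℕ, g * zG p (n + 1) d * g⁻¹ = zG p (n + 1) d ^ i := fun g =>
    hG.exists_conj n.succ_pos ((hG.mem_stabZ n.succ_pos).2 (hfix _))
  have hN := zpowers_normal hz
  have hfix' : ∀ z ∈ Subgroup.zpowers (zG p (n + 1) d), ∀ a : A, z • a = a := by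
    intro g hg a
    obtain ⟨i, rfl⟩ := mem_powers_iff_mem_zpowers.2 hg
    have h1 : zG p (n + 1) d ∈ MulAction.stabilizer Γ a := hfix a
    exact Subgroup.pow_mem _ h1 i
  have htriv : ∀ {S : Type} [AddCommGroup S] [Module k S] {σ : Representation k Γ S}, Irr σ →
      ∀ s, σ (zG p (n + 1) d) s = s := fun hσ => hσ.trivial_of_normal hG.prime hG.z_pow hz
  obtain ⟨ih₁, ih₂⟩ := @ih _ A _ (barAction _ hfix') _ _ _ _ _ (hG.bar hfix')
  rw [tot_push] at ih₁ ih₂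
  have hz1 : ∀ {ψ : Γ →* kˣ}, GData.Compat p (n + 1) d ψ →
      ∀ (g : Γ) (i : ℕ), g * zG p (n + 1) d * g⁻¹ = zG p (n + 1) d ^ i → (ψ g : k) = i :=
    fun hψ => hψ n.succ_pos
  have hone : ∀ {ψ : Γ →* kˣ}, GData.Compat p (n + 1) d ψ → ∀ g, Commute g (zG p (n + 1) d) →
      ψ g = 1 := by
    intro ψ hψ g hg
    ext
    rw [hz1 hψ g 1 (by rw [hg.eq]; group)]
    simp
  have hd : Commute d (zG p (n + 1) d) := (Commute.refl d).pow_right _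
  have hpsi : ∃ ψ : Γ →* kˣ, GData.Compat p (n + 1) d ψ := by
    obtain ⟨ψ, hψ⟩ := GData.exists_char (k := k) (hG.z_ord n.succ_pos) hz
    exact ⟨ψ, fun _ => hψ⟩
  have hinM : ∀ {M : Type} [AddCommGroup M] [Module k M] {ρ : Representation k Γ M},
      InMod (tot E) ρ → ∀ (h : ∀ g ∈ Subgroup.zpowers (zG p (n + 1) d), ρ g = 1),
      InMod (push (QuotientGroup.mk' _) (tot E)) (bar _ ρ h) := by
    intro M _ _ ρ hM h v
    rw [push_op (ρ := ρ) _ _ (fun g => rfl)]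
    exact hM v
  refine ⟨fun ψ hψ => ?_, ?_⟩
  · intro M S T _ _ _ _ _ _ _ _ _ ρ σ τ q r hM hq hr
    obtain ⟨φ, hφ, hφr⟩ := hr.exists_twist hq hz (htriv hq.irr) (htriv hr.irr) (hz1 hψ)
    by_cases h0 : φ = 0
    · have hu : ∀ v, r (ρ (zG p (n + 1) d) v) = r v := fun v => by
        have := hφr v
        rw [h0, LinearMap.zero_apply, eq_comm, sub_eq_zero] at this
        exact this
      have hNi := hr.inv_inf hq.eqv
      have hNt : ∀ v, quoR ρ hNi (zG p (n + 1) d) v = v := by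
        intro v
        obtain ⟨v, rfl⟩ := (LinearMap.ker q ⊓ LinearMap.ker r).mkQ_surjective v
        rw [← eqv_mkQ hNi, ← sub_eq_zero, ← map_sub, Submodule.mkQ_apply,
          Submodule.Quotient.mk_eq_zero]
        refine ⟨?_, ?_⟩
        · change q _ = 0
          rw [map_sub, hq.eqv, htriv hq.irr, sub_self]
        · change r _ = 0
          rw [map_sub, hu, sub_self]
      have hψ1 : ∀ z ∈ Subgroup.zpowers (zG p (n + 1) d), ψ z = 1 := by
        intro g hg
        obtain ⟨i, rfl⟩ := mem_powers_iff_mem_zpowers.2 hg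
        exact hone hψ _ ((Commute.refl _).pow_left i)
      obtain ⟨φ', hφ'⟩ := ih₁ _ (hG.compat_bar hψ hψ1) _ _ _ _ _ _ _ _
        (hinM (hM.quo hNi) (rep_zpowers hNt))
        ((hq.quo hNi inf_le_left).bar (rep_zpowers hNt) (rep_zpowers (htriv hq.irr)))
        ((hr.quo hNi inf_le_left inf_le_right).bar (rep_zpowers hNt) (rep_zpowers (htriv hr.irr)))
      exact ⟨φ', fun g s => hφ' (QuotientGroup.mk g) s⟩
    · obtain ⟨φ', rfl⟩ := Irr.equiv (hq.irr.tw (χ := ψ)) hr.irr hφ h0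
      exact ⟨φ', hφ⟩
  · intro M S T _ _ _ _ _ _ _ _ _ ρ σ τ q r₁ r₂ hM hq hr₁ hr₂
    obtain ⟨ψ, hψ⟩ := hpsi
    obtain ⟨φ₁, hφ₁, hφr₁⟩ := hr₁.exists_twist hq hz (htriv hq.irr) (htriv hr₁.irr) (hz1 hψ)
    obtain ⟨φ₂, hφ₂, hφr₂⟩ := hr₂.exists_twist hq hz (htriv hq.irr) (htriv hr₁.irr) (hz1 hψ)
    have hcomm : ∀ {φ : S →ₗ[k] T}, Eqv (tw ψ σ) τ φ → ∀ s, φ (σ d s) = τ d (φ s) := by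
      intro φ hφ s
      have := hφ d s
      rwa [tw_apply, hone hψ d hd, Units.val_one, one_smul] at this
    by_cases h1 : φ₁ = 0
    · have hu₁ : ∀ v, r₁ (ρ (zG p (n + 1) d) v) = r₁ v := fun v => by
        have := hφr₁ v
        rw [h1, LinearMap.zero_apply, eq_comm, sub_eq_zero] at this
        exact this
      by_cases h2 : φ₂ = 0
      · have hu₂ : ∀ v, r₂ (ρ (zG p (n + 1) d) v) = r₂ v := fun v => by
          have := hφr₂ v
          rw [h2, LinearMap.zero_apply, eq_comm, sub_eq_zero] at this
          exact this
        have hNi := (hr₁.inv_inf hq.eqv).inf (hr₂.inv_inf hq.eqv)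
        set N := (LinearMap.ker q ⊓ LinearMap.ker r₁) ⊓ (LinearMap.ker q ⊓ LinearMap.ker r₂)
        have hNq : N ≤ LinearMap.ker q := inf_le_left.trans inf_le_left
        have hN₁ : N ≤ LinearMap.ker r₁ := inf_le_left.trans inf_le_right
        have hN₂ : N ≤ LinearMap.ker r₂ := inf_le_right.trans inf_le_right
        have hNt : ∀ v, quoR ρ hNi (zG p (n + 1) d) v = v := by
          intro v
          obtain ⟨v, rfl⟩ := N.mkQ_surjective v
          rw [← eqv_mkQ hNi, ← sub_eq_zero, ← map_sub, Submodule.mkQ_apply,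
            Submodule.Quotient.mk_eq_zero]
          have hA : q (ρ (zG p (n + 1) d) v - v) = 0 := by
            rw [map_sub, hq.eqv, htriv hq.irr, sub_self]
          have hB : r₁ (ρ (zG p (n + 1) d) v - v) = 0 := by rw [map_sub, hu₁, sub_self]
          have hC : r₂ (ρ (zG p (n + 1) d) v - v) = 0 := by rw [map_sub, hu₂, sub_self]
          exact ⟨⟨hA, hB⟩, ⟨hA, hC⟩⟩
        obtain ⟨c, hc⟩ := ih₂ _ _ _ _ _ _ _ _ _
          (hinM (hM.quo hNi) (rep_zpowers hNt))
          ((hq.quo hNi hNq).bar (rep_zpowers hNt) (rep_zpowers (htriv hq.irr)))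
          ((hr₁.quo hNi hNq hN₁).bar (rep_zpowers hNt) (rep_zpowers (htriv hr₁.irr)))
          ((hr₂.quo hNi hNq hN₂).bar (rep_zpowers hNt) (rep_zpowers (htriv hr₁.irr)))
        refine ⟨c, fun v hv => ?_⟩
        have := hc (N.mkQ v) (by simpa using hv)
        simpa using this
      · obtain ⟨φ', rfl⟩ := Irr.equiv (hq.irr.tw (χ := ψ)) hr₁.irr hφ₂ h2
        exact (hG.no_trivial_ext hM hq hr₁ (htriv hq.irr) hu₁ hr₂ (hcomm hφ₂) hφr₂).elim
    · obtain ⟨φ', rfl⟩ := Irr.equiv (hq.irr.tw (χ := ψ)) hr₁.irr hφ₁ h1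
      obtain ⟨c, hc⟩ := hr₁.irr.schur (hφ₂.comp hφ₁.symm)
      have hc' : ∀ s, φ₂ s = c • φ' s := fun s => by
        have := LinearMap.congr_fun hc (φ' s)
        simpa using this
      refine ⟨c, ?_⟩
      by_contra! hcon
      have hr : Ext ρ τ q (r₂ - c • r₁) := by
        refine ⟨hr₁.irr, fun g v hv => ?_, ?_⟩
        · simp [hr₁.eqv g v hv, hr₂.eqv g v hv]
        · obtain ⟨v, hv, h⟩ := hcon
          exact ⟨v, hv, by simpa [sub_eq_zero] using h⟩
      refine hG.no_trivial_ext hM hq hr (htriv hq.irr) (fun v => ?_) hr₁ (hcomm hφ₁) hφr₁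
      have e1 := hφr₁ v
      have e2 := hφr₂ v
      rw [hc' (q v)] at e2
      rw [LinearEquiv.coe_coe] at e1
      rw [e1, eq_comm, smul_sub] at e2
      simp only [LinearMap.sub_apply, LinearMap.smul_apply]
      rw [← sub_eq_zero] at e2 ⊢
      rw [← e2]
      abel

end Step

section Local

variable {Γ A : Type} [Group Γ] [MulAction Γ A] [Fintype Γ] [Fintype A]
  {E : A → Γ → k} {a0 : A} {d z : Γ} {H : Subgroup Γ}

/-- The action of the stabiliser of the fixed points of `z` on them. -/
@[reducible] def fixAction (hG : Geo p a0 z H) : MulAction H {a : A // z • a = a} where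
  smul h a := ⟨(h : Γ) • a.1, (hG.fix_smul h.2 _).2 a.2⟩
  one_smul a := Subtype.ext (one_smul Γ a.1)
  mul_smul g h a := Subtype.ext (mul_smul (g : Γ) (h : Γ) a.1)

/-- The truncated family on the fixed points of `z`. -/
def fixFam (a0 : A) (z : Γ) (H : Subgroup Γ) (E : A → Γ → k) (a : {a : A // z • a = a}) (h : H) :
    k := EC a0 z E a h

lemma tot_fixFam [CharP k p] (hG : Geo p a0 z H) (hE : Dat E) :
    tot (fixFam a0 z H E) = eH z H E := by
  funext h
  rw [eH, eC_eq hG hE.eqv, tot, Finset.sum_subtype (p := fun a : A => z • a = a)]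
  · rfl
  · simp

lemma GData.fix [CharP k p] (hG : GData p n E a0 d) (hn : 0 < n) (hd : d ∈ hG.stabZ hn)
    (h0 : zG p n d • a0 = a0) :
    letI := fixAction (hG.geo hn)
    GData p n (fixFam a0 (zG p n d) (hG.stabZ hn) E) ⟨a0, h0⟩ ⟨d, hd⟩ := by
  let := fixAction (hG.geo hn)
  have hact : ∀ (h : hG.stabZ hn) (a : {a : A // zG p n d • a = a}),
      ((h • a : {a : A // zG p n d • a = a}) : A) = (h : Γ) • (a : A) := fun _ _ => rfl
  refine ⟨hG.prime, ?_, ?_, ?_, ?_, ?_⟩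
  · rintro ⟨a, ha⟩
    obtain ⟨g, rfl⟩ := hG.trans a
    exact ⟨⟨g, (hG.mem_stabZ hn).2 ha⟩, rfl⟩
  · rintro ⟨g, hg⟩
    rw [Subtype.ext_iff, hact]
    change g • a0 = a0 ↔ _
    rw [hG.stab]
    constructor
    · rintro ⟨i, hi⟩
      exact ⟨i, Subtype.ext hi⟩
    · rintro ⟨i, hi⟩
      exact ⟨i, congrArg Subtype.val hi⟩
  · rw [← hG.ord, ← Subgroup.orderOf_coe]
  · intro g a w
    exact EC_conj (hG.geo hn) hG.dat.eqv g a w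
  · rw [tot_fixFam (hG.geo hn) hG.dat]
    exact hG.dat.eH_idem (hG.geo hn)

theorem GData.exists_chains [IsAlgClosed k] [CharP k p] (ih : LayerThm k p n)
    (hG : GData p (n + 1) E a0 d) :
    ∃ χ : hG.stabZ n.succ_pos →* kˣ,
      HasChains (eH (zG p (n + 1) d) (hG.stabZ n.succ_pos) E) χ ∧
      ∀ ψ : Γ →* kˣ, GData.Compat p (n + 1) d ψ → ψ.comp (hG.stabZ n.succ_pos).subtype = χ := by
  have hgeo := hG.geo n.succ_pos
  have h0 : zG p (n + 1) d • a0 = a0 := hgeo.zfix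
  have hd0 : d • a0 = a0 := (hG.stab d).2 (Subgroup.mem_zpowers d)
  have hd : d ∈ hG.stabZ n.succ_pos := (hG.mem_stabZ n.succ_pos).2 (by rw [hd0, h0])
  let := fixAction hgeo
  have hF := hG.fix n.succ_pos hd h0
  have hzc : ((zG p (n + 1) (⟨d, hd⟩ : hG.stabZ n.succ_pos) : hG.stabZ n.succ_pos) : Γ)
      = zG p (n + 1) d := rfl
  obtain ⟨h₁, h₂⟩ := layer_of_normal ih hF (fun a => Subtype.ext a.2)
  have hconj : ∀ g : hG.stabZ n.succ_pos, ∃ i : ℕ,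
      g * zG p (n + 1) (⟨d, hd⟩ : hG.stabZ n.succ_pos) * g⁻¹ = zG p (n + 1) ⟨d, hd⟩ ^ i := by
    rintro ⟨g, hg⟩
    obtain ⟨i, hi⟩ := hG.exists_conj n.succ_pos hg
    exact ⟨i, Subtype.ext hi⟩
  obtain ⟨χ, hχ⟩ := GData.exists_char (k := k) (hF.z_ord n.succ_pos) hconj
  rw [tot_fixFam hgeo hG.dat] at h₁ h₂
  refine ⟨χ, hasChains_of_nak (hG.dat.eH_idem hgeo) (h₁ χ fun _ => hχ) h₂, fun ψ hψ => ?_⟩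
  ext g
  obtain ⟨i, hi⟩ := hconj g
  rw [hχ g i hi]
  exact hψ n.succ_pos g i (congrArg Subtype.val hi)

theorem GData.no_ext (hG : GData p 0 E a0 d) {M S T : Type} [AddCommGroup M] [Module k M]
    [AddCommGroup S] [Module k S] [AddCommGroup T] [Module k T]
    {ρ : Representation k Γ M} {σ : Representation k Γ S} {τ : Representation k Γ T}
    {q : M →ₗ[k] S} {r : M →ₗ[k] T} (hM : InMod (tot E) ρ) (hq : Loc ρ σ q) (hr : Ext ρ τ q r) :
    False := by
  have hd : d = 1 := by
    have := hG.ord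
    rwa [pow_zero, orderOf_eq_one_iff] at this
  exact hG.no_split hM hq hr (f := r) (fun v => by rw [hd]; simp) (fun _ _ => rfl)

end Local

theorem layerThm [IsAlgClosed k] [CharP k p] (n : ℕ) : LayerThm k p n := by
  induction n with
  | zero =>
    intro Γ A _ _ _ _ E a0 d hG
    refine ⟨fun ψ _ => ?_, ?_⟩
    · intro M S T _ _ _ _ _ _ _ _ _ ρ σ τ q r hM hq hr
      exact (hG.no_ext hM hq hr).elim
    · intro M S T _ _ _ _ _ _ _ _ _ ρ σ τ q r₁ r₂ hM hq hr _
      exact (hG.no_ext hM hq hr).elim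
  | succ n ih =>
    intro Γ A _ _ _ _ E a0 d hG
    obtain ⟨χ, hC, hχ⟩ := hG.exists_chains ih
    have hgeo := hG.geo n.succ_pos
    refine ⟨fun ψ hψ => ?_, ?_⟩
    · intro M S T _ _ _ _ _ _ _ _ _ ρ σ τ q r hM hq hr
      exact ext_twist hgeo hG.dat hC (hχ ψ hψ) hM hq hr
    · intro M S T _ _ _ _ _ _ _ _ _ ρ σ τ q r₁ r₂ hM hq hr₁ hr₂
      exact ext_unique hgeo hG.dat hC hM hq hr₁ hr₂

section Final

variable {Γ A : Type} [Group Γ] [MulAction Γ A] [Fintype Γ] [Fintype A]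
  {E : A → Γ → k} {a0 : A} {d : Γ}
variable {M S T T₁ T₂ T₃ : Type} [AddCommGroup M] [Module k M] [AddCommGroup S] [Module k S]
  [AddCommGroup T] [Module k T] [AddCommGroup T₁] [Module k T₁] [AddCommGroup T₂] [Module k T₂]
  [AddCommGroup T₃] [Module k T₃] [FiniteDimensional k M] [FiniteDimensional k S]
  [FiniteDimensional k T] [FiniteDimensional k T₁] [FiniteDimensional k T₂] [FiniteDimensional k T₃]
variable {ρ : Representation k Γ M} {σ : Representation k Γ S} {τ : Representation k Γ T}
  {τ₁ : Representation k Γ T₁} {τ₂ : Representation k Γ T₂} {τ₃ : Representation k Γ T₃}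
  {q : M →ₗ[k] S}

theorem GData.unique [IsAlgClosed k] [CharP k p] (hG : GData p n E a0 d) (hM : InMod (tot E) ρ)
    (hq : Loc ρ σ q) {r₁ r₂ : M →ₗ[k] T} (hr₁ : Ext ρ τ q r₁) (hr₂ : Ext ρ τ q r₂) :
    ∃ c : k, ∀ v ∈ LinearMap.ker q, r₂ v = c • r₁ v :=
  (layerThm n Γ A E a0 d hG).2 _ _ _ _ _ _ _ _ _ hM hq hr₁ hr₂

omit [FiniteDimensional k M] in
theorem GData.three [IsAlgClosed k] [CharP k p] (hG : GData p n E a0 d) (hM : InMod (tot E) ρ)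
    (hq : Loc ρ σ q) {r₁ : M →ₗ[k] T₁} {r₂ : M →ₗ[k] T₂} {r₃ : M →ₗ[k] T₃} (hr₁ : Ext ρ τ₁ q r₁)
    (hr₂ : Ext ρ τ₂ q r₂) (hr₃ : Ext ρ τ₃ q r₃) (h₁₂ : ¬ Iso τ₁ τ₂) (h₁₃ : ¬ Iso τ₁ τ₃)
    (h₂₃ : ¬ Iso τ₂ τ₃) : False := by
  rcases n with _ | n
  · exact hG.no_ext hM hq hr₁
  · obtain ⟨χ, hC, -⟩ := hG.exists_chains (layerThm n)
    exact ext_three (hG.geo n.succ_pos) hG.dat hC hM hq hr₁ hr₂ hr₃ h₁₂ h₁₃ h₂₃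

end Final

open ProfiniteBlocks

section LevelRep

variable {k : Type} [Field k] {G : Type} [Group G] [TopologicalSpace G]
variable {N : OpenNormalSubgroup G}

variable (k) in
/-- The elements of `k⟦G⟧` vanishing at level `N` annihilate `M`. -/
def LevelN (N : OpenNormalSubgroup G) (M : Type) [AddCommGroup M] [Module (CGA k G) M] : Prop :=
  ∀ x : CGA k G, projN k G N x = 0 → ∀ m : M, x • m = 0

variable {M : Type} [AddCommGroup M] [Module k M] [Module (CGA k G) M]
  [IsScalarTower k (CGA k G) M]

omit [Module k M] [IsScalarTower k (CGA k G) M] in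
lemma LevelN.congr (h : LevelN k N M) {x y : CGA k G} (hxy : projN k G N x = projN k G N y) (m : M) :
    x • m = y • m := by
  rw [← sub_eq_zero, ← sub_smul]
  apply h
  change projN k G N x - projN k G N y = 0
  rw [hxy, sub_self]

variable (k) in
/-- The projection to level `N`, as an algebra homomorphism. -/
def projHom (N : OpenNormalSubgroup G) : CGA k G →ₐ[k] MonoidAlgebra k (G ⧸ N.toSubgroup) :=
  (Pi.evalAlgHom k _ N).comp (CGA k G).val

lemma projHom_apply (x : CGA k G) : projHom k N x = projN k G N x := rfl

lemma projHom_ofG (g : G) :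
    projHom k N (ofG k G g) = MonoidAlgebra.single (g : G ⧸ N.toSubgroup) 1 := rfl

/-- The representation of `G/N` on a module of level `N`. -/
def LevelN.rep (h : LevelN k N M) : Representation k (G ⧸ N.toSubgroup) M where
  toFun w :=
    { toFun := fun m => ofG k G (Quotient.out w) • m
      map_add' := fun _ _ => smul_add _ _ _
      map_smul' := fun c m => by
        simp only [RingHom.id_apply]
        exact (smul_algebra_smul_comm c (ofG k G (Quotient.out w)) m) }
  map_one' := by
    ext m
    change ofG k G (Quotient.out (1 : G ⧸ N.toSubgroup)) • m = m
    rw [h.congr (y := 1) _ m, one_smul]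
    change MonoidAlgebra.single ((Quotient.out (1 : G ⧸ N.toSubgroup) : G) : G ⧸ N.toSubgroup) 1 = 1
    rw [QuotientGroup.out_eq']
    rfl
  map_mul' u v := by
    ext m
    change ofG k G (Quotient.out (u * v)) • m
      = ofG k G (Quotient.out u) • ofG k G (Quotient.out v) • m
    rw [← mul_smul, ← map_mul]
    apply h.congr
    change MonoidAlgebra.single ((Quotient.out (u * v) : G) : G ⧸ N.toSubgroup) 1
      = MonoidAlgebra.single ((Quotient.out u * Quotient.out v : G) : G ⧸ N.toSubgroup) 1
    rw [QuotientGroup.out_eq', QuotientGroup.mk_mul, QuotientGroup.out_eq', QuotientGroup.out_eq']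

lemma LevelN.rep_apply (h : LevelN k N M) (w : G ⧸ N.toSubgroup) (m : M) :
    h.rep w m = ofG k G (Quotient.out w) • m := rfl

variable [Fintype (G ⧸ N.toSubgroup)]

lemma LevelN.smul_eq (h : LevelN k N M) (x : CGA k G) (m : M) :
    x • m = op h.rep (fun w => (projN k G N x).coeff w) m := by
  rw [op_apply]
  simp only [h.rep_apply]
  have : x • m = (∑ w : G ⧸ N.toSubgroup,
      (projN k G N x).coeff w • ofG k G (Quotient.out w)) • m := by
    apply h.congr
    rw [← projHom_apply, ← projHom_apply, map_sum]
    simp only [map_smul, projHom_ofG, QuotientGroup.out_eq']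
    ext w
    simp [MonoidAlgebra.coeff_sum]
  rw [this, Finset.sum_smul]
  simp only [smul_assoc]

variable {T : Type} [AddCommGroup T] [Module k T] [Module (CGA k G) T]
  [IsScalarTower k (CGA k G) T]

omit [Fintype (G ⧸ N.toSubgroup)] in
lemma LevelN.eqv (hM : LevelN k N M) (hT : LevelN k N T) (f : M →ₗ[CGA k G] T) :
    Eqv hM.rep hT.rep (f.restrictScalars k) := fun _ _ => f.map_smul _ _

/-- The submodule given by an invariant subspace. -/
def LevelN.sub (h : LevelN k N M) (Z : Submodule k M) (hZ : Inv h.rep Z) :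
    Submodule (CGA k G) M where
  carrier := Z
  add_mem' := Z.add_mem
  zero_mem' := Z.zero_mem
  smul_mem' x m hm := by
    change x • m ∈ Z
    rw [h.smul_eq, op_apply]
    exact Z.sum_mem fun w _ => Z.smul_mem _ (hZ w m hm)

lemma LevelN.irr (h : LevelN k N M) (hM : IsSimpleModule (CGA k G) M) : Irr h.rep := by
  refine ⟨IsSimpleModule.nontrivial (CGA k G) M, fun Z hZ => ?_⟩
  rcases eq_bot_or_eq_top (h.sub Z hZ) with h0 | h0
  · left
    rw [eq_bot_iff]
    intro v hv
    have : v ∈ h.sub Z hZ := hv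
    rwa [h0] at this
  · right
    rw [eq_top_iff]
    intro v _
    have : v ∈ h.sub Z hZ := h0 ▸ Submodule.mem_top
    exact this

lemma LevelN.iso (hM : LevelN k N M) (hT : LevelN k N T) (h : Iso hM.rep hT.rep) :
    Nonempty (M ≃ₗ[CGA k G] T) := by
  obtain ⟨φ, hφ⟩ := h
  refine ⟨{ φ with map_smul' := fun x m => ?_ }⟩
  change φ.toLinearMap (x • m) = x • φ.toLinearMap m
  rw [hM.smul_eq, hT.smul_eq, hφ.op]

omit [IsScalarTower k (CGA k G) M] [Module k M] [Module k T] [IsScalarTower k (CGA k G) T]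
  [Fintype (G ⧸ N.toSubgroup)] in
lemma LevelN.of_surj (h : LevelN k N M) (f : M →ₗ[CGA k G] T) (hf : Function.Surjective f) :
    LevelN k N T := fun x hx t => by
  obtain ⟨m, rfl⟩ := hf t
  rw [← map_smul, h x hx, map_zero]

end LevelRep

section Family

variable {k : Type} {Γ : Type} [Group Γ]

/-- The conjugates of a group algebra element fixed by `Δ`, indexed by the cosets of `Δ`. -/
def conjFam (Δ : Subgroup Γ) (x : Γ → k) (a : Γ ⧸ Δ) (w : Γ) : k :=
  x ((Quotient.out a)⁻¹ * w * Quotient.out a)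

lemma conjFam_mk {Δ : Subgroup Γ} {x : Γ → k} (hx : ∀ h ∈ Δ, ∀ w, x (h⁻¹ * w * h) = x w) (g w : Γ) :
    conjFam Δ x (g : Γ ⧸ Δ) w = x (g⁻¹ * w * g) := by
  obtain ⟨h, hh⟩ := QuotientGroup.mk_out_eq_mul Δ g
  rw [conjFam, hh, ← hx h h.2 (g⁻¹ * w * g)]
  congr 1
  group

lemma gdata_conjFam [Field k] [Fintype Γ] {p n : ℕ} (hp : p.Prime) {d : Γ}
    (hd : orderOf d = p ^ n) {x : Γ → k}
    (hx : ∀ h ∈ Subgroup.zpowers d, ∀ w, x (h⁻¹ * w * h) = x w)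
    (he : CentralIdem (tot (conjFam (Subgroup.zpowers d) x))) :
    GData p n (conjFam (Subgroup.zpowers d) x) ((1 : Γ) : Γ ⧸ Subgroup.zpowers d) d where
  prime := hp
  trans a := by
    obtain ⟨g, rfl⟩ := QuotientGroup.mk_surjective a
    exact ⟨g, by rw [MulAction.Quotient.smul_coe, smul_eq_mul, mul_one]⟩
  stab g := by
    rw [MulAction.Quotient.smul_coe, smul_eq_mul, mul_one, eq_comm, QuotientGroup.eq, inv_one,
      one_mul]
  ord := hd
  dat :=
    { eqv := fun g a w => by
        obtain ⟨h, rfl⟩ := QuotientGroup.mk_surjective a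
        rw [MulAction.Quotient.smul_coe, smul_eq_mul, conjFam_mk hx, conjFam_mk hx]
        congr 1
        group
      idem := he }

end Family

section Defect

variable {k : Type} [Field k] {G : Type} [Group G] [TopologicalSpace G]
variable {N : OpenNormalSubgroup G} [Fintype (G ⧸ N.toSubgroup)]

lemma centralIdem_projN {e : CGA k G} (hc : e ∈ Set.center (CGA k G)) (hi : IsIdempotentElem e) :
    CentralIdem (fun w => (projN k G N e).coeff w) where
  conj g w := by
    obtain ⟨g, rfl⟩ := QuotientGroup.mk_surjective g
    have h := congrArg (projHom k N) (Set.mem_center_iff.1 hc |>.comm (ofG k G g))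
    rw [map_mul, map_mul, projHom_ofG, projHom_apply] at h
    have h1 := congrArg (fun y => y.coeff ((g : G ⧸ N.toSubgroup) * w)) h
    simp only [MonoidAlgebra.coeff_mul_single_apply, MonoidAlgebra.coeff_single_mul_apply] at h1
    simpa using h1
  idem F := by
    have h := congrArg (projHom k N) hi
    rw [map_mul, projHom_apply] at h
    have h1 := congrArg (fun y : MonoidAlgebra k (G ⧸ N.toSubgroup) => ∑ w, y.coeff w * F w) h
    simp only [MonoidAlgebra.coeff_mul_apply_left, Finsupp.sum_fintype, zero_mul,
      implies_true] at h1
    rw [← h1]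
    simp only [Finset.sum_mul]
    conv_rhs => rw [Finset.sum_comm]
    refine Finset.sum_congr rfl fun u _ => ?_
    conv_rhs => rw [← Equiv.sum_comp (Equiv.mulLeft u)]
    simp

omit [Fintype (G ⧸ N.toSubgroup)] in
lemma projN_conjAct (g : G) (x : CGA k G) (w : G ⧸ N.toSubgroup) :
    (projN k G N (conjAct k G g x)).coeff w
      = (projN k G N x).coeff ((g : G ⧸ N.toSubgroup)⁻¹ * w * g) := by
  have : projN k G N (conjAct k G g x)
      = projHom k N (ofG k G g) * projN k G N x * projHom k N (ofG k G g⁻¹) := rfl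
  rw [this, projHom_ofG, projHom_ofG, MonoidAlgebra.coeff_mul_single_apply,
    MonoidAlgebra.coeff_single_mul_apply]
  simp [mul_assoc]

lemma exists_gdata {p : ℕ} (hp : p.Prime) {e : CGA k G} (hc : e ∈ Set.center (CGA k G))
    (hi : IsIdempotentElem e) {D : Subgroup G} (he : e ∈ trImage k G (D ⊔ N.toSubgroup))
    {d : G ⧸ N.toSubgroup} (hd : D.map (QuotientGroup.mk' N.toSubgroup) = Subgroup.zpowers d)
    {m : ℕ} (hm : d ^ p ^ m = 1) :
    ∃ (n : ℕ) (x : G ⧸ N.toSubgroup → k),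
      tot (conjFam (Subgroup.zpowers d) x) = (fun w => (projN k G N e).coeff w) ∧
      GData p n (conjFam (Subgroup.zpowers d) x)
        ((1 : G ⧸ N.toSubgroup) : (G ⧸ N.toSubgroup) ⧸ Subgroup.zpowers d) d := by
  obtain ⟨x, hx, rfl⟩ := he
  obtain ⟨n, -, hn⟩ := (Nat.dvd_prime_pow hp).1 (orderOf_dvd_of_pow_eq_one hm)
  have hfix : ∀ h ∈ Subgroup.zpowers d, ∀ w,
      (projN k G N x).coeff (h⁻¹ * w * h) = (projN k G N x).coeff w := by
    intro h hh w
    rw [← hd] at hh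
    obtain ⟨g, hg, rfl⟩ := hh
    have := projN_conjAct (N := N) g x w
    rw [hx g (Subgroup.mem_sup_left hg)] at this
    exact this.symm
  have htot : tot (conjFam (Subgroup.zpowers d) fun w => (projN k G N x).coeff w)
      = fun w => (projN k G N (trMap k G (D ⊔ N.toSubgroup) x)).coeff w := by
    have hmem : ∀ g : G, g ∈ D ⊔ N.toSubgroup ↔ (g : G ⧸ N.toSubgroup) ∈ Subgroup.zpowers d := by
      intro g
      rw [← hd]
      change _ ↔ g ∈ (D.map (QuotientGroup.mk' N.toSubgroup)).comap (QuotientGroup.mk' N.toSubgroup)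
      rw [Subgroup.comap_map_eq, QuotientGroup.ker_mk']
    let f : G ⧸ (D ⊔ N.toSubgroup) → (G ⧸ N.toSubgroup) ⧸ Subgroup.zpowers d :=
      Quotient.map' (fun g => (g : G ⧸ N.toSubgroup)) fun a b hab => by
        rw [QuotientGroup.leftRel_apply] at hab ⊢
        exact (hmem _).1 hab
    have hf : ∀ g : G, f (g : G ⧸ (D ⊔ N.toSubgroup))
        = ((g : G ⧸ N.toSubgroup) : (G ⧸ N.toSubgroup) ⧸ Subgroup.zpowers d) := fun _ => rfl
    have hbij : Function.Bijective f := by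
      constructor
      · intro a b hab
        obtain ⟨a, rfl⟩ := QuotientGroup.mk_surjective a
        obtain ⟨b, rfl⟩ := QuotientGroup.mk_surjective b
        rw [hf, hf, QuotientGroup.eq] at hab
        rw [QuotientGroup.eq]
        exact (hmem _).2 hab
      · intro a
        obtain ⟨a, rfl⟩ := QuotientGroup.mk_surjective a
        obtain ⟨a, rfl⟩ := QuotientGroup.mk_surjective a
        exact ⟨a, rfl⟩
    have : Finite (G ⧸ (D ⊔ N.toSubgroup)) := Finite.of_injective f hbij.1
    have := Fintype.ofFinite (G ⧸ (D ⊔ N.toSubgroup))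
    ext w
    rw [trMap, finsum_eq_sum_of_fintype, ← projHom_apply (∑ i, _), map_sum, MonoidAlgebra.coeff_sum,
      Finsupp.finsetSum_apply, tot, ← hbij.sum_comp]
    refine Finset.sum_congr rfl fun c _ => ?_
    rw [projHom_apply, projN_conjAct]
    have hc : f c = (((Quotient.out c : G) : G ⧸ N.toSubgroup) :
        (G ⧸ N.toSubgroup) ⧸ Subgroup.zpowers d) := by
      rw [← hf, QuotientGroup.out_eq']
    rw [hc, conjFam_mk hfix]
  refine ⟨n, fun w => (projN k G N x).coeff w, htot, gdata_conjFam hp hn hfix ?_⟩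
  rw [htot]
  exact centralIdem_projN hc hi

end Defect

section CyclicImage

variable {G : Type} [Group G] [TopologicalSpace G]

lemma exists_gen {p : ℕ} [Fact p.Prime] {D : Subgroup G} (hD : IsCyclicProP G p D)
    (N : OpenNormalSubgroup G) :
    ∃ (d : D) (m : ℕ), (d : G) ^ p ^ m ∈ N.toSubgroup ∧
      ∀ g : D, ∃ j : ℕ, ((d ^ j)⁻¹ * g : G) ∈ N.toSubgroup := by
  rcases hD with ⟨hfin, hp, hc⟩ | ⟨φ, hφ⟩
  · obtain ⟨d, hd⟩ := hc.exists_generator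
    obtain ⟨m, hm⟩ := hp d
    refine ⟨d, m, ?_, fun g => ?_⟩
    · rw [← Subgroup.coe_pow, hm]
      exact N.toSubgroup.one_mem
    · obtain ⟨j, rfl⟩ := mem_powers_iff_mem_zpowers.2 (hd g)
      exact ⟨j, by simp [N.toSubgroup.one_mem]⟩
  · let f : Multiplicative ℤ_[p] →* D :=
      (MulEquiv.symm { φ.toEquiv with map_mul' := hφ } : Multiplicative ℤ_[p] ≃* D).toMonoidHom
    have hf : ∀ x, f x = φ.symm x := fun _ => rfl
    have hopen : IsOpen {x : ℤ_[p] | (φ.symm (Multiplicative.ofAdd x) : G) ∈ N.toSubgroup} := by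
      have h1 : Continuous fun x : ℤ_[p] => ((φ.symm (Multiplicative.ofAdd x) : D) : G) :=
        continuous_subtype_val.comp (φ.symm.continuous.comp continuous_ofAdd)
      exact N.toOpenSubgroup.isOpen.preimage h1
    have h0 : (0 : ℤ_[p]) ∈ {x : ℤ_[p] | (φ.symm (Multiplicative.ofAdd x) : G) ∈ N.toSubgroup} := by
      change ((f 1 : D) : G) ∈ N.toSubgroup
      rw [map_one]
      exact N.toSubgroup.one_mem
    obtain ⟨ε, hε, hball⟩ := Metric.isOpen_iff.1 hopen 0 h0
    obtain ⟨m, hm⟩ := PadicInt.exists_pow_neg_lt p hε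
    have key : ∀ x : ℤ_[p], x ∈ Ideal.span {(p : ℤ_[p]) ^ m} →
        ((f (Multiplicative.ofAdd x) : D) : G) ∈ N.toSubgroup := by
      intro x hx
      apply hball
      rw [mem_ball_zero_iff]
      exact lt_of_le_of_lt ((PadicInt.norm_le_pow_iff_mem_span_pow x m).2 hx) hm
    refine ⟨f (Multiplicative.ofAdd 1), m, ?_, fun g => ?_⟩
    · rw [← Subgroup.coe_pow, ← map_pow, ← ofAdd_nsmul]
      apply key
      simp
    · refine ⟨(φ g).toAdd.appr m, ?_⟩
      have h1 : g = f (φ g) := by rw [hf, φ.symm_apply_apply]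
      have h2 := key _ (PadicInt.appr_spec m (φ g).toAdd)
      have h3 : f (Multiplicative.ofAdd ((φ g).toAdd - ((φ g).toAdd.appr m : ℕ)))
          = (f (Multiplicative.ofAdd 1) ^ (φ g).toAdd.appr m)⁻¹ * g := by
        have h4 : Multiplicative.ofAdd ((φ g).toAdd - ((φ g).toAdd.appr m : ℕ))
            = (Multiplicative.ofAdd 1 ^ (φ g).toAdd.appr m)⁻¹ * φ g := by
          rw [← ofAdd_nsmul, ← ofAdd_neg, nsmul_one, sub_eq_neg_add, ofAdd_add, ofAdd_toAdd]
        rw [h4, map_mul, map_inv, map_pow, ← h1]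
      rw [h3] at h2
      simpa using h2

lemma exists_map_eq_zpowers {p : ℕ} [Fact p.Prime] {D : Subgroup G} (hD : IsCyclicProP G p D)
    (N : OpenNormalSubgroup G) :
    ∃ (d : G ⧸ N.toSubgroup) (m : ℕ),
      D.map (QuotientGroup.mk' N.toSubgroup) = Subgroup.zpowers d ∧ d ^ p ^ m = 1 := by
  obtain ⟨d, m, hm, h⟩ := exists_gen hD N
  refine ⟨QuotientGroup.mk' N.toSubgroup d, m, le_antisymm ?_ ?_, ?_⟩
  · rintro _ ⟨g, hg, rfl⟩
    obtain ⟨j, hj⟩ := h ⟨g, hg⟩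
    refine ⟨j, ?_⟩
    change (QuotientGroup.mk' N.toSubgroup d) ^ (j : ℤ) = _
    rw [zpow_natCast, ← map_pow]
    exact QuotientGroup.eq.2 hj
  · rw [Subgroup.zpowers_le]
    exact ⟨d, d.2, rfl⟩
  · rw [← map_pow]
    exact (QuotientGroup.eq_one_iff _).2 hm

end CyclicImage

section Level

variable {k : Type} [Field k] {G : Type} [Group G] [TopologicalSpace G]

lemma exists_projN_of_open {U : Set (CGA k G)} (hU : IsOpen U) (h0 : (0 : CGA k G) ∈ U) :
    ∃ N : OpenNormalSubgroup G, ∀ x : CGA k G, projN k G N x = 0 → x ∈ U := by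
  obtain ⟨V, hV, rfl⟩ := isOpen_induced_iff.1 hU
  obtain ⟨I, u, hu, hsub⟩ := isOpen_pi_iff.1 hV _ h0
  have : Nonempty (OpenNormalSubgroup G) :=
    ⟨{ toOpenSubgroup := ⊤, isNormal' := inferInstanceAs (⊤ : Subgroup G).Normal }⟩
  obtain ⟨N₀, hN₀⟩ : ∃ N₀ : OpenNormalSubgroup G, ∀ N ∈ I, N₀ ≤ N := by
    obtain ⟨N₀, h⟩ := Finset.exists_le (α := (OpenNormalSubgroup G)ᵒᵈ) (I.image OrderDual.toDual)
    exact ⟨OrderDual.ofDual N₀, fun N hN => h (OrderDual.toDual N) (by simpa using hN)⟩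
  refine ⟨N₀, fun x hx => hsub fun N hN => ?_⟩
  have hle : N₀ ≤ N := hN₀ N hN
  have h1 := x.2 _ _ hle
  have h2 : (x : ∀ N : OpenNormalSubgroup G, MonoidAlgebra k (G ⧸ N.toSubgroup)) N₀ = 0 := hx
  rw [h2, map_zero] at h1
  rw [← h1]
  exact (hu N hN).2

variable {P : Type} [AddCommGroup P] [Module k P] [Module (CGA k G) P]
  [IsScalarTower k (CGA k G) P] [TopologicalSpace P]

lemma exists_levelN [ContinuousSMul (CGA k G) P] (O : Submodule (CGA k G) P)
    (hO : IsOpen (O : Set P)) [FiniteDimensional k (P ⧸ O)] :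
    ∃ N : OpenNormalSubgroup G, LevelN k N (P ⧸ O) := by
  obtain ⟨s, hs⟩ := (Module.Finite.fg_top : (⊤ : Submodule k (P ⧸ O)).FG)
  have hopen : IsOpen (⋂ m ∈ s, {x : CGA k G | x • Quotient.out m ∈ O}) := by
    apply isOpen_biInter_finset
    intro m _
    exact hO.preimage (continuous_id.smul continuous_const)
  obtain ⟨N, hN⟩ := exists_projN_of_open hopen (by simp)
  refine ⟨N, fun x hx m => ?_⟩
  have hm : m ∈ Submodule.span k (s : Set (P ⧸ O)) := hs ▸ Submodule.mem_top
  induction hm using Submodule.span_induction with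
  | mem m hm =>
    have := Set.mem_iInter₂.1 (hN x hx) m hm
    have h1 : O.mkQ (x • Quotient.out m) = 0 := by
      rw [Submodule.mkQ_apply, Submodule.Quotient.mk_eq_zero]
      exact this
    rw [map_smul] at h1
    rw [← h1]
    congr 1
    exact (Quotient.out_eq' m).symm
  | zero => exact smul_zero x
  | add a b _ _ ha hb => rw [smul_add, ha, hb, add_zero]
  | smul c a _ ha => rw [smul_algebra_smul_comm, ha, smul_zero]

end Level

section Layer

variable {k : Type} [Field k] {G : Type} [Group G] [TopologicalSpace G]
variable {N : OpenNormalSubgroup G}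
variable {P : Type} [AddCommGroup P] [Module k P] [Module (CGA k G) P]
  [IsScalarTower k (CGA k G) P]
variable {R₀ O : Submodule (CGA k G) P}
variable {T : Type} [AddCommGroup T] [Module k T] [Module (CGA k G) T]
  [IsScalarTower k (CGA k G) T]

omit [Module k P] [IsScalarTower k (CGA k G) P] [Module k T] [IsScalarTower k (CGA k G) T] in
lemma LevelN.layer (hN : LevelN k N (P ⧸ O)) {f : R₀ →ₗ[CGA k G] T} (hf : Function.Surjective f)
    (hfO : ∀ x : R₀, (x : P) ∈ O → f x = 0) : LevelN k N T := fun x hx t => by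
  obtain ⟨a, rfl⟩ := hf t
  rw [← map_smul]
  apply hfO
  have := hN x hx (O.mkQ a)
  rwa [← map_smul, Submodule.mkQ_apply, Submodule.Quotient.mk_eq_zero] at this

lemma exists_extend_layer (f : R₀ →ₗ[CGA k G] T) (hO : O ≤ R₀)
    (hfO : ∀ x : R₀, (x : P) ∈ O → f x = 0) :
    ∃ r : P ⧸ O →ₗ[k] T, ∀ x : R₀, r (O.mkQ x) = f x := by
  obtain ⟨r, hr⟩ := LinearMap.exists_extend (p := R₀.restrictScalars k) (f.restrictScalars k)
  obtain ⟨s, hs⟩ := (O.mkQ.restrictScalars k).exists_rightInverse_of_surjective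
    (LinearMap.range_eq_top.2 O.mkQ_surjective)
  refine ⟨r ∘ₗ s, fun x => ?_⟩
  have hr' : ∀ y : R₀, r y = f y := fun y => LinearMap.congr_fun hr y
  have h1 : O.mkQ (s (O.mkQ x)) = O.mkQ x := LinearMap.congr_fun hs (O.mkQ x)
  have h2 : s (O.mkQ x) - x ∈ O := by
    rw [← Submodule.Quotient.mk_eq_zero, ← Submodule.mkQ_apply, map_sub, h1, sub_self]
  have h3 := hfO ⟨_, hO h2⟩ h2
  rw [← hr'] at h3
  change r (s (O.mkQ x)) = f x
  rw [← hr', ← sub_eq_zero, ← map_sub]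
  exact h3

lemma mem_ker_factor (hO : O ≤ R₀) (v : P ⧸ O) :
    v ∈ LinearMap.ker ((Submodule.factor hO).restrictScalars k) ↔ ∃ x : R₀, O.mkQ x = v := by
  obtain ⟨y, rfl⟩ := O.mkQ_surjective v
  constructor
  · intro h
    have h1 : Submodule.factor hO (O.mkQ y) = 0 := h
    rw [Submodule.factor_mk, Submodule.mkQ_apply, Submodule.Quotient.mk_eq_zero] at h1
    exact ⟨⟨y, h1⟩, rfl⟩
  · rintro ⟨x, hx⟩
    rw [← hx]
    change Submodule.factor hO (O.mkQ x) = 0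
    rw [Submodule.factor_mk, Submodule.mkQ_apply, Submodule.Quotient.mk_eq_zero]
    exact x.2

variable [Fintype (G ⧸ N.toSubgroup)]

lemma LevelN.loc (hN : LevelN k N (P ⧸ O)) (hO : O ≤ R₀) (hco : IsCoatom R₀)
    (hloc : ∀ W : Submodule (CGA k G) P, O ≤ W → W ≠ ⊤ → W ≤ R₀) :
    Loc hN.rep (hN.of_surj (Submodule.factor hO) (Submodule.factor_surjective hO)).rep
      ((Submodule.factor hO).restrictScalars k) where
  surj := Submodule.factor_surjective hO
  eqv := hN.eqv _ _
  irr := LevelN.irr _ (isSimpleModule_iff_isCoatom.2 hco)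
  le_ker Z hZ hne := by
    have h1 : (hN.sub Z hZ).comap O.mkQ ≤ R₀ := by
      apply hloc
      · intro x hx
        rw [Submodule.mem_comap, Submodule.mkQ_apply, (Submodule.Quotient.mk_eq_zero O).2 hx]
        exact Submodule.zero_mem _
      · intro h
        apply hne
        rw [eq_top_iff]
        intro v _
        obtain ⟨x, rfl⟩ := O.mkQ_surjective v
        have : x ∈ (hN.sub Z hZ).comap O.mkQ := h ▸ Submodule.mem_top
        exact this
    intro v hv
    obtain ⟨x, rfl⟩ := O.mkQ_surjective v
    exact (mem_ker_factor hO _).2 ⟨⟨x, h1 hv⟩, rfl⟩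

lemma LevelN.ext (hN : LevelN k N (P ⧸ O)) (hO : O ≤ R₀) {f : R₀ →ₗ[CGA k G] T}
    (hf : Function.Surjective f) (hfO : ∀ x : R₀, (x : P) ∈ O → f x = 0)
    (hT : IsSimpleModule (CGA k G) T) {r : P ⧸ O →ₗ[k] T} (hr : ∀ x : R₀, r (O.mkQ x) = f x) :
    Ext hN.rep (hN.layer hf hfO).rep ((Submodule.factor hO).restrictScalars k) r where
  irr := LevelN.irr _ hT
  eqv g v hv := by
    obtain ⟨x, rfl⟩ := (mem_ker_factor hO v).1 hv
    rw [LevelN.rep_apply, LevelN.rep_apply, hr, ← map_smul, ← map_smul]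
    exact hr (ofG k G (Quotient.out g) • x)
  ne := by
    have := IsSimpleModule.nontrivial (CGA k G) T
    obtain ⟨t, ht⟩ := exists_ne (0 : T)
    obtain ⟨x, rfl⟩ := hf t
    exact ⟨O.mkQ x, (mem_ker_factor hO _).2 ⟨x, rfl⟩, by rwa [hr]⟩

omit [Fintype (G ⧸ N.toSubgroup)] [IsScalarTower k (CGA k G) T] in
lemma finite_layer [FiniteDimensional k (P ⧸ O)] {f : R₀ →ₗ[CGA k G] T}
    (hf : Function.Surjective f) {r : P ⧸ O →ₗ[k] T} (hr : ∀ x : R₀, r (O.mkQ x) = f x) :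
    FiniteDimensional k T :=
  Module.Finite.of_surjective r fun t => by
    obtain ⟨x, rfl⟩ := hf t
    exact ⟨_, hr x⟩

lemma LevelN.inMod (hN : LevelN k N (P ⧸ O)) {e : CGA k G} (he : InBlock (CGA k G) (X := P) e) :
    InMod (fun w => (projN k G N e).coeff w) hN.rep := fun v => by
  rw [← hN.smul_eq]
  obtain ⟨x, rfl⟩ := O.mkQ_surjective v
  rw [← map_smul, he]

variable {p n : ℕ} [CharP k p] [IsAlgClosed k] {A : Type} [MulAction (G ⧸ N.toSubgroup) A]
  [Fintype A] {E : A → (G ⧸ N.toSubgroup) → k} {a₀ : A} {d : G ⧸ N.toSubgroup} {e : CGA k G}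
  [FiniteDimensional k (P ⧸ O)]

theorem ker_unique (hN : LevelN k N (P ⧸ O)) (hO : O ≤ R₀) (hco : IsCoatom R₀)
    (hloc : ∀ W : Submodule (CGA k G) P, O ≤ W → W ≠ ⊤ → W ≤ R₀)
    (he : InBlock (CGA k G) (X := P) e) (hG : GData p n E a₀ d)
    (hE : tot E = fun w => (projN k G N e).coeff w) (hT : IsSimpleModule (CGA k G) T)
    {f₁ f₂ : R₀ →ₗ[CGA k G] T} (hf₁ : Function.Surjective f₁) (hf₂ : Function.Surjective f₂)
    (hfO₁ : ∀ x : R₀, (x : P) ∈ O → f₁ x = 0) (hfO₂ : ∀ x : R₀, (x : P) ∈ O → f₂ x = 0) :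
    LinearMap.ker f₁ ≤ LinearMap.ker f₂ := by
  obtain ⟨r₁, hr₁⟩ := exists_extend_layer f₁ hO hfO₁
  obtain ⟨r₂, hr₂⟩ := exists_extend_layer f₂ hO hfO₂
  have := finite_layer hf₁ hr₁
  have : FiniteDimensional k (P ⧸ R₀) := Module.Finite.of_surjective
    ((Submodule.factor hO).restrictScalars k) (Submodule.factor_surjective hO)
  obtain ⟨c, hc⟩ := hG.unique (by rw [hE]; exact hN.inMod he) (hN.loc hO hco hloc)
    (hN.ext hO hf₁ hfO₁ hT hr₁) (hN.ext hO hf₂ hfO₂ hT hr₂)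
  intro x hx
  have h := hc _ ((mem_ker_factor hO _).2 ⟨x, rfl⟩)
  rw [hr₁, hr₂, LinearMap.mem_ker.1 hx, smul_zero] at h
  exact h

variable {T₁ T₂ T₃ : Type} [AddCommGroup T₁] [Module k T₁] [Module (CGA k G) T₁]
  [IsScalarTower k (CGA k G) T₁] [AddCommGroup T₂] [Module k T₂] [Module (CGA k G) T₂]
  [IsScalarTower k (CGA k G) T₂] [AddCommGroup T₃] [Module k T₃] [Module (CGA k G) T₃]
  [IsScalarTower k (CGA k G) T₃]

theorem no_three (hN : LevelN k N (P ⧸ O)) (hO : O ≤ R₀) (hco : IsCoatom R₀)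
    (hloc : ∀ W : Submodule (CGA k G) P, O ≤ W → W ≠ ⊤ → W ≤ R₀)
    (he : InBlock (CGA k G) (X := P) e) (hG : GData p n E a₀ d)
    (hE : tot E = fun w => (projN k G N e).coeff w) (hT₁ : IsSimpleModule (CGA k G) T₁)
    (hT₂ : IsSimpleModule (CGA k G) T₂) (hT₃ : IsSimpleModule (CGA k G) T₃)
    {f₁ : R₀ →ₗ[CGA k G] T₁} {f₂ : R₀ →ₗ[CGA k G] T₂} {f₃ : R₀ →ₗ[CGA k G] T₃}
    (hf₁ : Function.Surjective f₁) (hf₂ : Function.Surjective f₂) (hf₃ : Function.Surjective f₃)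
    (hfO₁ : ∀ x : R₀, (x : P) ∈ O → f₁ x = 0) (hfO₂ : ∀ x : R₀, (x : P) ∈ O → f₂ x = 0)
    (hfO₃ : ∀ x : R₀, (x : P) ∈ O → f₃ x = 0) (h₁₂ : IsEmpty (T₁ ≃ₗ[CGA k G] T₂))
    (h₁₃ : IsEmpty (T₁ ≃ₗ[CGA k G] T₃)) (h₂₃ : IsEmpty (T₂ ≃ₗ[CGA k G] T₃)) : False := by
  obtain ⟨r₁, hr₁⟩ := exists_extend_layer f₁ hO hfO₁
  obtain ⟨r₂, hr₂⟩ := exists_extend_layer f₂ hO hfO₂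
  obtain ⟨r₃, hr₃⟩ := exists_extend_layer f₃ hO hfO₃
  have := finite_layer hf₁ hr₁
  have := finite_layer hf₂ hr₂
  have := finite_layer hf₃ hr₃
  have : FiniteDimensional k (P ⧸ R₀) := Module.Finite.of_surjective
    ((Submodule.factor hO).restrictScalars k) (Submodule.factor_surjective hO)
  exact hG.three (by rw [hE]; exact hN.inMod he) (hN.loc hO hco hloc)
    (hN.ext hO hf₁ hfO₁ hT₁ hr₁) (hN.ext hO hf₂ hfO₂ hT₂ hr₂) (hN.ext hO hf₃ hfO₃ hT₃ hr₃)
    (fun h => (not_nonempty_iff.2 h₁₂) (LevelN.iso _ _ h))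
    (fun h => (not_nonempty_iff.2 h₁₃) (LevelN.iso _ _ h))
    (fun h => (not_nonempty_iff.2 h₂₃) (LevelN.iso _ _ h))

end Layer

section Pseudocompact

variable {k : Type} [Field k] {A : Type} [Ring A] [Algebra k A] [TopologicalSpace A]
  {X : Type} [AddCommGroup X] [Module k X] [Module A X] [IsScalarTower k A X]
  [TopologicalSpace X]

variable (k) in
/-- Open submodules of finite codimension. -/
abbrev OFD (V : Submodule A X) : Prop :=
  IsOpen (V : Set X) ∧ FiniteDimensional k (X ⧸ V.restrictScalars k)

omit [TopologicalSpace A] in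
lemma OFD.finite {V : Submodule A X} (h : OFD k V) : FiniteDimensional k (X ⧸ V) :=
  have := h.2
  Module.Finite.equiv (Submodule.Quotient.restrictScalarsEquiv k V)

omit [TopologicalSpace A] in
lemma OFD.mono [IsTopologicalAddGroup X] {V W : Submodule A X} (h : OFD k V) (hVW : V ≤ W) :
    OFD k W := by
  refine ⟨AddSubgroup.isOpen_mono (H₁ := V.toAddSubgroup) (H₂ := W.toAddSubgroup) hVW h.1, ?_⟩
  have := h.2
  have hle : V.restrictScalars k ≤ W.restrictScalars k := hVW
  exact Module.Finite.of_surjective (Submodule.factor hle) (Submodule.factor_surjective hle)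

omit [TopologicalSpace A] in
lemma isClosed_of_isOpen [IsTopologicalAddGroup X] {V : Submodule A X} (h : IsOpen (V : Set X)) :
    IsClosed (V : Set X) :=
  V.toAddSubgroup.isClosed_of_isOpen h

omit [TopologicalSpace A] [TopologicalSpace X] in
lemma mapQ'_mk {V W : Submodule A X} (h : V ≤ W) (x : X) :
    mapQ' V W LinearMap.id (Submodule.Quotient.mk x) = Submodule.Quotient.mk x := by
  have h' : V ≤ W.comap LinearMap.id := h
  rw [mapQ', dif_pos h']
  rfl

omit [Algebra k A] [TopologicalSpace A] [IsScalarTower k A X] [Module k X]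
  [TopologicalSpace X] in
lemma mk_eq_mk_iff {V : Submodule A X} {x y : X} :
    (Submodule.Quotient.mk x : X ⧸ V) = Submodule.Quotient.mk y ↔ x - y ∈ V :=
  Submodule.Quotient.eq V

lemma isPseudocompactMod_mk [T2Space X] [IsTopologicalAddGroup X] [ContinuousSMul A X]
    (hb : ∀ U ∈ nhds (0 : X), ∃ V : Submodule A X, OFD k V ∧ (V : Set X) ⊆ U)
    (hc : ∀ c : ∀ _ : {V : Submodule A X // OFD k V}, X,
      (∀ V W : {V : Submodule A X // OFD k V}, V.1 ≤ W.1 → c V - c W ∈ W.1) →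
      ∃ x, ∀ V, c V - x ∈ V.1) : IsPseudocompactMod k A X where
  t2 := inferInstance
  addGroup := inferInstance
  contSMul := inferInstance
  basis := ⟨fun U => ⟨fun hU => hb U hU, fun ⟨V, hV, hVU⟩ =>
    Filter.mem_of_superset (hV.1.mem_nhds V.zero_mem) hVU⟩⟩
  inf_bot := by
    rw [eq_bot_iff]
    intro x hx
    by_contra hne
    have hne : x ≠ 0 := hne
    obtain ⟨V, hV, hVU⟩ := hb _ (isOpen_compl_singleton.mem_nhds (Set.mem_compl_singleton_iff.2 hne.symm))
    exact hVU ((Submodule.mem_iInf _).1 ((Submodule.mem_iInf _).1 hx V) hV) rfl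
  complete c hcomp := by
    obtain ⟨x, hx⟩ := hc (fun V => Quotient.out (c V)) fun V W hVW => by
      have h := hcomp V W hVW
      rw [← mk_eq_mk_iff, ← mapQ'_mk hVW]
      have hV : (Submodule.Quotient.mk (Quotient.out (c V)) : X ⧸ V.1) = c V := Quotient.out_eq' _
      have hW : (Submodule.Quotient.mk (Quotient.out (c W)) : X ⧸ W.1) = c W := Quotient.out_eq' _
      rw [hV, hW, h]
    refine ⟨x, fun V => ?_⟩
    rw [← mk_eq_mk_iff.2 (hx V)]
    exact (Quotient.out_eq' _).symm

namespace IsPC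

lemma exists_ofd (hX : IsPseudocompactMod k A X) {U : Set X} (hU : U ∈ nhds (0 : X)) :
    ∃ V : Submodule A X, OFD k V ∧ (V : Set X) ⊆ U := hX.basis.mem_iff.1 hU

lemma ofd_inf (hX : IsPseudocompactMod k A X) {V W : Submodule A X} (hV : OFD k V) (hW : OFD k W) :
    OFD k (V ⊓ W) := by
  have := hX.addGroup
  obtain ⟨U, hU, hsub⟩ := exists_ofd hX ((hV.1.inter hW.1).mem_nhds ⟨V.zero_mem, W.zero_mem⟩)
  exact hU.mono hsub

lemma ofd_of_isOpen (hX : IsPseudocompactMod k A X) {V : Submodule A X} (hV : IsOpen (V : Set X)) :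
    OFD k V := by
  have := hX.addGroup
  obtain ⟨U, hU, hsub⟩ := exists_ofd hX (hV.mem_nhds V.zero_mem)
  exact hU.mono hsub

lemma eq_zero (hX : IsPseudocompactMod k A X) {x : X} (hx : ∀ V : Submodule A X, OFD k V → x ∈ V) :
    x = 0 := by
  have : x ∈ (⨅ (V : Submodule A X) (_ : OFD k V), V) :=
    (Submodule.mem_iInf _).2 fun V => (Submodule.mem_iInf _).2 fun hV => hx V hV
  rw [hX.inf_bot] at this
  exact this

lemma complete' (hX : IsPseudocompactMod k A X) (c : ∀ _ : {V : Submodule A X // OFD k V}, X)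
    (hc : ∀ V W : {V : Submodule A X // OFD k V}, V.1 ≤ W.1 → c V - c W ∈ W.1) :
    ∃ x, ∀ V, c V - x ∈ V.1 := by
  obtain ⟨x, hx⟩ := hX.complete (fun V => Submodule.Quotient.mk (c V)) fun V W h => by
    rw [mapQ'_mk h, mk_eq_mk_iff]
    exact hc V W h
  exact ⟨x, fun V => mk_eq_mk_iff.1 (hx V)⟩

lemma mem_of_isClosed (hX : IsPseudocompactMod k A X) {W : Submodule A X}
    (hW : IsClosed (W : Set X)) {x : X} (h : ∀ V : Submodule A X, OFD k V → ∃ w ∈ W, w - x ∈ V) :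
    x ∈ W := by
  have := hX.addGroup
  rw [← SetLike.mem_coe, ← hW.closure_eq, mem_closure_iff_nhds]
  intro U hU
  have h0 : (fun y => y + x) ⁻¹' U ∈ nhds (0 : X) :=
    (continuous_id.add continuous_const).continuousAt.preimage_mem_nhds (by simpa using hU)
  obtain ⟨V, hV, hsub⟩ := exists_ofd hX h0
  obtain ⟨w, hw, hwx⟩ := h V hV
  refine ⟨w, ?_, hw⟩
  have := hsub hwx
  simpa using this

/-- Sets of cosets of closed submodules which are directed downwards. -/
def DirCosets (𝓕 : Set (X × Submodule A X)) : Prop :=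
  (∀ c ∈ 𝓕, IsClosed (c.2 : Set X)) ∧
  ∀ c ∈ 𝓕, ∀ c' ∈ 𝓕, ∃ c'' ∈ 𝓕, (∀ z, z - c''.1 ∈ c''.2 → z - c.1 ∈ c.2 ∧ z - c'.1 ∈ c'.2)

omit [TopologicalSpace A] [TopologicalSpace X] in
lemma coset_le {x y : X} {V W : Submodule A X} (h : ∀ z, z - x ∈ V → z - y ∈ W) : V ≤ W := by
  intro v hv
  have h1 := h (v + x) (by simpa using hv)
  have h2 := h x (by simp)
  have := W.sub_mem h1 h2
  simpa using this

lemma exists_small (hX : IsPseudocompactMod k A X) {𝓕 : Set (X × Submodule A X)}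
    (hF : Maximal DirCosets 𝓕) (hne : 𝓕.Nonempty) {V : Submodule A X} (hV : OFD k V) :
    ∃ c ∈ 𝓕, c.2 ≤ V := by
  have := hX.addGroup
  have := hV.finite
  have : IsArtinian A (X ⧸ V) := isArtinian_of_tower k inferInstance
  obtain ⟨U, ⟨c, hc, rfl⟩, hmin⟩ := WellFounded.has_min (r := ((· < ·) : Submodule A (X ⧸ V) → _ → Prop))
    wellFounded_lt ((fun c : X × Submodule A X => c.2.map V.mkQ) '' 𝓕) (hne.image _)
  have hmeet : ∀ c' ∈ 𝓕, ∃ z, z - c'.1 ∈ c'.2 ∧ z - c.1 ∈ V := by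
    intro c' hc'
    obtain ⟨c'', hc'', hsub⟩ := hF.prop.2 c hc c' hc'
    have h1 : c''.2 ≤ c.2 := coset_le fun z hz => (hsub z hz).1
    have h2 : c''.2.map V.mkQ = c.2.map V.mkQ :=
      (Submodule.map_mono h1).eq_of_not_lt (hmin _ ⟨c'', hc'', rfl⟩)
    have h3 : c''.1 - c.1 ∈ c.2 := (hsub c''.1 (by simp)).1
    have h4 : V.mkQ (c''.1 - c.1) ∈ c''.2.map V.mkQ := h2 ▸ ⟨_, h3, rfl⟩
    obtain ⟨w, hw, hwe⟩ := h4
    refine ⟨c''.1 - w, (hsub _ ?_).2, ?_⟩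
    · simpa using c''.2.neg_mem hw
    · rw [← sub_eq_zero, ← map_sub, Submodule.mkQ_apply, Submodule.Quotient.mk_eq_zero] at hwe
      have := V.neg_mem hwe
      convert this using 1
      abel
  choose! z hz hzV using hmeet
  let new : X × Submodule A X → X × Submodule A X := fun c' => (z c', c'.2 ⊓ V)
  have hnew : ∀ c' ∈ 𝓕, ∀ y, y - (new c').1 ∈ (new c').2 ↔ y - c'.1 ∈ c'.2 ∧ y - c.1 ∈ V := by
    intro c' hc' y
    change y - z c' ∈ c'.2 ∧ y - z c' ∈ V ↔ _
    have e1 : y - c'.1 = (y - z c') + (z c' - c'.1) := by abel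
    have e2 : y - c.1 = (y - z c') + (z c' - c.1) := by abel
    rw [e1, e2, c'.2.add_mem_iff_left (hz c' hc'), V.add_mem_iff_left (hzV c' hc')]
  have hdir : DirCosets (𝓕 ∪ new '' 𝓕) := by
    have hall : ∀ a ∈ 𝓕 ∪ new '' 𝓕, ∃ b ∈ 𝓕, ∀ y, y - b.1 ∈ b.2 ∧ y - c.1 ∈ V → y - a.1 ∈ a.2 := by
      rintro a (ha | ⟨b, hb, rfl⟩)
      · exact ⟨a, ha, fun y hy => hy.1⟩
      · exact ⟨b, hb, fun y hy => (hnew b hb y).2 hy⟩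
    constructor
    · rintro a (ha | ⟨b, hb, rfl⟩)
      · exact hF.prop.1 a ha
      · exact (hF.prop.1 b hb).inter (isClosed_of_isOpen hV.1)
    · intro a ha a' ha'
      obtain ⟨b, hb, h⟩ := hall a ha
      obtain ⟨b', hb', h'⟩ := hall a' ha'
      obtain ⟨b'', hb'', h''⟩ := hF.prop.2 b hb b' hb'
      refine ⟨new b'', Or.inr ⟨b'', hb'', rfl⟩, fun y hy => ?_⟩
      have h3 := (hnew b'' hb'' y).1 hy
      exact ⟨h y ⟨(h'' y h3.1).1, h3.2⟩, h' y ⟨(h'' y h3.1).2, h3.2⟩⟩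
  have hmem := hF.le_of_ge hdir Set.subset_union_left (Or.inr ⟨c, hc, rfl⟩)
  exact ⟨new c, hmem, inf_le_right⟩

/-- Linear compactness. -/
lemma exists_mem_cosets (hX : IsPseudocompactMod k A X) {𝓕 : Set (X × Submodule A X)}
    (hF : DirCosets 𝓕) (hne : 𝓕.Nonempty) : ∃ z, ∀ c ∈ 𝓕, z - c.1 ∈ c.2 := by
  have := hX.addGroup
  obtain ⟨𝓜, hsub, hM⟩ := zorn_subset_nonempty {𝓕 : Set (X × Submodule A X) | DirCosets 𝓕}
    (fun C hC hchain _ => ⟨⋃₀ C, ⟨fun c ⟨s, hs, hc⟩ => (hC hs).1 c hc, by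
      rintro c ⟨s, hs, hc⟩ c' ⟨s', hs', hc'⟩
      obtain ⟨t, ht, hst, hst'⟩ := hchain.directedOn s hs s' hs'
      obtain ⟨c'', hc'', h⟩ := (hC ht).2 c (hst hc) c' (hst' hc')
      exact ⟨c'', ⟨t, ht, hc''⟩, h⟩⟩, fun s hs => Set.subset_sUnion_of_mem hs⟩) 𝓕 hF
  have hM : Maximal DirCosets 𝓜 := hM
  have hMne := hne.mono hsub
  have hsm : ∀ V : {V : Submodule A X // OFD k V}, ∃ c ∈ 𝓜, c.2 ≤ V.1 := fun V =>
    exists_small hX hM hMne V.2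
  choose c hcM hcV using hsm
  obtain ⟨x, hx⟩ := complete' hX (fun V => (c V).1) fun V W hVW => by
    obtain ⟨d, -, hd⟩ := hM.prop.2 _ (hcM V) _ (hcM W)
    have h1 := hd d.1 (by simp)
    have := W.1.sub_mem (hcV W h1.2) (hVW (hcV V h1.1))
    simpa using this
  refine ⟨x, fun a ha => mem_of_isClosed hX (hF.1 a ha) fun V hV => ?_⟩
  obtain ⟨d, -, hd⟩ := hM.prop.2 _ (hsub ha) _ (hcM ⟨V, hV⟩)
  have h1 := hd d.1 (by simp)
  refine ⟨d.1 - a.1, h1.1, ?_⟩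
  have := V.add_mem (hcV ⟨V, hV⟩ h1.2) (hx ⟨V, hV⟩)
  simpa using this

end IsPC

end Pseudocompact

namespace IsPC

section

variable {k : Type} [Field k] {A : Type} [Ring A] [Algebra k A] [TopologicalSpace A]
  {X : Type} [AddCommGroup X] [Module k X] [Module A X] [IsScalarTower k A X]
  [TopologicalSpace X]
  {Y : Type} [AddCommGroup Y] [Module k Y] [Module A Y] [IsScalarTower k A Y]
  [TopologicalSpace Y]

lemma ofd_top (hX : IsPseudocompactMod k A X) : OFD k (⊤ : Submodule A X) :=
  ofd_of_isOpen hX isOpen_univ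

lemma isClosed_map (hX : IsPseudocompactMod k A X) (hY : IsPseudocompactMod k A Y)
    (f : X →ₗ[A] Y) (hf : Continuous f) {W : Submodule A X} (hW : IsClosed (W : Set X)) :
    IsClosed (W.map f : Set Y) := by
  have := hX.addGroup
  have := hY.addGroup
  refine isClosed_of_closure_subset fun y hy => ?_
  have hex : ∀ V : {V : Submodule A Y // OFD k V}, ∃ w ∈ W, f w - y ∈ V.1 := by
    intro V
    have h0 : {z | z - y ∈ V.1} ∈ nhds y :=
      (continuous_id.sub continuous_const).continuousAt.preimage_mem_nhds
        (V.2.1.mem_nhds (by simp))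
    obtain ⟨z, hz, w, hw, rfl⟩ := mem_closure_iff_nhds.1 hy _ h0
    exact ⟨w, hw, hz⟩
  choose w hwW hwV using hex
  let c : {V : Submodule A Y // OFD k V} → X × Submodule A X :=
    fun V => (w V, W ⊓ V.1.comap f)
  have hle : ∀ V V' : {V : Submodule A Y // OFD k V}, V.1 ≤ V'.1 →
      ∀ z, z - (c V).1 ∈ (c V).2 → z - (c V').1 ∈ (c V').2 := by
    intro V V' h z hz
    refine ⟨?_, ?_⟩
    · have := W.add_mem hz.1 (W.sub_mem (hwW V) (hwW V'))
      simpa [c] using this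
    · have h1 : f (z - w V) ∈ V'.1 := h hz.2
      have := V'.1.add_mem h1 (V'.1.sub_mem (h (hwV V)) (hwV V'))
      simpa [c] using this
  obtain ⟨z, hz⟩ := exists_mem_cosets hX (𝓕 := Set.range c) ⟨by
      rintro _ ⟨V, rfl⟩
      exact hW.inter ((isClosed_of_isOpen V.2.1).preimage hf), by
      rintro _ ⟨V, rfl⟩ _ ⟨V', rfl⟩
      refine ⟨_, ⟨⟨V.1 ⊓ V'.1, ofd_inf hY V.2 V'.2⟩, rfl⟩, fun z hz => ⟨?_, ?_⟩⟩
      · exact hle _ V inf_le_left z hz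
      · exact hle _ V' inf_le_right z hz⟩ ⟨_, ⟨⟨⊤, ofd_top hY⟩, rfl⟩⟩
  refine ⟨z, ?_, ?_⟩
  · have h1 := (hz _ ⟨⟨⊤, ofd_top hY⟩, rfl⟩).1
    have := W.add_mem h1 (hwW ⟨⊤, ofd_top hY⟩)
    simpa [c] using this
  · rw [← sub_eq_zero]
    refine eq_zero hY fun V hV => ?_
    have h1 : f (z - w ⟨V, hV⟩) ∈ V := (hz _ ⟨⟨V, hV⟩, rfl⟩).2
    have := V.add_mem h1 (hwV ⟨V, hV⟩)
    simpa using this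

/-- Minimal closed supplements exist. -/
lemma exists_minimal_supplement (hX : IsPseudocompactMod k A X) {W P₀ : Submodule A X}
    (hW : IsClosed (W : Set X)) (hP₀ : IsClosed (P₀ : Set X)) (hsup : P₀ ⊔ W = ⊤) :
    ∃ Q ≤ P₀, IsClosed (Q : Set X) ∧ Q ⊔ W = ⊤ ∧
      ∀ Q' ≤ Q, IsClosed (Q' : Set X) → Q' ⊔ W = ⊤ → Q' = Q := by
  obtain ⟨Q, hQ, hmax⟩ := zorn_le_nonempty₀ (α := (Submodule A X)ᵒᵈ)
    {Q | IsClosed ((OrderDual.ofDual Q : Submodule A X) : Set X) ∧ OrderDual.ofDual Q ⊔ W = ⊤}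
    (by
      intro C hC hchain Q₀ hQ₀
      have hch : ∀ Q ∈ C, ∀ Q' ∈ C, ∃ Q'' ∈ C, OrderDual.ofDual Q'' ≤ OrderDual.ofDual Q ∧
          OrderDual.ofDual Q'' ≤ OrderDual.ofDual Q' := fun Q h Q' h' =>
        hchain.directedOn Q h Q' h'
      let S : Submodule A X := ⨅ Q ∈ C, OrderDual.ofDual Q
      refine ⟨OrderDual.toDual S, ⟨?_, ?_⟩, fun Q hQ => ?_⟩
      · have : (S : Set X) = ⋂ Q ∈ C, (OrderDual.ofDual Q : Submodule A X) := by
          simp [S]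
        change IsClosed (S : Set X)
        rw [this]
        exact isClosed_biInter fun Q hQ => (hC hQ).1
      · change S ⊔ W = ⊤
        rw [eq_top_iff]
        intro x _
        have hx : ∀ Q : C, ∃ y ∈ (OrderDual.ofDual Q.1 : Submodule A X), y - x ∈ W := by
          intro Q
          have : x ∈ OrderDual.ofDual Q.1 ⊔ W := (hC Q.2).2 ▸ Submodule.mem_top
          obtain ⟨y, hy, w, hw, rfl⟩ := Submodule.mem_sup.1 this
          exact ⟨y, hy, by simpa using hw⟩
        choose y hyQ hyW using hx
        let c : C → X × Submodule A X := fun Q => (y Q, OrderDual.ofDual Q.1 ⊓ W)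
        have hmem : ∀ Q z, z - (c Q).1 ∈ (c Q).2 ↔ z ∈ (OrderDual.ofDual Q.1 : Submodule A X) ∧
            z - x ∈ W := by
          intro Q z
          have e1 : z = (z - y Q) + y Q := by abel
          have e2 : z - x = (z - y Q) + (y Q - x) := by abel
          rw [e2, W.add_mem_iff_left (hyW Q)]
          change z - y Q ∈ (OrderDual.ofDual Q.1 : Submodule A X) ∧ z - y Q ∈ W ↔ _
          rw [Submodule.sub_mem_iff_left _ (hyQ Q)]
        obtain ⟨z, hz⟩ := exists_mem_cosets hX (𝓕 := Set.range c) ⟨by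
          rintro _ ⟨V, rfl⟩
          exact (hC V.2).1.inter hW, by
          rintro _ ⟨V, rfl⟩ _ ⟨V', rfl⟩
          obtain ⟨V'', h, h1, h2⟩ := hch _ V.2 _ V'.2
          refine ⟨_, ⟨⟨V'', h⟩, rfl⟩, fun z hz => ?_⟩
          have := (hmem _ _).1 hz
          exact ⟨(hmem _ _).2 ⟨h1 this.1, this.2⟩, (hmem _ _).2 ⟨h2 this.1, this.2⟩⟩⟩
          ⟨_, ⟨⟨Q₀, hQ₀⟩, rfl⟩⟩
        have hz' := fun Q => (hmem Q z).1 (hz _ ⟨Q, rfl⟩)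
        refine Submodule.mem_sup.2 ⟨z, ?_, x - z, ?_, by abel⟩
        · simp only [S, Submodule.mem_iInf]
          exact fun Q hQ => (hz' ⟨Q, hQ⟩).1
        · have := W.neg_mem (hz' ⟨Q₀, hQ₀⟩).2
          simpa using this
      · exact (biInf_le _ hQ : S ≤ _)) (OrderDual.toDual P₀) ⟨hP₀, hsup⟩
  exact ⟨OrderDual.ofDual Q, hQ, hmax.prop.1, hmax.prop.2, fun Q' hle hcl hs =>
    le_antisymm hle (hmax.le_of_ge (y := OrderDual.toDual Q') ⟨hcl, hs⟩ hle)⟩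

omit [TopologicalSpace A] [TopologicalSpace X] [TopologicalSpace Y] in
lemma finite_comap (f : X →ₗ[A] Y) (V : Submodule A Y)
    [FiniteDimensional k (Y ⧸ V.restrictScalars k)] :
    FiniteDimensional k (X ⧸ (V.comap f).restrictScalars k) := by
  let g : (X ⧸ (V.comap f).restrictScalars k) →ₗ[k] (Y ⧸ V.restrictScalars k) :=
    Submodule.mapQ _ _ (f.restrictScalars k) (fun _ h => h)
  refine Module.Finite.of_injective g ?_
  rw [injective_iff_map_eq_zero]
  intro x hx
  obtain ⟨x, rfl⟩ := Submodule.Quotient.mk_surjective _ x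
  have h1 : g (Submodule.Quotient.mk x) = Submodule.Quotient.mk (f x) := rfl
  rw [h1, Submodule.Quotient.mk_eq_zero] at hx
  rw [Submodule.Quotient.mk_eq_zero]
  exact hx

omit [TopologicalSpace A] in
lemma ofd_comap (f : X →ₗ[A] Y) (hf : Continuous f) {V : Submodule A Y} (hV : OFD k V) :
    OFD k (V.comap f) :=
  have := hV.2
  ⟨hV.1.preimage hf, finite_comap f V⟩

lemma of_isClosed (hX : IsPseudocompactMod k A X) {W : Submodule A X}
    (hW : IsClosed (W : Set X)) : IsPseudocompactMod k A W := by
  have := hX.addGroup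
  have := hX.t2
  have := hX.contSMul
  have hco : ∀ V : {V : Submodule A X // OFD k V}, OFD k (V.1.comap W.subtype) :=
    fun V => ofd_comap W.subtype continuous_subtype_val V.2
  have hsm : ∀ U ∈ nhds (0 : W), ∃ V : {V : Submodule A X // OFD k V},
      (V.1.comap W.subtype : Set W) ⊆ U := by
    intro U hU
    rw [nhds_subtype_eq_comap] at hU
    obtain ⟨U', hU', hsub⟩ := hU
    obtain ⟨V, hV, hVU⟩ := exists_ofd hX hU'
    exact ⟨⟨V, hV⟩, fun x hx => hsub (hVU hx)⟩
  have : IsTopologicalAddGroup W := inferInstanceAs (IsTopologicalAddGroup W.toAddSubgroup)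
  have : ContinuousSMul A W := ⟨by
    refine Continuous.subtype_mk ?_ _
    exact continuous_fst.smul (continuous_subtype_val.comp continuous_snd)⟩
  refine isPseudocompactMod_mk ?_ ?_
  · intro U hU
    obtain ⟨V, hV⟩ := hsm U hU
    exact ⟨_, hco V, hV⟩
  · intro c hc
    let d : {V : Submodule A X // OFD k V} → X × Submodule A X :=
      fun V => (c ⟨_, hco V⟩, W ⊓ V.1)
    have hle : ∀ V V' : {V : Submodule A X // OFD k V}, V.1 ≤ V'.1 →
        ∀ z, z - (d V).1 ∈ (d V).2 → z - (d V').1 ∈ (d V').2 := by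
      intro V V' h z hz
      have h1 := hc ⟨_, hco V⟩ ⟨_, hco V'⟩ (Submodule.comap_mono h)
      have e : z - (d V').1 = (z - (d V).1) + ((d V).1 - (d V').1) := by abel
      rw [e]
      exact add_mem ⟨hz.1, h hz.2⟩ ⟨W.sub_mem (c _).2 (c _).2, h1⟩
    obtain ⟨z, hz⟩ := exists_mem_cosets hX (𝓕 := Set.range d) ⟨by
        rintro _ ⟨V, rfl⟩
        exact hW.inter (isClosed_of_isOpen V.2.1), by
        rintro _ ⟨V, rfl⟩ _ ⟨V', rfl⟩
        refine ⟨_, ⟨⟨V.1 ⊓ V'.1, ofd_inf hX V.2 V'.2⟩, rfl⟩, fun z hz => ⟨?_, ?_⟩⟩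
        · exact hle _ V inf_le_left z hz
        · exact hle _ V' inf_le_right z hz⟩ ⟨_, ⟨⟨⊤, ofd_top hX⟩, rfl⟩⟩
    have hzW : z ∈ W := by
      have := W.add_mem (hz _ ⟨⟨⊤, ofd_top hX⟩, rfl⟩).1 (c ⟨_, hco ⟨⊤, ofd_top hX⟩⟩).2
      simpa [d] using this
    refine ⟨⟨z, hzW⟩, fun V => ?_⟩
    obtain ⟨U, hU⟩ := hsm _ (V.2.1.mem_nhds V.1.zero_mem)
    have h1 : c ⟨_, hco U⟩ - c V ∈ V.1 := hc _ _ hU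
    have h2 : (⟨z, hzW⟩ - c ⟨_, hco U⟩ : W) ∈ V.1 := hU (hz _ ⟨U, rfl⟩).2
    have := V.1.neg_mem (V.1.add_mem h2 h1)
    simpa using this

lemma prod (hX : IsPseudocompactMod k A X) (hY : IsPseudocompactMod k A Y) :
    IsPseudocompactMod k A (X × Y) := by
  have := hX.addGroup
  have := hX.t2
  have := hX.contSMul
  have := hY.addGroup
  have := hY.t2
  have := hY.contSMul
  have hprod : ∀ {V : Submodule A X} {V' : Submodule A Y}, OFD k V → OFD k V' →
      OFD k (V.prod V') := by
    intro V V' hV hV'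
    have := hV.finite
    have := hV'.finite
    refine ⟨hV.1.prod hV'.1, ?_⟩
    let f : (X × Y) →ₗ[A] (X ⧸ V) × (Y ⧸ V') := V.mkQ.prodMap V'.mkQ
    have h1 : V.prod V' = (⊥ : Submodule A ((X ⧸ V) × (Y ⧸ V'))).comap f := by
      ext ⟨x, y⟩
      simp [f]
    rw [h1]
    exact finite_comap f ⊥
  have hsm : ∀ U ∈ nhds (0 : X × Y), ∃ (V : Submodule A X) (V' : Submodule A Y), OFD k V ∧
      OFD k V' ∧ (V.prod V' : Set (X × Y)) ⊆ U := by
    intro U hU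
    obtain ⟨S, hS, S', hS', hsub⟩ := mem_nhds_prod_iff.1 hU
    obtain ⟨V, hV, hVS⟩ := exists_ofd hX hS
    obtain ⟨V', hV', hVS'⟩ := exists_ofd hY hS'
    exact ⟨V, V', hV, hV', fun x hx => hsub ⟨hVS hx.1, hVS' hx.2⟩⟩
  refine isPseudocompactMod_mk ?_ ?_
  · intro U hU
    obtain ⟨V, V', hV, hV', h⟩ := hsm U hU
    exact ⟨_, hprod hV hV', h⟩
  · intro c hc
    obtain ⟨x, hx⟩ := complete' hX (fun V => (c ⟨_, hprod V.2 (ofd_top hY)⟩).1) fun V W h =>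
      (hc ⟨_, hprod V.2 (ofd_top hY)⟩ ⟨_, hprod W.2 (ofd_top hY)⟩
        (Submodule.prod_mono h le_rfl)).1
    obtain ⟨y, hy⟩ := complete' hY (fun V => (c ⟨_, hprod (ofd_top hX) V.2⟩).2) fun V W h =>
      (hc ⟨_, hprod (ofd_top hX) V.2⟩ ⟨_, hprod (ofd_top hX) W.2⟩
        (Submodule.prod_mono le_rfl h)).2
    refine ⟨(x, y), fun U => ?_⟩
    obtain ⟨V, V', hV, hV', h⟩ := hsm _ (U.2.1.mem_nhds U.1.zero_mem)
    have h1 := hc ⟨_, hprod hV hV'⟩ U h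
    have h2 := (hc ⟨_, hprod hV hV'⟩ ⟨_, hprod hV (ofd_top hY)⟩
      (Submodule.prod_mono le_rfl le_top)).1
    have h3 := (hc ⟨_, hprod hV hV'⟩ ⟨_, hprod (ofd_top hX) hV'⟩
      (Submodule.prod_mono le_top le_rfl)).2
    have h4 : c ⟨_, hprod hV hV'⟩ - (x, y) ∈ V.prod V' := by
      refine ⟨?_, ?_⟩
      · have := V.add_mem h2 (hx ⟨V, hV⟩)
        simpa using this
      · have := V'.add_mem h3 (hy ⟨V', hV'⟩)
        simpa using this
    have := U.1.sub_mem (h h4) h1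
    simpa using this

end

end IsPC

section Local

variable {k : Type} [Field k] {G : Type} [Group G] [TopologicalSpace G]
  {P : Type} [AddCommGroup P] [Module k P] [Module (CGA k G) P]
  [IsScalarTower k (CGA k G) P] [TopologicalSpace P]

/-- A continuous splitting of the addition map `P' × W' → P`. -/
lemma exists_splitting (hP : IsPseudocompactMod k (CGA k G) P) (hproj : IsPCProjective k G P)
    {Q W : Submodule (CGA k G) P} (hQ : IsClosed (Q : Set P)) (hW : IsClosed (W : Set P))
    (hsup : Q ⊔ W = ⊤) : ∃ π ω : P →ₗ[CGA k G] P, Continuous π ∧ Continuous ω ∧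
      (∀ x, π x ∈ Q) ∧ (∀ x, ω x ∈ W) ∧ ∀ x, π x + ω x = x := by
  have := hP.addGroup
  obtain ⟨s, hs, hsplit⟩ := hproj (Q × W) (IsPC.prod (IsPC.of_isClosed hP hQ) (IsPC.of_isClosed hP hW))
    (Q.subtype.coprod W.subtype)
    ((continuous_subtype_val.comp continuous_fst).add (continuous_subtype_val.comp continuous_snd))
    (by
      intro x
      obtain ⟨a, ha, b, hb, rfl⟩ := Submodule.mem_sup.1 (hsup ▸ Submodule.mem_top : x ∈ Q ⊔ W)
      exact ⟨(⟨a, ha⟩, ⟨b, hb⟩), rfl⟩)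
  exact ⟨Q.subtype ∘ₗ LinearMap.fst _ _ _ ∘ₗ s, W.subtype ∘ₗ LinearMap.snd _ _ _ ∘ₗ s,
    continuous_subtype_val.comp (continuous_fst.comp hs),
    continuous_subtype_val.comp (continuous_snd.comp hs),
    fun x => (s x).1.2, fun x => (s x).2.2, fun x => LinearMap.congr_fun hsplit x⟩

lemma map_eq_zero_of_splitting (hP : IsPseudocompactMod k (CGA k G) P)
    {Q W : Submodule (CGA k G) P} (hQ : IsClosed (Q : Set P)) (hW : IsClosed (W : Set P))
    (hQmin : ∀ Q' ≤ Q, IsClosed (Q' : Set P) → Q' ⊔ W = ⊤ → Q' = Q)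
    (hWmin : ∀ W' ≤ W, IsClosed (W' : Set P) → W' ⊔ Q = ⊤ → W' = W)
    (hsup : Q ⊔ W = ⊤) {π ω : P →ₗ[CGA k G] P} (hωc : Continuous ω)
    (hπ : ∀ x, π x ∈ Q) (hω : ∀ x, ω x ∈ W) (hπω : ∀ x, π x + ω x = x) :
    ∀ y ∈ Q, ω y = 0 := by
  have := hP.addGroup
  have := hP.t2
  have h1 : W.map ω = W := by
    refine hWmin _ (by rintro _ ⟨x, -, rfl⟩; exact hω x) (IsPC.isClosed_map hP hP ω hωc hW) ?_
    rw [eq_top_iff, ← hsup]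
    refine sup_le le_sup_right fun x hx => ?_
    rw [← hπω x]
    exact add_mem (Submodule.mem_sup_right (hπ x)) (Submodule.mem_sup_left ⟨x, hx, rfl⟩)
  have hker : IsClosed (LinearMap.ker ω : Set P) := isClosed_singleton.preimage hωc
  have h2 : Q ⊓ LinearMap.ker ω = Q := by
    refine hQmin _ inf_le_left (hQ.inter hker) ?_
    rw [eq_top_iff, ← hsup]
    refine sup_le (fun y hy => ?_) le_sup_right
    obtain ⟨b, hb, hbe⟩ : ω y ∈ W.map ω := by rw [h1]; exact hω y
    have h3 : ω (y - b) = 0 := by rw [map_sub, hbe, sub_self]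
    have h4 : y - b ∈ Q := by
      rw [← hπω (y - b), h3, add_zero]
      exact hπ _
    have := add_mem (Submodule.mem_sup_left (T := W) (Submodule.mem_inf.2 ⟨h4, LinearMap.mem_ker.2 h3⟩))
      (Submodule.mem_sup_right hb)
    simpa using this
  intro y hy
  rw [← h2] at hy
  exact hy.2

/-- An indecomposable projective module is not the sum of two proper closed submodules. -/
lemma eq_top_or_eq_top (hP : IsPseudocompactMod k (CGA k G) P) (hproj : IsPCProjective k G P)
    (hind : IsIndecTop (CGA k G) P) {P₀ W : Submodule (CGA k G) P}
    (hP₀ : IsClosed (P₀ : Set P)) (hW : IsClosed (W : Set P)) (hsup : P₀ ⊔ W = ⊤) :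
    P₀ = ⊤ ∨ W = ⊤ := by
  obtain ⟨Q, hQP, hQ, hQW, hQmin⟩ := IsPC.exists_minimal_supplement hP hW hP₀ hsup
  obtain ⟨W', hWW, hW', hWQ, hWmin⟩ :=
    IsPC.exists_minimal_supplement hP hQ hW (by rw [sup_comm]; exact hQW)
  have hQmin' : ∀ Q' ≤ Q, IsClosed (Q' : Set P) → Q' ⊔ W' = ⊤ → Q' = Q := fun Q' hle hcl hs =>
    hQmin Q' hle hcl (eq_top_iff.2 (hs ▸ sup_le_sup le_rfl hWW))
  have hQW' : Q ⊔ W' = ⊤ := by rw [sup_comm]; exact hWQ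
  obtain ⟨π, ω, hπc, hωc, hπ, hω, hπω⟩ := exists_splitting hP hproj hQ hW' hQW'
  have h1 := map_eq_zero_of_splitting hP hQ hW' hQmin' hWmin hQW' hωc hπ hω hπω
  have h2 := map_eq_zero_of_splitting hP hW' hQ hWmin hQmin' hWQ hπc hω hπ
    (fun x => by rw [add_comm]; exact hπω x)
  have hcompl : IsCompl Q W' := by
    refine ⟨disjoint_iff.2 (eq_bot_iff.2 fun x hx => ?_), codisjoint_iff.2 hQW'⟩
    have := hπω x
    rw [h1 x hx.1, h2 x hx.2, add_zero] at this
    exact this.symm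
  rcases hind.2 Q W' hQ hW' hcompl with h | h
  · right
    rw [h, sup_bot_eq] at hWQ
    exact eq_top_iff.2 (hWQ ▸ hWW)
  · left
    rw [h, sup_bot_eq] at hQW'
    exact eq_top_iff.2 (hQW' ▸ hQP)

lemma exists_largest_open (hP : IsPseudocompactMod k (CGA k G) P) (hproj : IsPCProjective k G P)
    (hind : IsIndecTop (CGA k G) P) : ∃ R₀ : Submodule (CGA k G) P, IsCoatom R₀ ∧
      IsOpen (R₀ : Set P) ∧ ∀ W : Submodule (CGA k G) P, IsOpen (W : Set P) → W ≠ ⊤ → W ≤ R₀ := by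
  have := hP.addGroup
  obtain ⟨x, hx⟩ := @exists_ne P hind.1 0
  obtain ⟨V, hV, hxV⟩ : ∃ V : Submodule (CGA k G) P, OFD k V ∧ x ∉ V := by
    by_contra! hcon
    exact hx (IsPC.eq_zero hP hcon)
  have := hV.finite
  have : IsNoetherian (CGA k G) (P ⧸ V) := isNoetherian_of_tower k inferInstance
  have hVtop : (⊥ : Submodule (CGA k G) (P ⧸ V)) ≠ ⊤ := by
    intro h
    have h1 : (Submodule.Quotient.mk x : P ⧸ V) ∈ (⊥ : Submodule (CGA k G) (P ⧸ V)) := by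
      rw [h]; exact Submodule.mem_top
    exact hxV ((Submodule.Quotient.mk_eq_zero V).1 h1)
  obtain ⟨M, hM, -⟩ := (eq_top_or_exists_le_coatom (⊥ : Submodule (CGA k G) (P ⧸ V))).resolve_left hVtop
  have hco : IsCoatom (M.comap V.mkQ) :=
    (Submodule.isCoatom_comap_iff (f := V.mkQ) V.mkQ_surjective).2 hM
  have hopen : IsOpen (M.comap V.mkQ : Set P) :=
    (hV.mono (fun v hv => by simp [(Submodule.Quotient.mk_eq_zero V).2 hv])).1
  refine ⟨_, hco, hopen, fun W hW hne => ?_⟩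
  by_contra hle
  rcases eq_top_or_eq_top hP hproj hind (isClosed_of_isOpen hW) (isClosed_of_isOpen hopen)
    (sup_comm W _ ▸ hco.2 _ (lt_of_le_of_ne le_sup_left fun h => hle (h ▸ le_sup_right))) with h | h
  · exact hne h
  · exact hco.1 h

end Local

lemma radPow_one {R : Type} [Ring R] {X : Type} [AddCommGroup X] [Module R X]
    [TopologicalSpace X] {R₀ : Submodule R X} (hco : IsCoatom R₀) (hopen : IsOpen (R₀ : Set X))
    (hmax : ∀ W : Submodule R X, IsOpen (W : Set X) → W ≠ ⊤ → W ≤ R₀) : radPow R X 1 = R₀ := by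
  have hco' : IsCoatom (R₀.comap (⊤ : Submodule R X).subtype) :=
    (Submodule.isCoatom_comap_iff (f := (⊤ : Submodule R X).subtype) fun x => ⟨⟨x, trivial⟩, rfl⟩).2 hco
  have hopen' : IsOpen (R₀.comap (⊤ : Submodule R X).subtype : Set (⊤ : Submodule R X)) :=
    hopen.preimage continuous_subtype_val
  change (radical R (⊤ : Submodule R X)).map (⊤ : Submodule R X).subtype = R₀
  have hrad : radical R (⊤ : Submodule R X) = R₀.comap (⊤ : Submodule R X).subtype := by
    refine le_antisymm (sInf_le ⟨hco', hopen'⟩) (le_sInf ?_)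
    rintro W ⟨hW, hWo⟩
    have h1 : IsOpen (W.map (⊤ : Submodule R X).subtype : Set X) :=
      (isOpen_univ (X := X)).isOpenMap_subtype_val _ hWo
    have h2 : W ≤ R₀.comap (⊤ : Submodule R X).subtype := by
      rw [← Submodule.map_le_iff_le_comap]
      refine hmax _ h1 fun h => hW.1 (eq_top_iff.2 fun x _ => ?_)
      obtain ⟨y, hy, hyx⟩ : (x : X) ∈ W.map (⊤ : Submodule R X).subtype := by rw [h]; trivial
      rwa [← Subtype.ext hyx]
    exact (hW.le_iff.1 h2).elim (fun h => absurd h hco'.1) fun h => h.le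
  rw [hrad, Submodule.map_comap_subtype, top_inf_eq]

section TwoMaximal

variable {R M : Type} [Ring R] [AddCommGroup M] [Module R M]

lemma exists_two_simples_aux {K L₁ L₂ : Submodule R M} (hK : K = L₁ ⊓ L₂) (h : L₁ ⊔ L₂ = ⊤) :
    IsCompl (L₂.map K.mkQ) (L₁.map K.mkQ) ∧
      Nonempty (L₂.map K.mkQ ≃ₗ[R] M ⧸ L₁) ∧ Nonempty (L₁.map K.mkQ ≃ₗ[R] M ⧸ L₂) := by
  have hc : ∀ L : Submodule R M, K ≤ L → (L.map K.mkQ).comap K.mkQ = L := fun L hL => by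
    rw [Submodule.comap_map_mkQ, sup_eq_right.2 hL]
  have h1 : K ≤ L₁ := hK ▸ inf_le_left
  have h2 : K ≤ L₂ := hK ▸ inf_le_right
  have hcompl : IsCompl (L₂.map K.mkQ) (L₁.map K.mkQ) := by
    refine ⟨disjoint_iff.2 ?_, codisjoint_iff.2 ?_⟩
    · apply Submodule.comap_injective_of_surjective K.mkQ_surjective
      rw [Submodule.comap_inf, hc _ h1, hc _ h2, inf_comm, ← hK, Submodule.comap_bot, Submodule.ker_mkQ]
    · rw [← Submodule.map_sup, sup_comm, h, Submodule.map_top, Submodule.range_mkQ]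
  exact ⟨hcompl,
    ⟨(Submodule.quotientEquivOfIsCompl _ _ hcompl.symm).symm.trans
      (Submodule.quotientQuotientEquivQuotient K L₁ h1)⟩,
    ⟨(Submodule.quotientEquivOfIsCompl _ _ hcompl).symm.trans
      (Submodule.quotientQuotientEquivQuotient K L₂ h2)⟩⟩

/-- The quotient by an intersection of at most two maximal submodules. -/
lemma exists_two_simples {𝓜 : Set (Submodule R M)} (hco : ∀ L ∈ 𝓜, IsCoatom L)
    (h2 : ∀ L₁ ∈ 𝓜, ∀ L₂ ∈ 𝓜, Nonempty ((M ⧸ L₁) ≃ₗ[R] (M ⧸ L₂)) → L₁ = L₂)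
    (h3 : ∀ L₁ ∈ 𝓜, ∀ L₂ ∈ 𝓜, ∀ L₃ ∈ 𝓜, L₁ ≠ L₂ → L₁ ≠ L₃ → L₂ ≠ L₃ → False)
    {K : Submodule R M} (hK : K = sInf 𝓜) :
    ∃ T T' : Submodule R (M ⧸ K), IsCompl T T' ∧ (IsSimpleModule R T ∨ T = ⊥) ∧
      (IsSimpleModule R T' ∨ T' = ⊥) ∧ (T ≠ ⊥ → T' ≠ ⊥ → IsEmpty (T ≃ₗ[R] T')) := by
  have hsimple : ∀ L ∈ 𝓜, IsSimpleModule R (M ⧸ L) := fun L hL =>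
    isSimpleModule_iff_isCoatom.2 (hco L hL)
  rcases 𝓜.eq_empty_or_nonempty with rfl | ⟨L₁, hL₁⟩
  · rw [sInf_empty] at hK
    have : Subsingleton (M ⧸ K) := Submodule.Quotient.subsingleton_iff.2 hK
    exact ⟨⊤, ⊥, isCompl_top_bot, Or.inr (Subsingleton.elim _ _), Or.inr rfl,
      fun _ h => absurd rfl h⟩
  have := hsimple L₁ hL₁
  by_cases hall : ∀ L ∈ 𝓜, L = L₁
  · have hK' : K = L₁ := hK.trans (le_antisymm (sInf_le hL₁) (le_sInf fun L hL => (hall L hL).ge))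
    subst hK'
    exact ⟨⊤, ⊥, isCompl_top_bot, Or.inl (IsSimpleModule.congr Submodule.topEquiv), Or.inr rfl,
      fun _ h => absurd rfl h⟩
  push Not at hall
  obtain ⟨L₂, hL₂, hne⟩ := hall
  have := hsimple L₂ hL₂
  have hK' : K = L₁ ⊓ L₂ := by
    refine hK.trans (le_antisymm (le_inf (sInf_le hL₁) (sInf_le hL₂)) (le_sInf fun L hL => ?_))
    by_cases e1 : L₁ = L
    · exact e1 ▸ inf_le_left
    by_cases e2 : L₂ = L
    · exact e2 ▸ inf_le_right
    exact (h3 L₁ hL₁ L₂ hL₂ L hL hne.symm e1 e2).elim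
  obtain ⟨hc, ⟨e1⟩, ⟨e2⟩⟩ := exists_two_simples_aux hK'
    (codisjoint_iff.1 ((hco L₁ hL₁).codisjoint_of_ne (hco L₂ hL₂) hne.symm))
  exact ⟨_, _, hc, Or.inl (IsSimpleModule.congr e1), Or.inl (IsSimpleModule.congr e2),
    fun _ _ => ⟨fun f => hne.symm (h2 L₁ hL₁ L₂ hL₂ ⟨(e1.symm.trans f).trans e2⟩)⟩⟩

lemma isOpen_map_subtype [TopologicalSpace M] {R₀ : Submodule R M} {L : Submodule R R₀}
    (hR : IsOpen (R₀ : Set M)) (hL : IsOpen (L : Set R₀)) :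
    IsOpen (L.map R₀.subtype : Set M) :=
  hR.isOpenMap_subtype_val _ hL

lemma mkQ_eq_zero_of_mem {R₀ O : Submodule R M} {L : Submodule R R₀}
    (hO : O ≤ L.map R₀.subtype) (x : R₀) (hx : (x : M) ∈ O) : L.mkQ x = 0 := by
  obtain ⟨y, hy, hyx⟩ := hO hx
  rw [Submodule.mkQ_apply, Submodule.Quotient.mk_eq_zero]
  rwa [← Subtype.ext hyx]

end TwoMaximal

section Final

variable {p : ℕ} [Fact p.Prime] {k : Type} [Field k] [CharP k p] [IsAlgClosed k]
  {G : Type} [Group G] [TopologicalSpace G] [IsTopologicalGroup G] [CompactSpace G]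
  {e : CGA k G} {D : Subgroup G}
  {P : Type} [AddCommGroup P] [Module k P] [Module (CGA k G) P]
  [IsScalarTower k (CGA k G) P] [TopologicalSpace P] {R₀ : Submodule (CGA k G) P}

lemma eq_of_quotient_equiv (he : IsBlockIdem (CGA k G) e) (hD : IsDefectGroup k G e D)
    (hcyc : IsCyclicProP G p D) (hP : IsPseudocompactMod k (CGA k G) P)
    (hPe : InBlock (CGA k G) (X := P) e) (hco : IsCoatom R₀) (hR : IsOpen (R₀ : Set P))
    (hmax : ∀ W : Submodule (CGA k G) P, IsOpen (W : Set P) → W ≠ ⊤ → W ≤ R₀)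
    {L₁ L₂ : Submodule (CGA k G) R₀} (h₁ : IsCoatom L₁) (h₂ : IsCoatom L₂)
    (ho₁ : IsOpen (L₁ : Set R₀)) (ho₂ : IsOpen (L₂ : Set R₀))
    (hiso : Nonempty ((R₀ ⧸ L₁) ≃ₗ[CGA k G] (R₀ ⧸ L₂))) : L₁ = L₂ := by
  have := hP.addGroup
  have := hP.contSMul
  obtain ⟨φ⟩ := hiso
  let O : Submodule (CGA k G) P := L₁.map R₀.subtype ⊓ L₂.map R₀.subtype
  have hOo : IsOpen (O : Set P) := (isOpen_map_subtype hR ho₁).inter (isOpen_map_subtype hR ho₂)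
  have hOR : O ≤ R₀ := inf_le_left.trans (Submodule.map_subtype_le _ _)
  have hofd := IsPC.ofd_of_isOpen hP hOo
  have := hofd.finite
  obtain ⟨N, hN⟩ := exists_levelN (k := k) O hOo
  have : Finite (G ⧸ N.toSubgroup) := Subgroup.quotient_finite_of_isOpen _ N.isOpen'
  have := Fintype.ofFinite (G ⧸ N.toSubgroup)
  obtain ⟨d, m, hd, hm⟩ := exists_map_eq_zpowers hcyc N
  obtain ⟨n, x, hE, hG⟩ := exists_gdata (Fact.out : p.Prime) he.central he.idem (hD.defect N) hd hm
  have hle := ker_unique hN hOR hco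
    (fun W hW hne => hmax W (hofd.mono hW).1 hne) hPe hG hE (isSimpleModule_iff_isCoatom.2 h₂)
    (f₁ := φ.toLinearMap ∘ₗ L₁.mkQ) (f₂ := L₂.mkQ)
    (φ.surjective.comp L₁.mkQ_surjective) L₂.mkQ_surjective
    (fun x hx => by
      rw [LinearMap.comp_apply, mkQ_eq_zero_of_mem inf_le_left x hx, map_zero])
    (fun x hx => mkQ_eq_zero_of_mem inf_le_right x hx)
  rw [LinearEquiv.ker_comp, Submodule.ker_mkQ, Submodule.ker_mkQ] at hle
  exact (h₁.le_iff.1 hle).elim (fun h => absurd h h₂.1) fun h => h.symm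

lemma not_three (he : IsBlockIdem (CGA k G) e) (hD : IsDefectGroup k G e D)
    (hcyc : IsCyclicProP G p D) (hP : IsPseudocompactMod k (CGA k G) P)
    (hPe : InBlock (CGA k G) (X := P) e) (hco : IsCoatom R₀) (hR : IsOpen (R₀ : Set P))
    (hmax : ∀ W : Submodule (CGA k G) P, IsOpen (W : Set P) → W ≠ ⊤ → W ≤ R₀)
    {L₁ L₂ L₃ : Submodule (CGA k G) R₀} (h₁ : IsCoatom L₁) (h₂ : IsCoatom L₂) (h₃ : IsCoatom L₃)
    (ho₁ : IsOpen (L₁ : Set R₀)) (ho₂ : IsOpen (L₂ : Set R₀)) (ho₃ : IsOpen (L₃ : Set R₀))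
    (h₁₂ : L₁ ≠ L₂) (h₁₃ : L₁ ≠ L₃) (h₂₃ : L₂ ≠ L₃) : False := by
  have := hP.addGroup
  have := hP.contSMul
  let O : Submodule (CGA k G) P :=
    L₁.map R₀.subtype ⊓ L₂.map R₀.subtype ⊓ L₃.map R₀.subtype
  have hO₁ : O ≤ L₁.map R₀.subtype := inf_le_left.trans inf_le_left
  have hO₂ : O ≤ L₂.map R₀.subtype := inf_le_left.trans inf_le_right
  have hO₃ : O ≤ L₃.map R₀.subtype := inf_le_right
  have hOo : IsOpen (O : Set P) := ((isOpen_map_subtype hR ho₁).inter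
    (isOpen_map_subtype hR ho₂)).inter (isOpen_map_subtype hR ho₃)
  have hofd := IsPC.ofd_of_isOpen hP hOo
  have := hofd.finite
  obtain ⟨N, hN⟩ := exists_levelN (k := k) O hOo
  have : Finite (G ⧸ N.toSubgroup) := Subgroup.quotient_finite_of_isOpen _ N.isOpen'
  have := Fintype.ofFinite (G ⧸ N.toSubgroup)
  obtain ⟨d, m, hd, hm⟩ := exists_map_eq_zpowers hcyc N
  obtain ⟨n, x, hE, hG⟩ := exists_gdata (Fact.out : p.Prime) he.central he.idem (hD.defect N) hd hm
  have hne : ∀ {L L' : Submodule (CGA k G) R₀}, IsCoatom L → IsCoatom L' → IsOpen (L : Set R₀) →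
      IsOpen (L' : Set R₀) → L ≠ L' → IsEmpty ((R₀ ⧸ L) ≃ₗ[CGA k G] (R₀ ⧸ L')) :=
    fun h h' ho ho' hLL => ⟨fun φ => hLL
      (eq_of_quotient_equiv he hD hcyc hP hPe hco hR hmax h h' ho ho' ⟨φ⟩)⟩
  exact no_three hN (hO₁.trans (Submodule.map_subtype_le _ _)) hco
    (fun W hW hne => hmax W (hofd.mono hW).1 hne) hPe hG hE
    (isSimpleModule_iff_isCoatom.2 h₁) (isSimpleModule_iff_isCoatom.2 h₂)
    (isSimpleModule_iff_isCoatom.2 h₃) L₁.mkQ_surjective L₂.mkQ_surjective L₃.mkQ_surjective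
    (mkQ_eq_zero_of_mem hO₁) (mkQ_eq_zero_of_mem hO₂) (mkQ_eq_zero_of_mem hO₃)
    (hne h₁ h₂ ho₁ ho₂ h₁₂) (hne h₁ h₃ ho₁ ho₃ h₁₃) (hne h₂ h₃ ho₂ ho₃ h₂₃)

lemma exists_radical_layer (he : IsBlockIdem (CGA k G) e) (hD : IsDefectGroup k G e D)
    (hcyc : IsCyclicProP G p D) (hP : IsPseudocompactMod k (CGA k G) P)
    (hproj : IsPCProjective k G P) (hind : IsIndecTop (CGA k G) P)
    (hPe : InBlock (CGA k G) (X := P) e) :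
    ∃ T T' : Submodule (CGA k G) (subQuot (radPow (CGA k G) P 1) (radPow (CGA k G) P 2)),
      IsCompl T T' ∧ (IsSimpleModule (CGA k G) T ∨ T = ⊥) ∧
      (IsSimpleModule (CGA k G) T' ∨ T' = ⊥) ∧
      (T ≠ ⊥ → T' ≠ ⊥ → IsEmpty (T ≃ₗ[CGA k G] T')) := by
  obtain ⟨R₀, hco, hR, hmax⟩ := exists_largest_open hP hproj hind
  have hrad := radPow_one hco hR hmax
  rw [← hrad] at hco hR hmax
  refine exists_two_simples
    (𝓜 := {L : Submodule (CGA k G) (radPow (CGA k G) P 1) |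
      IsCoatom L ∧ IsOpen (L : Set (radPow (CGA k G) P 1))})
    (fun L hL => hL.1)
    (fun L₁ h₁ L₂ h₂ hiso => eq_of_quotient_equiv he hD hcyc hP hPe hco hR hmax
      h₁.1 h₂.1 h₁.2 h₂.2 hiso)
    (fun L₁ h₁ L₂ h₂ L₃ h₃ => not_three he hD hcyc hP hPe hco hR hmax
      h₁.1 h₂.1 h₃.1 h₁.2 h₂.2 h₃.2) ?_
  change ((radical (CGA k G) (radPow (CGA k G) P 1)).map (radPow (CGA k G) P 1).subtype).comap
    (radPow (CGA k G) P 1).subtype = _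
  rw [Submodule.comap_map_eq_of_injective (Submodule.injective_subtype _)]
  rfl

end Final

end CyclicBlock

namespace ProfiniteBlocks

/-- Lemma 3.7: for an indecomposable projective module `P` of a
block with non-trivial cyclic defect group, `Rad(P)/Rad²(P) ≅ T ⊕ T'` where `T, T'`
are simple or zero, and non-isomorphic if both non-zero. -/
theorem rad_mod_radsq_sum_of_two_simples
    (p : ℕ) [Fact p.Prime] (k : Type) [Field k] [CharP k p] [IsAlgClosed k]
    (G : Type) [Group G] [TopologicalSpace G] [IsTopologicalGroup G]
    [CompactSpace G] [TotallyDisconnectedSpace G] [T2Space G]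
    (e : CGA k G) (he : IsBlockIdem (CGA k G) e)
    (D : Subgroup G) (hD : IsDefectGroup k G e D)
    (hcyc : IsCyclicProP G p D) (hnt : D ≠ ⊥)
    (P : Type) [AddCommGroup P] [Module k P] [Module (CGA k G) P]
    [IsScalarTower k (CGA k G) P] [TopologicalSpace P]
    (hPpc : IsPseudocompactMod k (CGA k G) P) (hPproj : IsPCProjective k G P)
    (hPind : IsIndecTop (CGA k G) P) (hPe : InBlock (CGA k G) (X := P) e) :
    ∃ T T' : Submodule (CGA k G)
        (subQuot (radPow (CGA k G) P 1) (radPow (CGA k G) P 2)),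
      IsCompl T T' ∧
      (IsSimpleModule (CGA k G) T ∨ T = ⊥) ∧
      (IsSimpleModule (CGA k G) T' ∨ T' = ⊥) ∧
      (T ≠ ⊥ → T' ≠ ⊥ → IsEmpty (T ≃ₗ[CGA k G] T')) := by
  exact CyclicBlock.exists_radical_layer he hD hcyc hPpc hPproj hPind hPe

end ProfiniteBlocks
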